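/- Let λ>2 be a non-integer and let D be a bounded domain in ℝⁿ (n>2) with boundary of class C^λ. Then for all integers 0 ≤ k ≤ [λ] and any cube Q in ℝⁿ with 2Q ⊂ D and |Q| = δⁿ, one has |∂²U(x,y)/∂x_i∂x_j − Σ_{|α|≤k} (∂^α/∂y^α)(∂²U(x,x₀)/∂x_i∂x_j)·(y−x₀)^α| ≤ C_{p,n,λ}·δ^{k(λ)}/|x−x₀|^{n+k(λ)} for all x ∈ D∖2Q and all y, x₀ ∈ Q, where the sum is the order-k Taylor polynomial in the second variable about x₀, and k(λ)=k+1 if k<[λ] while k(λ)=λ if k=[λ]. -/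

import Mathlib

noncomputable section

open MeasureTheory Metric Set Real
open scoped ENNReal NNReal RealInnerProductSpace FourierTransform

/-- Euclidean space ℝⁿ. -/
abbrev Eu (n : ℕ) := EuclideanSpace ℝ (Fin n)

variable {n : ℕ}

/-- δ(x) = dist(x, ℝⁿ ∖ D). -/
def bdist (D : Set (Eu n)) (x : Eu n) : ℝ := Metric.infDist x Dᶜ

/-- First-order partial derivative ∂u/∂xᵢ. -/
def pd (i : Fin n) (u : Eu n → ℝ) (x : Eu n) : ℝ :=
  fderiv ℝ u x (EuclideanSpace.single i 1)

/-- Second-order partial derivative ∂²u/∂xᵢ∂xⱼ. -/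
def pd2 (i j : Fin n) (u : Eu n → ℝ) : Eu n → ℝ :=
  fun x => pd i (fun z => pd j u z) x

/-- Iterated partial derivatives along a list of coordinate directions. -/
def pdMulti : List (Fin n) → (Eu n → ℝ) → Eu n → ℝ
  | [], u => u
  | i :: L, u => pd i (pdMulti L u)

/-- The Laplacian Δu = Σᵢ ∂²u/∂xᵢ². -/
def lapl (u : Eu n → ℝ) (x : Eu n) : ℝ := ∑ i, pd2 i i u x

/-- A list of coordinate directions realizing the multi-index α. -/
def multiList (α : Fin n → ℕ) : List (Fin n) :=
  (List.finRange n).flatMap fun i => List.replicate (α i) i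

/-- The derivative ∂^α u corresponding to a multi-index α. -/
def pdAlpha (α : Fin n → ℕ) (u : Eu n → ℝ) : Eu n → ℝ := pdMulti (multiList α) u

/-- The monomial y^α. -/
def monom (α : Fin n → ℕ) (y : Eu n) : ℝ := ∏ i, y i ^ α i

/-- α! = ∏ᵢ (αᵢ)!. -/
def multiFact (α : Fin n → ℕ) : ℕ := ∏ i, Nat.factorial (α i)

/-- |α| = Σᵢ αᵢ. -/
def multiDeg (α : Fin n → ℕ) : ℕ := ∑ i, α i

/-- The finite set of multi-indices of degree at most k. -/
def multiIdxLE (n k : ℕ) : Finset (Fin n → ℕ) :=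
  (Fintype.piFinset fun _ : Fin n => Finset.range (k + 1)).filter fun α => multiDeg α ≤ k

/-- A bounded domain: open, connected, bounded. -/
def IsBddDomain (D : Set (Eu n)) : Prop :=
  IsOpen D ∧ IsConnected D ∧ Bornology.IsBounded D

/-- `v` is an outward unit normal vector to `D` at the boundary point `y`. -/
def IsOutwardNormalAt (D : Set (Eu n)) (y v : Eu n) : Prop :=
  ‖v‖ = 1 ∧ ∃ ε > 0, (∀ t : ℝ, 0 < t → t < ε → y + t • v ∉ closure D) ∧
    ∀ t : ℝ, 0 < t → t < ε → y - t • v ∈ D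

/-- Hölder class C^s regularity of a globally defined function: it is C^⌊s⌋ and,
if s is not an integer, its ⌊s⌋-th derivative is Hölder continuous of exponent s - ⌊s⌋. -/
def HolderSmooth (s : ℝ) (g : Eu n → ℝ) : Prop :=
  ContDiff ℝ (⌊s⌋₊ : ℕ) g ∧
    (s ≠ (⌊s⌋₊ : ℕ) → ∃ C : ℝ≥0,
      HolderWith C (s - (⌊s⌋₊ : ℕ)).toNNReal (iteratedFDeriv ℝ ⌊s⌋₊ g))

/-- C^{k,ε} regularity: C^k with ε-Hölder k-th derivatives. -/
def CkHolder (k : ℕ) (ε : ℝ) (g : Eu n → ℝ) : Prop :=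
  ContDiff ℝ (k : ℕ) g ∧ ∃ C : ℝ≥0, HolderWith C ε.toNNReal (iteratedFDeriv ℝ k g)

/-- `D` has boundary which is locally the graph of a function enjoying the regularity
property `R`: near each boundary point, after choosing a unit direction `v`, the domain
is the subgraph `{x | ⟪x,v⟫ < g x}` of a function `g` depending only on the component
orthogonal to `v`. -/
def HasGraphBoundary (D : Set (Eu n)) (R : (Eu n → ℝ) → Prop) : Prop :=
  ∀ y ∈ frontier D, ∃ v : Eu n, ‖v‖ = 1 ∧ ∃ V : Set (Eu n), IsOpen V ∧ y ∈ V ∧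
    ∃ g : Eu n → ℝ, R g ∧ (∀ x : Eu n, g x = g (x - ⟪x, v⟫ • v)) ∧
      D ∩ V = {x ∈ V | ⟪x, v⟫ < g x} ∧
      frontier D ∩ V = {x ∈ V | ⟪x, v⟫ = g x}

/-- The surface area ωₙ of the unit sphere in ℝⁿ. -/
def sphereArea (n : ℕ) : ℝ := n * (volume (Metric.ball (0 : Eu n) 1)).toReal

/-- The fundamental solution Γ of the Laplacian on ℝⁿ, n > 2. -/
def fundSol (n : ℕ) (x : Eu n) : ℝ :=
  -(((n : ℝ) - 2)⁻¹ * (sphereArea n)⁻¹ * ‖x‖ ^ (2 - (n : ℝ)))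

/-- `u` is harmonic on `D`. -/
def IsHarmonicOn (u : Eu n → ℝ) (D : Set (Eu n)) : Prop :=
  ContDiffOn ℝ 2 u D ∧ ∀ x ∈ D, lapl u x = 0

/-- `U` is the harmonic correction for the Green's function of `D`: for each `y ∈ D`,
`U(·,y)` is harmonic in `D`, continuous on `D̄`, with boundary values `Γ(y−·)`. -/
def IsGreenCorrection (D : Set (Eu n)) (U : Eu n → Eu n → ℝ) : Prop :=
  ∀ y ∈ D, IsHarmonicOn (fun x => U x y) D ∧
    ContinuousOn (fun x => U x y) (closure D) ∧
    ∀ x ∈ frontier D, U x y = fundSol n (y - x)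

/-- The Green's function G(x,y) = Γ(x−y) − U(x,y). -/
def greenFn (U : Eu n → Eu n → ℝ) : Eu n → Eu n → ℝ :=
  fun x y => fundSol n (x - y) - U x y

/-- `V` is the correction for the Neumann kernel of `D`: for each `y ∈ D`, `V(·,y)` solves
`ΔV(·,y) = Vol(D)⁻¹` in `D` with normal derivative `∂Γ(y−·)/∂ν` on `∂D`. -/
def IsNeumannCorrection (D : Set (Eu n)) (V : Eu n → Eu n → ℝ) : Prop :=
  ∀ y ∈ D, (ContDiffOn ℝ 2 (fun x => V x y) D ∧
      ∀ x ∈ D, lapl (fun x' => V x' y) x = ((volume D).toReal)⁻¹) ∧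
    ∀ z ∈ frontier D, ∀ v : Eu n, IsOutwardNormalAt D z v →
      fderiv ℝ (fun x => V x y) z v = fderiv ℝ (fun x => fundSol n (y - x)) z v

/-- `u` solves the Dirichlet problem Δu = f in D, u = 0 on ∂D. -/
def IsDirichletSol (D : Set (Eu n)) (f u : Eu n → ℝ) : Prop :=
  ContDiffOn ℝ 2 u D ∧ (∀ x ∈ D, lapl u x = f x) ∧
    ContinuousOn u (closure D) ∧ ∀ x ∈ frontier D, u x = 0

/-- `u` solves the Neumann problem Δu = f in D, ∂u/∂ν = 0 on ∂D. -/
def IsNeumannSol (D : Set (Eu n)) (f u : Eu n → ℝ) : Prop :=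
  ContDiffOn ℝ 2 u D ∧ (∀ x ∈ D, lapl u x = f x) ∧
    ∀ y ∈ frontier D, ∀ v : Eu n, IsOutwardNormalAt D y v → fderiv ℝ u y v = 0

/-- A fixed nonnegative smooth bump function supported in the unit ball with integral one. -/
structure IsBump (n : ℕ) (φ : Eu n → ℝ) : Prop where
  smooth : ContDiff ℝ (⊤ : ℕ∞) φ
  supp : ∀ x : Eu n, 1 ≤ ‖x‖ → φ x = 0
  nonneg : ∀ x, 0 ≤ φ x
  integral_one : ∫ x, φ x = 1

/-- φ_t(x) = t⁻ⁿ φ(x/t). -/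
def dil (φ : Eu n → ℝ) (t : ℝ) (x : Eu n) : ℝ := t⁻¹ ^ n * φ (t⁻¹ • x)

/-- The radial maximal function f⁺(x) = sup_{0<t<δ(x)} |∫_D φ_t(x−y) f(y) dy|. -/
def radMax (D : Set (Eu n)) (φ f : Eu n → ℝ) (x : Eu n) : ℝ :=
  ⨆ t : {t : ℝ // 0 < t ∧ t < bdist D x}, |∫ y in D, dil φ (t : ℝ) (x - y) * f y|

/-- The h^p_r(D) (quasi-)norm: the L^p(D) norm of the radial maximal function. -/
def hrNorm (D : Set (Eu n)) (φ : Eu n → ℝ) (p : ℝ) (f : Eu n → ℝ) : ℝ≥0∞ :=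
  eLpNorm (radMax D φ f) (ENNReal.ofReal p) (volume.restrict D)

/-- The local (Goldberg) maximal function sup_{0<t<1} |φ_t * g(x)|. -/
def locMax (φ g : Eu n → ℝ) (x : Eu n) : ℝ :=
  ⨆ t : {t : ℝ // 0 < t ∧ t < 1}, |∫ y, dil φ (t : ℝ) (x - y) * g y|

/-- Membership in the local Hardy space h^p(ℝⁿ). -/
def MemHp (φ : Eu n → ℝ) (p : ℝ) (g : Eu n → ℝ) : Prop :=
  Measurable g ∧ eLpNorm (locMax φ g) (ENNReal.ofReal p) volume < ⊤

/-- `g` is an extension of `f` to ℝⁿ vanishing off `D̄`. -/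
def IsHpzExtension (D : Set (Eu n)) (f g : Eu n → ℝ) : Prop :=
  (∀ x ∈ D, g x = f x) ∧ ∀ x ∉ closure D, g x = 0

/-- Membership in h^p_z(D): f has an extension in h^p(ℝⁿ) vanishing off D̄. -/
def MemHpz (D : Set (Eu n)) (φ : Eu n → ℝ) (p : ℝ) (f : Eu n → ℝ) : Prop :=
  ∃ g, IsHpzExtension D f g ∧ MemHp φ p g

/-- The h^p_z(D) (quasi-)norm: infimum of h^p(ℝⁿ) norms over all admissible extensions. -/
def hzNorm (D : Set (Eu n)) (φ : Eu n → ℝ) (p : ℝ) (f : Eu n → ℝ) : ℝ≥0∞ :=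
  ⨅ g ∈ {g | IsHpzExtension D f g},
    eLpNorm (locMax φ g) (ENNReal.ofReal p) volume

/-- An axis-parallel cube in ℝⁿ, given by its center and half side length. -/
structure Cube (n : ℕ) where
  center : Eu n
  half : ℝ
  half_pos : 0 < half

/-- The cube concentric with Q whose side length is c times that of Q. -/
def Cube.scaled (Q : Cube n) (c : ℝ) : Set (Eu n) :=
  {x | ∀ i, |x i - Q.center i| ≤ c * Q.half}

/-- The cube Q as a subset of ℝⁿ. -/
def Cube.carrier (Q : Cube n) : Set (Eu n) := Q.scaled 1

/-- |Q|, the volume of Q. -/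
def Cube.vol (Q : Cube n) : ℝ := (2 * Q.half) ^ n

/-- The side length of Q. -/
def Cube.side (Q : Cube n) : ℝ := 2 * Q.half

/-- [n(1/p−1)]. -/
def npIndex (n : ℕ) (p : ℝ) : ℕ := ⌊(n : ℝ) * (1 / p - 1)⌋₊

/-- An h^p(ℝⁿ) atom (p-atom) supported in the cube Q. -/
def IsPAtom (n : ℕ) (p : ℝ) (Q : Cube n) (a : Eu n → ℝ) : Prop :=
  Measurable a ∧ (∃ M : ℝ, ∀ x, |a x| ≤ M) ∧ (∀ x ∉ Q.carrier, a x = 0) ∧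
    (∫ x, a x ^ 2) ≤ Q.vol ^ (1 - 2 / p) ∧
    (Q.vol ≤ 1 → ∀ α : Fin n → ℕ, multiDeg α ≤ npIndex n p →
      ∫ x, monom α x * a x = 0)

/-- `g` is the weak partial derivative ∂f/∂xᵢ on `D`. -/
def IsWeakPd (D : Set (Eu n)) (i : Fin n) (f g : Eu n → ℝ) : Prop :=
  ∀ ψ : Eu n → ℝ, ContDiff ℝ (⊤ : ℕ∞) ψ → HasCompactSupport ψ → tsupport ψ ⊆ D →
    ∫ x in D, f x * pd i ψ x = -∫ x in D, g x * ψ x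

/-- `g` is an iterated weak derivative of `f` on `D` along the list of directions `L`. -/
def IsWeakDerivSeq (D : Set (Eu n)) : List (Fin n) → (Eu n → ℝ) → (Eu n → ℝ) → Prop
  | [], f, g => ∀ x ∈ D, f x = g x
  | i :: L, f, g => ∃ h, IsWeakDerivSeq D L f h ∧ IsWeakPd D i h g

/-- Membership in the Hardy–Sobolev space h^{k,p}_z(D): all weak derivatives of order ≤ k
lie in h^p_z(D). -/
def MemHkz (D : Set (Eu n)) (φ : Eu n → ℝ) (p : ℝ) (k : ℕ) (f : Eu n → ℝ) : Prop :=
  ∀ L : List (Fin n), L.length ≤ k → ∃ g, IsWeakDerivSeq D L f g ∧ MemHpz D φ p g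

/-- The h^{k,p}_z(D) (quasi-)norm. -/
def hkzNorm (D : Set (Eu n)) (φ : Eu n → ℝ) (p : ℝ) (k : ℕ) (f : Eu n → ℝ) : ℝ≥0∞ :=
  ⨆ L : {L : List (Fin n) // L.length ≤ k},
    ⨅ g ∈ {g | IsWeakDerivSeq D (L : List (Fin n)) f g}, hzNorm D φ p g

/-- The h^{k,p}_r(D) (quasi-)norm. -/
def hkrNorm (D : Set (Eu n)) (φ : Eu n → ℝ) (p : ℝ) (k : ℕ) (f : Eu n → ℝ) : ℝ≥0∞ :=
  ⨆ L : {L : List (Fin n) // L.length ≤ k},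
    ⨅ g ∈ {g | IsWeakDerivSeq D (L : List (Fin n)) f g}, hrNorm D φ p g

section

open scoped ContDiff Topology

/-- The standard basis vectors of `Eu n`. -/
abbrev stdE (i : Fin n) : Eu n := EuclideanSpace.single i (1 : ℝ)

lemma norm_stdE (i : Fin n) : ‖stdE i‖ = 1 := by simp [stdE]

lemma eu_eq_sum (h : Eu n) : h = ∑ i, h i • stdE i := by
  ext j
  simp [stdE, Finset.sum_apply, Pi.single_apply]

lemma ContDiffAt.pd {m : ℕ∞} {u : Eu n → ℝ} {x : Eu n} (i : Fin n)
    (hu : ContDiffAt ℝ (m + 1 : ℕ∞) u x) : ContDiffAt ℝ m (_root_.pd i u) x := by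
  have := hu.fderiv_right (m := m) (by exact_mod_cast le_rfl)
  exact this.clm_apply contDiffAt_const

lemma ContDiff.pd {m : ℕ∞} {u : Eu n → ℝ} (i : Fin n)
    (hu : ContDiff ℝ (m + 1 : ℕ∞) u) : ContDiff ℝ m (_root_.pd i u) :=
  contDiff_iff_contDiffAt.2 fun _ => (hu.contDiffAt).pd i

lemma ContDiff.pd_top {u : Eu n → ℝ} (i : Fin n) (hu : ContDiff ℝ ∞ u) :
    ContDiff ℝ ∞ (_root_.pd i u) :=
  ContDiff.pd (m := ⊤) i (by simpa using hu)

lemma ContDiff.pdMulti_top {u : Eu n → ℝ} (L : List (Fin n)) (hu : ContDiff ℝ ∞ u) :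
    ContDiff ℝ ∞ (_root_.pdMulti L u) := by
  induction L with
  | nil => exact hu
  | cons i L ih => exact ih.pd_top i

lemma pd_congr_nhds {u v : Eu n → ℝ} {x : Eu n} (i : Fin n) (h : u =ᶠ[𝓝 x] v) :
    pd i u =ᶠ[𝓝 x] pd i v := by
  filter_upwards [h.eventuallyEq_nhds] with y hy
  simp only [pd, hy.fderiv_eq]

lemma pdMulti_congr_nhds {u v : Eu n → ℝ} {x : Eu n} (L : List (Fin n)) (h : u =ᶠ[𝓝 x] v) :
    pdMulti L u =ᶠ[𝓝 x] pdMulti L v := by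
  induction L with
  | nil => exact h
  | cons i L ih => exact pd_congr_nhds i ih

lemma pd2_congr_nhds {u v : Eu n → ℝ} {x : Eu n} (i j : Fin n) (h : u =ᶠ[𝓝 x] v) :
    pd2 i j u =ᶠ[𝓝 x] pd2 i j v := pd_congr_nhds i (pd_congr_nhds j h)

lemma lapl_congr_nhds {u v : Eu n → ℝ} {x : Eu n} (h : u =ᶠ[𝓝 x] v) :
    lapl u =ᶠ[𝓝 x] lapl v := by
  have : ∀ᶠ y in 𝓝 x, ∀ i, pd2 i i u y = pd2 i i v y :=
    Filter.eventually_all.2 fun i => pd2_congr_nhds i i h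
  filter_upwards [this] with y hy
  simp [lapl, hy]

lemma pd2_eq_fderiv {u : Eu n → ℝ} {x : Eu n} (i j : Fin n) (hu : ContDiffAt ℝ 2 u x) :
    pd2 i j u x = fderiv ℝ (fderiv ℝ u) x (stdE i) (stdE j) := by
  have h1 : DifferentiableAt ℝ (fderiv ℝ u) x :=
    (hu.fderiv_right (m := 1) (by norm_num)).differentiableAt (by norm_num)
  simp only [pd2, pd]
  rw [fderiv_clm_apply h1 (differentiableAt_const _)]
  simp

lemma lapl_eq_laplacian {u : Eu n → ℝ} {x : Eu n} (hu : ContDiffAt ℝ 2 u x) :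
    lapl u x = Laplacian.laplacian u x := by
  rw [InnerProductSpace.laplacian_eq_iteratedFDeriv_orthonormalBasis u
    (EuclideanSpace.basisFun (Fin n) ℝ)]
  simp only [lapl]
  refine Finset.sum_congr rfl fun i _ => ?_
  rw [pd2_eq_fderiv i i hu, iteratedFDeriv_two_apply]
  simp

lemma pdMulti_eq_iteratedFDeriv {f : Eu n → ℝ} {x : Eu n} (L : List (Fin n))
    (hf : ContDiffAt ℝ L.length f x) :
    pdMulti L f x = iteratedFDeriv ℝ L.length f x (fun i => stdE (L.get i)) := by
  induction L generalizing x with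
  | nil => simp [pdMulti]
  | cons i L ih =>
    have h1 : ∀ᶠ y in 𝓝 x, ContDiffAt ℝ (L.length + 1 : ℕ) f y := by
      have := hf.eventually (by simp)
      simpa using this
    have h2 : pdMulti L f =ᶠ[𝓝 x]
        fun y => iteratedFDeriv ℝ L.length f y (fun i => stdE (L.get i)) := by
      filter_upwards [h1] with y hy
      exact ih (hy.of_le (by exact_mod_cast Nat.le_succ _))
    have h3 : DifferentiableAt ℝ (iteratedFDeriv ℝ L.length f) x :=
      ContDiffAt.differentiableAt_iteratedFDeriv hf (by simp; exact_mod_cast Nat.lt_succ_self _)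
    simp only [List.length_cons, iteratedFDeriv_succ_apply_left]
    show pd i (pdMulti L f) x = _
    rw [pd, h2.fderiv_eq, fderiv_continuousMultilinear_apply_const_apply h3]
    rfl

lemma abs_pdMulti_le {f : Eu n → ℝ} {x : Eu n} (L : List (Fin n))
    (hf : ContDiffAt ℝ L.length f x) :
    |pdMulti L f x| ≤ ‖iteratedFDeriv ℝ L.length f x‖ := by
  rw [pdMulti_eq_iteratedFDeriv L hf]
  have := (iteratedFDeriv ℝ L.length f x).le_opNorm (fun i => stdE (L.get i))
  simpa [norm_stdE] using this

lemma multilinear_apply_eq_sum {m : ℕ} (A : ContinuousMultilinearMap ℝ (fun _ : Fin m => Eu n) ℝ)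
    (v : Fin m → Eu n) :
    A v = ∑ r : Fin m → Fin n, (∏ a, v a (r a)) * A fun a => stdE (r a) := by
  have h : v = fun a => ∑ i, v a i • stdE i := by
    funext a; exact eu_eq_sum (v a)
  conv_lhs => rw [h]
  rw [ContinuousMultilinearMap.map_sum]
  refine Finset.sum_congr rfl fun r _ => ?_
  rw [ContinuousMultilinearMap.map_smul_univ]
  rfl

lemma abs_apply_le_norm (h : Eu n) (i : Fin n) : |h i| ≤ ‖h‖ := by
  simpa using PiLp.norm_apply_le h i

lemma norm_iteratedFDeriv_le_of_pdMulti {f : Eu n → ℝ} {x : Eu n} {m : ℕ} {B : ℝ}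
    (hf : ContDiffAt ℝ m f x)
    (hB : ∀ L : List (Fin n), L.length = m → |pdMulti L f x| ≤ B) :
    ‖iteratedFDeriv ℝ m f x‖ ≤ (n : ℝ) ^ m * B := by
  have key : ∀ r : Fin m → Fin n, |iteratedFDeriv ℝ m f x (fun a => stdE (r a))| ≤ B := by
    intro r
    have h := hB (List.ofFn r) (by simp)
    rw [pdMulti_eq_iteratedFDeriv _ (by simpa using hf)] at h
    convert h using 2
    have : ∀ (m' : ℕ) (hm : m' = m) (g : Fin m' → Eu n) (g' : Fin m → Eu n),
        (∀ a, g a = g' (Fin.cast hm a)) →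
        iteratedFDeriv ℝ m f x g' = iteratedFDeriv ℝ m' f x g := by
      rintro m' rfl g g' hg
      congr 1; funext a; simp [hg]
    refine this _ (by simp) _ _ ?_
    intro a; simp; rfl
  by_cases hne : 0 ≤ (n : ℝ) ^ m * B
  · refine ContinuousMultilinearMap.opNorm_le_bound hne fun v => ?_
    rw [multilinear_apply_eq_sum, Real.norm_eq_abs]
    refine (Finset.abs_sum_le_sum_abs _ _).trans ?_
    calc _ ≤ ∑ r : Fin m → Fin n, (∏ a, ‖v a‖) * B := by
          refine Finset.sum_le_sum fun r _ => ?_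
          rw [abs_mul]
          refine mul_le_mul ?_ (key r) (abs_nonneg _) (by positivity)
          rw [Finset.abs_prod]
          exact Finset.prod_le_prod (fun _ _ => abs_nonneg _) fun a _ => abs_apply_le_norm _ _
      _ = _ := by simp; ring
  · exfalso
    push Not at hne
    have hn : (n : ℝ) ^ m ≠ 0 := by intro h; rw [h] at hne; simp at hne
    have hB0 : B < 0 := by
      by_contra hc; push Not at hc
      exact absurd hne (not_lt.2 (by positivity))
    rcases Nat.eq_zero_or_pos m with rfl | hm
    · exact absurd ((abs_nonneg _).trans (key (fun a => a.elim0))) (not_le.2 hB0)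
    · have hn0 : 0 < n := by
        rcases Nat.eq_zero_or_pos n with rfl | h
        · simp [hm.ne'] at hn
        · exact h
      exact absurd ((abs_nonneg _).trans (key (fun _ => ⟨0, hn0⟩))) (not_le.2 hB0)

lemma pdMulti_perm {L L' : List (Fin n)} (h : L.Perm L') {f : Eu n → ℝ} {x : Eu n}
    (hf : ContDiffAt ℝ L.length f x) : pdMulti L f x = pdMulti L' f x := by
  induction h generalizing x with
  | nil => rfl
  | @cons i L₁ L₂ h ih =>
    have h1 : ∀ᶠ y in 𝓝 x, ContDiffAt ℝ (L₁.length + 1 : ℕ) f y := by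
      simpa using hf.eventually (by simp)
    have h2 : pdMulti L₁ f =ᶠ[𝓝 x] pdMulti L₂ f := by
      filter_upwards [h1] with y hy
      exact ih (hy.of_le (by exact_mod_cast Nat.le_succ _))
    exact (pd_congr_nhds i h2).self_of_nhds
  | @swap i j L₁ =>
    have h1 : ContDiffAt ℝ 2 (pdMulti L₁ f) x := by
      have aux : ∀ (L : List (Fin n)) (m : ℕ) (y : Eu n),
          ContDiffAt ℝ (L.length + m : ℕ) f y → ContDiffAt ℝ (m : ℕ∞) (pdMulti L f) y := by
        intro L
        induction L with
        | nil => intro m y hy; simpa [pdMulti] using hy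
        | cons i L ih =>
          intro m y hy
          refine ContDiffAt.pd i (m := (m : ℕ∞)) ?_
          have := ih (m + 1) y (by convert hy using 2; simp; ring)
          simpa using this
      have hlen : (j :: i :: L₁).length = L₁.length + 2 := rfl
      exact aux L₁ 2 x (hlen ▸ hf)
    show pd2 j i (pdMulti L₁ f) x = pd2 i j (pdMulti L₁ f) x
    rw [pd2_eq_fderiv _ _ h1, pd2_eq_fderiv _ _ h1]
    exact (h1.isSymmSndFDerivAt (by simp)).eq _ _
  | @trans L₁ L₂ L₃ h₁ h₂ ih₁ ih₂ =>
    rw [ih₁ hf, ih₂ (by rwa [← h₁.length_eq])]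

lemma count_multiList (α : Fin n → ℕ) (i : Fin n) : (multiList α).count i = α i := by
  simp only [multiList, List.count_flatMap]
  have : (List.map (List.count i ∘ fun i => List.replicate (α i) i) (List.finRange n)).sum =
      ∑ j, (if j = i then α j else 0) := by
    rw [← List.sum_ofFn, List.ofFn_eq_map]
    congr 1
    refine List.map_congr_left fun j _ => ?_
    simp [List.count_replicate]
  rw [this]; simp

lemma length_multiList (α : Fin n → ℕ) : (multiList α).length = multiDeg α := by
  simp only [multiList, List.length_flatMap, List.length_replicate, multiDeg]
  rw [← List.sum_ofFn, List.ofFn_eq_map]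

/-- Number of occurrences of each direction in a tuple of directions. -/
def tupleCount {m : ℕ} (r : Fin m → Fin n) (i : Fin n) : ℕ := (List.ofFn r).count i

lemma pdMulti_eq_pdAlpha_count (L : List (Fin n)) {f : Eu n → ℝ} {x : Eu n}
    (hf : ContDiffAt ℝ L.length f x) : pdMulti L f x = pdAlpha (fun i => L.count i) f x := by
  refine pdMulti_perm ?_ hf
  rw [List.perm_iff_count]
  intro i
  rw [count_multiList]

lemma prod_list_count {M : Type*} [CommMonoid M] (L : List (Fin n)) (g : Fin n → M) :
    (L.map g).prod = ∏ i, g i ^ L.count i := by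
  induction L with
  | nil => simp
  | cons a L ih =>
    simp only [List.map_cons, List.prod_cons, ih, List.count_cons]
    simp_rw [pow_add, Finset.prod_mul_distrib]
    rw [mul_comm]
    congr 1
    rw [Finset.prod_eq_single a]
    · simp
    · intro b _ hb; simp [Ne.symm hb]
    · simp

lemma prod_tuple_count {M : Type*} [CommMonoid M] {m : ℕ} (r : Fin m → Fin n) (g : Fin n → M) :
    ∏ a, g (r a) = ∏ i, g i ^ tupleCount r i := by
  show _ = ∏ i, g i ^ (List.ofFn r).count i
  rw [← prod_list_count, List.map_ofFn, ← List.prod_ofFn]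
  rfl

/-- Summation over tuples grouped by multi-index. -/
lemma sum_tuple_eq_sum_multi (m : ℕ) (F : (Fin n → ℕ) → ℝ) :
    ∑ r : Fin m → Fin n, F (tupleCount r) =
      ∑ α ∈ Finset.piAntidiag Finset.univ m, (Nat.multinomial Finset.univ α : ℝ) * F α := by
  classical
  let ℓ : MvPolynomial (Fin n) ℝ →ₗ[ℝ] ℝ :=
    (MvPolynomial.basisMonomials (Fin n) ℝ).constr ℝ fun β => F β
  have hℓ : ∀ α : Fin n → ℕ, ℓ (∏ i, (MvPolynomial.X i : MvPolynomial (Fin n) ℝ) ^ α i) = F α := by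
    intro α
    have : (∏ i, (MvPolynomial.X i : MvPolynomial (Fin n) ℝ) ^ α i) =
        MvPolynomial.basisMonomials (Fin n) ℝ (Finsupp.equivFunOnFinite.symm α) := by
      simp only [MvPolynomial.coe_basisMonomials]
      rw [MvPolynomial.monomial_eq]
      simp [Finsupp.prod_fintype]
    rw [this, Module.Basis.constr_basis]
    simp
  have h1 := Fintype.sum_pow (fun i : Fin n => (MvPolynomial.X i : MvPolynomial (Fin n) ℝ)) m
  rw [Finset.sum_pow_eq_sum_piAntidiag] at h1
  have h2 := congrArg ℓ h1
  rw [map_sum, map_sum] at h2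
  rw [show ∑ r : Fin m → Fin n, F (tupleCount r) = ∑ r : Fin m → Fin n,
    ℓ (∏ a, MvPolynomial.X (r a)) from ?_, ← h2]
  · refine Finset.sum_congr rfl fun α _ => ?_
    rw [← hℓ α, ← smul_eq_mul (a := (Nat.multinomial Finset.univ α : ℝ)), ← map_smul,
      MvPolynomial.smul_eq_C_mul]
    congr 1
  · refine Finset.sum_congr rfl fun r _ => ?_
    rw [prod_tuple_count, hℓ]

lemma iteratedFDeriv_diag_eq {f : Eu n → ℝ} {x : Eu n} {m : ℕ} (hf : ContDiffAt ℝ m f x)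
    (h : Eu n) :
    ((m.factorial : ℝ))⁻¹ * iteratedFDeriv ℝ m f x (fun _ => h) =
      ∑ α ∈ Finset.piAntidiag Finset.univ m,
        (multiFact α : ℝ)⁻¹ * pdAlpha α f x * monom α h := by
  rw [multilinear_apply_eq_sum]
  have h1 : ∀ r : Fin m → Fin n, (∏ a, h (r a)) *
      iteratedFDeriv ℝ m f x (fun a => stdE (r a)) =
      (fun α => monom α h * pdAlpha α f x) (tupleCount r) := by
    intro r
    rw [prod_tuple_count r (fun i => h i)]
    have h2 := pdMulti_eq_pdAlpha_count (List.ofFn r) (f := f) (x := x) (by simpa using hf)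
    have h3 := pdMulti_eq_iteratedFDeriv (List.ofFn r) (f := f) (x := x) (by simpa using hf)
    have : iteratedFDeriv ℝ m f x (fun a => stdE (r a)) = pdMulti (List.ofFn r) f x := by
      rw [h3]
      have : ∀ (m' : ℕ) (hm : m' = m) (g : Fin m' → Eu n) (g' : Fin m → Eu n),
          (∀ a, g a = g' (Fin.cast hm a)) →
          iteratedFDeriv ℝ m f x g' = iteratedFDeriv ℝ m' f x g := by
        rintro m' rfl g g' hg
        congr 1; funext a; simp [hg]
      refine this _ (by simp) _ _ ?_
      intro a; simp; rfl
    rw [this, h2]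
    rfl
  rw [Finset.sum_congr rfl fun r _ => h1 r, sum_tuple_eq_sum_multi m
    (fun α => monom α h * pdAlpha α f x), Finset.mul_sum]
  refine Finset.sum_congr rfl fun α hα => ?_
  have hs : ∑ i, α i = m := by simpa using (Finset.mem_piAntidiag.1 hα).1
  have h3 := Nat.multinomial_spec Finset.univ α
  rw [hs] at h3
  have h4 : (multiFact α : ℝ) * (Nat.multinomial Finset.univ α : ℝ) = m.factorial := by
    rw [← h3]; push_cast [multiFact]; rfl
  have h5 : (multiFact α : ℝ) ≠ 0 := by
    simp only [multiFact]; push_cast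
    exact Finset.prod_ne_zero_iff.2 fun i _ => by positivity
  have h6 : (m.factorial : ℝ) ≠ 0 := by positivity
  rw [← h4] at h6 ⊢
  have h7 : (Nat.multinomial Finset.univ α : ℝ) ≠ 0 := right_ne_zero_of_mul h6
  field_simp

lemma sum_multiIdxLE (k : ℕ) (F : (Fin n → ℕ) → ℝ) :
    ∑ α ∈ multiIdxLE n k, F α =
      ∑ m ∈ Finset.range (k + 1), ∑ α ∈ Finset.piAntidiag Finset.univ m, F α := by
  rw [← Finset.sum_biUnion]
  · refine Finset.sum_congr ?_ fun _ _ => rfl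
    ext α
    rw [multiIdxLE, Finset.mem_filter]
    simp only [Fintype.mem_piFinset, Finset.mem_range,
      Finset.mem_biUnion, Finset.mem_piAntidiag, multiDeg]
    constructor
    · rintro ⟨_, h⟩
      exact ⟨_, Nat.lt_succ_iff.2 h, rfl, by simp⟩
    · rintro ⟨m, hm, h, -⟩
      have h' : ∑ i, α i = m := h
      refine ⟨fun i => ?_, by omega⟩
      have : α i ≤ ∑ i, α i := Finset.single_le_sum (f := α) (fun _ _ => Nat.zero_le _)
        (Finset.mem_univ i)
      omega
  · intro a _ b _ hab
    rw [Function.onFun, Finset.disjoint_left]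
    intro α h1 h2
    exact hab ((Finset.mem_piAntidiag.1 h1).1.symm.trans (Finset.mem_piAntidiag.1 h2).1)

/-- The Taylor polynomial of order `k` of `f` at `x`, evaluated at the increment `h`. -/
def tay (k : ℕ) (f : Eu n → ℝ) (x h : Eu n) : ℝ :=
  ∑ α ∈ multiIdxLE n k, (multiFact α : ℝ)⁻¹ * pdAlpha α f x * monom α h

lemma tay_eq_sum {k : ℕ} {f : Eu n → ℝ} {x : Eu n} (hf : ContDiffAt ℝ k f x) (h : Eu n) :
    tay k f x h = ∑ m ∈ Finset.range (k + 1),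
      ((m.factorial : ℝ))⁻¹ * iteratedFDeriv ℝ m f x (fun _ => h) := by
  rw [tay, sum_multiIdxLE]
  refine Finset.sum_congr rfl fun m hm => ?_
  rw [iteratedFDeriv_diag_eq (hf.of_le _)]
  exact_mod_cast Nat.lt_succ_iff.1 (Finset.mem_range.1 hm)

lemma taylor_aux {k : ℕ} {f : Eu n → ℝ} {x h : Eu n} {c B : ℝ}
    (hf : ∀ t ∈ Icc (0 : ℝ) 1, ContDiffAt ℝ (k + 1) f (x + t • h))
    (hB : ∀ t ∈ Icc (0 : ℝ) 1,
      |iteratedFDeriv ℝ (k + 1) f (x + t • h) (fun _ => h) - c| ≤ B) :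
    |f (x + h) - tay k f x h - ((k + 1).factorial : ℝ)⁻¹ * c| ≤ B := by
  have hx : ContDiffAt ℝ (k + 1) f x := by simpa using hf 0 (by simp)
  rw [map_add_eq_sum_add_integral_iteratedFDeriv hf, tay_eq_sum (hx.of_le (by norm_cast; simp))]
  simp only [smul_eq_mul, add_sub_cancel_left]
  have hcont : ContinuousOn (fun t : ℝ => iteratedFDeriv ℝ (k + 1) f (x + t • h) (fun _ => h))
      (Icc 0 1) := by
    intro t ht
    have h1 : ContinuousAt (iteratedFDeriv ℝ (k + 1) f) (x + t • h) :=
      (hf t ht).continuousAt_iteratedFDeriv (by norm_cast)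
    have h2 : ContinuousAt (fun t : ℝ => x + t • h) t := by fun_prop
    have h3 : ContinuousAt (fun t : ℝ => iteratedFDeriv ℝ (k + 1) f (x + t • h)) t :=
      ContinuousAt.comp (f := fun t : ℝ => x + t • h) h1 h2
    exact ((ContinuousMultilinearMap.apply ℝ (fun _ : Fin (k + 1) => Eu n) ℝ
      (fun _ => h)).continuous.continuousAt.comp h3).continuousWithinAt
  have hInt : IntervalIntegrable (fun t : ℝ => (1 - t) ^ k *
      iteratedFDeriv ℝ (k + 1) f (x + t • h) (fun _ => h)) volume 0 1 := by
    refine ContinuousOn.intervalIntegrable_of_Icc zero_le_one ?_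
    exact ContinuousOn.mul (by fun_prop) hcont
  have hInt2 : IntervalIntegrable (fun t : ℝ => (1 - t) ^ k * c) volume 0 1 :=
    Continuous.intervalIntegrable (by fun_prop) _ _
  have hc : ((k + 1).factorial : ℝ)⁻¹ * c = ((k.factorial : ℝ))⁻¹ *
      ∫ t in (0 : ℝ)..1, (1 - t) ^ k * c := by
    rw [intervalIntegral.integral_mul_const]
    have : ∫ t in (0 : ℝ)..1, (1 - t) ^ k = ((k : ℝ) + 1)⁻¹ := by
      rw [intervalIntegral.integral_comp_sub_left (fun t => t ^ k) 1]
      simp [integral_pow]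
    rw [this, Nat.factorial_succ]
    push_cast
    rw [mul_inv]
    ring
  rw [hc, ← mul_sub, ← intervalIntegral.integral_sub hInt hInt2, abs_mul]
  have hI : |∫ t in (0 : ℝ)..1, ((1 - t) ^ k *
      iteratedFDeriv ℝ (k + 1) f (x + t • h) (fun _ => h) - (1 - t) ^ k * c)| ≤ B := by
    have := intervalIntegral.norm_integral_le_of_norm_le_const (a := (0 : ℝ)) (b := 1) (C := B)
      (f := fun t => ((1 - t) ^ k *
      iteratedFDeriv ℝ (k + 1) f (x + t • h) (fun _ => h) - (1 - t) ^ k * c)) ?_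
    · simpa using this
    · intro t ht
      rw [uIoc_of_le zero_le_one] at ht
      rw [← mul_sub, norm_mul, norm_pow, Real.norm_eq_abs, Real.norm_eq_abs]
      have h1 : |1 - t| ≤ 1 := by rw [abs_le]; constructor <;> linarith [ht.1, ht.2]
      have h2 := hB t ⟨ht.1.le, ht.2⟩
      calc _ ≤ 1 * B := mul_le_mul (pow_le_one₀ (abs_nonneg _) h1) h2 (abs_nonneg _) zero_le_one
        _ = B := one_mul _
  have hfac : |((k.factorial : ℝ))⁻¹| ≤ 1 := by
    rw [abs_of_nonneg (by positivity)]
    exact inv_le_one_of_one_le₀ (by exact_mod_cast Nat.succ_le_of_lt (Nat.factorial_pos k))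
  have hB0 : 0 ≤ B := (abs_nonneg _).trans hI
  calc _ ≤ 1 * B := mul_le_mul hfac hI (abs_nonneg _) zero_le_one
    _ = B := one_mul _

/-- Taylor's inequality for functions of class `C^{k+1}` along a segment. -/
lemma taylor_le {k : ℕ} {f : Eu n → ℝ} {x h : Eu n} {B : ℝ}
    (hf : ∀ t ∈ Icc (0 : ℝ) 1, ContDiffAt ℝ (k + 1) f (x + t • h))
    (hB : ∀ t ∈ Icc (0 : ℝ) 1, ‖iteratedFDeriv ℝ (k + 1) f (x + t • h)‖ ≤ B) :
    |f (x + h) - tay k f x h| ≤ B * ‖h‖ ^ (k + 1) := by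
  have := taylor_aux (c := 0) (B := B * ‖h‖ ^ (k + 1)) hf ?_
  · simpa using this
  · intro t ht
    rw [sub_zero]
    have h1 := (iteratedFDeriv ℝ (k + 1) f (x + t • h)).le_opNorm (fun _ => h)
    simp only [Finset.prod_const, Finset.card_univ, Fintype.card_fin] at h1
    exact h1.trans (mul_le_mul_of_nonneg_right (hB t ht) (by positivity))

/-- Taylor's inequality for functions of class `C^{k+1}` with controlled oscillation of the
top order derivative. -/
lemma taylor_holder {k : ℕ} {f : Eu n → ℝ} {x h : Eu n} {B : ℝ}
    (hf : ∀ t ∈ Icc (0 : ℝ) 1, ContDiffAt ℝ (k + 1) f (x + t • h))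
    (hB : ∀ t ∈ Icc (0 : ℝ) 1,
      ‖iteratedFDeriv ℝ (k + 1) f (x + t • h) - iteratedFDeriv ℝ (k + 1) f x‖ ≤ B) :
    |f (x + h) - tay (k + 1) f x h| ≤ B * ‖h‖ ^ (k + 1) := by
  have := taylor_aux (c := iteratedFDeriv ℝ (k + 1) f x (fun _ => h))
    (B := B * ‖h‖ ^ (k + 1)) hf ?_
  · have hx : ContDiffAt ℝ (k + 1) f x := by simpa using hf 0 (by simp)
    rw [tay_eq_sum (by exact_mod_cast hx), Finset.sum_range_succ,
      ← tay_eq_sum (hx.of_le (by norm_cast; simp)), ← sub_sub]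
    exact this
  · intro t ht
    have h1 := (iteratedFDeriv ℝ (k + 1) f (x + t • h) - iteratedFDeriv ℝ (k + 1) f x).le_opNorm
      (fun _ => h)
    simp only [Finset.prod_const, Finset.card_univ, Fintype.card_fin,
      _root_.sub_apply] at h1
    exact h1.trans (mul_le_mul_of_nonneg_right (hB t ht) (by positivity))

lemma pd_add {u v : Eu n → ℝ} {x : Eu n} (i : Fin n) (hu : DifferentiableAt ℝ u x)
    (hv : DifferentiableAt ℝ v x) : pd i (fun y => u y + v y) x = pd i u x + pd i v x := by
  simp only [pd]
  rw [fderiv_fun_add hu hv]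
  rfl

lemma pd_const_mul {u : Eu n → ℝ} {x : Eu n} (i : Fin n) (c : ℝ)
    (hu : DifferentiableAt ℝ u x) : pd i (fun y => c * u y) x = c * pd i u x := by
  simp only [pd]
  rw [fderiv_const_mul hu]
  rfl

lemma pd_mul {u v : Eu n → ℝ} {x : Eu n} (i : Fin n) (hu : DifferentiableAt ℝ u x)
    (hv : DifferentiableAt ℝ v x) :
    pd i (fun y => u y * v y) x = u x * pd i v x + v x * pd i u x := by
  simp only [pd]
  rw [fderiv_fun_mul hu hv]
  rfl

lemma ContDiffAt.eventually_differentiableAt {u : Eu n → ℝ} {x : Eu n}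
    (hu : ContDiffAt ℝ 2 u x) : ∀ᶠ y in 𝓝 x, DifferentiableAt ℝ u y := by
  filter_upwards [hu.eventually (by simp)] with y hy
  exact hy.differentiableAt (by norm_num)

lemma ContDiffAt.pd_differentiableAt {u : Eu n → ℝ} {x : Eu n} (i : Fin n)
    (hu : ContDiffAt ℝ 2 u x) : DifferentiableAt ℝ (_root_.pd i u) x := by
  have : ContDiffAt ℝ ((1 : ℕ∞) : WithTop ℕ∞) (_root_.pd i u) x := ContDiffAt.pd i (by
    convert hu using 1; norm_num)
  exact this.differentiableAt (by norm_num)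

lemma pd2_add {u v : Eu n → ℝ} {x : Eu n} (i j : Fin n) (hu : ContDiffAt ℝ 2 u x)
    (hv : ContDiffAt ℝ 2 v x) : pd2 i j (fun y => u y + v y) x = pd2 i j u x + pd2 i j v x := by
  have h1 : (fun z => pd j (fun y => u y + v y) z) =ᶠ[𝓝 x] fun z => pd j u z + pd j v z := by
    filter_upwards [hu.eventually_differentiableAt, hv.eventually_differentiableAt] with y h1 h2
    exact pd_add j h1 h2
  rw [pd2, (pd_congr_nhds i h1).self_of_nhds,
    pd_add i (hu.pd_differentiableAt j) (hv.pd_differentiableAt j)]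
  rfl

lemma pd2_const_mul {u : Eu n → ℝ} {x : Eu n} (i j : Fin n) (c : ℝ)
    (hu : ContDiffAt ℝ 2 u x) : pd2 i j (fun y => c * u y) x = c * pd2 i j u x := by
  have h1 : (fun z => pd j (fun y => c * u y) z) =ᶠ[𝓝 x] fun z => c * pd j u z := by
    filter_upwards [hu.eventually_differentiableAt] with y h1
    exact pd_const_mul j c h1
  rw [pd2, (pd_congr_nhds i h1).self_of_nhds, pd_const_mul i c (hu.pd_differentiableAt j)]
  rfl

lemma pd2_mul {u v : Eu n → ℝ} {x : Eu n} (i j : Fin n) (hu : ContDiffAt ℝ 2 u x)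
    (hv : ContDiffAt ℝ 2 v x) : pd2 i j (fun y => u y * v y) x =
      u x * pd2 i j v x + pd i u x * pd j v x + pd j u x * pd i v x + v x * pd2 i j u x := by
  have h1 : (fun z => pd j (fun y => u y * v y) z) =ᶠ[𝓝 x]
      fun z => u z * pd j v z + v z * pd j u z := by
    filter_upwards [hu.eventually_differentiableAt, hv.eventually_differentiableAt] with y h1 h2
    exact pd_mul j h1 h2
  have hu1 := hu.differentiableAt (by norm_num)
  have hv1 := hv.differentiableAt (by norm_num)
  rw [pd2, (pd_congr_nhds i h1).self_of_nhds,
    pd_add (u := fun z => u z * pd j v z) (v := fun z => v z * pd j u z) i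
      (hu1.mul (hv.pd_differentiableAt j)) (hv1.mul (hu.pd_differentiableAt j)),
    pd_mul i hu1 (hv.pd_differentiableAt j), pd_mul i hv1 (hu.pd_differentiableAt j)]
  simp only [pd2]
  ring

lemma lapl_add {u v : Eu n → ℝ} {x : Eu n} (hu : ContDiffAt ℝ 2 u x) (hv : ContDiffAt ℝ 2 v x) :
    lapl (fun y => u y + v y) x = lapl u x + lapl v x := by
  simp only [lapl, pd2_add _ _ hu hv, Finset.sum_add_distrib]

lemma lapl_const_mul {u : Eu n → ℝ} {x : Eu n} (c : ℝ) (hu : ContDiffAt ℝ 2 u x) :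
    lapl (fun y => c * u y) x = c * lapl u x := by
  simp only [lapl, pd2_const_mul _ _ c hu, Finset.mul_sum]

lemma lapl_neg (u : Eu n → ℝ) (x : Eu n) : lapl (fun y => - u y) x = - lapl u x := by
  have : ∀ (i : Fin n) (w : Eu n → ℝ), pd i (fun y => - w y) = fun z => - pd i w z := by
    intro i w; funext z; simp [pd, fderiv_fun_neg]
  simp only [lapl, pd2, this, Finset.sum_neg_distrib]

lemma lapl_sub {u v : Eu n → ℝ} {x : Eu n} (hu : ContDiffAt ℝ 2 u x) (hv : ContDiffAt ℝ 2 v x) :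
    lapl (fun y => u y - v y) x = lapl u x - lapl v x := by
  simp only [sub_eq_add_neg]
  rw [lapl_add hu hv.neg, lapl_neg]

lemma lapl_mul {u v : Eu n → ℝ} {x : Eu n} (hu : ContDiffAt ℝ 2 u x) (hv : ContDiffAt ℝ 2 v x) :
    lapl (fun y => u y * v y) x =
      u x * lapl v x + 2 * ∑ i, pd i u x * pd i v x + v x * lapl u x := by
  simp only [lapl, pd2_mul _ _ hu hv, Finset.mul_sum, ← Finset.sum_add_distrib]
  refine Finset.sum_congr rfl fun i _ => ?_
  ring

lemma pd_const (i : Fin n) (c : ℝ) : pd i (fun _ => c) = fun _ => 0 := by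
  funext x; simp [pd]

lemma lapl_const (c : ℝ) (x : Eu n) : lapl (fun _ => c) x = 0 := by
  simp [lapl, pd2, pd_const]

lemma pd_coord (i j : Fin n) : pd i (fun y => y j) = fun _ => if i = j then 1 else 0 := by
  funext x
  have : (fun y : Eu n => y j) = EuclideanSpace.proj (𝕜 := ℝ) j := rfl
  simp only [pd, this, ContinuousLinearMap.fderiv]
  simp [eq_comm]

lemma lapl_coord (j : Fin n) (x : Eu n) : lapl (fun y => y j) x = 0 := by
  simp only [lapl, pd2, pd_coord, pd_const]; simp

lemma contDiff_coord (j : Fin n) {m : WithTop ℕ∞} : ContDiff ℝ m (fun y : Eu n => y j) :=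
  (EuclideanSpace.proj (𝕜 := ℝ) j).contDiff

/-- The Laplacian is invariant under similarities, up to the square of the dilation factor. -/
lemma lapl_comp_similarity {u : Eu n → ℝ} (L : Eu n ≃ₗᵢ[ℝ] Eu n) (a : Eu n) (r : ℝ) {x : Eu n}
    (hu : ContDiffAt ℝ 2 u (a + r • L x)) :
    lapl (fun y => u (a + r • L y)) x = r ^ 2 * lapl u (a + r • L x) := by
  have hA : ContDiff ℝ 2 (fun y : Eu n => a + r • L y) :=
    contDiff_const.add (L.contDiff.const_smul r)
  have hw : ContDiffAt ℝ 2 (fun y => u (a + r • L y)) x := hu.comp x hA.contDiffAt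
  rw [lapl_eq_laplacian hu, InnerProductSpace.laplacian_eq_iteratedFDeriv_orthonormalBasis u
    ((EuclideanSpace.basisFun (Fin n) ℝ).map L)]
  simp only [lapl, Finset.mul_sum]
  refine Finset.sum_congr rfl fun i _ => ?_
  have hd : ∀ y, HasFDerivAt (fun y : Eu n => a + r • L y)
      (r • (L.toContinuousLinearEquiv : Eu n →L[ℝ] Eu n)) y := by
    intro y
    exact ((L.toContinuousLinearEquiv : Eu n →L[ℝ] Eu n).hasFDerivAt.const_smul r).const_add a
  have hf : fderiv ℝ (fun y => u (a + r • L y)) =ᶠ[𝓝 x] fun y =>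
      (fderiv ℝ u (a + r • L y)).comp (r • (L.toContinuousLinearEquiv : Eu n →L[ℝ] Eu n)) := by
    have h1 : ∀ᶠ y in 𝓝 x, DifferentiableAt ℝ u (a + r • L y) :=
      (hA.continuous.continuousAt (x := x)).eventually hu.eventually_differentiableAt
    filter_upwards [h1] with y hy
    exact (hy.hasFDerivAt.comp y (hd y)).fderiv
  have h1 : DifferentiableAt ℝ (fderiv ℝ u) (a + r • L x) :=
    (hu.fderiv_right (m := 1) (by norm_num)).differentiableAt (by norm_num)
  have h2 : HasFDerivAt (fun y => fderiv ℝ u (a + r • L y))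
      ((fderiv ℝ (fderiv ℝ u) (a + r • L x)).comp
        (r • (L.toContinuousLinearEquiv : Eu n →L[ℝ] Eu n))) x :=
    HasFDerivAt.comp (f := fun y : Eu n => a + r • L y) x h1.hasFDerivAt (hd x)
  have h3 : HasFDerivAt (fderiv ℝ (fun y => u (a + r • L y)))
      (((ContinuousLinearMap.compL ℝ (Eu n) (Eu n) ℝ).flip
        (r • (L.toContinuousLinearEquiv : Eu n →L[ℝ] Eu n))).comp
      ((fderiv ℝ (fderiv ℝ u) (a + r • L x)).comp
        (r • (L.toContinuousLinearEquiv : Eu n →L[ℝ] Eu n)))) x :=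
    (((ContinuousLinearMap.compL ℝ (Eu n) (Eu n) ℝ).flip
        (r • (L.toContinuousLinearEquiv : Eu n →L[ℝ] Eu n))).hasFDerivAt.comp x
          h2).congr_of_eventuallyEq hf
  rw [pd2_eq_fderiv i i hw, h3.fderiv, iteratedFDeriv_two_apply]
  simp [stdE]
  ring

lemma lapl_comp_dil {u : Eu n → ℝ} (a : Eu n) (r : ℝ) {x : Eu n}
    (hu : ContDiffAt ℝ 2 u (a + r • x)) :
    lapl (fun y => u (a + r • y)) x = r ^ 2 * lapl u (a + r • x) :=
  lapl_comp_similarity (LinearIsometryEquiv.refl ℝ (Eu n)) a r hu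

/-- Laplacian of a radial function written in terms of the squared norm. -/
lemma lapl_radial {f f' : ℝ → ℝ} {f'' : ℝ} {x : Eu n}
    (hf : ∀ᶠ s in 𝓝 (‖x‖ ^ 2), HasDerivAt f (f' s) s) (hf' : HasDerivAt f' f'' (‖x‖ ^ 2)) :
    lapl (fun y => f (‖y‖ ^ 2)) x = 4 * ‖x‖ ^ 2 * f'' + 2 * n * f' (‖x‖ ^ 2) := by
  have hN : ∀ y : Eu n, HasFDerivAt (fun y : Eu n => ‖y‖ ^ 2) (2 • innerSL ℝ y) y := fun y =>
    (hasStrictFDerivAt_norm_sq y).hasFDerivAt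
  have hc : ContinuousAt (fun y : Eu n => ‖y‖ ^ 2) x := by fun_prop
  have h1 : ∀ i, (fun z => pd i (fun y => f (‖y‖ ^ 2)) z) =ᶠ[𝓝 x]
      fun z => f' (‖z‖ ^ 2) * (2 * z i) := by
    intro i
    filter_upwards [hc.eventually hf] with y hy
    have h := hy.comp_hasFDerivAt y (hN y)
    have h' : fderiv ℝ (fun y : Eu n => f (‖y‖ ^ 2)) y = _ := h.fderiv
    simp only [pd, h']
    simp [inner]
  have h2 : ∀ i, pd2 i i (fun y => f (‖y‖ ^ 2)) x =
      f' (‖x‖ ^ 2) * 2 + 4 * (x i) ^ 2 * f'' := by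
    intro i
    rw [pd2, (pd_congr_nhds i (h1 i)).self_of_nhds]
    have hd := hf'.comp_hasFDerivAt x (hN x)
    have hd' : DifferentiableAt ℝ (fun y : Eu n => f' (‖y‖ ^ 2)) x := hd.differentiableAt
    have hd'' : fderiv ℝ (fun y : Eu n => f' (‖y‖ ^ 2)) x = _ := hd.fderiv
    have hci := ((contDiff_coord (n := n) i (m := 1)).differentiable (by norm_num)) x
    rw [pd_mul i hd' (hci.const_mul 2), pd_const_mul i 2 hci, pd_coord]
    simp only [pd, hd'']
    simp [inner]
    ring
  simp only [lapl, h2, Finset.sum_add_distrib]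
  rw [← Finset.sum_mul, ← Finset.sum_mul, ← Finset.mul_sum, ← EuclideanSpace.real_norm_sq_eq]
  simp
  ring

lemma lapl_normSq_sub (c x : Eu n) : lapl (fun y => ‖y - c‖ ^ 2) x = 2 * n := by
  have h := lapl_comp_dil (u := fun y : Eu n => ‖y‖ ^ 2) (-c) 1 (x := x)
    (contDiff_norm_sq ℝ).contDiffAt
  have h2 := lapl_radial (n := n) (f := id) (f' := fun _ => 1) (f'' := 0) (x := -c + (1 : ℝ) • x)
    (Filter.Eventually.of_forall fun s => hasDerivAt_id s) (hasDerivAt_const _ _)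
  simp only [id] at h2
  rw [h2] at h
  have h3 : (fun y : Eu n => ‖y - c‖ ^ 2) = fun y => ‖-c + (1 : ℝ) • y‖ ^ 2 := by
    funext y; rw [one_smul, sub_eq_neg_add]
  rw [h3, h]
  ring

lemma IsHarmonicOn.contDiffAt {u : Eu n → ℝ} {Ω : Set (Eu n)} (hu : IsHarmonicOn u Ω)
    (hΩ : IsOpen Ω) {x : Eu n} (hx : x ∈ Ω) : ContDiffAt ℝ 2 u x :=
  hu.1.contDiffAt (hΩ.mem_nhds hx)

lemma isHarmonicOn_of_contDiffAt {u : Eu n → ℝ} {Ω : Set (Eu n)}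
    (h : ∀ x ∈ Ω, ContDiffAt ℝ 2 u x ∧ lapl u x = 0) : IsHarmonicOn u Ω :=
  ⟨fun x hx => (h x hx).1.contDiffWithinAt, fun x hx => (h x hx).2⟩

lemma IsHarmonicOn.mono {u : Eu n → ℝ} {Ω Ω' : Set (Eu n)} (hu : IsHarmonicOn u Ω)
    (h : Ω' ⊆ Ω) : IsHarmonicOn u Ω' := ⟨hu.1.mono h, fun x hx => hu.2 x (h hx)⟩

lemma IsHarmonicOn.add {u v : Eu n → ℝ} {Ω : Set (Eu n)} (hΩ : IsOpen Ω)
    (hu : IsHarmonicOn u Ω) (hv : IsHarmonicOn v Ω) : IsHarmonicOn (fun x => u x + v x) Ω :=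
  ⟨hu.1.add hv.1, fun x hx => by
    rw [lapl_add (hu.contDiffAt hΩ hx) (hv.contDiffAt hΩ hx), hu.2 x hx, hv.2 x hx, add_zero]⟩

lemma IsHarmonicOn.sub {u v : Eu n → ℝ} {Ω : Set (Eu n)} (hΩ : IsOpen Ω)
    (hu : IsHarmonicOn u Ω) (hv : IsHarmonicOn v Ω) : IsHarmonicOn (fun x => u x - v x) Ω :=
  ⟨hu.1.sub hv.1, fun x hx => by
    rw [lapl_sub (hu.contDiffAt hΩ hx) (hv.contDiffAt hΩ hx), hu.2 x hx, hv.2 x hx, sub_zero]⟩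

lemma IsHarmonicOn.const_mul {u : Eu n → ℝ} {Ω : Set (Eu n)} (hΩ : IsOpen Ω)
    (hu : IsHarmonicOn u Ω) (c : ℝ) : IsHarmonicOn (fun x => c * u x) Ω :=
  ⟨contDiffOn_const.mul hu.1, fun x hx => by
    rw [lapl_const_mul c (hu.contDiffAt hΩ hx), hu.2 x hx, mul_zero]⟩

lemma isHarmonicOn_const (c : ℝ) (Ω : Set (Eu n)) : IsHarmonicOn (fun _ => c) Ω :=
  ⟨contDiffOn_const, fun x _ => lapl_const c x⟩

lemma IsHarmonicOn.comp_similarity {u : Eu n → ℝ} {Ω : Set (Eu n)} (hΩ : IsOpen Ω)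
    (hu : IsHarmonicOn u Ω) (L : Eu n ≃ₗᵢ[ℝ] Eu n) (a : Eu n) (r : ℝ) :
    IsHarmonicOn (fun y => u (a + r • L y)) ((fun y => a + r • L y) ⁻¹' Ω) := by
  refine isHarmonicOn_of_contDiffAt fun x hx => ?_
  have h := hu.contDiffAt hΩ hx
  have hA : ContDiff ℝ 2 (fun y : Eu n => a + r • L y) :=
    contDiff_const.add (L.contDiff.const_smul r)
  refine ⟨h.comp x hA.contDiffAt, ?_⟩
  rw [lapl_comp_similarity L a r h, hu.2 _ hx, mul_zero]

lemma pd2_self_eq_deriv {w : Eu n → ℝ} {x : Eu n} (i : Fin n) (hw : ContDiffAt ℝ 2 w x) :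
    (∀ᶠ t in 𝓝 (0 : ℝ), HasDerivAt (fun t : ℝ => w (x + t • stdE i))
      (pd i w (x + t • stdE i)) t) ∧
    HasDerivAt (fun t : ℝ => pd i w (x + t • stdE i)) (pd2 i i w x) 0 := by
  have hA : ∀ t : ℝ, HasDerivAt (fun t : ℝ => x + t • stdE i) (stdE i) t := fun t => by
    simpa using ((hasDerivAt_id t).smul_const (stdE i)).const_add x
  have hc : Filter.Tendsto (fun t : ℝ => x + t • stdE i) (𝓝 0) (𝓝 x) := by
    simpa using (hA 0).continuousAt.tendsto
  constructor
  · filter_upwards [hc.eventually hw.eventually_differentiableAt] with t ht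
    exact ht.hasFDerivAt.comp_hasDerivAt t (hA t)
  · have h := hw.pd_differentiableAt i
    have h0 : x + (0 : ℝ) • stdE i = x := by simp
    have h1 : HasFDerivAt (pd i w) (fderiv ℝ (pd i w) x) (x + (0 : ℝ) • stdE i) := by
      rw [h0]; exact h.hasFDerivAt
    exact h1.comp_hasDerivAt 0 (hA 0)

lemma pd2_self_nonpos_of_isLocalMax {w : Eu n → ℝ} {x : Eu n} (i : Fin n)
    (hw : ContDiffAt ℝ 2 w x) (hmax : IsLocalMax w x) : pd2 i i w x ≤ 0 := by
  by_contra! hpos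
  obtain ⟨h1, h2⟩ := pd2_self_eq_deriv i hw
  set g : ℝ → ℝ := fun t => w (x + t • stdE i) with hg
  have hc : Filter.Tendsto (fun t : ℝ => x + t • stdE i) (𝓝 0) (𝓝 x) := by
    have : Continuous (fun t : ℝ => x + t • stdE i) := by fun_prop
    simpa using this.tendsto 0
  have hgmax : IsLocalMax g 0 := by
    have := hc.eventually hmax
    filter_upwards [this] with t ht
    simpa [hg] using ht
  have hder : deriv g =ᶠ[𝓝 0] fun t => pd i w (x + t • stdE i) := by
    filter_upwards [h1] with t ht
    exact ht.deriv
  have hdd : deriv (deriv g) 0 = pd2 i i w x := by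
    rw [hder.deriv_eq]; exact h2.deriv
  have hmin : IsLocalMin g 0 := isLocalMin_of_deriv_deriv_pos (by rw [hdd]; exact hpos)
    hgmax.deriv_eq_zero h1.self_of_nhds.continuousAt
  have hconst : g =ᶠ[𝓝 0] fun _ => g 0 := by
    filter_upwards [hgmax, hmin] with t h3 h4
    exact le_antisymm h3 h4
  have : deriv (deriv g) 0 = 0 := by
    rw [hconst.deriv.deriv_eq]; simp
  linarith

/-- The weak maximum principle for subharmonic functions on bounded open sets. -/
theorem max_principle (hn : 0 < n) {Ω : Set (Eu n)} (hΩ : IsOpen Ω)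
    (hb : Bornology.IsBounded Ω) {u : Eu n → ℝ} (hu : ∀ x ∈ Ω, ContDiffAt ℝ 2 u x)
    (hl : ∀ x ∈ Ω, 0 ≤ lapl u x)
    (hbd : ∀ z ∈ frontier Ω, ∀ ε > 0, ∀ᶠ x in 𝓝[Ω] z, u x ≤ ε) : ∀ x ∈ Ω, u x ≤ 0 := by
  intro x₁ hx₁
  by_contra! hpos
  obtain ⟨R, hR⟩ := hb.subset_ball (0 : Eu n)
  set a := u x₁ / 2 with ha
  set K := {x ∈ Ω | a ≤ u x} with hK
  have hKc : IsCompact K := by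
    refine Metric.isCompact_of_isClosed_isBounded ?_ (hb.subset fun x hx => hx.1)
    refine isClosed_of_closure_subset fun z hz => ?_
    have hzΩ : z ∈ Ω := by
      by_contra hzn
      have hzf : z ∈ frontier Ω := by
        rw [hΩ.frontier_eq]
        exact ⟨closure_mono (fun x hx => hx.1) hz, hzn⟩
      have h1 := hbd z hzf (a / 2) (by linarith)
      rw [eventually_nhdsWithin_iff] at h1
      obtain ⟨y, hy1, hy2⟩ := mem_closure_iff_nhds.1 hz _ h1
      have := hy1 hy2.1
      linarith [hy2.2]
    refine ⟨hzΩ, ?_⟩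
    by_contra! hlt
    have h1 : ∀ᶠ y in 𝓝 z, u y < a := (hu z hzΩ).continuousAt.eventually (gt_mem_nhds hlt)
    obtain ⟨y, hy1, hy2⟩ := mem_closure_iff_nhds.1 hz _ h1
    exact absurd hy2.2 (not_le.2 hy1)
  have hR0 : 0 < R := by
    have := hR hx₁
    rw [mem_ball_zero_iff] at this
    linarith [norm_nonneg x₁]
  set ε := a / (2 * R ^ 2) with hε
  have hε0 : 0 < ε := by positivity
  have hεR : ε * R ^ 2 = a / 2 := by rw [hε]; field_simp
  have hcont : ContinuousOn (fun x => u x + ε * ‖x‖ ^ 2) K := fun x hx =>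
    ((hu x hx.1).continuousAt.add (by fun_prop)).continuousWithinAt
  obtain ⟨x₀, hx₀, hmax⟩ := hKc.exists_isMaxOn ⟨x₁, hx₁, by linarith⟩ hcont
  have hq : ∀ x ∈ Ω, ε * ‖x‖ ^ 2 ≤ a / 2 := by
    intro x hx
    rw [← hεR]
    have := hR hx
    rw [mem_ball_zero_iff] at this
    gcongr
  have hux₀ : a < u x₀ := by
    have h1 := hmax (⟨hx₁, by linarith⟩ : x₁ ∈ K)
    simp only [mem_ofPred_eq] at h1
    have h2 := hq x₀ hx₀.1
    have : 0 ≤ ε * ‖x₁‖ ^ 2 := by positivity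
    linarith
  have hloc : IsLocalMax (fun x => u x + ε * ‖x‖ ^ 2) x₀ := by
    have h1 : ∀ᶠ y in 𝓝 x₀, a < u y := (hu x₀ hx₀.1).continuousAt.eventually (lt_mem_nhds hux₀)
    filter_upwards [h1, hΩ.mem_nhds hx₀.1] with y hy1 hy2
    exact hmax (⟨hy2, hy1.le⟩ : y ∈ K)
  have hN : ContDiffAt ℝ 2 (fun x : Eu n => ‖x‖ ^ 2) x₀ := (contDiff_norm_sq ℝ).contDiffAt
  have hN2 : ContDiffAt ℝ 2 (fun x : Eu n => ε * ‖x‖ ^ 2) x₀ := contDiffAt_const.mul hN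
  have h3 : lapl (fun x => u x + ε * ‖x‖ ^ 2) x₀ ≤ 0 :=
    Finset.sum_nonpos fun i _ => pd2_self_nonpos_of_isLocalMax i ((hu x₀ hx₀.1).add hN2) hloc
  have h4 := lapl_normSq_sub (0 : Eu n) x₀
  simp only [sub_zero] at h4
  rw [lapl_add (hu x₀ hx₀.1) hN2, lapl_const_mul ε hN, h4] at h3
  have h5 := hl x₀ hx₀.1
  have : 0 < ε * (2 * (n : ℝ)) := by positivity
  linarith

/-- Comparison principle. -/
theorem comparison_principle (hn : 0 < n) {Ω : Set (Eu n)} (hΩ : IsOpen Ω)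
    (hb : Bornology.IsBounded Ω) {u v : Eu n → ℝ} (hu : ∀ x ∈ Ω, ContDiffAt ℝ 2 u x)
    (hv : ∀ x ∈ Ω, ContDiffAt ℝ 2 v x)
    (hl : ∀ x ∈ Ω, lapl v x ≤ lapl u x)
    (hbd : ∀ z ∈ frontier Ω, ∀ ε > 0, ∀ᶠ x in 𝓝[Ω] z, u x ≤ v x + ε) :
    ∀ x ∈ Ω, u x ≤ v x := by
  intro x hx
  have := max_principle hn hΩ hb (u := fun x => u x - v x) (fun x hx => (hu x hx).sub (hv x hx))
    (fun x hx => by rw [lapl_sub (hu x hx) (hv x hx)]; linarith [hl x hx])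
    (fun z hz ε hε => (hbd z hz ε hε).mono fun x hx => by linarith) x hx
  linarith

lemma tsupport_pd_subset (i : Fin n) (φ : Eu n → ℝ) : tsupport (pd i φ) ⊆ tsupport φ :=
  (closure_mono fun x hx => by
    by_contra h
    exact hx (by simp only [pd, fderiv_of_notMem_tsupport ℝ h]; rfl)).trans
      isClosed_closure.closure_subset

lemma HasCompactSupport.pd {φ : Eu n → ℝ} (h : HasCompactSupport φ) (i : Fin n) :
    HasCompactSupport (_root_.pd i φ) :=
  h.mono' ((subset_tsupport _).trans (tsupport_pd_subset i φ))

lemma tsupport_pd2_subset (i j : Fin n) (φ : Eu n → ℝ) : tsupport (pd2 i j φ) ⊆ tsupport φ :=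
  (tsupport_pd_subset i _).trans (tsupport_pd_subset j φ)

lemma tsupport_lapl_subset (φ : Eu n → ℝ) : tsupport (lapl φ) ⊆ tsupport φ := by
  refine (closure_mono fun x hx => ?_).trans isClosed_closure.closure_subset
  by_contra h
  refine hx (Finset.sum_eq_zero fun i _ => ?_)
  exact image_eq_zero_of_notMem_tsupport fun h' => h (tsupport_pd2_subset i i φ h')

lemma HasCompactSupport.lapl {φ : Eu n → ℝ} (h : HasCompactSupport φ) :
    HasCompactSupport (_root_.lapl φ) :=
  h.mono' ((subset_tsupport _).trans (tsupport_lapl_subset φ))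

lemma ContDiff.lapl_top {u : Eu n → ℝ} (hu : ContDiff ℝ ∞ u) : ContDiff ℝ ∞ (_root_.lapl u) :=
  ContDiff.sum fun i _ => (hu.pd_top i).pd_top i

lemma tsupport_pdMulti_subset (L : List (Fin n)) (φ : Eu n → ℝ) :
    tsupport (pdMulti L φ) ⊆ tsupport φ := by
  induction L with
  | nil => exact subset_rfl
  | cons i L ih => exact (tsupport_pd_subset i _).trans ih

/-- A product of a function continuous near the support of a compactly supported function. -/
lemma continuous_mul_of_tsupport {u φ : Eu n → ℝ} {Ω : Set (Eu n)} (hΩ : IsOpen Ω)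
    (hu : ContinuousOn u Ω) (hφ : Continuous φ) (hs : tsupport φ ⊆ Ω) :
    Continuous fun x => u x * φ x := by
  refine continuous_of_tsupport fun x hx => ?_
  have hxφ : x ∈ tsupport φ := closure_mono (fun y hy => right_ne_zero_of_mul hy) hx
  exact (hu.continuousAt (hΩ.mem_nhds (hs hxφ))).mul hφ.continuousAt

lemma integrable_mul_of_tsupport {u φ : Eu n → ℝ} {Ω : Set (Eu n)} (hΩ : IsOpen Ω)
    (hu : ContinuousOn u Ω) (hφ : Continuous φ) (hc : HasCompactSupport φ) (hs : tsupport φ ⊆ Ω) :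
    Integrable fun x => u x * φ x :=
  (continuous_mul_of_tsupport hΩ hu hφ hs).integrable_of_hasCompactSupport hc.mul_left

lemma integral_mul_pd {u φ : Eu n → ℝ} {Ω : Set (Eu n)} (hΩ : IsOpen Ω) (i : Fin n)
    (hu : ContDiffOn ℝ 1 u Ω) (hφ : ContDiff ℝ 1 φ) (hc : HasCompactSupport φ)
    (hs : tsupport φ ⊆ Ω) : ∫ x, u x * pd i φ x = - ∫ x, pd i u x * φ x := by
  have hpu : ContinuousOn (pd i u) Ω :=
    (hu.continuousOn_fderiv_of_isOpen hΩ le_rfl).clm_apply continuousOn_const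
  have hpφ : Continuous (pd i φ) := (hφ.continuous_fderiv (by simp)).clm_apply continuous_const
  refine integral_mul_fderiv_eq_neg_fderiv_mul_of_integrable ?_ ?_ ?_ ?_ ?_
  · exact integrable_mul_of_tsupport hΩ hpu hφ.continuous hc hs
  · exact integrable_mul_of_tsupport hΩ hu.continuousOn hpφ (hc.pd i)
      ((tsupport_pd_subset i φ).trans hs)
  · exact integrable_mul_of_tsupport hΩ hu.continuousOn hφ.continuous hc hs
  · exact fun x hx => (hu.contDiffAt (hΩ.mem_nhds (hs hx))).differentiableAt (by simp)
  · exact fun x _ => hφ.differentiable (by simp) x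

lemma integral_mul_lapl {u φ : Eu n → ℝ} {Ω : Set (Eu n)} (hΩ : IsOpen Ω)
    (hu : ContDiffOn ℝ 2 u Ω) (hφ : ContDiff ℝ ∞ φ) (hc : HasCompactSupport φ)
    (hs : tsupport φ ⊆ Ω) : ∫ x, u x * lapl φ x = ∫ x, lapl u x * φ x := by
  have hu1 : ContDiffOn ℝ 1 u Ω := hu.of_le (by norm_num)
  have hpu : ∀ i, ContDiffOn ℝ 1 (pd i u) Ω := fun i =>
    (hu.fderiv_of_isOpen hΩ (by norm_num)).clm_apply contDiffOn_const
  have hpu2 : ∀ i, ContinuousOn (pd2 i i u) Ω := fun i =>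
    ((hpu i).continuousOn_fderiv_of_isOpen hΩ le_rfl).clm_apply continuousOn_const
  simp only [lapl, Finset.mul_sum, Finset.sum_mul]
  have hp : ∀ i, ContDiff ℝ ∞ (pd i φ) := fun i => hφ.pd_top i
  rw [integral_finsetSum, integral_finsetSum]
  · refine Finset.sum_congr rfl fun i _ => ?_
    have h1 := integral_mul_pd hΩ i hu1 ((hp i).of_le (by exact_mod_cast le_top)) (hc.pd i)
      ((tsupport_pd_subset i φ).trans hs)
    have h2 := integral_mul_pd hΩ i (hpu i) (hφ.of_le (by exact_mod_cast le_top)) hc hs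
    simp only [pd2]
    rw [h1, h2, neg_neg]
  · exact fun i _ => integrable_mul_of_tsupport hΩ (hpu2 i) hφ.continuous hc hs
  · exact fun i _ => integrable_mul_of_tsupport hΩ hu.continuousOn ((hp i).pd_top i).continuous
      ((hc.pd i).pd i) ((tsupport_pd2_subset i i φ).trans hs)

/-- Weak (distributional) harmonicity. -/
def WeaklyHarmonicOn (u : Eu n → ℝ) (Ω : Set (Eu n)) : Prop :=
  ∀ φ : Eu n → ℝ, ContDiff ℝ ∞ φ → HasCompactSupport φ → tsupport φ ⊆ Ω →
    ∫ x, u x * lapl φ x = 0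

lemma IsHarmonicOn.weaklyHarmonicOn {u : Eu n → ℝ} {Ω : Set (Eu n)} (hΩ : IsOpen Ω)
    (hu : IsHarmonicOn u Ω) : WeaklyHarmonicOn u Ω := by
  intro φ hφ hc hs
  rw [integral_mul_lapl hΩ hu.1 hφ hc hs]
  refine integral_eq_zero_of_ae (Filter.Eventually.of_forall fun x => ?_)
  by_cases hx : x ∈ Ω
  · simp [hu.2 x hx]
  · simp [image_eq_zero_of_notMem_tsupport fun h => hx (hs h)]

/-- Convolution of real functions on Euclidean space. -/
def cv (f g : Eu n → ℝ) (x : Eu n) : ℝ := ∫ y, f y * g (x - y)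

lemma cv_eq (f g : Eu n → ℝ) :
    cv f g = MeasureTheory.convolution f g (ContinuousLinearMap.lsmul ℝ ℝ) volume := rfl

section

variable {f g : Eu n → ℝ}

lemma contDiff_cv (hf : LocallyIntegrable f) (hg : ContDiff ℝ ∞ g) (hc : HasCompactSupport g) :
    ContDiff ℝ ∞ (cv f g) := by
  rw [cv_eq]
  exact hc.contDiff_convolution_right _ hf hg

lemma pd_cv (hf : LocallyIntegrable f) (hg : ContDiff ℝ ∞ g) (hc : HasCompactSupport g)
    (i : Fin n) : pd i (cv f g) = cv f (pd i g) := by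
  funext x
  have h := hc.hasFDerivAt_convolution_right (ContinuousLinearMap.lsmul ℝ ℝ) hf
    (hg.of_le (by exact_mod_cast le_top)) x
  rw [pd, cv_eq, h.fderiv]
  have hInt : ConvolutionExistsAt f (fderiv ℝ g) x
      ((ContinuousLinearMap.lsmul ℝ ℝ).precompR (Eu n)) volume :=
    (hc.fderiv ℝ).convolutionExists_right _ hf
      (hg.continuous_fderiv (by simp)) x
  rw [convolution, ContinuousLinearMap.integral_apply hInt]
  rfl

lemma pdMulti_cv (hf : LocallyIntegrable f) (hg : ContDiff ℝ ∞ g) (hc : HasCompactSupport g)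
    (L : List (Fin n)) : pdMulti L (cv f g) = cv f (pdMulti L g) := by
  induction L with
  | nil => rfl
  | cons i L ih =>
    rw [pdMulti, ih, pd_cv hf (hg.pdMulti_top L)
      (hc.mono' ((subset_tsupport _).trans (tsupport_pdMulti_subset L g)))]
    rfl

lemma integrable_cv (hf : LocallyIntegrable f) (hg : Continuous g) (hc : HasCompactSupport g)
    (x : Eu n) : Integrable fun y => f y * g (x - y) :=
  hc.convolutionExists_right (ContinuousLinearMap.lsmul ℝ ℝ) hf hg x

lemma lapl_cv (hf : LocallyIntegrable f) (hg : ContDiff ℝ ∞ g) (hc : HasCompactSupport g)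
    (x : Eu n) : lapl (cv f g) x = cv f (lapl g) x := by
  have : ∀ i, pd2 i i (cv f g) x = cv f (pd2 i i g) x := fun i =>
    congrFun (pdMulti_cv hf hg hc [i, i]) x
  rw [show lapl (cv f g) x = ∑ i, pd2 i i (cv f g) x from rfl]
  simp only [this]
  have h2 : ∀ y, f y * lapl g (x - y) = ∑ i, f y * pd2 i i g (x - y) := fun y =>
    Finset.mul_sum _ _ _
  simp only [cv, h2]
  rw [integral_finsetSum]
  exact fun i _ => integrable_cv hf ((hg.pd_top i).pd_top i).continuous ((hc.pd i).pd i) x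

end

lemma lapl_comp_sub (g : Eu n → ℝ) (hg : ContDiff ℝ 2 g) (x y : Eu n) :
    lapl (fun z => g (x - z)) y = lapl g (x - y) := by
  have h := lapl_comp_similarity (u := g) (LinearIsometryEquiv.neg ℝ) x 1 (x := y) hg.contDiffAt
  simpa [sub_eq_add_neg] using h

lemma two_le_infty : (2 : WithTop ℕ∞) ≤ ((⊤ : ℕ∞) : WithTop ℕ∞) :=
  show ((2 : ℕ∞) : WithTop ℕ∞) ≤ ((⊤ : ℕ∞) : WithTop ℕ∞) from by exact_mod_cast le_top

/-- A smooth step, vanishing on `(-∞, 1/2]` and equal to one on `[1, ∞)`. -/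
def stepFn (s : ℝ) : ℝ := smoothTransition (2 * s - 1)

lemma stepFn_contDiff : ContDiff ℝ ∞ stepFn :=
  smoothTransition.contDiff.comp ((contDiff_const.mul contDiff_id).sub contDiff_const)

lemma stepFn_zero {s : ℝ} (h : s ≤ 1 / 2) : stepFn s = 0 :=
  smoothTransition.zero_of_nonpos (by linarith)

lemma stepFn_one {s : ℝ} (h : 1 ≤ s) : stepFn s = 1 :=
  smoothTransition.one_of_one_le (by linarith)

lemma stepFn_deriv_nonneg (s : ℝ) : 0 ≤ deriv stepFn s := by
  refine Monotone.deriv_nonneg fun a b hab => ?_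
  exact smoothTransition.monotone (by linarith)

lemma stepFn_deriv_one {s : ℝ} (h : 1 ≤ s) : deriv stepFn s = 0 := by
  refine IsLocalMax.deriv_eq_zero (Filter.Eventually.of_forall fun y => ?_)
  rw [stepFn_one h]
  exact smoothTransition.le_one _

lemma stepFn_deriv_zero {s : ℝ} (h : s ≤ 1 / 2) : deriv stepFn s = 0 := by
  refine IsLocalMin.deriv_eq_zero (Filter.Eventually.of_forall fun y => ?_)
  rw [stepFn_zero h]
  exact smoothTransition.nonneg _

/-- Derivative of the regularized radial profile. -/
def profD (a s : ℝ) : ℝ := (1 - a) * (s ^ (-a) * stepFn s)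

lemma profD_hasDerivAt (a : ℝ) {s : ℝ} (hs : 0 < s) : HasDerivAt (profD a)
    ((1 - a) * (-a * s ^ (-a - 1) * stepFn s + s ^ (-a) * deriv stepFn s)) s := by
  have h1 : HasDerivAt (fun s : ℝ => s ^ (-a)) (-a * s ^ (-a - 1)) s :=
    Real.hasDerivAt_rpow_const (Or.inl hs.ne')
  have h2 : HasDerivAt stepFn (deriv stepFn s) s :=
    (stepFn_contDiff.differentiable (by simp) s).hasDerivAt
  exact (h1.mul h2).const_mul _

lemma profD_eventually_zero (a : ℝ) {s : ℝ} (hs : s < 1 / 2) : profD a =ᶠ[𝓝 s] fun _ => 0 := by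
  filter_upwards [gt_mem_nhds hs] with y hy
  simp [profD, stepFn_zero hy.le]

lemma profD_contDiff (a : ℝ) : ContDiff ℝ ∞ (profD a) := by
  rw [contDiff_iff_contDiffAt]
  intro s
  by_cases hs : s < 1 / 2
  · exact contDiffAt_const.congr_of_eventuallyEq (profD_eventually_zero a hs)
  · have : s ≠ 0 := by linarith
    exact contDiffAt_const.mul ((Real.contDiffAt_rpow_const_of_ne this).mul
      stepFn_contDiff.contDiffAt)

/-- The regularized radial profile, equal to `s ^ (1 - a)` for `s ≥ 1`. -/
def prof (a s : ℝ) : ℝ := 1 + ∫ x in (1 : ℝ)..s, profD a x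

lemma prof_hasDerivAt (a s : ℝ) : HasDerivAt (prof a) (profD a s) s := by
  have hc := (profD_contDiff a).continuous
  exact (intervalIntegral.integral_hasDerivAt_right (hc.intervalIntegrable _ _)
    (hc.stronglyMeasurableAtFilter _ _) hc.continuousAt).const_add 1

lemma prof_contDiff (a : ℝ) : ContDiff ℝ ∞ (prof a) := by
  rw [contDiff_infty_iff_deriv]
  refine ⟨fun s => (prof_hasDerivAt a s).differentiableAt, ?_⟩
  rw [show deriv (prof a) = profD a from funext fun s => (prof_hasDerivAt a s).deriv]
  exact profD_contDiff a

lemma prof_eq (a : ℝ) (ha : 1 < a) {s : ℝ} (hs : 1 ≤ s) : prof a s = s ^ (1 - a) := by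
  have h1 : ∫ x in (1 : ℝ)..s, profD a x = ∫ x in (1 : ℝ)..s, (1 - a) * x ^ (-a) := by
    refine intervalIntegral.integral_congr fun x hx => ?_
    rw [uIcc_of_le hs] at hx
    simp [profD, stepFn_one hx.1]
  rw [prof, h1, intervalIntegral.integral_const_mul, integral_rpow]
  · have : 1 - a ≠ 0 := by linarith
    rw [show -a + 1 = 1 - a by ring, Real.one_rpow]
    field_simp
    ring
  · right
    refine ⟨by linarith, ?_⟩
    rw [uIcc_of_le hs]
    intro h
    linarith [h.1]

/-- A smooth radial function coinciding with `‖x‖ ^ (2 - n)` outside the unit ball. -/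
def regNewton (n : ℕ) (x : Eu n) : ℝ := prof ((n : ℝ) / 2) (‖x‖ ^ 2)

lemma regNewton_contDiff : ContDiff ℝ ∞ (regNewton n) :=
  (prof_contDiff _).comp (contDiff_norm_sq ℝ)

lemma rpow_sq_eq (hn : 2 < n) {s : ℝ} (hs : 0 ≤ s) :
    (s ^ 2) ^ (1 - (n : ℝ) / 2) = s⁻¹ ^ (n - 2) := by
  rw [← Real.rpow_natCast s 2, ← Real.rpow_mul hs, ← Real.rpow_natCast, Nat.cast_sub hn.le,
    Real.inv_rpow hs, ← Real.rpow_neg hs]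
  congr 1
  push_cast
  ring

lemma regNewton_eq (hn : 2 < n) {x : Eu n} (hx : 1 ≤ ‖x‖) : regNewton n x = ‖x‖⁻¹ ^ (n - 2) := by
  have hn' : (2 : ℝ) < n := by exact_mod_cast hn
  rw [regNewton, prof_eq _ (by linarith) (one_le_pow₀ hx), rpow_sq_eq hn (norm_nonneg x)]

lemma lapl_regNewton (hn : 2 < n) (x : Eu n) : lapl (regNewton n) x =
    -(4 * ((n : ℝ) / 2 - 1) * ((‖x‖ ^ 2) ^ (1 - (n : ℝ) / 2) * deriv stepFn (‖x‖ ^ 2))) := by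
  set a : ℝ := (n : ℝ) / 2 with ha
  have hev := Filter.Eventually.of_forall (f := 𝓝 (‖x‖ ^ 2)) (prof_hasDerivAt a)
  by_cases hs : ‖x‖ ^ 2 < 1 / 2
  · have h0 : HasDerivAt (profD a) 0 (‖x‖ ^ 2) :=
      (hasDerivAt_const _ _).congr_of_eventuallyEq (profD_eventually_zero a hs)
    have := lapl_radial hev h0
    unfold regNewton
    rw [this, (profD_eventually_zero a hs).self_of_nhds, stepFn_deriv_zero hs.le]
    ring
  · have hpos : 0 < ‖x‖ ^ 2 := by linarith
    have := lapl_radial hev (profD_hasDerivAt a hpos)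
    unfold regNewton
    rw [this]
    set s := ‖x‖ ^ 2
    have e1 : s ^ (-a) = s * s ^ (-a - 1) := by
      rw [← Real.rpow_one_add' hpos.le]
      · ring_nf
      · have : 0 < a := by
          have : (2 : ℝ) < n := by exact_mod_cast hn
          positivity
        intro h; linarith
    have e2 : s ^ (1 - a) = s * s ^ (-a) := by
      rw [sub_eq_add_neg, Real.rpow_add hpos, Real.rpow_one]
    rw [profD, e2, e1, show (n : ℝ) = 2 * a by rw [ha]; ring]
    ring

/-- A smooth radial bump whose dilates differ by Laplacians of compactly supported functions. -/
structure IsKernel (n : ℕ) (η : Eu n → ℝ) : Prop extends IsBump n η where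
  radial : ∀ x y : Eu n, ‖x‖ = ‖y‖ → η x = η y
  diff_eq_lapl : ∀ t τ : ℝ, 0 < t → 0 < τ → ∃ Ψ : Eu n → ℝ, ContDiff ℝ ∞ Ψ ∧
    (∀ x, max t τ ≤ ‖x‖ → Ψ x = 0) ∧ ∀ x, lapl Ψ x = dil η t x - dil η τ x

theorem exists_kernel (hn : 2 < n) : ∃ η : Eu n → ℝ, IsKernel n η := by
  have hn' : (2 : ℝ) < n := by exact_mod_cast hn
  set η₀ : Eu n → ℝ := fun x => - lapl (regNewton n) x with hη₀
  have hsm : ContDiff ℝ ∞ η₀ := regNewton_contDiff.lapl_top.neg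
  have hform : ∀ x, η₀ x =
      4 * ((n : ℝ) / 2 - 1) * ((‖x‖ ^ 2) ^ (1 - (n : ℝ) / 2) * deriv stepFn (‖x‖ ^ 2)) := by
    intro x; rw [hη₀]; simp only [lapl_regNewton hn, neg_neg]
  have hnn : ∀ x, 0 ≤ η₀ x := by
    intro x
    rw [hform]
    have := stepFn_deriv_nonneg (‖x‖ ^ 2)
    have h2 : (0 : ℝ) ≤ (n : ℝ) / 2 - 1 := by linarith
    positivity
  have hsupp : ∀ x : Eu n, 1 ≤ ‖x‖ → η₀ x = 0 := by
    intro x hx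
    rw [hform, stepFn_deriv_one (one_le_pow₀ hx)]
    ring
  have hcs : HasCompactSupport η₀ := by
    refine HasCompactSupport.intro (isCompact_closedBall (0 : Eu n) 1) fun x hx => hsupp x ?_
    rw [mem_closedBall_zero_iff, not_le] at hx
    exact hx.le
  obtain ⟨s, hs⟩ : ∃ s, deriv stepFn s ≠ 0 := by
    by_contra! h
    have := is_const_of_deriv_eq_zero (stepFn_contDiff.differentiable (by simp)) h 0 1
    rw [stepFn_zero (by norm_num), stepFn_one le_rfl] at this
    norm_num at this
  have hs0 : 0 < s := by
    by_contra! h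
    exact hs (stepFn_deriv_zero (by linarith))
  have hI : 0 < ∫ x, η₀ x := by
    refine hsm.continuous.integral_pos_of_hasCompactSupport_nonneg_nonzero hcs hnn
      (x := √s • stdE ⟨0, by omega⟩) ?_
    rw [hform, norm_smul, norm_stdE, mul_one, Real.norm_of_nonneg (Real.sqrt_nonneg s),
      Real.sq_sqrt hs0.le]
    have h1 : 0 < s ^ (1 - (n : ℝ) / 2) := Real.rpow_pos_of_pos hs0 _
    have h2 : (n : ℝ) / 2 - 1 ≠ 0 := by linarith
    have := h1.ne'
    positivity
  set c := ∫ x, η₀ x with hc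
  refine ⟨fun x => c⁻¹ * η₀ x, ⟨⟨contDiff_const.mul hsm, fun x hx => by simp [hsupp x hx],
    fun x => mul_nonneg (by positivity) (hnn x), ?_⟩, ?_, ?_⟩⟩
  · rw [integral_const_mul, ← hc, inv_mul_cancel₀ hI.ne']
  · intro x y hxy
    simp only [hform, hxy]
  · intro t τ ht hτ
    have key : ∀ t > 0, ContDiff ℝ ∞ (fun x : Eu n => t⁻¹ ^ (n - 2) * regNewton n (t⁻¹ • x)) ∧
        (∀ x : Eu n, t ≤ ‖x‖ → t⁻¹ ^ (n - 2) * regNewton n (t⁻¹ • x) = ‖x‖⁻¹ ^ (n - 2)) ∧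
        ∀ x : Eu n, lapl (fun x : Eu n => t⁻¹ ^ (n - 2) * regNewton n (t⁻¹ • x)) x =
          - dil η₀ t x := by
      intro t ht
      have h1 : ContDiff ℝ ∞ (fun x : Eu n => regNewton n (t⁻¹ • x)) :=
        regNewton_contDiff.comp (contDiff_id.const_smul _)
      refine ⟨contDiff_const.mul h1, fun x hx => ?_, fun x => ?_⟩
      · have hn1 : ‖t⁻¹ • x‖ = t⁻¹ * ‖x‖ := by
          rw [norm_smul, Real.norm_of_nonneg (by positivity)]
        rw [regNewton_eq hn, hn1, mul_inv, inv_inv, mul_pow, ← mul_assoc, ← mul_pow,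
          inv_mul_cancel₀ ht.ne', one_pow, one_mul]
        rw [hn1, inv_mul_eq_div, le_div_iff₀ ht, one_mul]
        exact hx
      · rw [lapl_const_mul _ (h1.of_le two_le_infty).contDiffAt]
        have h2 := lapl_comp_dil (u := regNewton n) 0 t⁻¹ (x := x)
          (regNewton_contDiff.of_le two_le_infty).contDiffAt
        simp only [zero_add] at h2
        rw [h2, dil, hη₀]
        simp only
        rw [← mul_assoc, ← pow_add, Nat.sub_add_cancel hn.le]
        ring
    obtain ⟨a1, a2, a3⟩ := key t ht
    obtain ⟨b1, b2, b3⟩ := key τ hτ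
    refine ⟨fun x => c⁻¹ * (τ⁻¹ ^ (n - 2) * regNewton n (τ⁻¹ • x) -
      t⁻¹ ^ (n - 2) * regNewton n (t⁻¹ • x)), contDiff_const.mul (b1.sub a1), fun x hx => ?_,
      fun x => ?_⟩
    · beta_reduce
      rw [a2 x ((le_max_left _ _).trans hx), b2 x ((le_max_right _ _).trans hx)]
      ring
    · have h1 := (a1.of_le (m := 2) two_le_infty).contDiffAt (x := x)
      have h2 := (b1.of_le (m := 2) two_le_infty).contDiffAt (x := x)
      rw [lapl_const_mul _ (h2.sub h1), lapl_sub h2 h1, a3, b3]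
      simp only [dil]
      ring

lemma pd_dil (i : Fin n) (φ : Eu n → ℝ) (t : ℝ) :
    pd i (dil φ t) = fun x => t⁻¹ * dil (pd i φ) t x := by
  funext x
  have h : dil φ t = (t⁻¹ ^ n) • (φ <| t⁻¹ • ·) := rfl
  rw [h, pd, fderiv_const_smul_field, Pi.smul_apply, fderiv_comp_smul]
  simp only [dil, pd, smul_eq_mul, FunLike.coe_smul, Pi.smul_apply]
  ring

lemma pdMulti_dil (L : List (Fin n)) (φ : Eu n → ℝ) (t : ℝ) :
    pdMulti L (dil φ t) = fun x => t⁻¹ ^ L.length * dil (pdMulti L φ) t x := by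
  induction L with
  | nil => simp [pdMulti]
  | cons i L ih =>
    funext x
    have h : (fun x => t⁻¹ ^ L.length * dil (pdMulti L φ) t x) =
      t⁻¹ ^ L.length • dil (pdMulti L φ) t := rfl
    rw [pdMulti, ih, h, pd, fderiv_const_smul_field, Pi.smul_apply]
    have := congrFun (pd_dil i (pdMulti L φ) t) x
    simp only [FunLike.coe_smul, Pi.smul_apply, smul_eq_mul, List.length_cons]
    rw [← pd, this, pdMulti]
    ring

lemma integral_dil (φ : Eu n → ℝ) {t : ℝ} (ht : 0 < t) : ∫ x, dil φ t x = ∫ x, φ x := by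
  have := Measure.integral_comp_inv_smul_of_nonneg (volume : Measure (Eu n)) φ ht.le
  simp only [dil]
  rw [integral_const_mul, this, smul_eq_mul, finrank_euclideanSpace_fin, ← mul_assoc, ← mul_pow,
    inv_mul_cancel₀ ht.ne', one_pow, one_mul]

lemma contDiff_dil {φ : Eu n → ℝ} (hφ : ContDiff ℝ ∞ φ) (t : ℝ) : ContDiff ℝ ∞ (dil φ t) :=
  contDiff_const.mul (hφ.comp (contDiff_id.const_smul _))

namespace IsBump

variable {η : Eu n → ℝ}

lemma hasCompactSupport (h : IsBump n η) : HasCompactSupport η :=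
  HasCompactSupport.intro (isCompact_closedBall (0 : Eu n) 1) fun x hx => h.supp x (by
    rw [mem_closedBall_zero_iff, not_le] at hx; exact hx.le)

lemma dil_eq_zero (h : IsBump n η) {t : ℝ} (ht : 0 < t) {x : Eu n} (hx : t ≤ ‖x‖) :
    dil η t x = 0 := by
  rw [dil, h.supp, mul_zero]
  rw [norm_smul, Real.norm_of_nonneg (by positivity), inv_mul_eq_div, le_div_iff₀ ht, one_mul]
  exact hx

lemma dil_nonneg (h : IsBump n η) {t : ℝ} (ht : 0 < t) (x : Eu n) : 0 ≤ dil η t x :=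
  mul_nonneg (by positivity) (h.nonneg _)

lemma dil_hasCompactSupport (h : IsBump n η) {t : ℝ} (ht : 0 < t) : HasCompactSupport (dil η t) :=
  HasCompactSupport.intro (isCompact_closedBall (0 : Eu n) t) fun x hx => h.dil_eq_zero ht (by
    rw [mem_closedBall_zero_iff, not_le] at hx; exact hx.le)

lemma integral_dil_sub (h : IsBump n η) {t : ℝ} (ht : 0 < t) (x : Eu n) :
    ∫ y, dil η t (x - y) = 1 := by
  rw [integral_sub_left_eq_self (fun y => dil η t y), integral_dil _ ht, h.integral_one]

lemma integrable_dil_sub (h : IsBump n η) {t : ℝ} (ht : 0 < t) (x : Eu n) :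
    Integrable fun y => dil η t (x - y) :=
  ((contDiff_dil h.smooth t).continuous.integrable_of_hasCompactSupport
    (h.dil_hasCompactSupport ht)).comp_sub_left x

lemma abs_integral_mul_dil_sub_le (h : IsBump n η) {t : ℝ} (ht : 0 < t) {f : Eu n → ℝ} {x : Eu n}
    {c ε : ℝ} (hf : Integrable fun y => f y * dil η t (x - y))
    (hε : ∀ y, ‖x - y‖ < t → |f y - c| ≤ ε) : |(∫ y, f y * dil η t (x - y)) - c| ≤ ε := by
  have h1 := h.integrable_dil_sub ht x
  have e : (∫ y, f y * dil η t (x - y)) - c = ∫ y, (f y - c) * dil η t (x - y) := by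
    simp only [sub_mul]
    rw [integral_sub hf (h1.const_mul c), integral_const_mul, h.integral_dil_sub ht, mul_one]
  rw [e]
  have h2 := norm_integral_le_of_norm_le (f := fun y => (f y - c) * dil η t (x - y))
    (h1.const_mul ε) (ae_of_all _ fun y => ?_)
  · rwa [integral_const_mul, h.integral_dil_sub ht, mul_one, Real.norm_eq_abs] at h2
  · rw [norm_mul, Real.norm_of_nonneg (h.dil_nonneg ht _), Real.norm_eq_abs]
    by_cases hy : ‖x - y‖ < t
    · exact mul_le_mul_of_nonneg_right (hε y hy) (h.dil_nonneg ht _)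
    · rw [h.dil_eq_zero ht (not_lt.1 hy), mul_zero, mul_zero]

end IsBump

lemma tsupport_comp_sub_subset {g : Eu n → ℝ} {t : ℝ} (hg : ∀ x, t ≤ ‖x‖ → g x = 0) (x : Eu n) :
    tsupport (fun y => g (x - y)) ⊆ closedBall x t := by
  refine closure_minimal (fun y hy => ?_) isClosed_closedBall
  rw [mem_closedBall, dist_comm, dist_eq_norm]
  by_contra! h
  exact hy (hg _ h.le)

/-- Mean value property of weakly harmonic functions. -/
theorem WeaklyHarmonicOn.eq_integral {η : Eu n → ℝ} (hη : IsKernel n η) {f : Eu n → ℝ}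
    {Ω : Set (Eu n)} (hΩ : IsOpen Ω) (hc : ContinuousOn f Ω) (hw : WeaklyHarmonicOn f Ω)
    {x : Eu n} {t : ℝ} (ht : 0 < t) (hx : closedBall x t ⊆ Ω) :
    f x = ∫ y, f y * dil η t (x - y) := by
  have hsub : ContDiff ℝ ∞ fun y => x - y := contDiff_const.sub contDiff_id
  have hi : ∀ τ, 0 < τ → τ ≤ t → Integrable fun y => f y * dil η τ (x - y) := by
    intro τ hτ hτt
    have h0 := tsupport_comp_sub_subset (fun y => hη.dil_eq_zero hτ (x := y)) x
    exact integrable_mul_of_tsupport hΩ hc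
      ((contDiff_dil hη.smooth τ).continuous.comp hsub.continuous)
      ((isCompact_closedBall x τ).of_isClosed_subset (isClosed_tsupport _) h0)
      (h0.trans ((closedBall_subset_closedBall hτt).trans hx))
  have hconst : ∀ τ, 0 < τ → τ ≤ t →
      ∫ y, f y * dil η t (x - y) = ∫ y, f y * dil η τ (x - y) := by
    intro τ hτ hτt
    obtain ⟨Ψ, h1, h2, h3⟩ := hη.diff_eq_lapl t τ ht hτ
    rw [max_eq_left hτt] at h2
    have h0 := tsupport_comp_sub_subset h2 x
    have := hw (fun y => Ψ (x - y)) (h1.comp hsub)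
      ((isCompact_closedBall x t).of_isClosed_subset (isClosed_tsupport _) h0) (h0.trans hx)
    simp only [lapl_comp_sub Ψ (h1.of_le two_le_infty), h3, mul_sub] at this
    rw [integral_sub (hi t ht le_rfl) (hi τ hτ hτt)] at this
    linarith
  have hcx : ContinuousAt f x := hc.continuousAt (hΩ.mem_nhds (hx (mem_closedBall_self ht.le)))
  refine eq_of_forall_dist_le fun ε hε => ?_
  obtain ⟨δ, hδ, hδ'⟩ := Metric.continuousAt_iff.1 hcx ε hε
  have hm : 0 < min δ t := lt_min hδ ht
  rw [dist_comm, hconst _ hm (min_le_right _ _), Real.dist_eq]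
  refine hη.abs_integral_mul_dil_sub_le hm (hi _ hm (min_le_right _ _)) fun y hy => ?_
  have := hδ' (x := y) (by
    rw [dist_comm, dist_eq_norm]; exact hy.trans_le (min_le_left _ _))
  exact (Real.dist_eq _ _ ▸ this).le

lemma locallyIntegrable_indicator_of_bound {f : Eu n → ℝ} {Ω : Set (Eu n)} (hΩ : IsOpen Ω)
    (hc : ContinuousOn f Ω) {M : ℝ} (hM : ∀ x ∈ Ω, |f x| ≤ M) :
    LocallyIntegrable (Ω.indicator f) := by
  have hm : AEStronglyMeasurable (Ω.indicator f) volume :=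
    (aestronglyMeasurable_indicator_iff hΩ.measurableSet).2
      (hc.aestronglyMeasurable hΩ.measurableSet)
  refine LocallyIntegrable.mono (f := fun _ : Eu n => |M|) (locallyIntegrable_const _) hm
    (ae_of_all _ fun x => ?_)
  by_cases hx : x ∈ Ω
  · simp only [indicator_of_mem hx, Real.norm_eq_abs, abs_abs]
    exact (hM x hx).trans (le_abs_self _)
  · simp [indicator_of_notMem hx]

/-- Local representation of a bounded weakly harmonic function as a mollification. -/
lemma WeaklyHarmonicOn.eventuallyEq_cv {η : Eu n → ℝ} (hη : IsKernel n η) {f : Eu n → ℝ}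
    {x : Eu n} {t r : ℝ} (ht : 0 < t) (htr : t < r) (hc : ContinuousOn f (ball x r))
    (hw : WeaklyHarmonicOn f (ball x r)) :
    f =ᶠ[𝓝 x] cv ((ball x r).indicator f) (dil η t) := by
  filter_upwards [ball_mem_nhds x (sub_pos.2 htr)] with z hz
  have hz' : closedBall z t ⊆ ball x r := by
    intro y hy
    rw [mem_closedBall] at hy
    rw [mem_ball] at hz ⊢
    linarith [dist_triangle y z x]
  rw [hw.eq_integral hη isOpen_ball hc ht hz', cv]
  refine integral_congr_ae (ae_of_all _ fun y => ?_)
  by_cases hy : y ∈ ball x r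
  · simp [indicator_of_mem hy]
  · simp only [indicator_of_notMem hy, zero_mul]
    rw [hη.dil_eq_zero ht, mul_zero]
    by_contra! h
    refine hy (hz' ?_)
    rw [mem_closedBall, dist_comm, dist_eq_norm]
    exact h.le

/-- Weyl's lemma. -/
theorem WeaklyHarmonicOn.isHarmonicOn (hn : 2 < n) {f : Eu n → ℝ} {Ω : Set (Eu n)}
    (hΩ : IsOpen Ω) (hc : ContinuousOn f Ω) (hw : WeaklyHarmonicOn f Ω) :
    (∀ x ∈ Ω, ContDiffAt ℝ ∞ f x) ∧ IsHarmonicOn f Ω := by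
  obtain ⟨η, hη⟩ := exists_kernel hn
  have key : ∀ x ∈ Ω, ContDiffAt ℝ ∞ f x ∧ lapl f x = 0 := by
    intro x hx
    obtain ⟨r₀, hr₀, hr⟩ := Metric.isOpen_iff.1 hΩ x hx
    obtain ⟨r₁, hr₁, M, hM⟩ : ∃ r₁ > 0, ∃ M, ∀ y ∈ ball x r₁, |f y| ≤ M := by
      obtain ⟨r₁, h1, h2⟩ := Metric.continuousAt_iff.1 (hc.continuousAt (hΩ.mem_nhds hx)) 1 one_pos
      refine ⟨r₁, h1, |f x| + 1, fun y hy => ?_⟩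
      have := h2 hy
      rw [Real.dist_eq] at this
      have h3 := abs_sub_abs_le_abs_sub (f y) (f x)
      linarith
    set r := min r₀ r₁
    have hrpos : 0 < r := lt_min hr₀ hr₁
    have hrΩ : ball x r ⊆ Ω := (ball_subset_ball (min_le_left _ _)).trans hr
    have hc' := hc.mono hrΩ
    have hw' : WeaklyHarmonicOn f (ball x r) := fun φ h1 h2 h3 => hw φ h1 h2 (h3.trans hrΩ)
    have hloc := locallyIntegrable_indicator_of_bound isOpen_ball hc'
      (fun y hy => hM y (ball_subset_ball (min_le_right _ _) hy))
    have heq := hw'.eventuallyEq_cv hη (half_pos hrpos) (half_lt_self hrpos) hc'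
    have hs := contDiff_dil hη.smooth (r / 2)
    have hcs := hη.dil_hasCompactSupport (half_pos hrpos)
    refine ⟨(contDiff_cv hloc hs hcs).contDiffAt.congr_of_eventuallyEq heq, ?_⟩
    rw [(lapl_congr_nhds heq).self_of_nhds, lapl_cv hloc hs hcs, cv]
    have h0 := tsupport_comp_sub_subset (fun y => hη.dil_eq_zero (half_pos hrpos) (x := y)) x
    have hsub : closedBall x (r / 2) ⊆ ball x r := closedBall_subset_ball (half_lt_self hrpos)
    have := hw' (fun y => dil η (r / 2) (x - y)) (hs.comp (contDiff_const.sub contDiff_id))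
      ((isCompact_closedBall x (r / 2)).of_isClosed_subset (isClosed_tsupport _) h0)
      (h0.trans hsub)
    rw [← this]
    refine integral_congr_ae (ae_of_all _ fun y => ?_)
    simp only [lapl_comp_sub _ (hs.of_le two_le_infty)]
    by_cases hy : y ∈ ball x r
    · simp [indicator_of_mem hy]
    · simp only [indicator_of_notMem hy, zero_mul]
      have : lapl (dil η (r / 2)) (x - y) = 0 := by
        rw [← lapl_comp_sub _ (hs.of_le two_le_infty)]
        by_contra h
        refine hy (hsub (h0 ?_))
        exact tsupport_lapl_subset _ (subset_tsupport _ h)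
      rw [this, mul_zero]
  exact ⟨fun x hx => (key x hx).1, isHarmonicOn_of_contDiffAt fun x hx =>
    ⟨(key x hx).1.of_le two_le_infty, (key x hx).2⟩⟩

lemma IsHarmonicOn.smooth (hn : 2 < n) {f : Eu n → ℝ} {Ω : Set (Eu n)} (hΩ : IsOpen Ω)
    (hf : IsHarmonicOn f Ω) {x : Eu n} (hx : x ∈ Ω) : ContDiffAt ℝ ∞ f x :=
  ((hf.weaklyHarmonicOn hΩ).isHarmonicOn hn hΩ hf.1.continuousOn).1 x hx

/-- Interior derivative estimates for harmonic functions. -/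
theorem interior_estimate (hn : 2 < n) (m : ℕ) : ∃ C : ℝ, 0 < C ∧ ∀ (u : Eu n → ℝ) (x : Eu n)
    (r M : ℝ), 0 < r → IsHarmonicOn u (ball x r) → (∀ y ∈ ball x r, |u y| ≤ M) →
    ‖iteratedFDeriv ℝ m u x‖ ≤ C * M * r⁻¹ ^ m := by
  obtain ⟨η, hη⟩ := exists_kernel hn
  obtain ⟨K, hK⟩ := ((List.finite_length_eq (Fin n) m).image
    fun L => ∫ x, |pdMulti L η x|).bddAbove
  refine ⟨n ^ m * (max K 0 * 2 ^ m) + 1, by positivity, fun u x r M hr hu hM => ?_⟩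
  have hM0 : 0 ≤ M := (abs_nonneg _).trans (hM x (mem_ball_self hr))
  have hsm := hu.smooth hn isOpen_ball (mem_ball_self hr)
  have h1 : ‖iteratedFDeriv ℝ m u x‖ ≤ n ^ m * (M * ((r / 2)⁻¹ ^ m * max K 0)) := by
    refine norm_iteratedFDeriv_le_of_pdMulti (hsm.of_le (by exact_mod_cast le_top)) fun L hL => ?_
    have ht := half_pos hr
    have heq := (hu.weaklyHarmonicOn isOpen_ball).eventuallyEq_cv hη ht (half_lt_self hr)
      hu.1.continuousOn
    have hloc := locallyIntegrable_indicator_of_bound isOpen_ball hu.1.continuousOn hM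
    have hs := contDiff_dil hη.smooth (r / 2)
    have hcs := hη.dil_hasCompactSupport ht
    rw [(pdMulti_congr_nhds L heq).self_of_nhds, pdMulti_cv hloc hs hcs, cv, pdMulti_dil, hL]
    have hInt : Integrable (dil (pdMulti L η) (r / 2)) := by
      have hcont := (contDiff_dil (hη.smooth.pdMulti_top L) (r / 2)).continuous
      refine hcont.integrable_of_hasCompactSupport ?_
      exact (hη.hasCompactSupport.mono' ((subset_tsupport _).trans
        (tsupport_pdMulti_subset L η))).comp_smul (inv_ne_zero ht.ne') |>.mul_left
    have hab : ∀ y, |dil (pdMulti L η) (r / 2) y| = dil (fun z => |pdMulti L η z|) (r / 2) y := by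
      intro y
      rw [dil, dil, abs_mul, abs_of_nonneg (by positivity)]
    have h2 : ‖∫ y, (ball x r).indicator u y * ((r / 2)⁻¹ ^ m * dil (pdMulti L η) (r / 2) (x - y))‖
        ≤ ∫ y, M * ((r / 2)⁻¹ ^ m * |dil (pdMulti L η) (r / 2) (x - y)|) := by
      refine norm_integral_le_of_norm_le (((hInt.abs.comp_sub_left x).const_mul _).const_mul _)
        (ae_of_all _ fun y => ?_)
      rw [norm_mul, norm_mul, Real.norm_eq_abs, Real.norm_eq_abs, Real.norm_eq_abs,
        abs_of_nonneg (by positivity : 0 ≤ (r / 2)⁻¹ ^ m)]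
      refine mul_le_mul_of_nonneg_right ?_ (by positivity)
      by_cases hy : y ∈ ball x r
      · rw [indicator_of_mem hy]; exact hM y hy
      · rw [indicator_of_notMem hy, abs_zero]; exact hM0
    rw [integral_const_mul, integral_const_mul,
      integral_sub_left_eq_self (fun y => |dil (pdMulti L η) (r / 2) y|)] at h2
    simp only [hab] at h2
    rw [integral_dil _ ht] at h2
    refine h2.trans (mul_le_mul_of_nonneg_left (mul_le_mul_of_nonneg_left ?_ (by positivity)) hM0)
    exact (hK ⟨L, hL, rfl⟩).trans (le_max_left _ _)
  refine h1.trans ?_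
  have h3 : (r / 2)⁻¹ ^ m = 2 ^ m * r⁻¹ ^ m := by rw [← mul_pow]; congr 1; field_simp
  rw [h3]
  have : 0 ≤ M * r⁻¹ ^ m := by positivity
  nlinarith

/-- Polynomials in `n` real variables. -/
abbrev Pol (n : ℕ) := MvPolynomial (Fin n) ℝ

namespace Pol

open MvPolynomial

/-- The `ℓ¹` norm of the coefficients of a polynomial. -/
def pnorm (p : Pol n) : ℝ := ∑ m ∈ p.support, |coeff m p|

lemma pnorm_nonneg (p : Pol n) : 0 ≤ pnorm p := Finset.sum_nonneg fun _ _ => abs_nonneg _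

lemma pnorm_eq_sum {p : Pol n} {s : Finset (Fin n →₀ ℕ)} (h : p.support ⊆ s) :
    pnorm p = ∑ m ∈ s, |coeff m p| :=
  Finset.sum_subset h fun m _ hm => by simp [notMem_support_iff.1 hm]

@[simp] lemma pnorm_zero : pnorm (0 : Pol n) = 0 := by simp [pnorm]

lemma pnorm_add_le (p q : Pol n) : pnorm (p + q) ≤ pnorm p + pnorm q := by
  classical
  rw [pnorm_eq_sum (support_add (p := p) (q := q)),
    pnorm_eq_sum (Finset.subset_union_left (s₁ := p.support) (s₂ := q.support)),
    pnorm_eq_sum (Finset.subset_union_right (s₁ := p.support) (s₂ := q.support)),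
    ← Finset.sum_add_distrib]
  exact Finset.sum_le_sum fun m _ => by rw [coeff_add]; exact abs_add_le _ _

lemma pnorm_sum_le {ι : Type*} (s : Finset ι) (f : ι → Pol n) :
    pnorm (∑ i ∈ s, f i) ≤ ∑ i ∈ s, pnorm (f i) := by
  classical
  induction s using Finset.induction_on with
  | empty => simp
  | insert a s ha ih =>
    rw [Finset.sum_insert ha, Finset.sum_insert ha]
    exact (pnorm_add_le _ _).trans (by linarith)

lemma pnorm_monomial (m : Fin n →₀ ℕ) (c : ℝ) : pnorm (monomial m c) = |c| := by
  classical
  rw [pnorm_eq_sum (support_monomial_subset), Finset.sum_singleton, coeff_monomial, if_pos rfl]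

lemma pnorm_neg (p : Pol n) : pnorm (-p) = pnorm p := by
  simp [pnorm, support_neg]

/-- A linear operation on polynomials is bounded if it is bounded on monomials. -/
lemma pnorm_map_le (F : Pol n →ₗ[ℝ] Pol n) {K : ℝ} {p : Pol n}
    (h : ∀ m ∈ p.support, pnorm (F (monomial m 1)) ≤ K) : pnorm (F p) ≤ K * pnorm p := by
  conv_lhs => rw [as_sum p]
  rw [map_sum]
  refine (pnorm_sum_le _ _).trans ?_
  rw [pnorm, Finset.mul_sum]
  refine Finset.sum_le_sum fun m hm => ?_
  have h1 : monomial m (coeff m p) = (coeff m p) • monomial m (1 : ℝ) := by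
    rw [smul_monomial, smul_eq_mul, mul_one]
  have h2 : ∀ (c : ℝ) (q : Pol n), pnorm (c • q) ≤ |c| * pnorm q := by
    intro c q
    rw [pnorm_eq_sum (support_smul (a := c) (f := q)), pnorm, Finset.mul_sum]
    exact (Finset.sum_congr rfl fun m _ => by rw [coeff_smul, smul_eq_mul, abs_mul]).le
  rw [h1, map_smul, mul_comm]
  exact (h2 _ _).trans (mul_le_mul_of_nonneg_left (h m hm) (abs_nonneg _))

lemma pnorm_mul_le (p q : Pol n) : pnorm (p * q) ≤ pnorm p * pnorm q := by
  conv_lhs => rw [as_sum p, as_sum q, Finset.sum_mul_sum]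
  refine (pnorm_sum_le _ _).trans ?_
  rw [pnorm, pnorm, Finset.sum_mul_sum]
  refine Finset.sum_le_sum fun a _ => (pnorm_sum_le _ _).trans (Finset.sum_le_sum fun b _ => ?_)
  rw [monomial_mul, pnorm_monomial, abs_mul]

lemma pnorm_X (i : Fin n) : pnorm (X i : Pol n) = 1 := by
  rw [X, pnorm_monomial, abs_one]

/-- All monomials of `p` have degree between `a` and `b`. -/
def DegIn (a b : ℕ) (p : Pol n) : Prop := ∀ m, coeff m p ≠ 0 → a ≤ m.degree ∧ m.degree ≤ b

lemma DegIn.mono {a b a' b' : ℕ} {p : Pol n} (h : DegIn a b p) (ha : a' ≤ a) (hb : b ≤ b') :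
    DegIn a' b' p := fun m hm => ⟨ha.trans (h m hm).1, (h m hm).2.trans hb⟩

lemma degIn_zero (a b : ℕ) : DegIn a b (0 : Pol n) := fun m hm => by simp at hm

lemma DegIn.eq_zero {a b : ℕ} {p : Pol n} (h : DegIn a b p) (hab : b < a) : p = 0 := by
  ext m
  by_contra hm
  rw [coeff_zero] at hm
  have := h m hm
  omega

lemma DegIn.add {a b : ℕ} {p q : Pol n} (hp : DegIn a b p) (hq : DegIn a b q) :
    DegIn a b (p + q) := by
  intro m hm
  rw [coeff_add] at hm
  by_cases h : coeff m p = 0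
  · exact hq m (by simpa [h] using hm)
  · exact hp m h

lemma DegIn.neg {a b : ℕ} {p : Pol n} (hp : DegIn a b p) : DegIn a b (-p) :=
  fun m hm => hp m (by simpa using hm)

lemma DegIn.sub {a b : ℕ} {p q : Pol n} (hp : DegIn a b p) (hq : DegIn a b q) :
    DegIn a b (p - q) := by rw [sub_eq_add_neg]; exact hp.add hq.neg

lemma degIn_sum {ι : Type*} {s : Finset ι} {f : ι → Pol n} {a b : ℕ}
    (h : ∀ i ∈ s, DegIn a b (f i)) : DegIn a b (∑ i ∈ s, f i) := by
  intro m hm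
  rw [coeff_sum] at hm
  obtain ⟨i, hi, hne⟩ := Finset.exists_ne_zero_of_sum_ne_zero hm
  exact h i hi m hne

lemma degIn_monomial {m : Fin n →₀ ℕ} {c : ℝ} {a b : ℕ} (ha : a ≤ m.degree) (hb : m.degree ≤ b) :
    DegIn a b (monomial m c) := by
  classical
  intro m' hm'
  rw [coeff_monomial] at hm'
  split_ifs at hm' with h
  · subst h; exact ⟨ha, hb⟩
  · exact absurd rfl hm'

lemma DegIn.mul {a b c d : ℕ} {p q : Pol n} (hp : DegIn a b p) (hq : DegIn c d q) :
    DegIn (a + c) (b + d) (p * q) := by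
  rw [as_sum p, as_sum q, Finset.sum_mul_sum]
  refine degIn_sum fun m hm => degIn_sum fun m' hm' => ?_
  have h1 := hp m (mem_support_iff.1 hm)
  have h2 := hq m' (mem_support_iff.1 hm')
  rw [monomial_mul]
  refine degIn_monomial ?_ ?_ <;> rw [map_add] <;> omega

lemma degIn_X (i : Fin n) : DegIn 1 1 (X i : Pol n) :=
  degIn_monomial (by simp [Finsupp.degree_single]) (by simp [Finsupp.degree_single])

lemma degree_sub_single {m : Fin n →₀ ℕ} {i : Fin n} (h : m i ≠ 0) :
    (m - Finsupp.single i 1).degree + 1 = m.degree := by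
  have h1 : Finsupp.single i 1 ≤ m := by
    rw [Finsupp.single_le_iff]; omega
  conv_rhs => rw [← tsub_add_cancel_of_le h1, map_add, Finsupp.degree_single]

lemma DegIn.pderiv {a b : ℕ} {p : Pol n} (hp : DegIn a b p) (i : Fin n) :
    DegIn (a - 1) (b - 1) (pderiv i p) := by
  rw [as_sum p, map_sum]
  refine degIn_sum fun m hm => ?_
  rw [pderiv_monomial]
  by_cases h : m i = 0
  · simp only [h, Nat.cast_zero, mul_zero, monomial_zero]
    exact degIn_zero _ _
  · have h1 := hp m (mem_support_iff.1 hm)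
    have h2 := degree_sub_single h
    exact degIn_monomial (by omega) (by omega)

lemma pnorm_pderiv_le {a b : ℕ} {p : Pol n} (hp : DegIn a b p) (i : Fin n) :
    pnorm (MvPolynomial.pderiv i p) ≤ b * pnorm p := by
  refine pnorm_map_le (MvPolynomial.pderiv (R := ℝ) i).toLinearMap fun m hm => ?_
  have h1 := hp m (mem_support_iff.1 hm)
  have h2 : m i ≤ m.degree := Finsupp.le_degree i m
  simp only [Derivation.coeFn_coe, pderiv_monomial, pnorm_monomial, one_mul, Nat.abs_cast]
  exact_mod_cast h2.trans h1.2

/-- The Laplacian of a polynomial. -/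
def plapl : Pol n →ₗ[ℝ] Pol n :=
  ∑ i, (MvPolynomial.pderiv (R := ℝ) i).toLinearMap ∘ₗ (MvPolynomial.pderiv (R := ℝ) i).toLinearMap

lemma plapl_apply (p : Pol n) :
    plapl p = ∑ i, MvPolynomial.pderiv i (MvPolynomial.pderiv i p) := by
  simp [plapl, LinearMap.sum_apply]

lemma DegIn.plapl {a b : ℕ} {p : Pol n} (hp : DegIn a b p) :
    DegIn (a - 2) (b - 2) (plapl p) := by
  rw [plapl_apply]
  exact degIn_sum fun i _ => (hp.pderiv i).pderiv i

lemma pnorm_plapl_le {a b : ℕ} {p : Pol n} (hp : DegIn a b p) :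
    pnorm (Pol.plapl p) ≤ n * b ^ 2 * pnorm p := by
  rw [plapl_apply]
  refine (pnorm_sum_le _ _).trans ?_
  have : ∀ i ∈ (Finset.univ : Finset (Fin n)),
      pnorm (MvPolynomial.pderiv i (MvPolynomial.pderiv i p)) ≤ b ^ 2 * pnorm p := by
    intro i _
    have h0 := pnorm_pderiv_le hp i
    have h2 := pnorm_pderiv_le ((hp.pderiv i).mono le_rfl (Nat.sub_le _ _)) i
    refine h2.trans ?_
    rw [pow_two, mul_assoc]
    exact mul_le_mul_of_nonneg_left h0 (Nat.cast_nonneg _)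
  refine (Finset.sum_le_sum this).trans ?_
  simp [mul_assoc]

/-- Truncation of a polynomial to degree at most `k`. -/
def trunc (k : ℕ) : Pol n →ₗ[ℝ] Pol n := ∑ i ∈ Finset.range (k + 1), homogeneousComponent i

lemma coeff_trunc (k : ℕ) (p : Pol n) (m : Fin n →₀ ℕ) :
    coeff m (trunc k p) = if m.degree ≤ k then coeff m p else 0 := by
  simp only [trunc, LinearMap.sum_apply, coeff_sum, coeff_homogeneousComponent,
    Finset.sum_ite_eq, Finset.mem_range, Nat.lt_succ_iff]

lemma DegIn.trunc {a b : ℕ} {p : Pol n} (hp : DegIn a b p) (k : ℕ) : DegIn a k (trunc k p) := by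
  intro m hm
  rw [coeff_trunc] at hm
  split_ifs at hm with h
  · exact ⟨(hp m hm).1, h⟩
  · exact absurd rfl hm

lemma DegIn.sub_trunc {a b : ℕ} {p : Pol n} (hp : DegIn a b p) (k : ℕ) :
    DegIn (k + 1) b (p - Pol.trunc k p) := by
  intro m hm
  rw [coeff_sub, coeff_trunc] at hm
  split_ifs at hm with h
  · simp at hm
  · rw [sub_zero] at hm
    exact ⟨by omega, (hp m hm).2⟩

lemma DegIn.trunc_eq {a b k : ℕ} {p : Pol n} (hp : DegIn a b p) (hbk : b ≤ k) :
    Pol.trunc k p = p := by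
  ext m
  rw [coeff_trunc]
  split_ifs with h
  · rfl
  · by_contra hm
    exact h ((hp m (Ne.symm hm)).2.trans hbk)

lemma pnorm_trunc_le (k : ℕ) (p : Pol n) : pnorm (trunc k p) ≤ pnorm p := by
  have h : (trunc k p).support ⊆ p.support := by
    intro m hm
    rw [mem_support_iff, coeff_trunc] at hm
    rw [mem_support_iff]
    exact fun h => hm (by simp [h])
  rw [pnorm_eq_sum h, pnorm]
  refine Finset.sum_le_sum fun m _ => ?_
  rw [coeff_trunc]
  split_ifs <;> simp

lemma pnorm_sub_trunc_le (k : ℕ) (p : Pol n) : pnorm (p - trunc k p) ≤ pnorm p := by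
  have h : (p - trunc k p).support ⊆ p.support := by
    intro m hm
    rw [mem_support_iff, coeff_sub, coeff_trunc] at hm
    rw [mem_support_iff]
    exact fun h => hm (by simp [h])
  rw [pnorm_eq_sum h, pnorm]
  refine Finset.sum_le_sum fun m _ => ?_
  rw [coeff_sub, coeff_trunc]
  split_ifs <;> simp

/-- Evaluation of a polynomial as a function on Euclidean space. -/
def ev (p : Pol n) (x : Eu n) : ℝ := eval (fun i => x i) p

lemma ev_add (p q : Pol n) (x : Eu n) : ev (p + q) x = ev p x + ev q x := map_add _ _ _
lemma ev_sub (p q : Pol n) (x : Eu n) : ev (p - q) x = ev p x - ev q x := map_sub _ _ _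
lemma ev_mul (p q : Pol n) (x : Eu n) : ev (p * q) x = ev p x * ev q x := map_mul _ _ _
lemma ev_X (i : Fin n) (x : Eu n) : ev (X i) x = x i := eval_X _
lemma ev_monomial (m : Fin n →₀ ℕ) (c : ℝ) (x : Eu n) :
    ev (monomial m c) x = c * ∏ i, x i ^ m i := by
  rw [ev, eval_monomial, Finsupp.prod_fintype _ _ (by simp)]
lemma ev_sum {ι : Type*} (s : Finset ι) (f : ι → Pol n) (x : Eu n) :
    ev (∑ i ∈ s, f i) x = ∑ i ∈ s, ev (f i) x := map_sum _ _ _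

lemma ev_C (a : ℝ) : ev (C a : Pol n) = fun _ => a := funext fun _ => eval_C _
lemma ev_add' (p q : Pol n) : ev (p + q) = fun x => ev p x + ev q x := funext (ev_add p q)
lemma ev_mul_X (p : Pol n) (i : Fin n) : ev (p * X i) = fun x => ev p x * x i :=
  funext fun x => by rw [ev_mul, ev_X]

lemma contDiff_ev (p : Pol n) {k : WithTop ℕ∞} : ContDiff ℝ k (ev p) := by
  induction p using MvPolynomial.induction_on with
  | C a => rw [ev_C]; exact contDiff_const
  | add p q hp hq => rw [ev_add']; exact hp.add hq
  | mul_X p i hp => rw [ev_mul_X]; exact hp.mul (contDiff_coord i)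

lemma pd_ev (i : Fin n) (p : Pol n) : pd i (ev p) = ev (MvPolynomial.pderiv i p) := by
  funext x
  have hd : ∀ p : Pol n, DifferentiableAt ℝ (ev p) x := fun p =>
    (contDiff_ev p (k := 1)).differentiable (by simp) x
  induction p using MvPolynomial.induction_on with
  | C a => rw [ev_C, pd_const, pderiv_C, ev, map_zero]
  | add p q hp hq =>
    rw [ev_add', pd_add i (hd p) (hd q), hp, hq, map_add, ev_add]
  | mul_X p j hp =>
    rw [ev_mul_X, pd_mul i (hd p) ((contDiff_coord j (m := 1)).differentiable (by simp) x), hp,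
      pd_coord, pderiv_mul, ev_add, ev_mul, ev_mul, ev_X]
    by_cases hij : i = j
    · subst hij; rw [pderiv_X_self, if_pos rfl, ev, ev, ev, map_one]; ring
    · rw [pderiv_X_of_ne (Ne.symm hij), if_neg hij, ev, ev, ev, map_zero]; ring

lemma lapl_ev (p : Pol n) (x : Eu n) : lapl (ev p) x = ev (plapl p) x := by
  simp only [lapl, pd2]
  rw [plapl_apply, ev_sum]
  refine Finset.sum_congr rfl fun i _ => ?_
  have : (fun z => pd i (ev p) z) = pd i (ev p) := rfl
  rw [this, pd_ev, pd_ev]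

lemma isHarmonicOn_ev {p : Pol n} (h : plapl p = 0) (Ω : Set (Eu n)) : IsHarmonicOn (ev p) Ω :=
  isHarmonicOn_of_contDiffAt fun x _ => ⟨(contDiff_ev p).contDiffAt, by
    rw [lapl_ev, h, ev, map_zero]⟩

lemma abs_prod_le (m : Fin n →₀ ℕ) (x : Eu n) : |∏ i, x i ^ m i| ≤ ‖x‖ ^ m.degree := by
  rw [Finset.abs_prod, Finsupp.degree_eq_sum, ← Finset.prod_pow_eq_pow_sum]
  refine Finset.prod_le_prod (fun _ _ => abs_nonneg _) fun i _ => ?_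
  rw [abs_pow]
  exact pow_le_pow_left₀ (abs_nonneg _) (abs_apply_le_norm x i) _

lemma abs_ev_le_sum (p : Pol n) {x : Eu n} {K : ℝ}
    (h : ∀ m, coeff m p ≠ 0 → ‖x‖ ^ m.degree ≤ K) : |ev p x| ≤ pnorm p * K := by
  conv_lhs => rw [as_sum p, ev_sum]
  refine (Finset.abs_sum_le_sum_abs _ _).trans ?_
  rw [pnorm, Finset.sum_mul]
  refine Finset.sum_le_sum fun m hm => ?_
  rw [ev_monomial, abs_mul]
  exact mul_le_mul_of_nonneg_left ((abs_prod_le m x).trans (h m (mem_support_iff.1 hm)))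
    (abs_nonneg _)

lemma abs_ev_le_pow {a b : ℕ} {p : Pol n} (hp : DegIn a b p) {x : Eu n} (hx : ‖x‖ ≤ 1) :
    |ev p x| ≤ pnorm p * ‖x‖ ^ a :=
  abs_ev_le_sum p fun m hm => pow_le_pow_of_le_one (norm_nonneg x) hx (hp m hm).1

lemma abs_ev_le_growth {a b : ℕ} {p : Pol n} (hp : DegIn a b p) (x : Eu n) :
    |ev p x| ≤ pnorm p * (1 + ‖x‖) ^ b :=
  abs_ev_le_sum p fun m hm => by
    have h0 := norm_nonneg x
    exact (pow_le_pow_left₀ h0 (by linarith) _).trans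
      (pow_le_pow_right₀ (by linarith) (hp m hm).2)

/-- Rescaling of a polynomial vanishing to second order. -/
lemma exists_rescale {k : ℕ} {S : Pol n} (hS : DegIn 2 k S) {r : ℝ} (hr : 0 < r) (hr1 : r ≤ 1) :
    ∃ S' : Pol n, DegIn 2 k S' ∧ pnorm S' ≤ r * pnorm S ∧ ∀ x, ev S' x = r⁻¹ * ev S (r • x) := by
  refine ⟨∑ m ∈ S.support, monomial m (r ^ (m.degree - 1) * coeff m S),
    degIn_sum fun m hm => ?_, ?_, fun x => ?_⟩
  · have := hS m (mem_support_iff.1 hm)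
    exact degIn_monomial this.1 this.2
  · refine (pnorm_sum_le _ _).trans ?_
    rw [pnorm, Finset.mul_sum]
    refine Finset.sum_le_sum fun m hm => ?_
    have := hS m (mem_support_iff.1 hm)
    rw [pnorm_monomial, abs_mul, abs_of_nonneg (by positivity)]
    refine mul_le_mul_of_nonneg_right ?_ (abs_nonneg _)
    exact pow_le_of_le_one hr.le hr1 (by omega)
  · conv_rhs => rw [as_sum S, ev_sum]
    rw [ev_sum, Finset.mul_sum]
    refine Finset.sum_congr rfl fun m hm => ?_
    have := hS m (mem_support_iff.1 hm)
    rw [ev_monomial, ev_monomial]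
    simp only [PiLp.smul_apply, smul_eq_mul, mul_pow, Finset.prod_mul_distrib]
    rw [Finset.prod_pow_eq_pow_sum, ← Finsupp.degree_eq_sum]
    have h2 : r ^ m.degree = r * r ^ (m.degree - 1) := by
      rw [← pow_succ']; congr 1; omega
    rw [h2]
    field_simp

end Pol

namespace Pol

open MvPolynomial

lemma exists_plapl_X_mul_monomial (e : Fin n) (b : ℕ) : ∀ α : Fin n →₀ ℕ, α.degree ≤ α e + b →
    ∃ Q : Pol n, DegIn (α.degree + 1) (α.degree + 1) Q ∧
      plapl (X e * Q) = monomial α (1 : ℝ) := by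
  induction b using Nat.strong_induction_on with
  | _ b ih =>
  intro α hα
  set c : ℝ := (((α e : ℝ) + 2) * ((α e : ℝ) + 1))⁻¹ with hc
  set γ := α + Finsupp.single e 2 with hγ
  have hQ : ∀ i, i ≠ e → ∃ Q : Pol n, DegIn (α.degree + 1) (α.degree + 1) Q ∧
      plapl (X e * Q) = MvPolynomial.pderiv i (MvPolynomial.pderiv i (monomial γ c)) := by
    intro i hi
    rw [pderiv_monomial, pderiv_monomial]
    have hγi : γ i = α i := by simp [hγ, Ne.symm hi]
    by_cases h2 : α i ≤ 1
    · refine ⟨0, degIn_zero _ _, ?_⟩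
      have : (γ i : ℝ) * ((γ - Finsupp.single i 1 : Fin n →₀ ℕ) i : ℝ) = 0 := by
        rw [Finsupp.tsub_apply, Finsupp.single_eq_same, hγi, ← Nat.cast_mul]
        norm_cast
        interval_cases α i <;> rfl
      rw [mul_zero, map_zero, mul_assoc, this, mul_zero, monomial_zero]
    · push Not at h2
      set β := γ - Finsupp.single i 1 - Finsupp.single i 1 with hβ
      have e1 : (γ - Finsupp.single i 1).degree + 1 = γ.degree :=
        degree_sub_single (by omega)
      have e2 : β.degree + 1 = (γ - Finsupp.single i 1).degree :=
        degree_sub_single (by rw [Finsupp.tsub_apply, Finsupp.single_eq_same]; omega)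
      have e3 : γ.degree = α.degree + 2 := by rw [hγ, map_add, Finsupp.degree_single]
      have e4 : β e = α e + 2 := by
        simp [hβ, hγ, Finsupp.tsub_apply, hi]
      have e5 : α i + α e ≤ α.degree := by
        rw [Finsupp.degree_eq_sum, ← Finset.sum_pair hi]
        exact Finset.sum_le_sum_of_subset (Finset.subset_univ _)
      have e6 : β.degree = α.degree := by omega
      obtain ⟨Q, h3, h4⟩ := ih (b - 2) (by omega) β (by omega)
      refine ⟨(c * γ i * ((γ - Finsupp.single i 1 : Fin n →₀ ℕ) i : ℝ)) • Q, ?_, ?_⟩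
      · intro m hm
        rw [coeff_smul] at hm
        exact e6 ▸ h3 m fun h => hm (by rw [h, smul_zero])
      · rw [mul_smul_comm, map_smul, h4, smul_monomial, smul_eq_mul, mul_one]
  choose! Q hQ1 hQ2 using hQ
  refine ⟨monomial (α + Finsupp.single e 1) c - ∑ i ∈ Finset.univ.erase e, Q i, ?_, ?_⟩
  · refine DegIn.sub (degIn_monomial ?_ ?_)
      (degIn_sum fun i hi => hQ1 i (Finset.ne_of_mem_erase hi))
      <;> rw [map_add, Finsupp.degree_single]
  · have e1 : X e * monomial (α + Finsupp.single e 1) c = monomial γ c := by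
      rw [X, monomial_mul, one_mul, hγ, add_comm, add_assoc, ← Finsupp.single_add]
    rw [mul_sub, Finset.mul_sum, map_sub, map_sum, e1,
      Finset.sum_congr rfl fun i hi => hQ2 i (Finset.ne_of_mem_erase hi), plapl_apply,
      ← Finset.add_sum_erase _ _ (Finset.mem_univ e), add_sub_cancel_right,
      pderiv_monomial, pderiv_monomial]
    have e2 : γ - Finsupp.single e 1 - Finsupp.single e 1 = α := by
      rw [hγ, tsub_tsub, ← Finsupp.single_add, add_tsub_cancel_right]
    have e3 : γ e = α e + 2 := by simp [hγ]
    have e4 : (γ - Finsupp.single e 1 : Fin n →₀ ℕ) e = α e + 1 := by simp [hγ]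
    rw [e2, e3, e4, hc]
    congr 1
    push_cast
    field_simp

/-- Solvability of the Dirichlet problem for the Laplacian on a half space, for polynomials. -/
lemma exists_plapl_X_mul (n : ℕ) (e : Fin n) (K : ℕ) : ∃ c : ℝ, 0 < c ∧
    ∀ (a b : ℕ) (f : Pol n), b ≤ K → DegIn a b f →
    ∃ Q : Pol n, DegIn (a + 1) (b + 1) Q ∧ plapl (X e * Q) = f ∧ pnorm Q ≤ c * pnorm f := by
  choose Q hQ1 hQ2 using fun α : Fin n →₀ ℕ =>
    exists_plapl_X_mul_monomial e α.degree α (by omega)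
  obtain ⟨c, hc⟩ := ((Finsupp.finite_of_degree_le (σ := Fin n) K).image
    fun α => pnorm (Q α)).bddAbove
  refine ⟨max c 1, by positivity, fun a b f hb hf => ?_⟩
  refine ⟨∑ m ∈ f.support, coeff m f • Q m, ?_, ?_, ?_⟩
  · refine degIn_sum fun m hm m' hm' => ?_
    rw [coeff_smul] at hm'
    have h1 := hQ1 m m' fun h => hm' (by rw [h, smul_zero])
    have h2 := hf m (mem_support_iff.1 hm)
    omega
  · rw [Finset.mul_sum, map_sum]
    conv_rhs => rw [as_sum f]
    refine Finset.sum_congr rfl fun m _ => ?_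
    rw [mul_smul_comm, map_smul, hQ2, smul_monomial, smul_eq_mul, mul_one]
  · refine (pnorm_sum_le _ _).trans ?_
    rw [pnorm.eq_1 f, Finset.mul_sum]
    refine Finset.sum_le_sum fun m hm => ?_
    have h2 := hf m (mem_support_iff.1 hm)
    rw [smul_eq_C_mul, C_apply]
    refine (pnorm_mul_le _ _).trans ?_
    rw [pnorm_monomial, mul_comm]
    exact mul_le_mul_of_nonneg_right ((hc ⟨m, h2.2.trans hb, rfl⟩).trans (le_max_left _ _))
      (abs_nonneg _)

/-- The curved Laplacian operator `Q ↦ Δ (trunc_k (Q (X_e + S)))`. -/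
def curvedLapl (e : Fin n) (S : Pol n) (k : ℕ) (Q : Pol n) : Pol n :=
  plapl (trunc k (Q * (X e + S)))

lemma curvedLapl_sub (e : Fin n) (S : Pol n) (k : ℕ) (P Q : Pol n) :
    curvedLapl e S k (P - Q) = curvedLapl e S k P - curvedLapl e S k Q := by
  rw [curvedLapl, sub_mul, map_sub, map_sub, curvedLapl, curvedLapl]

lemma curvedLapl_add (e : Fin n) (S : Pol n) (k : ℕ) (P Q : Pol n) :
    curvedLapl e S k (P + Q) = curvedLapl e S k P + curvedLapl e S k Q := by
  rw [curvedLapl, add_mul, map_add, map_add, curvedLapl, curvedLapl]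

lemma curvedLapl_eq {e : Fin n} {S : Pol n} {k a b : ℕ} {Q : Pol n} (hQ : DegIn a b Q)
    (hb : b + 1 ≤ k) :
    curvedLapl e S k Q = plapl (X e * Q) + plapl (trunc k (Q * S)) := by
  rw [curvedLapl, mul_add, map_add, map_add, (hQ.mul (degIn_X e)).trunc_eq hb, mul_comm]

lemma pnorm_plapl_trunc_le {S : Pol n} {k : ℕ} {Q : Pol n} {δ : ℝ} (hδ : pnorm S ≤ δ) :
    pnorm (plapl (trunc k (Q * S))) ≤ n * k ^ 2 * (pnorm Q * δ) := by
  have h1 : DegIn 0 k (trunc k (Q * S)) :=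
    fun m hm => ⟨Nat.zero_le _, by
      by_contra h
      rw [coeff_trunc, if_neg h] at hm
      exact hm rfl⟩
  refine (pnorm_plapl_le h1).trans ?_
  refine mul_le_mul_of_nonneg_left ?_ (by positivity)
  exact (pnorm_trunc_le _ _).trans ((pnorm_mul_le _ _).trans
    (mul_le_mul_of_nonneg_left hδ (pnorm_nonneg _)))

/-- Solvability of the curved problem, with bounds. -/
lemma exists_curvedLapl_eq (n : ℕ) (e : Fin n) (k : ℕ) (hk : 2 ≤ k) (i : ℕ) : ∃ c : ℝ, 0 < c ∧
    ∀ S : Pol n, DegIn 2 k S → pnorm S ≤ 1 → ∀ f : Pol n, DegIn (k - 1 - i) (k - 2) f →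
    ∃ Q : Pol n, DegIn 0 (k - 1) Q ∧ curvedLapl e S k Q = f ∧ pnorm Q ≤ c * pnorm f := by
  induction i with
  | zero =>
    refine ⟨1, one_pos, fun S _ _ f hf => ⟨0, degIn_zero _ _, ?_, ?_⟩⟩
    · rw [hf.eq_zero (by omega)]; simp [curvedLapl]
    · simpa using pnorm_nonneg f
  | succ i ih =>
    obtain ⟨c₁, hc₁, h₁⟩ := exists_plapl_X_mul n e (k - 2)
    obtain ⟨c₂, hc₂, h₂⟩ := ih
    refine ⟨c₁ + c₂ * (n * k ^ 2 * c₁), by positivity, fun S hS hS1 f hf => ?_⟩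
    obtain ⟨Q₁, hQ₁, hQ₁f, hQ₁n⟩ := h₁ _ _ f le_rfl hf
    have hd : k - 2 + 1 = k - 1 := by omega
    rw [hd] at hQ₁
    have heq := curvedLapl_eq (S := S) (e := e) hQ₁ (k := k) (by omega)
    rw [hQ₁f] at heq
    obtain ⟨Q₂, hQ₂, hQ₂f, hQ₂n⟩ := h₂ S hS hS1 (-plapl (trunc k (Q₁ * S)))
      ((((hQ₁.mul hS).trunc k).plapl.neg).mono (by omega) le_rfl)
    refine ⟨Q₁ + Q₂, (hQ₁.mono (Nat.zero_le _) le_rfl).add hQ₂, ?_, ?_⟩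
    · rw [curvedLapl_add, heq, hQ₂f]; ring
    · have h3 := pnorm_plapl_trunc_le (k := k) (Q := Q₁) hS1
      rw [pnorm_neg] at hQ₂n
      have h4 : pnorm (plapl (trunc k (Q₁ * S))) ≤ n * k ^ 2 * c₁ * pnorm f := by
        refine h3.trans ?_
        rw [mul_one, mul_assoc _ c₁]
        exact mul_le_mul_of_nonneg_left hQ₁n (by positivity)
      have h5 := mul_le_mul_of_nonneg_left h4 hc₂.le
      have := pnorm_add_le Q₁ Q₂
      nlinarith

/-- Correction of an almost harmonic polynomial vanishing on a hyperplane to a harmonic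
polynomial vanishing to high order on a curved hypersurface. -/
theorem exists_correction (n : ℕ) (e : Fin n) (k : ℕ) (hk : 2 ≤ k) : ∃ c : ℝ, 0 < c ∧
    ∀ (S : Pol n) (δ : ℝ), DegIn 2 k S → pnorm S ≤ δ → δ ≤ 1 → ∀ Q₀ : Pol n, DegIn 0 (k - 1) Q₀ →
    ∃ Q : Pol n, DegIn 0 (k - 1) Q ∧ plapl (trunc k (Q * (X e + S))) = 0 ∧
      pnorm (Q - Q₀) ≤ c * (pnorm (plapl (X e * Q₀)) + δ * pnorm Q₀) := by
  obtain ⟨c, hc, h⟩ := exists_curvedLapl_eq n e k hk (k - 1)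
  refine ⟨c * (1 + n * k ^ 2), by positivity, fun S δ hS hSδ hδ Q₀ hQ₀ => ?_⟩
  have hdeg : DegIn (k - 1 - (k - 1)) (k - 2) (curvedLapl e S k Q₀) :=
    ((hQ₀.mul (((degIn_X e).mono le_rfl (by omega)).add
      (hS.mono (by omega) le_rfl))).trunc k).plapl.mono (by omega) le_rfl
  obtain ⟨Q, hQ, hQf, hQn⟩ := h S hS (hSδ.trans hδ) _ hdeg
  refine ⟨Q₀ - Q, hQ₀.sub hQ, ?_, ?_⟩
  · have := curvedLapl_sub e S k Q₀ Q
    rw [hQf, sub_self] at this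
    exact this
  · rw [show Q₀ - Q - Q₀ = -Q by ring, pnorm_neg]
    refine hQn.trans ?_
    rw [curvedLapl_eq hQ₀ (by omega), mul_assoc]
    refine mul_le_mul_of_nonneg_left ?_ hc.le
    refine (pnorm_add_le _ _).trans ?_
    have h3 := pnorm_plapl_trunc_le (k := k) (Q := Q₀) hSδ
    have h4 := pnorm_nonneg (plapl (X e * Q₀))
    have h5 := pnorm_nonneg Q₀
    have h6 : 0 ≤ δ := (pnorm_nonneg S).trans hSδ
    have h7 : 0 ≤ (n : ℝ) * k ^ 2 := by positivity
    nlinarith [mul_nonneg h7 h4, mul_nonneg h6 h5]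

end Pol

lemma lapl_coord_add_sq (e : Fin n) (c : ℝ) (x : Eu n) :
    lapl (fun y => (y e + c) ^ 2) x = 2 := by
  have h : ContDiff ℝ 2 (fun y : Eu n => y e + c) := (contDiff_coord e).add contDiff_const
  have h1 : lapl (fun y : Eu n => y e + c) x = 0 := by
    rw [lapl_add (contDiff_coord e).contDiffAt contDiffAt_const, lapl_coord, lapl_const, add_zero]
  have h2 : ∀ i, pd i (fun y : Eu n => y e + c) x = if i = e then 1 else 0 := by
    intro i
    rw [pd_add i ((contDiff_coord e (m := 1)).differentiable (by simp) x)
      (differentiableAt_const c), pd_coord, pd_const, add_zero]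
  simp only [pow_two]
  rw [lapl_mul h.contDiffAt h.contDiffAt, h1]
  simp only [h2]
  simp

/-- The quadratic harmonic barrier. -/
lemma barrier_harmonic (e : Fin n) (a ε A B δ : ℝ) (c x : Eu n) :
    lapl (fun y => ε + (A * (y e + δ) + B * (‖y - c‖ ^ 2 - ((y e + a) ^ 2 +
      ((n : ℝ) - 1) * (y e + δ) ^ 2)))) x = 0 := by
  have h1 : ContDiff ℝ 2 (fun y : Eu n => y e + δ) := (contDiff_coord e).add contDiff_const
  have h1' : ContDiff ℝ 2 (fun y : Eu n => y e + a) := (contDiff_coord e).add contDiff_const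
  have h2 : ContDiff ℝ 2 (fun y : Eu n => ‖y - c‖ ^ 2) :=
    (contDiff_norm_sq ℝ).comp (contDiff_id.sub contDiff_const)
  have h3 : ContDiff ℝ 2 (fun y : Eu n => ((n : ℝ) - 1) * (y e + δ) ^ 2) :=
    contDiff_const.mul (h1.pow 2)
  have h4 : ContDiff ℝ 2 (fun y : Eu n => (y e + a) ^ 2 + ((n : ℝ) - 1) * (y e + δ) ^ 2) :=
    (h1'.pow 2).add h3
  rw [lapl_add contDiffAt_const ((contDiff_const.mul h1).add
      (contDiff_const.mul (h2.sub h4))).contDiffAt, lapl_const,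
    lapl_add (contDiff_const.mul h1).contDiffAt (contDiff_const.mul (h2.sub h4)).contDiffAt,
    lapl_const_mul _ h1.contDiffAt, lapl_const_mul _ (h2.sub h4).contDiffAt,
    lapl_add (contDiff_coord e).contDiffAt contDiffAt_const, lapl_coord, lapl_const,
    lapl_sub h2.contDiffAt h4.contDiffAt, lapl_normSq_sub,
    lapl_add (h1'.pow 2).contDiffAt h3.contDiffAt, lapl_const_mul _ (h1.pow 2).contDiffAt,
    lapl_coord_add_sq, lapl_coord_add_sq]
  ring

lemma sq_coord_add_sq_le (e : Fin n) (x y : Eu n) {q s a : ℝ}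
    (hq : ‖x - y‖ ^ 2 - (x e - y e) ^ 2 ≤ q ^ 2) (hq0 : 0 ≤ q) (hy : ‖y‖ ≤ a) (hs : |x e| ≤ s) :
    ‖x‖ ≤ q + a + s := by
  set p : Eu n := x - y - (x e - y e) • stdE e with hp
  have h1 : ‖p‖ ^ 2 = ‖x - y‖ ^ 2 - (x e - y e) ^ 2 := by
    rw [EuclideanSpace.real_norm_sq_eq, EuclideanSpace.real_norm_sq_eq,
      ← Finset.add_sum_erase _ _ (Finset.mem_univ e),
      ← Finset.add_sum_erase (a := e) _ (fun i => (x - y) i ^ 2) (Finset.mem_univ e)]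
    have h2 : ∀ i ∈ Finset.univ.erase e, p i ^ 2 = (x - y) i ^ 2 := by
      intro i hi
      simp [hp, stdE, Finset.ne_of_mem_erase hi]
    rw [Finset.sum_congr rfl h2]
    simp [hp, stdE]
  have h3 : ‖p‖ ≤ q := by
    rw [← h1] at hq
    exact le_of_sq_le_sq hq hq0
  set y' : Eu n := y - y e • stdE e with hy'
  have h4 : ‖y'‖ ^ 2 = ‖y‖ ^ 2 - (y e) ^ 2 := by
    rw [EuclideanSpace.real_norm_sq_eq, EuclideanSpace.real_norm_sq_eq,
      ← Finset.add_sum_erase _ _ (Finset.mem_univ e),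
      ← Finset.add_sum_erase (a := e) _ (fun i => y i ^ 2) (Finset.mem_univ e)]
    have h2 : ∀ i ∈ Finset.univ.erase e, y' i ^ 2 = y i ^ 2 := by
      intro i hi
      simp [hy', stdE, Finset.ne_of_mem_erase hi]
    rw [Finset.sum_congr rfl h2]
    simp [hy', stdE]
  have h5 : ‖y'‖ ≤ a := by
    refine le_trans (le_of_sq_le_sq ?_ (norm_nonneg y)) hy
    rw [h4]; nlinarith [sq_nonneg (y e)]
  have h6 : x = p + y' + x e • stdE e := by
    rw [hp, hy', sub_smul]; abel
  rw [h6]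
  refine (norm_add₃_le).trans ?_
  rw [norm_smul, norm_stdE, mul_one, Real.norm_eq_abs]
  linarith

/-- Linear decay of bounded harmonic functions near an almost flat boundary portion. -/
lemma barrier_one_sided (hn : 2 < n) (e : Fin n) : ∃ A : ℝ, 1 ≤ A ∧
    ∀ (Ω : Set (Eu n)) (δ ε : ℝ) (w : Eu n → ℝ), IsOpen Ω → 0 < δ → δ < 1 / 8 → 0 ≤ ε →
    (∀ x ∈ Ω ∩ ball 0 1, -δ < x e) → IsHarmonicOn w (Ω ∩ ball 0 1) →
    (∀ x ∈ Ω ∩ ball 0 1, w x ≤ 1) →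
    (∀ z ∈ frontier Ω ∩ ball 0 1, ∀ᶠ x in 𝓝[Ω] z, w x ≤ ε) →
    ∀ x ∈ Ω ∩ ball 0 (1 / 2), w x ≤ ε + A * (x e + δ) := by
  set N : ℝ := (n : ℝ) - 1 with hN
  have hN2 : 2 ≤ N := by
    have : (3 : ℝ) ≤ n := by exact_mod_cast hn
    linarith
  set s₀ : ℝ := √(1 / (32 * N)) with hs₀
  have hs₀sq : s₀ ^ 2 = 1 / (32 * N) := Real.sq_sqrt (by positivity)
  have hs₀pos : 0 < s₀ := Real.sqrt_pos.2 (by positivity)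
  have hs₀sq' : 32 * N * s₀ ^ 2 = 1 := by rw [hs₀sq]; field_simp
  have hs₀le : s₀ ≤ 1 / 8 := by nlinarith
  set A : ℝ := 2 / s₀ with hA
  have hAs : A * s₀ = 2 := by rw [hA]; field_simp
  have hA1 : 1 ≤ A := by nlinarith
  refine ⟨A, hA1, fun Ω δ ε w hΩ hδ hδ8 hε hlow hw hw1 hbd x hx => ?_⟩
  have hxB : x ∈ Ω ∩ ball 0 1 := ⟨hx.1, ball_subset_ball (by norm_num) hx.2⟩
  have hxs := hlow x hxB
  by_cases hxs0 : s₀ ≤ x e + δ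
  · have := hw1 x hxB
    nlinarith
  push Not at hxs0
  have hxn : ‖x‖ < 1 / 2 := mem_ball_zero_iff.1 hx.2
  set q : Eu n → ℝ := fun y => ‖y - x‖ ^ 2 - (y e - x e) ^ 2 with hq
  have hce : Continuous fun y : Eu n => y e := (contDiff_coord e (m := 0)).continuous
  have hqc : Continuous q := by fun_prop
  set V : Set (Eu n) := {y | q y < (1 / 4) ^ 2 ∧ y e + δ < s₀ ∧ -(1 / 8) < y e} with hV
  have hVo : IsOpen V := (isOpen_lt hqc continuous_const).inter
    ((isOpen_lt (hce.add continuous_const) continuous_const).inter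
      (isOpen_lt continuous_const hce))
  have hVc : ∀ y ∈ closure V, q y ≤ (1 / 4) ^ 2 ∧ y e + δ ≤ s₀ ∧ -(1 / 8) ≤ y e := by
    intro y hy
    have hcl : IsClosed {y : Eu n | q y ≤ (1 / 4) ^ 2 ∧ y e + δ ≤ s₀ ∧ -(1 / 8) ≤ y e} :=
      (isClosed_le hqc continuous_const).inter
        ((isClosed_le (hce.add continuous_const) continuous_const).inter
          (isClosed_le continuous_const hce))
    exact hcl.closure_subset_iff.2 (fun z hz => ⟨hz.1.le, hz.2.1.le, hz.2.2.le⟩) hy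
  have hVball : ∀ y ∈ closure V, y ∈ ball (0 : Eu n) 1 := by
    intro y hy
    obtain ⟨h1, h2, h3⟩ := hVc y hy
    have h4 : ‖y‖ ≤ 1 / 4 + ‖x‖ + 1 / 8 :=
      sq_coord_add_sq_le e y x h1 (by norm_num) le_rfl (abs_le.2 ⟨h3, by linarith⟩)
    rw [mem_ball_zero_iff]; linarith
  set b : Eu n → ℝ := fun y => ε + (A * (y e + δ) + 32 * (‖y - x‖ ^ 2 - ((y e + -x e) ^ 2 +
      N * (y e + δ) ^ 2))) with hb
  have hb' : ∀ y, b y = ε + A * (y e + δ) + 32 * q y - 32 * N * (y e + δ) ^ 2 := by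
    intro y; simp only [hb, hq]; ring
  have hbsm : ContDiff ℝ 2 b := by
    have h1 : ∀ c : ℝ, ContDiff ℝ 2 (fun y : Eu n => y e + c) := fun c =>
      (contDiff_coord e).add contDiff_const
    have h2 : ContDiff ℝ 2 (fun y : Eu n => ‖y - x‖ ^ 2) :=
      (contDiff_norm_sq ℝ).comp (contDiff_id.sub contDiff_const)
    exact contDiff_const.add ((contDiff_const.mul (h1 δ)).add (contDiff_const.mul
      (h2.sub (((h1 _).pow 2).add (contDiff_const.mul ((h1 δ).pow 2))))))
  have hqnn : ∀ y, 0 ≤ q y := by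
    intro y
    have h1 := abs_apply_le_norm (y - x) e
    have h2 : ((y - x) e) ^ 2 ≤ ‖y - x‖ ^ 2 := sq_le_sq.2 (by rwa [abs_norm])
    simp only [hq]
    have h3 : (y - x) e = y e - x e := rfl
    rw [h3] at h2
    linarith
  set R := Ω ∩ V with hR
  have hRo : IsOpen R := hΩ.inter hVo
  have hRsub : R ⊆ Ω ∩ ball 0 1 := fun y hy => ⟨hy.1, hVball y (subset_closure hy.2)⟩
  have hRs : ∀ z ∈ closure R, 0 ≤ z e + δ := by
    intro z hz
    have hcl : IsClosed {y : Eu n | 0 ≤ y e + δ} :=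
      isClosed_le continuous_const (hce.add continuous_const)
    refine hcl.closure_subset_iff.2 (fun y hy => ?_) hz
    have := hlow y (hRsub hy)
    change 0 ≤ y e + δ
    linarith
  have hcomp := comparison_principle (by omega) hRo
    (isBounded_ball.subset (hRsub.trans inter_subset_right)) (u := w) (v := b)
    (fun y hy => hw.contDiffAt (hΩ.inter isOpen_ball) (hRsub hy)) (fun y _ => hbsm.contDiffAt)
    (fun y hy => by
      rw [hw.2 y (hRsub hy)]
      exact (barrier_harmonic e (-x e) ε A 32 δ x y).le) ?_ x ?_
  · rw [hb'] at hcomp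
    have : q x = 0 := by simp [hq]
    rw [this] at hcomp
    nlinarith [sq_nonneg (x e + δ)]
  · intro z hz ε' hε'
    have hzc : z ∈ closure R := frontier_subset_closure hz
    have hzV : z ∈ closure V := closure_mono inter_subset_right hzc
    obtain ⟨h1, h2, h3⟩ := hVc z hzV
    have h0 := hRs z hzc
    have hzR : z ∉ R := by rw [hRo.frontier_eq] at hz; exact hz.2
    have hN' : 32 * N * (z e + δ) ^ 2 ≤ 1 := by
      rw [← hs₀sq']
      exact mul_le_mul_of_nonneg_left (pow_le_pow_left₀ h0 h2 2) (by positivity)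
    have hqz := hqnn z
    have hAz : 32 * N * (z e + δ) ^ 2 ≤ A * (z e + δ) := by
      have : 32 * N * (z e + δ) ≤ A := by nlinarith
      nlinarith
    by_cases hzΩ : z ∈ Ω
    · have hbz : 1 ≤ b z := by
        rw [hb']
        have hAz0 : 0 ≤ A * (z e + δ) := mul_nonneg (by linarith) h0
        by_cases hq1 : (1 / 4) ^ 2 ≤ q z
        · norm_num at hq1
          nlinarith
        · have h5 : s₀ ≤ z e + δ := by
            by_contra! h6
            refine hzR ⟨hzΩ, not_le.1 hq1, h6, ?_⟩
            have := hlow z ⟨hzΩ, hVball z hzV⟩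
            linarith
          nlinarith
      have := hbsm.continuous.continuousAt.eventually
        (lt_mem_nhds (show b z - ε' < b z by linarith))
      filter_upwards [mem_nhdsWithin_of_mem_nhds this, self_mem_nhdsWithin] with y hy hyR
      have := hw1 y (hRsub hyR)
      linarith
    · have hzf : z ∈ frontier Ω := by
        rw [hΩ.frontier_eq]
        exact ⟨closure_mono inter_subset_left hzc, hzΩ⟩
      have hbz : ε ≤ b z := by rw [hb']; nlinarith
      have := hbsm.continuous.continuousAt.eventually
        (lt_mem_nhds (show b z - ε' < b z by linarith))
      filter_upwards [mem_nhdsWithin_of_mem_nhds this,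
        nhdsWithin_mono z inter_subset_left (hbd z ⟨hzf, hVball z hzV⟩)] with y hy hyw
      linarith
  · refine ⟨hx.1, ?_, hxs0, by linarith⟩
    simp [hq]

lemma barrier_bound (hn : 2 < n) (e : Fin n) : ∃ A : ℝ, 1 ≤ A ∧
    ∀ (Ω : Set (Eu n)) (δ ε : ℝ) (w : Eu n → ℝ), IsOpen Ω → 0 < δ → δ < 1 / 8 → 0 ≤ ε →
    (∀ x ∈ Ω ∩ ball 0 1, -δ < x e) → IsHarmonicOn w (Ω ∩ ball 0 1) →
    (∀ x ∈ Ω ∩ ball 0 1, |w x| ≤ 1) →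
    (∀ z ∈ frontier Ω ∩ ball 0 1, ∀ᶠ x in 𝓝[Ω] z, |w x| ≤ ε) →
    ∀ x ∈ Ω ∩ ball 0 (1 / 2), |w x| ≤ ε + A * (x e + δ) := by
  obtain ⟨A, hA, h⟩ := barrier_one_sided hn e
  refine ⟨A, hA, fun Ω δ ε w hΩ hδ hδ8 hε hlow hw hw1 hbd x hx => abs_le.2 ⟨?_, ?_⟩⟩
  · have := h Ω δ ε (fun y => (-1) * w y) hΩ hδ hδ8 hε hlow
      (hw.const_mul (hΩ.inter isOpen_ball) (-1))
      (fun y hy => by linarith [(abs_le.1 (hw1 y hy)).1])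
      (fun z hz => (hbd z hz).mono fun y hy => by linarith [(abs_le.1 hy).1]) x hx
    linarith
  · exact h Ω δ ε w hΩ hδ hδ8 hε hlow hw (fun y hy => (abs_le.1 (hw1 y hy)).2)
      (fun z hz => (hbd z hz).mono fun y hy => (abs_le.1 hy).2) x hx

/-- Reflection in the `e`-th coordinate. -/
def mirror (e : Fin n) : Eu n ≃ₗᵢ[ℝ] Eu n :=
  LinearIsometryEquiv.piLpCongrRight 2 fun i =>
    if i = e then LinearIsometryEquiv.neg ℝ else LinearIsometryEquiv.refl ℝ ℝ

lemma mirror_apply (e i : Fin n) (x : Eu n) : mirror e x i = if i = e then -x i else x i := by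
  rw [mirror, LinearIsometryEquiv.piLpCongrRight_apply]
  simp only
  split_ifs <;> simp

lemma mirror_apply_self (e : Fin n) (x : Eu n) : mirror e x e = -x e := by simp [mirror_apply]

lemma mirror_mirror (e : Fin n) (x : Eu n) : mirror e (mirror e x) = x := by
  ext i; simp only [mirror_apply]; split_ifs <;> simp

lemma sub_mirror (e : Fin n) (x : Eu n) : x - mirror e x = (2 * x e) • stdE e := by
  ext i
  simp only [PiLp.sub_apply, mirror_apply, PiLp.smul_apply, stdE, PiLp.single_apply,
    smul_eq_mul]
  split_ifs with h
  · subst h; ring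
  · ring

lemma norm_sub_mirror (e : Fin n) (x : Eu n) : ‖x - mirror e x‖ = 2 * |x e| := by
  rw [sub_mirror, norm_smul, norm_stdE, Real.norm_eq_abs, abs_mul]; simp

lemma pd_comp_mirror (e i : Fin n) (u : Eu n → ℝ) (x : Eu n) :
    pd i (fun y => u (mirror e y)) x = (if i = e then -1 else 1) * pd i u (mirror e x) := by
  have h : fderiv ℝ (fun y => u (mirror e y)) x =
      (fderiv ℝ u (mirror e x)).comp ((mirror e).toContinuousLinearEquiv : Eu n →L[ℝ] Eu n) :=
    (mirror e).toContinuousLinearEquiv.comp_right_fderiv (f := u) (x := x)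
  have h2 : mirror e (stdE i) = (if i = e then (-1 : ℝ) else 1) • stdE i := by
    ext j
    simp only [mirror_apply, stdE, PiLp.single_apply, PiLp.smul_apply, smul_eq_mul]
    split_ifs <;> simp_all
  rw [pd, h, ContinuousLinearMap.comp_apply]
  change fderiv ℝ u (mirror e x) (mirror e (stdE i)) = _
  rw [h2, map_smul, smul_eq_mul]
  rfl

lemma pdMulti_comp_mirror (e : Fin n) (u : Eu n → ℝ) (L : List (Fin n)) (x : Eu n) :
    pdMulti L (fun y => u (mirror e y)) x = (-1) ^ L.count e * pdMulti L u (mirror e x) := by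
  induction L generalizing x with
  | nil => simp [pdMulti]
  | cons i L ih =>
    have h1 : pdMulti L (fun y => u (mirror e y)) =
        fun x => (-1) ^ L.count e * pdMulti L u (mirror e x) := funext ih
    rw [pdMulti, h1]
    have h2 : pd i (fun x => (-1 : ℝ) ^ L.count e * pdMulti L u (mirror e x)) x =
        (-1) ^ L.count e * pd i (fun x => pdMulti L u (mirror e x)) x := by
      simp only [pd]
      rw [show (fun x => (-1 : ℝ) ^ L.count e * pdMulti L u (mirror e x)) =
        ((-1 : ℝ) ^ L.count e) • fun x => pdMulti L u (mirror e x) from rfl,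
      fderiv_const_smul_field]
      rfl
    rw [h2, pd_comp_mirror, List.count_cons, pdMulti]
    by_cases h : i = e
    · simp [h, pow_succ]
    · simp [h]

lemma pdMulti_zero_of_odd {e : Fin n} {u : Eu n → ℝ} (hu : ∀ x, u (mirror e x) = -u x)
    {L : List (Fin n)} (hL : Even (L.count e)) : pdMulti L u 0 = 0 := by
  have h1 := pdMulti_comp_mirror e u L 0
  rw [hL.neg_one_pow, map_zero, one_mul] at h1
  have h2 : ∀ x, pdMulti L (fun y => -u y) x = - pdMulti L u x := by
    clear hL h1
    intro x
    induction L generalizing x with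
    | nil => rfl
    | cons i L ih => rw [pdMulti, funext ih, pd, fderiv_fun_neg]; rfl
  rw [funext hu, h2] at h1
  linarith

lemma pd_comp_coord {f : ℝ → ℝ} (hf : Differentiable ℝ f) (e i : Fin n) (c : ℝ) :
    pd i (fun x : Eu n => f (c * x e)) =
      fun x => if i = e then c * deriv f (c * x e) else 0 := by
  funext x
  have h1 : HasFDerivAt (fun x : Eu n => c * x e)
      (c • (EuclideanSpace.proj (𝕜 := ℝ) e : Eu n →L[ℝ] ℝ)) x :=
    ((EuclideanSpace.proj (𝕜 := ℝ) e : Eu n →L[ℝ] ℝ).hasFDerivAt).const_mul c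
  have h2 := (hf (c * x e)).hasDerivAt.comp_hasFDerivAt x h1
  rw [pd, show (fun x : Eu n => f (c * x e)) = f ∘ fun x : Eu n => c * x e from rfl, h2.fderiv]
  have h3 : (EuclideanSpace.proj (𝕜 := ℝ) e : Eu n →L[ℝ] ℝ) (EuclideanSpace.single i 1) =
      if i = e then 1 else 0 := by simp [eq_comm]
  rw [smul_apply, smul_apply, h3]
  split_ifs <;> simp [mul_comm]

lemma lapl_comp_coord {f : ℝ → ℝ} (hf : ContDiff ℝ 2 f) (e : Fin n) (c : ℝ) (x : Eu n) :
    lapl (fun x : Eu n => f (c * x e)) x = c ^ 2 * deriv (deriv f) (c * x e) := by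
  have hf1 : Differentiable ℝ f := hf.differentiable (by simp)
  have hf2 : Differentiable ℝ (deriv f) := by
    have : ContDiff ℝ (1 + 1) f := by simpa [one_add_one_eq_two] using hf
    exact ((contDiff_succ_iff_deriv.1 this).2.2).differentiable (by simp)
  have h : ∀ i, pd2 i i (fun x : Eu n => f (c * x e)) x =
      if i = e then c ^ 2 * deriv (deriv f) (c * x e) else 0 := by
    intro i
    simp only [pd2]
    rw [show (fun z => pd i (fun x : Eu n => f (c * x e)) z) = _ from pd_comp_coord hf1 e i c]
    split_ifs with h
    · rw [show (fun x : Eu n => c * deriv f (c * x e)) =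
        c • fun x : Eu n => deriv f (c * x e) from rfl, pd, fderiv_const_smul_field]
      have := congrFun (pd_comp_coord hf2 e i c) x
      simp only [if_pos h] at this
      change c * pd i _ x = _
      rw [this]; ring
    · simp [pd]
  simp only [lapl, h, Finset.sum_ite_eq', Finset.mem_univ, if_true]

lemma stepFn_bounds :
    ∃ S : ℝ, 1 ≤ S ∧ ∀ s, |deriv stepFn s| ≤ S ∧ |deriv (deriv stepFn) s| ≤ S := by
  have hd : ContDiff ℝ ∞ (deriv stepFn) := (contDiff_infty_iff_deriv.1 stepFn_contDiff).2
  have hs : HasCompactSupport (deriv stepFn) :=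
    HasCompactSupport.intro (isCompact_Icc (a := (1 / 2 : ℝ)) (b := 1)) fun s h => by
      by_cases h1 : s ≤ 1 / 2
      · exact stepFn_deriv_zero h1
      · exact stepFn_deriv_one (by by_contra! h2; exact h ⟨by linarith, h2.le⟩)
  obtain ⟨a, ha⟩ := hs.exists_bound_of_continuous hd.continuous
  obtain ⟨b, hb⟩ := hs.deriv.exists_bound_of_continuous
    ((contDiff_infty_iff_deriv.1 hd).2).continuous
  exact ⟨max 1 (max a b), le_max_left _ _,
    fun s => ⟨(ha s).trans (by simp), (hb s).trans (by simp)⟩⟩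

/-- A harmonic function on an almost flat domain, almost vanishing on the boundary. -/
structure StripData (e : Fin n) (Ω : Set (Eu n)) (δ : ℝ) (w : Eu n → ℝ) : Prop where
  isOpen : IsOpen Ω
  pos : 0 < δ
  lt : δ < 1 / 8
  upper : ∀ x ∈ ball (0 : Eu n) 1, δ < x e → x ∈ Ω
  lower : ∀ x ∈ Ω ∩ ball 0 1, -δ < x e
  harm : IsHarmonicOn w (Ω ∩ ball 0 1)
  bound : ∀ x ∈ Ω ∩ ball 0 1, |w x| ≤ 1
  bdry : ∀ z ∈ frontier Ω ∩ ball 0 1, ∀ᶠ x in 𝓝[Ω] z, |w x| ≤ δ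

/-- Cutting off near the boundary. -/
def cutStrip (e : Fin n) (δ : ℝ) (w : Eu n → ℝ) (x : Eu n) : ℝ :=
  stepFn ((4 * δ)⁻¹ * x e) * w x

lemma cutStrip_eq_zero {e : Fin n} {δ : ℝ} (hδ : 0 < δ) (w : Eu n → ℝ) {x : Eu n}
    (hx : x e ≤ 2 * δ) : cutStrip e δ w x = 0 := by
  rw [cutStrip, stepFn_zero, zero_mul]
  rw [inv_mul_le_iff₀ (by positivity)]; linarith

lemma cutStrip_eq {e : Fin n} {δ : ℝ} (hδ : 0 < δ) (w : Eu n → ℝ) {x : Eu n}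
    (hx : 4 * δ ≤ x e) : cutStrip e δ w x = w x := by
  rw [cutStrip, stepFn_one, one_mul]
  rw [le_inv_mul_iff₀ (by positivity)]; linarith

lemma abs_cutStrip_le (e : Fin n) (δ : ℝ) (w : Eu n → ℝ) (x : Eu n) :
    |cutStrip e δ w x| ≤ |w x| := by
  rw [cutStrip, abs_mul]
  refine mul_le_of_le_one_left (abs_nonneg _) ?_
  rw [stepFn, abs_of_nonneg (smoothTransition.nonneg _)]
  exact smoothTransition.le_one _

lemma abs_coord_sub_le (e : Fin n) (x y : Eu n) : |x e - y e| ≤ ‖x - y‖ := by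
  simpa using abs_apply_le_norm (x - y) e

namespace StripData

variable {e : Fin n} {Ω : Set (Eu n)} {δ : ℝ} {w : Eu n → ℝ}

lemma cutStrip_contDiffOn (h : StripData e Ω δ w) : ContDiffOn ℝ 2 (cutStrip e δ w) (ball 0 1) := by
  intro x hx
  refine ContDiffAt.contDiffWithinAt ?_
  have hcont : Continuous fun y : Eu n => y e := (contDiff_coord e (m := 2)).continuous
  by_cases h1 : x e < 2 * δ
  · refine (contDiffAt_const (c := (0 : ℝ))).congr_of_eventuallyEq ?_
    filter_upwards [hcont.continuousAt.eventually (gt_mem_nhds h1)] with y hy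
    exact cutStrip_eq_zero h.pos w hy.le
  · have hxΩ : x ∈ Ω := h.upper x hx (by linarith [h.pos])
    refine ContDiffAt.mul ?_ (h.harm.contDiffAt (h.isOpen.inter isOpen_ball) ⟨hxΩ, hx⟩)
    exact ((stepFn_contDiff.of_le two_le_infty).comp
      (contDiff_const.mul (contDiff_coord e))).contDiffAt

lemma lapl_cutStrip_eq_zero (h : StripData e Ω δ w) {x : Eu n} (hx : x ∈ ball (0 : Eu n) 1)
    (hx' : ¬(2 * δ ≤ x e ∧ x e ≤ 4 * δ)) : lapl (cutStrip e δ w) x = 0 := by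
  have hcont : Continuous fun y : Eu n => y e := (contDiff_coord e (m := 2)).continuous
  by_cases h1 : x e < 2 * δ
  · rw [(lapl_congr_nhds (v := fun _ => (0 : ℝ)) ?_).eq_of_nhds, lapl_const]
    filter_upwards [hcont.continuousAt.eventually (gt_mem_nhds h1)] with y hy
    exact cutStrip_eq_zero h.pos w hy.le
  · have h2 : 4 * δ < x e := by
      by_contra! h3; exact hx' ⟨not_lt.1 h1, h3⟩
    rw [(lapl_congr_nhds (v := w) ?_).eq_of_nhds,
      h.harm.2 x ⟨h.upper x hx (by linarith [h.pos]), hx⟩]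
    filter_upwards [hcont.continuousAt.eventually (lt_mem_nhds h2)] with y hy
    exact cutStrip_eq h.pos w hy.le

end StripData

lemma lapl_cutStrip_bound (hn : 2 < n) (e : Fin n) : ∃ A B : ℝ, 1 ≤ A ∧ 0 < B ∧
    ∀ (Ω : Set (Eu n)) (δ : ℝ) (w : Eu n → ℝ), StripData e Ω δ w →
      (∀ x ∈ Ω ∩ ball 0 (1 / 2), |w x| ≤ A * (x e + 2 * δ)) ∧
      ∀ x ∈ ball (0 : Eu n) (1 / 4), |lapl (cutStrip e δ w) x| ≤ B / δ := by
  obtain ⟨A, hA, h⟩ := barrier_bound hn e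
  obtain ⟨S, hS, hS'⟩ := stepFn_bounds
  obtain ⟨C, hC, hC'⟩ := interior_estimate hn 1
  refine ⟨A, 4 * (A * C * S) + A * S, hA, by positivity, fun Ω δ w hd => ?_⟩
  have hδ := hd.pos
  have hw : ∀ x ∈ Ω ∩ ball 0 (1 / 2), |w x| ≤ A * (x e + 2 * δ) := by
    intro x hx
    have := h Ω δ δ w hd.isOpen hδ hd.lt hδ.le hd.lower hd.harm hd.bound hd.bdry x hx
    nlinarith
  refine ⟨hw, fun x hx => ?_⟩
  have hx1 : x ∈ ball (0 : Eu n) 1 := ball_subset_ball (by norm_num) hx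
  by_cases hx2 : 2 * δ ≤ x e ∧ x e ≤ 4 * δ
  · obtain ⟨ha, hb⟩ := hx2
    have hsub : ball x δ ⊆ Ω ∩ ball 0 (1 / 2) := by
      intro y hy
      have h1 : y ∈ ball (0 : Eu n) (1 / 2) := by
        have h2 := dist_triangle y x 0
        have h3 := mem_ball.1 hy
        have h4 := mem_ball.1 hx
        have h5 := hd.lt
        rw [mem_ball]; linarith
      refine ⟨hd.upper y (ball_subset_ball (by norm_num) h1) ?_, h1⟩
      have h2 := abs_coord_sub_le e y x
      rw [← dist_eq_norm] at h2
      have h3 := mem_ball.1 hy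
      have h4 := neg_abs_le (y e - x e)
      linarith
    have hxs := hsub (mem_ball_self hδ)
    have hsub1 : ball x δ ⊆ Ω ∩ ball 0 1 :=
      hsub.trans (inter_subset_inter_right _ (ball_subset_ball (by norm_num)))
    have hcd := hd.harm.contDiffAt (hd.isOpen.inter isOpen_ball) (hsub1 (mem_ball_self hδ))
    have hg : |pd e w x| ≤ C * (7 * A * δ) * δ⁻¹ ^ 1 := by
      have h1 := hC' w x δ (7 * A * δ) hδ (hd.harm.mono hsub1) fun y hy => by
        refine (hw y (hsub hy)).trans ?_
        have h2 := abs_coord_sub_le e y x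
        rw [← dist_eq_norm] at h2
        have h3 := mem_ball.1 hy
        have h4 := le_abs_self (y e - x e)
        have h5 : y e + 2 * δ ≤ 7 * δ := by linarith
        nlinarith
      exact (abs_pdMulti_le [e] (hcd.of_le (by norm_num))).trans h1
    have hg' : |pd e w x| ≤ 7 * A * C := by
      refine hg.trans (le_of_eq ?_); field_simp
    have hwx : |w x| ≤ 6 * A * δ := by
      refine (hw x hxs).trans ?_; nlinarith
    have hZ : ContDiff ℝ 2 fun y : Eu n => stepFn ((4 * δ)⁻¹ * y e) :=
      (stepFn_contDiff.of_le two_le_infty).comp (contDiff_const.mul (contDiff_coord e))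
    have e1 : lapl (cutStrip e δ w) x = 2 * ((4 * δ)⁻¹ * deriv stepFn ((4 * δ)⁻¹ * x e) * pd e w x)
        + w x * ((4 * δ)⁻¹ ^ 2 * deriv (deriv stepFn) ((4 * δ)⁻¹ * x e)) := by
      rw [show cutStrip e δ w = fun y => stepFn ((4 * δ)⁻¹ * y e) * w y from rfl,
        lapl_mul hZ.contDiffAt hcd, hd.harm.2 x (hsub1 (mem_ball_self hδ)),
        lapl_comp_coord (stepFn_contDiff.of_le two_le_infty)]
      have : ∀ i, pd i (fun y : Eu n => stepFn ((4 * δ)⁻¹ * y e)) x =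
          if i = e then (4 * δ)⁻¹ * deriv stepFn ((4 * δ)⁻¹ * x e) else 0 := fun i =>
        congrFun (pd_comp_coord (stepFn_contDiff.differentiable (by simp)) e i _) x
      simp only [this, ite_mul, zero_mul, Finset.sum_ite_eq', Finset.mem_univ, if_true]
      ring
    obtain ⟨hs1, hs2⟩ := hS' ((4 * δ)⁻¹ * x e)
    rw [e1]
    calc _ ≤ 2 * ((4 * δ)⁻¹ * S * (7 * A * C)) + 6 * A * δ * ((4 * δ)⁻¹ ^ 2 * S) := by
          refine (abs_add_le _ _).trans (add_le_add ?_ ?_)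
          · rw [abs_mul, abs_mul, abs_mul, abs_two, abs_of_pos (by positivity : 0 < (4 * δ)⁻¹)]
            gcongr
          · rw [abs_mul, abs_mul, abs_of_pos (by positivity : 0 < (4 * δ)⁻¹ ^ 2)]
            gcongr
      _ = (7 / 2 * (A * C * S) + 3 / 8 * (A * S)) / δ := by field_simp; ring
      _ ≤ _ := by
          refine div_le_div_of_nonneg_right ?_ hδ.le
          have : 0 < A * C * S := by positivity
          have : 0 < A * S := by positivity
          linarith
  · rw [hd.lapl_cutStrip_eq_zero hx1 hx2, abs_zero]; positivity

lemma ContDiffOn.continuousOn_lapl {u : Eu n → ℝ} {Ω : Set (Eu n)} (hΩ : IsOpen Ω)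
    (hu : ContDiffOn ℝ 2 u Ω) : ContinuousOn (_root_.lapl u) Ω := by
  have hpu : ∀ i, ContDiffOn ℝ 1 (_root_.pd i u) Ω := fun i =>
    (hu.fderiv_of_isOpen hΩ (by norm_num)).clm_apply contDiffOn_const
  have hpu2 : ∀ i, ContinuousOn (pd2 i i u) Ω := fun i =>
    ((hpu i).continuousOn_fderiv_of_isOpen hΩ le_rfl).clm_apply continuousOn_const
  exact continuousOn_finsetSum _ fun i _ => hpu2 i

/-- A thin box containing the part of a strip in a small ball. -/
def slabBox (e : Fin n) (δ : ℝ) : Set (Eu n) :=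
  (@WithLp.ofLp 2 (Fin n → ℝ)) ⁻¹' Icc (fun i => if i = e then 2 * δ else -(1 / 4))
    (fun i => if i = e then 4 * δ else 1 / 4)

lemma volume_slabBox_le (e : Fin n) {δ : ℝ} (hδ : 0 < δ) :
    (volume (slabBox e δ)).toReal ≤ 2 * δ ∧ volume (slabBox e δ) ≠ ⊤ ∧
      MeasurableSet (slabBox e δ) := by
  have hm : MeasurableSet (slabBox e δ) :=
    (PiLp.volume_preserving_ofLp (Fin n)).measurable measurableSet_Icc
  have h1 : volume (slabBox e δ) = _ :=
    (PiLp.volume_preserving_ofLp (Fin n)).measure_preimage measurableSet_Icc.nullMeasurableSet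
  refine ⟨?_, ?_, hm⟩
  · rw [h1, volume_Icc_pi_toReal]
    · have : ∀ i : Fin n, ((if i = e then 4 * δ else 1 / 4) - if i = e then 2 * δ else -(1 / 4) : ℝ)
          = if i = e then 2 * δ else 1 / 2 := fun i => by split_ifs <;> ring
      simp only [this]
      rw [← Finset.mul_prod_erase Finset.univ _ (Finset.mem_univ e), if_pos rfl]
      refine mul_le_of_le_one_right (by positivity) ?_
      refine Finset.prod_le_one (fun i _ => ?_) fun i hi => ?_
      · split_ifs <;> positivity
      · rw [if_neg (Finset.ne_of_mem_erase hi)]; norm_num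
    · intro i; dsimp only; split_ifs
      · linarith
      · norm_num
  · rw [h1]; exact isCompact_Icc.measure_ne_top

/-- The odd reflection of the cut-off function. -/
def oddCut (e : Fin n) (δ : ℝ) (w : Eu n → ℝ) (x : Eu n) : ℝ :=
  cutStrip e δ w x - cutStrip e δ w (mirror e x)

lemma oddCut_mirror (e : Fin n) (δ : ℝ) (w : Eu n → ℝ) (x : Eu n) :
    oddCut e δ w (mirror e x) = - oddCut e δ w x := by
  simp [oddCut, mirror_mirror]

lemma mirror_mem_ball (e : Fin n) {x : Eu n} {r : ℝ} :
    mirror e x ∈ ball (0 : Eu n) r ↔ x ∈ ball (0 : Eu n) r := by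
  simp

lemma measurePreserving_mirror (e : Fin n) :
    MeasurePreserving (mirror e) (volume : Measure (Eu n)) volume :=
  (mirror e).measurePreserving

lemma integral_comp_mirror (e : Fin n) (g : Eu n → ℝ) : ∫ x, g (mirror e x) = ∫ x, g x :=
  (measurePreserving_mirror e).integral_comp
    (mirror e).toHomeomorph.measurableEmbedding g

namespace StripData

variable {e : Fin n} {Ω : Set (Eu n)} {δ : ℝ} {w : Eu n → ℝ}

lemma oddCut_contDiffOn (h : StripData e Ω δ w) : ContDiffOn ℝ 2 (oddCut e δ w) (ball 0 1) :=
  h.cutStrip_contDiffOn.sub (h.cutStrip_contDiffOn.comp (mirror e).contDiff.contDiffOn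
    fun _ hx => (mirror_mem_ball e).2 hx)

lemma lapl_oddCut (h : StripData e Ω δ w) {x : Eu n} (hx : x ∈ ball (0 : Eu n) 1) :
    lapl (oddCut e δ w) x =
      lapl (cutStrip e δ w) x - lapl (cutStrip e δ w) (mirror e x) := by
  have h1 : ∀ y ∈ ball (0 : Eu n) 1, ContDiffAt ℝ 2 (cutStrip e δ w) y := fun y hy =>
    h.cutStrip_contDiffOn.contDiffAt (isOpen_ball.mem_nhds hy)
  have h2 := h1 _ ((mirror_mem_ball e).2 hx)
  rw [show oddCut e δ w = fun y => cutStrip e δ w y - cutStrip e δ w (mirror e y) from rfl,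
    lapl_sub (v := fun y => cutStrip e δ w (mirror e y)) (h1 x hx)
      (h2.comp x (mirror e).contDiff.contDiffAt)]
  have := lapl_comp_similarity (u := cutStrip e δ w) (mirror e) 0 1 (x := x) (by simpa using h2)
  simp only [zero_add, one_smul, one_pow, one_mul] at this
  rw [← this]

end StripData

/-- The odd reflection is almost weakly harmonic. -/
lemma oddCut_almost_harmonic (hn : 2 < n) (e : Fin n) : ∃ A B : ℝ, 1 ≤ A ∧ 0 < B ∧
    ∀ (Ω : Set (Eu n)) (δ : ℝ) (w : Eu n → ℝ), StripData e Ω δ w →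
      (∀ x ∈ Ω ∩ ball 0 (1 / 2), |w x| ≤ A * (x e + 2 * δ)) ∧
      ∀ (φ : Eu n → ℝ) (K : ℝ), ContDiff ℝ ∞ φ → HasCompactSupport φ →
        tsupport φ ⊆ ball 0 (1 / 4) → (∀ x y, |φ x - φ y| ≤ K * ‖x - y‖) →
        |∫ x, oddCut e δ w x * lapl φ x| ≤ B * K * δ := by
  obtain ⟨A, B, hA, hB, h⟩ := lapl_cutStrip_bound hn e
  refine ⟨A, 16 * B, hA, by positivity, fun Ω δ w hd => ?_⟩
  obtain ⟨h1, h2⟩ := h Ω δ w hd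
  refine ⟨h1, fun φ K hφ hc hs hK => ?_⟩
  have hδ := hd.pos
  have hK0 : 0 ≤ K := by
    have := (abs_nonneg _).trans (hK (stdE e) 0)
    rwa [sub_zero, norm_stdE, mul_one] at this
  set F := cutStrip e δ w
  have hs1 : tsupport φ ⊆ ball 0 1 := hs.trans (ball_subset_ball (by norm_num))
  have hlF : ContinuousOn (lapl F) (ball 0 1) :=
    hd.cutStrip_contDiffOn.continuousOn_lapl isOpen_ball
  set ψ : Eu n → ℝ := fun x => φ (mirror e x) with hψ
  have hψd : ContDiff ℝ ∞ ψ := hφ.comp (mirror e).contDiff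
  have hψc : HasCompactSupport ψ := hc.comp_homeomorph (mirror e).toHomeomorph
  have hψs : tsupport ψ ⊆ ball 0 1 := by
    have : tsupport ψ ⊆ (mirror e) ⁻¹' tsupport φ :=
      closure_minimal (fun x hx => subset_tsupport _ hx)
        ((isClosed_tsupport φ).preimage (mirror e).continuous)
    exact fun x hx => (mirror_mem_ball e).1 (hs1 (this hx))
  have i1 := integrable_mul_of_tsupport isOpen_ball hlF hφ.continuous hc hs1
  have i2 := integrable_mul_of_tsupport isOpen_ball hlF hψd.continuous hψc hψs
  have hz : ∀ x ∉ ball (0 : Eu n) (1 / 4), φ x = 0 := fun x hx =>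
    image_eq_zero_of_notMem_tsupport fun h => hx (hs h)
  have e1 : ∫ x, oddCut e δ w x * lapl φ x = ∫ x, lapl F x * (φ x - ψ x) := by
    rw [integral_mul_lapl isOpen_ball hd.oddCut_contDiffOn hφ hc hs1]
    have : ∀ x, lapl (oddCut e δ w) x * φ x =
        lapl F x * φ x - lapl F (mirror e x) * ψ (mirror e x) := by
      intro x
      by_cases hx : x ∈ ball (0 : Eu n) 1
      · rw [hd.lapl_oddCut hx, hψ]; simp only [mirror_mirror]; ring
      · have : φ x = 0 := image_eq_zero_of_notMem_tsupport fun h => hx (hs1 h)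
        simp [hψ, mirror_mirror, this]
    simp only [this]
    have i3 : Integrable fun x => lapl F (mirror e x) * ψ (mirror e x) :=
      (measurePreserving_mirror e).integrable_comp_of_integrable i2
    rw [integral_sub i1 i3,
      integral_comp_mirror e fun x => lapl F x * ψ x, ← integral_sub i1 i2]
    simp only [mul_sub]
  obtain ⟨hv, hv', hvm⟩ := volume_slabBox_le e hδ
  have e2 : ∀ x, ‖lapl F x * (φ x - ψ x)‖ ≤ (slabBox e δ).indicator (fun _ => 8 * B * K) x := by
    intro x
    by_cases hx : x ∈ ball (0 : Eu n) (1 / 4)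
    · by_cases hx2 : 2 * δ ≤ x e ∧ x e ≤ 4 * δ
      · have hxb : x ∈ slabBox e δ := by
          have hc : ∀ i, |x i| ≤ 1 / 4 := fun i =>
            (abs_apply_le_norm x i).trans (mem_ball_zero_iff.1 hx).le
          constructor
          · intro i
            dsimp only
            split_ifs with hi
            · subst hi; exact hx2.1
            · exact (abs_le.1 (hc i)).1
          · intro i
            dsimp only
            split_ifs with hi
            · subst hi; exact hx2.2
            · exact (abs_le.1 (hc i)).2
        rw [indicator_of_mem hxb, norm_mul, Real.norm_eq_abs, Real.norm_eq_abs]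
        have h3 : |φ x - ψ x| ≤ K * (8 * δ) := by
          refine (hK _ _).trans (mul_le_mul_of_nonneg_left ?_ hK0)
          rw [norm_sub_mirror, abs_of_nonneg (by linarith)]; linarith
        calc _ ≤ B / δ * (K * (8 * δ)) := mul_le_mul (h2 x hx) h3 (abs_nonneg _) (by positivity)
          _ = 8 * B * K := by field_simp
      · rw [hd.lapl_cutStrip_eq_zero (ball_subset_ball (by norm_num) hx) hx2, zero_mul, norm_zero]
        exact indicator_nonneg (fun _ _ => by positivity) _
    · rw [hψ]; dsimp only
      rw [hz x hx, hz _ (fun h => hx ((mirror_mem_ball e).1 h)), sub_zero, mul_zero, norm_zero]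
      exact indicator_nonneg (fun _ _ => by positivity) _
  have e3 := norm_integral_le_of_norm_le
    ((integrable_indicator_iff hvm).2 (integrableOn_const (C := 8 * B * K) hv')) (ae_of_all _ e2)
  rw [integral_indicator hvm, setIntegral_const, smul_eq_mul] at e3
  rw [e1]
  refine e3.trans ?_
  calc _ ≤ 2 * δ * (8 * B * K) := mul_le_mul_of_nonneg_right hv (by positivity)
    _ = _ := by ring

lemma exists_lipschitz_bound {φ : Eu n → ℝ} (hφ : ContDiff ℝ ∞ φ) (hc : HasCompactSupport φ) :
    ∃ K : ℝ, ∀ x y, |φ x - φ y| ≤ K * ‖x - y‖ := by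
  obtain ⟨K, hK⟩ := ContDiff.lipschitzWith_of_hasCompactSupport hc
    (n := 1) (hφ.of_le (mod_cast le_top)) (by simp)
  refine ⟨K, fun x y => ?_⟩
  have := hK.dist_le_mul x y
  rwa [Real.dist_eq, dist_eq_norm] at this

namespace StripData

variable {e : Fin n} {Ω : Set (Eu n)} {δ : ℝ} {w : Eu n → ℝ}

lemma abs_cutStrip_le_of (h : StripData e Ω δ w) {x : Eu n} {b : ℝ} (hx : x ∈ ball (0 : Eu n) 1)
    (hb : 0 ≤ b) (h' : x ∈ Ω → |w x| ≤ b) : |cutStrip e δ w x| ≤ b := by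
  by_cases h1 : x e ≤ 2 * δ
  · rw [cutStrip_eq_zero h.pos w h1, abs_zero]; exact hb
  · exact (abs_cutStrip_le e δ w x).trans (h' (h.upper x hx (by linarith [h.pos])))

lemma abs_oddCut_le_two (h : StripData e Ω δ w) {x : Eu n} (hx : x ∈ ball (0 : Eu n) 1) :
    |oddCut e δ w x| ≤ 2 := by
  have h1 := h.abs_cutStrip_le_of hx zero_le_one fun hΩ => h.bound x ⟨hΩ, hx⟩
  have hx' := (mirror_mem_ball e).2 hx
  have h2 := h.abs_cutStrip_le_of hx' zero_le_one fun hΩ => h.bound _ ⟨hΩ, hx'⟩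
  refine (abs_sub _ _).trans ?_
  linarith

lemma abs_oddCut_le (h : StripData e Ω δ w) {A : ℝ} (hA : 1 ≤ A)
    (hw : ∀ x ∈ Ω ∩ ball 0 (1 / 2), |w x| ≤ A * (x e + 2 * δ)) {x : Eu n}
    (hx : x ∈ ball (0 : Eu n) (1 / 2)) : |oddCut e δ w x| ≤ 2 * A * (|x e| + 2 * δ) := by
  have hδ := h.pos
  have h1 : |cutStrip e δ w x| ≤ A * (|x e| + 2 * δ) :=
    h.abs_cutStrip_le_of (ball_subset_ball (by norm_num) hx) (by positivity) fun hΩ => by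
      refine (hw x ⟨hΩ, hx⟩).trans ?_
      gcongr
      exact le_abs_self _
  have hx' := (mirror_mem_ball e).2 hx
  have h2 : |cutStrip e δ w (mirror e x)| ≤ A * (|x e| + 2 * δ) :=
    h.abs_cutStrip_le_of (ball_subset_ball (by norm_num) hx') (by positivity) fun hΩ => by
      refine (hw _ ⟨hΩ, hx'⟩).trans ?_
      gcongr
      rw [mirror_apply_self]
      exact neg_le_abs _
  refine (abs_sub _ _).trans ?_
  linarith

end StripData

/-- Approximation of almost-flat boundary solutions by smooth odd functions that are harmonic to
high order at the origin. -/
lemma odd_approx (hn : 2 < n) (e : Fin n) (k : ℕ) : ∃ C : ℝ, 0 < C ∧ ∀ κ : ℝ, 0 < κ →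
    ∃ δ₀ : ℝ, 0 < δ₀ ∧ δ₀ < 1 / 8 ∧ ∀ (Ω : Set (Eu n)) (w : Eu n → ℝ), StripData e Ω δ₀ w →
      ∃ h : Eu n → ℝ, ContDiff ℝ ∞ h ∧ (∀ x, h (mirror e x) = - h x) ∧
        (∀ x, ∀ m ≤ k + 1, ‖iteratedFDeriv ℝ m h x‖ ≤ C) ∧
        (∀ x ∈ Ω ∩ ball 0 (1 / 8), |w x - h x| ≤ κ) ∧
        ∀ L : List (Fin n), L.length ≤ k → |lapl (pdMulti L h) 0| ≤ κ := by
  obtain ⟨η, hη⟩ := exists_kernel hn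
  obtain ⟨A, B, hA, hB, hAB⟩ := oddCut_almost_harmonic hn e
  have h8 : (0 : ℝ) < 1 / 8 := by norm_num
  set g : Eu n → ℝ := dil η (1 / 8) with hg
  have hgs : ContDiff ℝ ∞ g := contDiff_dil hη.smooth _
  have hgc : HasCompactSupport g := hη.dil_hasCompactSupport h8
  have hg0 : ∀ L x, 1 / 8 ≤ ‖x‖ → pdMulti L g x = 0 := by
    intro L x hx
    have h1 : tsupport (pdMulti L g) ⊆ closedBall 0 (1 / 8) :=
      (tsupport_pdMulti_subset L g).trans (closure_minimal (fun y hy => by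
        rw [mem_closedBall_zero_iff]
        by_contra! h; exact hy (hη.dil_eq_zero h8 h.le)) isClosed_closedBall)
    have h2 : ∀ x, 1 / 8 < ‖x‖ → pdMulti L g x = 0 := fun x hx =>
      image_eq_zero_of_notMem_tsupport fun h => by
        have := mem_closedBall_zero_iff.1 (h1 h); linarith
    have hcl : IsClosed {x : Eu n | pdMulti L g x = 0} :=
      isClosed_eq (hgs.pdMulti_top L).continuous continuous_const
    have : x ∈ closure ((ball (0 : Eu n) (1 / 8))ᶜ ∩ {x | 1 / 8 < ‖x‖}) := by
      have hx0 : x ≠ 0 := by rintro rfl; rw [norm_zero] at hx; linarith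
      have hl : Filter.Tendsto (fun t : ℝ => (1 + t) • x) (𝓝[>] 0) (𝓝 x) := by
        have : Filter.Tendsto (fun t : ℝ => (1 + t) • x) (𝓝 0) (𝓝 ((1 + 0 : ℝ) • x)) :=
          Continuous.tendsto (by fun_prop) 0
        rw [add_zero, one_smul] at this
        exact this.mono_left nhdsWithin_le_nhds
      refine mem_closure_of_tendsto hl ?_
      filter_upwards [self_mem_nhdsWithin] with t ht
      have ht' : (0 : ℝ) < t := ht
      have h3 : 1 / 8 < ‖(1 + t) • x‖ := by
        rw [norm_smul, Real.norm_of_nonneg (by linarith)]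
        nlinarith
      exact ⟨by simpa using h3.le, h3⟩
    exact closure_minimal (fun y hy => h2 y hy.2) hcl this
  have hgLc : ∀ L, HasCompactSupport (pdMulti L g) := fun L =>
    hgc.mono' ((subset_tsupport _).trans (tsupport_pdMulti_subset L g))
  obtain ⟨K₃, hK₃⟩ := ((List.finite_length_le (Fin n) (k + 1)).image
    fun L => ∫ x, |pdMulti L g x|).bddAbove
  have hK₃' : ∀ L : List (Fin n), L.length ≤ k + 1 → ∫ x, |pdMulti L g x| ≤ K₃ := fun L hL =>
    hK₃ (mem_image_of_mem _ hL)
  have hK₃0 : 0 ≤ K₃ := (integral_nonneg fun x => abs_nonneg _).trans (hK₃' [] (by simp))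
  choose KL hKL using fun L => exists_lipschitz_bound (hgs.pdMulti_top L) (hgLc L)
  obtain ⟨K₂, hK₂⟩ := ((List.finite_length_le (Fin n) k).image KL).bddAbove
  have hn1 : (1 : ℝ) ≤ n := by exact_mod_cast (by omega : 1 ≤ n)
  refine ⟨n ^ (k + 1) * (2 * K₃) + 1, by positivity, fun κ hκ => ?_⟩
  set τ : ℝ := min (1 / 8) (κ / (46 * A)) with hτdef
  have hτ : 0 < τ := by positivity
  have hτ8 : τ ≤ 1 / 8 := min_le_left _ _
  have hτκ : 23 * A * τ ≤ κ / 2 := by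
    have : τ ≤ κ / (46 * A) := min_le_right _ _
    rw [le_div_iff₀ (by positivity)] at this
    linarith
  obtain ⟨Ψ, hΨs, hΨ0, hΨl⟩ := hη.diff_eq_lapl (1 / 8) τ h8 hτ
  rw [max_eq_left hτ8] at hΨ0
  have hΨc : HasCompactSupport Ψ :=
    HasCompactSupport.intro (isCompact_closedBall (0 : Eu n) (1 / 8)) fun x hx => hΨ0 x (by
      rw [mem_closedBall_zero_iff, not_le] at hx; exact hx.le)
  obtain ⟨K₁, hK₁⟩ := exists_lipschitz_bound hΨs hΨc
  set K : ℝ := max 1 (max K₁ K₂) with hK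
  have hK1 : 1 ≤ K := le_max_left _ _
  refine ⟨min τ (min (1 / 16) (κ / (2 * B * K))), by positivity,
    (min_le_right _ _).trans_lt ((min_le_left _ _).trans_lt (by norm_num)), fun Ω w hd => ?_⟩
  set δ := min τ (min (1 / 16) (κ / (2 * B * K)))
  have hδ := hd.pos
  have hδτ : δ ≤ τ := min_le_left _ _
  have hδκ : B * K * δ ≤ κ / 2 := by
    have : δ ≤ κ / (2 * B * K) := (min_le_right _ _).trans (min_le_right _ _)
    rw [le_div_iff₀ (by positivity)] at this
    linarith
  obtain ⟨hw, htest⟩ := hAB Ω δ w hd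
  set V : Eu n → ℝ := (ball (0 : Eu n) 1).indicator (oddCut e δ w) with hV
  have hVle : ∀ x, |V x| ≤ 2 := by
    intro x
    by_cases hx : x ∈ ball (0 : Eu n) 1
    · rw [hV, indicator_of_mem hx]; exact hd.abs_oddCut_le_two hx
    · rw [hV, indicator_of_notMem hx]; norm_num
  have hVl : LocallyIntegrable V :=
    locallyIntegrable_indicator_of_bound isOpen_ball hd.oddCut_contDiffOn.continuousOn
      fun x hx => hd.abs_oddCut_le_two hx
  have hVodd : ∀ x, V (mirror e x) = - V x := by
    intro x
    by_cases hx : x ∈ ball (0 : Eu n) 1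
    · rw [hV, indicator_of_mem hx, indicator_of_mem ((mirror_mem_ball e).2 hx), oddCut_mirror]
    · rw [hV, indicator_of_notMem hx, indicator_of_notMem (fun h => hx ((mirror_mem_ball e).1 h)),
        neg_zero]
  have hVtest : ∀ (φ : Eu n → ℝ) (x : Eu n), ContDiff ℝ ∞ φ → (∀ y, 1 / 8 ≤ ‖y‖ → φ y = 0) →
      (∀ y z, |φ y - φ z| ≤ K * ‖y - z‖) → x ∈ ball (0 : Eu n) (1 / 8) →
      |∫ y, V y * lapl φ (x - y)| ≤ κ / 2 := by
    intro φ x hφ hφ0 hφK hx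
    have hs0 := tsupport_comp_sub_subset hφ0 x
    have hs : tsupport (fun y => φ (x - y)) ⊆ ball 0 (1 / 4) := by
      refine hs0.trans (closedBall_subset_ball' ?_)
      have := mem_ball.1 hx
      linarith
    have h1 := htest (fun y => φ (x - y)) K (hφ.comp (contDiff_const.sub contDiff_id))
      ((isCompact_closedBall x (1 / 8)).of_isClosed_subset (isClosed_tsupport _) hs0) hs
      fun y z => by
        refine (hφK _ _).trans (le_of_eq ?_)
        rw [sub_sub_sub_cancel_left, norm_sub_rev]
    have h2 : ∀ y, V y * lapl φ (x - y) = oddCut e δ w y * lapl (fun y => φ (x - y)) y := by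
      intro y
      rw [lapl_comp_sub φ (hφ.of_le two_le_infty)]
      by_cases hy : y ∈ ball (0 : Eu n) 1
      · rw [hV, indicator_of_mem hy]
      · have : lapl (fun y => φ (x - y)) y = 0 := image_eq_zero_of_notMem_tsupport fun h =>
          hy (ball_subset_ball (by norm_num) (hs (tsupport_lapl_subset _ h)))
        rw [lapl_comp_sub φ (hφ.of_le two_le_infty)] at this
        rw [this, mul_zero, mul_zero]
    simp only [h2]
    exact h1.trans hδκ
  refine ⟨cv V g, contDiff_cv hVl hgs hgc, fun x => ?_, fun x m hm => ?_, fun x hx => ?_,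
    fun L hL => ?_⟩
  · rw [cv, ← integral_comp_mirror e, cv, ← integral_neg]
    refine integral_congr_ae (ae_of_all _ fun y => ?_)
    have : g (mirror e x - mirror e y) = g (x - y) := by
      rw [← map_sub, hg, dil, dil]
      congr 1
      exact hη.radial _ _ (by rw [norm_smul, norm_smul, LinearIsometryEquiv.norm_map])
    simp only [hVodd, this, neg_mul]
  · refine (norm_iteratedFDeriv_le_of_pdMulti (B := 2 * K₃)
      ((contDiff_cv hVl hgs hgc).contDiffAt.of_le (by exact_mod_cast le_top))
      fun L hL => ?_).trans ?_
    · rw [pdMulti_cv hVl hgs hgc, cv]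
      have hi : Integrable fun y => |pdMulti L g y| :=
        ((hgs.pdMulti_top L).continuous.integrable_of_hasCompactSupport (hgLc L)).abs
      have h1 := norm_integral_le_of_norm_le (f := fun y => V y * pdMulti L g (x - y))
        ((hi.comp_sub_left x).const_mul 2) (ae_of_all _ fun y => by
          rw [norm_mul]
          exact mul_le_mul_of_nonneg_right (hVle y) (abs_nonneg _))
      rw [integral_const_mul, integral_sub_left_eq_self (fun y => |pdMulti L g y|)] at h1
      have := hK₃' L (hL.trans_le hm)
      rw [Real.norm_eq_abs] at h1
      linarith
    · have : (n : ℝ) ^ m * (2 * K₃) ≤ n ^ (k + 1) * (2 * K₃) := by gcongr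
      linarith
  · have hx8 := mem_ball_zero_iff.1 hx.2
    have hxs := hd.lower x ⟨hx.1, ball_subset_ball (by norm_num) hx.2⟩
    have i1 := integrable_cv hVl hgs.continuous hgc x
    have i2 := integrable_cv hVl (contDiff_dil hη.smooth τ).continuous
      (hη.dil_hasCompactSupport hτ) x
    have h1 := hVtest Ψ x hΨs hΨ0 (fun y z => (hK₁ y z).trans (by
      gcongr; exact (le_max_left _ _).trans (le_max_right _ _))) hx.2
    simp only [hΨl, mul_sub] at h1
    rw [integral_sub i1 i2] at h1
    have h2 : |w x - ∫ y, V y * dil η τ (x - y)| ≤ κ / 2 := by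
      by_cases hxe : 4 * δ + τ < x e
      · have hnear : ∀ y, dist y x ≤ τ → 4 * δ < y e ∧ y ∈ ball (0 : Eu n) 1 ∧ y ∈ Ω := by
          intro y hy
          have h3 := abs_coord_sub_le e y x
          rw [← dist_eq_norm] at h3
          have h4 := neg_abs_le (y e - x e)
          have h5 : y ∈ ball (0 : Eu n) 1 := by
            have h6 := dist_triangle y x 0
            rw [dist_zero_right x] at h6
            rw [mem_ball]; linarith
          exact ⟨by linarith, h5, hd.upper y h5 (by linarith)⟩
        have h3 := ((hd.harm).weaklyHarmonicOn (hd.isOpen.inter isOpen_ball)).eq_integral hη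
          (hd.isOpen.inter isOpen_ball) hd.harm.1.continuousOn (x := x) hτ
          (fun y hy => ⟨(hnear y hy).2.2, (hnear y hy).2.1⟩)
        have h4 : ∀ y, w y * dil η τ (x - y) = V y * dil η τ (x - y) := by
          intro y
          by_cases hy : ‖x - y‖ < τ
          · rw [norm_sub_rev, ← dist_eq_norm] at hy
            obtain ⟨ha, hb, -⟩ := hnear y hy.le
            rw [hV, indicator_of_mem hb, oddCut, cutStrip_eq hδ w ha.le,
              cutStrip_eq_zero hδ w (x := mirror e y), sub_zero]
            rw [mirror_apply_self]; linarith
          · rw [hη.dil_eq_zero hτ (not_lt.1 hy), mul_zero, mul_zero]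
        simp only [h4] at h3
        rw [← h3, sub_self, abs_zero]; positivity
      · rw [not_lt] at hxe
        have h3 : |w x| ≤ 7 * A * τ := by
          refine (hw x ⟨hx.1, ball_subset_ball (by norm_num) hx.2⟩).trans ?_
          have : x e + 2 * δ ≤ 7 * τ := by linarith
          nlinarith
        have h4 := hη.abs_integral_mul_dil_sub_le hτ (c := 0) (ε := 16 * A * τ) i2 fun y hy => by
          have hy' := hy
          rw [norm_sub_rev, ← dist_eq_norm] at hy'
          have h5 : y ∈ ball (0 : Eu n) (1 / 2) := by
            have h6 := dist_triangle y x 0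
            rw [dist_zero_right x] at h6
            rw [mem_ball]; linarith
          rw [sub_zero, hV, indicator_of_mem (ball_subset_ball (by norm_num) h5)]
          refine (hd.abs_oddCut_le hA hw h5).trans ?_
          have h6 := abs_coord_sub_le e y x
          rw [← dist_eq_norm] at h6
          have h7 : |y e| ≤ 6 * τ := by
            rw [abs_le] at h6 ⊢
            constructor <;> linarith
          nlinarith
        rw [sub_zero] at h4
        refine (abs_sub _ _).trans ?_
        linarith
    calc |w x - cv V g x| = |(w x - ∫ y, V y * dil η τ (x - y)) -
          ((∫ y, V y * g (x - y)) - ∫ y, V y * dil η τ (x - y))| := by rw [cv]; congr 1; ring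
      _ ≤ κ / 2 + κ / 2 := (abs_sub _ _).trans (add_le_add h2 h1)
      _ = κ := by ring
  · rw [pdMulti_cv hVl hgs hgc, lapl_cv hVl (hgs.pdMulti_top L) (hgLc L), cv]
    refine (hVtest (pdMulti L g) 0 (hgs.pdMulti_top L) (hg0 L) (fun y z => (hKL L y z).trans ?_)
      (mem_ball_self h8)).trans (by linarith)
    gcongr
    exact (hK₂ (mem_image_of_mem _ hL)).trans ((le_max_right _ _).trans (le_max_right _ _))

namespace Pol
open MvPolynomial

lemma mem_multiIdxLE {k : ℕ} {α : Fin n → ℕ} : α ∈ multiIdxLE n k ↔ multiDeg α ≤ k := by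
  simp only [multiIdxLE, Finset.mem_filter, Fintype.mem_piFinset, Finset.mem_range,
    and_iff_right_iff_imp]
  intro h i
  exact Nat.lt_succ_iff.2 ((Finset.single_le_sum (f := α) (fun _ _ => Nat.zero_le _)
    (Finset.mem_univ i)).trans h)

/-- The coefficient of `x ^ α` in the Taylor polynomial of `h` at the origin. -/
def jetCoeff (h : Eu n → ℝ) (α : Fin n → ℕ) : ℝ := (multiFact α : ℝ)⁻¹ * pdAlpha α h 0

/-- A multi-index as a finitely supported function. -/
abbrev toFinsupp (α : Fin n → ℕ) : Fin n →₀ ℕ := Finsupp.equivFunOnFinite.symm α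

lemma degree_toFinsupp (α : Fin n → ℕ) : (toFinsupp α).degree = multiDeg α := by
  rw [Finsupp.degree_eq_sum]; rfl

/-- The Taylor polynomial of order `k` of `h` at the origin. -/
def jet (k : ℕ) (h : Eu n → ℝ) : Pol n :=
  ∑ α ∈ multiIdxLE n k, monomial (toFinsupp α) (jetCoeff h α)

lemma ev_jet (k : ℕ) (h : Eu n → ℝ) (x : Eu n) : ev (jet k h) x = tay k h 0 x := by
  rw [jet, ev_sum, tay]
  refine Finset.sum_congr rfl fun α _ => ?_
  rw [ev_monomial]; rfl

lemma coeff_jet (k : ℕ) (h : Eu n → ℝ) (m : Fin n →₀ ℕ) :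
    coeff m (jet k h) = if m.degree ≤ k then jetCoeff h m else 0 := by
  classical
  rw [jet, coeff_sum]
  simp only [coeff_monomial]
  have : ∀ α : Fin n → ℕ, (if toFinsupp α = m then jetCoeff h α else 0) =
      if α = ⇑m then jetCoeff h α else 0 := by
    intro α
    refine if_congr ?_ rfl rfl
    rw [Equiv.symm_apply_eq]; rfl
  simp only [this, Finset.sum_ite_eq', mem_multiIdxLE]
  rw [show multiDeg ⇑m = m.degree by rw [Finsupp.degree_eq_sum]; rfl]

lemma multiFact_add_single (m : Fin n →₀ ℕ) (i : Fin n) :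
    multiFact ((m + Finsupp.single i 1 : Fin n →₀ ℕ) : Fin n → ℕ) = (m i + 1) * multiFact ⇑m := by
  classical
  rw [multiFact, multiFact, ← Finset.mul_prod_erase _ _ (Finset.mem_univ i),
    ← Finset.mul_prod_erase _ (fun j => (m j).factorial) (Finset.mem_univ i), ← mul_assoc]
  congr 1
  · simp [Nat.factorial_succ]
  · refine Finset.prod_congr rfl fun j hj => ?_
    simp [(Finset.ne_of_mem_erase hj).symm]

lemma multiFact_pos (α : Fin n → ℕ) : 0 < multiFact α :=
  Finset.prod_pos fun _ _ => Nat.factorial_pos _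

lemma pdAlpha_add_single {h : Eu n → ℝ} (hh : ContDiff ℝ ∞ h) (m : Fin n →₀ ℕ) (i : Fin n) :
    pdAlpha ((m + Finsupp.single i 1 + Finsupp.single i 1 : Fin n →₀ ℕ) : Fin n → ℕ) h 0 =
      pd2 i i (pdAlpha ⇑m h) 0 := by
  classical
  have : (multiList ((m + Finsupp.single i 1 + Finsupp.single i 1 : Fin n →₀ ℕ) : Fin n → ℕ)).Perm
      (i :: i :: multiList ⇑m) := by
    rw [List.perm_iff_count]
    intro j
    rw [count_multiList, List.count_cons, List.count_cons, count_multiList]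
    by_cases hij : i = j
    · subst hij; simp
    · simp [hij]
  exact pdMulti_perm this (hh.of_le (by exact_mod_cast le_top)).contDiffAt

lemma coeff_plapl_jet {h : Eu n → ℝ} (hh : ContDiff ℝ ∞ h) (k : ℕ) (m : Fin n →₀ ℕ) :
    coeff m (plapl (jet k h)) =
      if m.degree + 2 ≤ k then (multiFact ⇑m : ℝ)⁻¹ * lapl (pdAlpha ⇑m h) 0 else 0 := by
  rw [plapl_apply, coeff_sum]
  simp only [coeff_pderiv, coeff_jet, map_add, Finsupp.degree_single, add_assoc, Nat.reduceAdd]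
  split_ifs with hm
  · rw [lapl, Finset.mul_sum]
    refine Finset.sum_congr rfl fun i _ => ?_
    rw [jetCoeff, ← add_assoc m, pdAlpha_add_single hh, multiFact_add_single,
      multiFact_add_single]
    have h0 : (multiFact ⇑m : ℝ) ≠ 0 := by exact_mod_cast (multiFact_pos _).ne'
    have h1 : (m i : ℝ) + 1 ≠ 0 := by positivity
    have h2 : (m i : ℝ) + 1 + 1 ≠ 0 := by positivity
    simp only [Finsupp.coe_add, Pi.add_apply, Finsupp.single_eq_same]
    push_cast
    field_simp
  · simp

lemma abs_inv_multiFact_mul_le (α : Fin n → ℕ) (a : ℝ) : |(multiFact α : ℝ)⁻¹ * a| ≤ |a| := by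
  rw [abs_mul, abs_of_nonneg (by positivity)]
  refine mul_le_of_le_one_left (abs_nonneg _) (inv_le_one_of_one_le₀ ?_)
  exact_mod_cast multiFact_pos α

lemma pnorm_plapl_jet_le {h : Eu n → ℝ} (hh : ContDiff ℝ ∞ h) {k : ℕ} {κ : ℝ}
    (hκ : ∀ L : List (Fin n), L.length ≤ k → |lapl (pdMulti L h) 0| ≤ κ) :
    pnorm (plapl (jet k h)) ≤ (multiIdxLE n k).card * κ := by
  classical
  have hsub : (plapl (jet k h)).support ⊆ (multiIdxLE n k).image toFinsupp := by
    intro m hm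
    rw [mem_support_iff, coeff_plapl_jet hh] at hm
    have : m.degree + 2 ≤ k := by by_contra h'; simp [h'] at hm
    refine Finset.mem_image.2 ⟨⇑m, mem_multiIdxLE.2 ?_, ?_⟩
    · rw [multiDeg, ← Finsupp.degree_eq_sum]; omega
    · rw [Equiv.symm_apply_eq]; rfl
  rw [pnorm_eq_sum hsub]
  have hκ0 : 0 ≤ κ := (abs_nonneg _).trans (hκ [] (Nat.zero_le _))
  refine (Finset.sum_le_card_nsmul _ _ κ fun m hm => ?_).trans ?_
  · rw [coeff_plapl_jet hh]
    split_ifs with h'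
    · refine (abs_inv_multiFact_mul_le _ _).trans (hκ _ ?_)
      rw [length_multiList, multiDeg, ← Finsupp.degree_eq_sum]; omega
    · simpa using hκ0
  · rw [nsmul_eq_mul]
    gcongr
    exact Finset.card_image_le

lemma jetCoeff_eq_zero {e : Fin n} {h : Eu n → ℝ} (hodd : ∀ x, h (mirror e x) = - h x)
    {α : Fin n → ℕ} (hα : α e = 0) : jetCoeff h α = 0 := by
  rw [jetCoeff, pdAlpha, pdMulti_zero_of_odd hodd (by rw [count_multiList, hα]; exact Even.zero),
    mul_zero]

lemma abs_jetCoeff_le {h : Eu n → ℝ} (hh : ContDiff ℝ ∞ h) {k : ℕ} {C : ℝ}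
    (hC : ∀ m ≤ k, ‖iteratedFDeriv ℝ m h 0‖ ≤ C) {α : Fin n → ℕ} (hα : α ∈ multiIdxLE n k) :
    |jetCoeff h α| ≤ C := by
  refine (abs_inv_multiFact_mul_le _ _).trans ?_
  refine (abs_pdMulti_le _ (hh.of_le (by exact_mod_cast le_top)).contDiffAt).trans (hC _ ?_)
  rw [length_multiList]; exact mem_multiIdxLE.1 hα

/-- The Taylor polynomial of a function odd in `x e` is divisible by `X e`. -/
lemma exists_jet_eq_X_mul {e : Fin n} {h : Eu n → ℝ} (hh : ContDiff ℝ ∞ h)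
    (hodd : ∀ x, h (mirror e x) = - h x) {k : ℕ} {C : ℝ}
    (hC : ∀ m ≤ k, ‖iteratedFDeriv ℝ m h 0‖ ≤ C) :
    ∃ Q : Pol n, DegIn 0 (k - 1) Q ∧ X e * Q = jet k h ∧
      pnorm Q ≤ (multiIdxLE n k).card * C := by
  refine ⟨∑ α ∈ multiIdxLE n k, monomial (toFinsupp α - Finsupp.single e 1) (jetCoeff h α),
    degIn_sum fun α hα => ?_, ?_, ?_⟩
  · by_cases h0 : α e = 0
    · rw [jetCoeff_eq_zero hodd h0, map_zero]; exact degIn_zero _ _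
    · refine degIn_monomial (Nat.zero_le _) ?_
      have h1 := degree_sub_single (m := toFinsupp α) (i := e) h0
      have h2 := mem_multiIdxLE.1 hα
      rw [degree_toFinsupp] at h1
      omega
  · rw [Finset.mul_sum, jet]
    refine Finset.sum_congr rfl fun α _ => ?_
    by_cases h0 : α e = 0
    · simp [jetCoeff_eq_zero hodd h0]
    · rw [X, monomial_mul, one_mul, add_tsub_cancel_of_le]
      rw [Finsupp.single_le_iff]
      exact Nat.one_le_iff_ne_zero.2 h0
  · refine (pnorm_sum_le _ _).trans ?_
    refine (Finset.sum_le_card_nsmul _ _ C fun α hα => ?_).trans (nsmul_eq_mul _ _).le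
    rw [pnorm_monomial]
    exact abs_jetCoeff_le hh hC hα

end Pol

section

lemma exists_small_scale {C a : ℝ} (hC : 0 < C) (ha : 0 < a) :
    ∃ θ : ℝ, 0 < θ ∧ θ ≤ 1 / 8 ∧ C * θ ^ a ≤ 1 := by
  refine ⟨min (1 / 8) (C⁻¹ ^ a⁻¹), lt_min (by norm_num) (by positivity), min_le_left _ _, ?_⟩
  calc C * min (1 / 8) (C⁻¹ ^ a⁻¹) ^ a ≤ C * (C⁻¹ ^ a⁻¹) ^ a := by
        gcongr
        exact min_le_right _ _
    _ = 1 := by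
        rw [← Real.rpow_mul (by positivity), inv_mul_cancel₀ ha.ne', Real.rpow_one,
          mul_inv_cancel₀ hC.ne']

open MvPolynomial Pol

set_option maxHeartbeats 1000000 in
/-- One step of the approximation by harmonic polynomials vanishing to high order on a curved
boundary. -/
theorem improvement (hn : 2 < n) (e : Fin n) {k : ℕ} (hk : 2 ≤ k) {lam : ℝ} (hlam : lam < k + 1) :
    ∃ θ δ₀ δ₁ C : ℝ, 0 < θ ∧ θ ≤ 1 / 8 ∧ 0 < δ₀ ∧ δ₀ < 1 / 8 ∧ 0 < δ₁ ∧ 0 < C ∧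
      ∀ (Ω : Set (Eu n)) (S : Pol n) (δ : ℝ) (w : Eu n → ℝ), 0 ≤ δ → δ ≤ δ₁ → DegIn 2 k S →
        pnorm S ≤ δ → StripData e Ω δ₀ w →
        (∀ x ∈ frontier Ω ∩ ball 0 1, |x e + ev S x| ≤ δ * ‖x‖ ^ lam) →
        ∃ P : Pol n, DegIn 0 k P ∧ plapl P = 0 ∧ pnorm P ≤ C ∧
          (∀ x ∈ frontier Ω ∩ ball 0 1, |ev P x| ≤ C * δ * ‖x‖ ^ lam) ∧
          ∀ x ∈ Ω ∩ ball 0 θ, |w x - ev P x| ≤ θ ^ lam := by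
  obtain ⟨C₁, hC₁, hodd⟩ := odd_approx hn e k
  obtain ⟨c, hc, hcorr⟩ := exists_correction n e k hk
  set N : ℝ := ((multiIdxLE n k).card : ℝ) with hN
  have hN0 : 0 ≤ N := Nat.cast_nonneg _
  obtain ⟨θ, hθ, hθ8, hθC⟩ := exists_small_scale (C := 3 * C₁) (a := k + 1 - lam) (by positivity)
    (by linarith)
  have hθl : 0 < θ ^ lam := Real.rpow_pos_of_pos hθ _
  have hTay : C₁ * θ ^ (k + 1) ≤ θ ^ lam / 3 := by
    have : θ ^ ((k : ℝ) + 1 - lam) = θ ^ (k + 1) / θ ^ lam := by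
      rw [Real.rpow_sub hθ]; norm_cast
    rw [this, mul_div_assoc', div_le_one hθl] at hθC
    linarith
  set K : ℝ := N * C₁ + c * (N + N * C₁) with hK
  have hK0 : 0 ≤ K := by positivity
  set κ : ℝ := min 1 (θ ^ lam / (3 * (1 + c * N))) with hκ
  have hκ0 : 0 < κ := lt_min one_pos (by positivity)
  have hκ1 : κ ≤ 1 := min_le_left _ _
  have hκ2 : κ * (1 + c * N) ≤ θ ^ lam / 3 := by
    have := min_le_right 1 (θ ^ lam / (3 * (1 + c * N)))
    rw [← hκ, le_div_iff₀ (by positivity)] at this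
    linarith
  obtain ⟨δ₀, hδ₀, hδ₀8, happ⟩ := hodd κ hκ0
  set δ₁ : ℝ := min 1 (θ ^ lam / (3 * (1 + c * (N * C₁) + K))) with hδ₁
  have hδ₁0 : 0 < δ₁ := lt_min one_pos (by positivity)
  refine ⟨θ, δ₀, δ₁, 2 * K + 1, hθ, hθ8, hδ₀, hδ₀8, hδ₁0, by positivity, ?_⟩
  intro Ω S δ w hδ hδle hS hSδ hstrip hbd
  have hδ1 : δ ≤ 1 := hδle.trans (min_le_left _ _)
  have hδ2 : δ * (c * (N * C₁) + K) ≤ θ ^ lam / 3 := by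
    have := hδle.trans (min_le_right 1 (θ ^ lam / (3 * (1 + c * (N * C₁) + K))))
    rw [le_div_iff₀ (by positivity)] at this
    linarith
  obtain ⟨h, hh, hho, hhC, hwh, hhl⟩ := happ Ω w hstrip
  obtain ⟨Q₀, hQ₀, hQ₀e, hQ₀n⟩ := exists_jet_eq_X_mul hh hho (k := k) (C := C₁)
    fun m hm => hhC 0 m (by omega)
  obtain ⟨Q, hQ, hQ0, hQn⟩ := hcorr S δ hS hSδ hδ1 Q₀ hQ₀
  have hT := pnorm_plapl_jet_le hh hhl
  rw [hQ₀e] at hQn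
  have hQd : pnorm (Q - Q₀) ≤ c * (N * κ + δ * (N * C₁)) := hQn.trans (by gcongr)
  have hQK : pnorm Q ≤ K := by
    have h1 : pnorm Q ≤ pnorm (Q - Q₀) + pnorm Q₀ := by
      simpa using pnorm_add_le (Q - Q₀) Q₀
    have h2 : c * (N * κ + δ * (N * C₁)) ≤ c * (N * 1 + 1 * (N * C₁)) := by gcongr
    rw [hK]; linarith
  have hXQ : DegIn 0 k (Q * X e) := (hQ.mul (degIn_X e)).mono (by omega) (by omega)
  set P := trunc k (Q * (X e + S)) with hP
  have hPe : P = Q * X e + trunc k (Q * S) := by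
    rw [hP, mul_add, map_add, hXQ.trunc_eq le_rfl]
  have hQS : pnorm (Q * S) ≤ K * δ :=
    (pnorm_mul_le _ _).trans (mul_le_mul hQK hSδ (pnorm_nonneg _) hK0)
  refine ⟨P, ?_, hQ0, ?_, ?_, ?_⟩
  · rw [hPe]
    exact hXQ.add ((hQ.mul hS).mono (by omega) le_rfl |>.trunc k)
  · rw [hPe]
    refine (pnorm_add_le _ _).trans ?_
    have h1 : pnorm (Q * X e) ≤ K * 1 := (pnorm_mul_le _ _).trans (by rw [pnorm_X]; gcongr)
    have h2 := (pnorm_trunc_le k (Q * S)).trans hQS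
    have h3 : K * δ ≤ K * 1 := by gcongr
    linarith
  · intro x hx
    have hx1 : ‖x‖ ≤ 1 := (mem_ball_zero_iff.1 hx.2).le
    have hrest : DegIn (k + 1) (k - 1 + k) (Q * S - trunc k (Q * S)) :=
      ((hQ.mul hS).mono (Nat.zero_le _) le_rfl).sub_trunc k
    have e1 : ev P x = ev Q x * (x e + ev S x) - ev (Q * S - trunc k (Q * S)) x := by
      rw [hPe, ev_add, ev_sub, ev_mul, ev_mul, ev_X]; ring
    have h1 : |ev Q x| ≤ K := by
      refine (abs_ev_le_pow hQ hx1).trans ?_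
      simpa using hQK
    have h2 : |ev (Q * S - trunc k (Q * S)) x| ≤ K * δ * ‖x‖ ^ (k + 1) := by
      refine (abs_ev_le_pow hrest hx1).trans ?_
      gcongr
      exact (pnorm_sub_trunc_le _ _).trans hQS
    have h3 : ‖x‖ ^ (k + 1) ≤ ‖x‖ ^ lam := by
      rcases (norm_nonneg x).eq_or_lt with h0 | h0
      · rw [← h0, zero_pow (Nat.succ_ne_zero k)]; exact Real.rpow_nonneg le_rfl _
      · rw [← Real.rpow_natCast]
        exact Real.rpow_le_rpow_of_exponent_ge h0 hx1 (by push_cast; exact hlam.le)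
    have h4 : 0 ≤ ‖x‖ ^ lam := Real.rpow_nonneg (norm_nonneg _) _
    rw [e1]
    calc _ ≤ |ev Q x| * |x e + ev S x| + |ev (Q * S - trunc k (Q * S)) x| := by
          rw [← abs_mul]; exact abs_sub _ _
      _ ≤ K * (δ * ‖x‖ ^ lam) + K * δ * ‖x‖ ^ lam :=
          add_le_add (mul_le_mul h1 (hbd x hx) (abs_nonneg _) hK0)
            (h2.trans (mul_le_mul_of_nonneg_left h3 (by positivity)))
      _ ≤ (2 * K + 1) * δ * ‖x‖ ^ lam := by
          have : 0 ≤ δ * ‖x‖ ^ lam := by positivity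
          linarith
  · intro x hx
    have hxθ : ‖x‖ < θ := mem_ball_zero_iff.1 hx.2
    have hx1 : ‖x‖ ≤ 1 := by linarith
    have h1 : |w x - h x| ≤ κ := hwh x ⟨hx.1, mem_ball_zero_iff.2 (by linarith)⟩
    have h2 : |h x - ev (jet k h) x| ≤ C₁ * θ ^ (k + 1) := by
      have := taylor_le (k := k) (f := h) (x := 0) (h := x) (B := C₁)
        (fun t _ => (hh.of_le (by exact_mod_cast le_top)).contDiffAt)
        (fun t _ => hhC _ _ le_rfl)
      rw [zero_add] at this
      rw [ev_jet]
      exact this.trans (by gcongr)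
    have e1 : ev (jet k h) x - ev P x = - (ev (Q - Q₀) x * x e) - ev (trunc k (Q * S)) x := by
      rw [hPe, ← hQ₀e, ev_add, ev_sub, ev_mul, ev_mul, ev_X]; ring
    have h3 : |ev (Q - Q₀) x| ≤ c * (N * κ + δ * (N * C₁)) := by
      refine (abs_ev_le_pow (hQ.sub hQ₀) hx1).trans ?_
      simpa using hQd
    have h4 : |ev (trunc k (Q * S)) x| ≤ K * δ := by
      have hd : DegIn 0 k (trunc k (Q * S)) := ((hQ.mul hS).mono (Nat.zero_le _) le_rfl).trunc k
      refine (abs_ev_le_pow hd hx1).trans ?_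
      rw [pow_zero, mul_one]
      exact (pnorm_trunc_le k (Q * S)).trans hQS
    have h5 : |x e| ≤ 1 := (abs_apply_le_norm x e).trans hx1
    have h6 : |ev (jet k h) x - ev P x| ≤ c * (N * κ + δ * (N * C₁)) + K * δ := by
      rw [e1]
      refine (abs_sub _ _).trans (add_le_add ?_ h4)
      rw [abs_neg, abs_mul]
      exact (mul_le_of_le_one_right (abs_nonneg _) h5).trans h3
    calc |w x - ev P x| = |(w x - h x) + (h x - ev (jet k h) x) + (ev (jet k h) x - ev P x)| := by
          congr 1; ring
      _ ≤ |w x - h x| + |h x - ev (jet k h) x| + |ev (jet k h) x - ev P x| := abs_add_three _ _ _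
      _ ≤ κ + C₁ * θ ^ (k + 1) + (c * (N * κ + δ * (N * C₁)) + K * δ) := by gcongr
      _ = κ * (1 + c * N) + C₁ * θ ^ (k + 1) + δ * (c * (N * C₁) + K) := by ring
      _ ≤ θ ^ lam := by linarith

end

section

open Pol

lemma preimage_similarity_frontier (L : Eu n ≃ₗᵢ[ℝ] Eu n) (a : Eu n) {r : ℝ} (hr : r ≠ 0)
    (Ω : Set (Eu n)) :
    frontier ((fun y => a + r • L y) ⁻¹' Ω) = (fun y => a + r • L y) ⁻¹' frontier Ω :=
  ((L.toHomeomorph.trans ((Homeomorph.smulOfNeZero r hr).trans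
    (Homeomorph.addLeft a))).preimage_frontier Ω).symm

lemma preimage_smul_frontier {r : ℝ} (hr : r ≠ 0) (Ω : Set (Eu n)) :
    frontier ((fun y => r • y) ⁻¹' Ω) = (fun y => r • y) ⁻¹' frontier Ω :=
  ((Homeomorph.smulOfNeZero r hr).preimage_frontier Ω).symm

lemma IsHarmonicOn.comp_smul {u : Eu n → ℝ} {Ω : Set (Eu n)} (hΩ : IsOpen Ω)
    (hu : IsHarmonicOn u Ω) (r : ℝ) :
    IsHarmonicOn (fun y => u (r • y)) ((fun y => r • y) ⁻¹' Ω) := by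
  simpa using hu.comp_similarity hΩ (LinearIsometryEquiv.refl ℝ (Eu n)) 0 r

/-- Near the origin, `Ω` agrees with `{x | 0 < x e + S x}` up to an error of order `‖x‖ ^ lam`. -/
structure Curved (e : Fin n) (k : ℕ) (lam : ℝ) (Ω : Set (Eu n)) (S : Pol n) (δ : ℝ) : Prop where
  isOpen : IsOpen Ω
  degIn : DegIn 2 k S
  pnorm_le : pnorm S ≤ δ
  upper : ∀ x ∈ ball (0 : Eu n) 1, δ * ‖x‖ ^ lam < x e + ev S x → x ∈ Ω
  lower : ∀ x ∈ Ω ∩ ball 0 1, -(δ * ‖x‖ ^ lam) ≤ x e + ev S x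
  bdry : ∀ x ∈ frontier Ω ∩ ball 0 1, |x e + ev S x| ≤ δ * ‖x‖ ^ lam

namespace Curved

variable {e : Fin n} {k : ℕ} {lam : ℝ} {Ω : Set (Eu n)} {S : Pol n} {δ : ℝ}

lemma nonneg (h : Curved e k lam Ω S δ) : 0 ≤ δ := (pnorm_nonneg S).trans h.pnorm_le

lemma rescale (h : Curved e k lam Ω S δ) (hlam : 2 ≤ lam) {r : ℝ} (hr : 0 < r) (hr1 : r ≤ 1) :
    ∃ S' : Pol n, Curved e k lam ((fun y => r • y) ⁻¹' Ω) S' (δ * r) := by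
  obtain ⟨S', hS', hn', hev⟩ := exists_rescale h.degIn hr hr1
  have hball : ∀ x ∈ ball (0 : Eu n) 1, r • x ∈ ball (0 : Eu n) 1 := by
    intro x hx
    rw [mem_ball_zero_iff] at hx ⊢
    rw [norm_smul, Real.norm_of_nonneg hr.le]
    nlinarith [norm_nonneg x]
  have hpow : ∀ x : Eu n, δ * ‖r • x‖ ^ lam ≤ r * (δ * r * ‖x‖ ^ lam) := by
    intro x
    rw [norm_smul, Real.norm_of_nonneg hr.le, Real.mul_rpow hr.le (norm_nonneg x)]
    have h1 : r ^ lam ≤ r ^ (2 : ℝ) := Real.rpow_le_rpow_of_exponent_ge hr hr1 hlam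
    rw [Real.rpow_two] at h1
    have h2 : 0 ≤ ‖x‖ ^ lam := Real.rpow_nonneg (norm_nonneg x) _
    have := mul_le_mul_of_nonneg_right h1 h2
    have := mul_le_mul_of_nonneg_left this h.nonneg
    linarith
  have hT : ∀ x : Eu n, x e + ev S' x = r⁻¹ * ((r • x) e + ev S (r • x)) := by
    intro x
    rw [hev, PiLp.smul_apply, smul_eq_mul, mul_add, inv_mul_cancel_left₀ hr.ne']
  refine ⟨S', h.isOpen.preimage (continuous_const_smul r), hS', ?_, ?_, ?_, ?_⟩
  · rw [mul_comm]; exact hn'.trans (by gcongr; exact h.pnorm_le)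
  · intro x hx hlt
    rw [hT, lt_inv_mul_iff₀ hr] at hlt
    exact h.upper _ (hball x hx) ((hpow x).trans_lt hlt)
  · rintro x ⟨hxΩ, hx⟩
    have := h.lower _ ⟨hxΩ, hball x hx⟩
    rw [hT, le_inv_mul_iff₀ hr]
    linarith [hpow x]
  · rintro x ⟨hxΩ, hx⟩
    rw [preimage_smul_frontier hr.ne'] at hxΩ
    rw [hT, abs_mul, abs_of_pos (inv_pos.2 hr), inv_mul_le_iff₀ hr]
    exact (h.bdry _ ⟨hxΩ, hball x hx⟩).trans (hpow x)

lemma abs_coord_le (h : Curved e k lam Ω S δ) {x : Eu n} (hx : x ∈ ball (0 : Eu n) 1) :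
    |ev S x| ≤ δ := by
  have hx1 := (mem_ball_zero_iff.1 hx).le
  refine (abs_ev_le_pow h.degIn hx1).trans ?_
  have : ‖x‖ ^ 2 ≤ 1 := pow_le_one₀ (norm_nonneg x) hx1
  have h0 := pnorm_nonneg S
  nlinarith [h.pnorm_le]

lemma stripData (h : Curved e k lam Ω S δ) (hlam : 0 ≤ lam) {δ₀ : ℝ} (hδ : 2 * δ < δ₀)
    (hδ₀ : δ₀ < 1 / 8) {w : Eu n → ℝ} (hw : IsHarmonicOn w (Ω ∩ ball 0 1))
    (hb : ∀ x ∈ Ω ∩ ball 0 1, |w x| ≤ 1)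
    (hbd : ∀ z ∈ frontier Ω ∩ ball 0 1, ∀ᶠ x in 𝓝[Ω] z, |w x| ≤ δ₀) :
    StripData e Ω δ₀ w := by
  have hpow : ∀ x ∈ ball (0 : Eu n) 1, δ * ‖x‖ ^ lam ≤ δ := by
    intro x hx
    exact mul_le_of_le_one_right h.nonneg
      (Real.rpow_le_one (norm_nonneg x) (mem_ball_zero_iff.1 hx).le hlam)
  refine ⟨h.isOpen, by linarith [h.nonneg], hδ₀, ?_, ?_, hw, hb, hbd⟩
  · intro x hx hlt
    refine h.upper x hx ?_
    have := abs_le.1 (h.abs_coord_le hx)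
    linarith [hpow x hx]
  · intro x hx
    have := abs_le.1 (h.abs_coord_le hx.2)
    linarith [hpow x hx.2, h.lower x hx]

end Curved

lemma geom_sum_le_inv {q : ℝ} (hq : 0 ≤ q) (hq1 : q < 1) (j : ℕ) :
    ∑ i ∈ Finset.range j, q ^ i ≤ (1 - q)⁻¹ := by
  rw [← one_div, le_div_iff₀ (by linarith), geom_sum_mul_neg]
  linarith [pow_nonneg hq j]

lemma mul_one_add_div_pow_le {lam : ℝ} {k : ℕ} {r : ℝ} (hr : 0 < r) (hr1 : r ≤ 1) {t : ℝ}
    (ht : 0 ≤ t) : r ^ lam * (1 + r⁻¹ * t) ^ k ≤ r ^ (lam - k) * (1 + t) ^ k := by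
  have h1 : 1 + r⁻¹ * t ≤ r⁻¹ * (1 + t) := by
    have := (one_le_inv₀ hr).2 hr1
    linarith
  calc r ^ lam * (1 + r⁻¹ * t) ^ k ≤ r ^ lam * (r⁻¹ * (1 + t)) ^ k := by gcongr
    _ = r ^ (lam - k) * (1 + t) ^ k := by
        rw [Real.rpow_sub hr, Real.rpow_natCast, mul_pow, inv_pow]; ring

/-- Approximation, at every scale, of a harmonic function vanishing on a curved boundary, by a
harmonic function of polynomial growth on the whole space. -/
theorem Curved.exists_approx (hn : 2 < n) (e : Fin n) {k : ℕ} (hk : 2 ≤ k) {lam : ℝ}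
    (hklam : k < lam) (hlam : lam < k + 1) :
    ∃ δ C : ℝ, 0 < δ ∧ 0 < C ∧ ∀ (Ω : Set (Eu n)) (S : Pol n) (u : Eu n → ℝ),
      Curved e k lam Ω S δ → IsHarmonicOn u (Ω ∩ ball 0 1) → (∀ x ∈ Ω ∩ ball 0 1, |u x| ≤ 1) →
      (∀ z ∈ frontier Ω ∩ ball 0 1, Filter.Tendsto u (𝓝[Ω] z) (𝓝 0)) →
      ∀ ρ : ℝ, 0 < ρ → ρ ≤ 1 → ∃ p : Eu n → ℝ, IsHarmonicOn p univ ∧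
        (∀ x, |p x| ≤ C * (1 + ‖x‖) ^ k) ∧ ∀ x ∈ Ω ∩ ball 0 ρ, |u x - p x| ≤ C * ρ ^ lam := by
  obtain ⟨θ, δ₀, δ₁, C₁, hθ, hθ8, hδ₀, hδ₀8, hδ₁, hC₁, himp⟩ := improvement hn e hk hlam
  have hθ1 : θ < 1 := by linarith
  have h2l : 2 ≤ lam := by have : (2 : ℝ) ≤ k := by exact_mod_cast hk
                           linarith
  set q : ℝ := θ ^ (lam - k) with hq
  have hq0 : 0 < q := Real.rpow_pos_of_pos hθ _
  have hq1 : q < 1 := Real.rpow_lt_one hθ.le hθ1 (by linarith)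
  set δ : ℝ := min δ₁ (δ₀ / (4 * (1 + C₁))) with hδ
  have hδpos : 0 < δ := lt_min hδ₁ (by positivity)
  have hδ4 : δ * (4 * (1 + C₁)) ≤ δ₀ := (le_div_iff₀ (by positivity)).1 (min_le_right _ _)
  have key : ∀ (Ω : Set (Eu n)) (S : Pol n) (u : Eu n → ℝ),
      Curved e k lam Ω S δ → IsHarmonicOn u (Ω ∩ ball 0 1) → (∀ x ∈ Ω ∩ ball 0 1, |u x| ≤ 1) →
      (∀ z ∈ frontier Ω ∩ ball 0 1, Filter.Tendsto u (𝓝[Ω] z) (𝓝 0)) → ∀ j : ℕ,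
      ∃ p : Eu n → ℝ, IsHarmonicOn p univ ∧
        (∀ x, |p x| ≤ C₁ * (∑ i ∈ Finset.range j, q ^ i) * (1 + ‖x‖) ^ k) ∧
        (∀ x ∈ frontier Ω ∩ ball 0 (θ ^ j),
          |p x| ≤ C₁ * δ * (∑ i ∈ Finset.range j, θ ^ i) * ‖x‖ ^ lam) ∧
        ∀ x ∈ Ω ∩ ball 0 (θ ^ j), |u x - p x| ≤ (θ ^ j) ^ lam := by
    intro Ω S u hcur hu hub hubd j
    induction j with
    | zero =>
      refine ⟨fun _ => 0, isHarmonicOn_const 0 _, fun x => by simp, fun x _ => by simp, ?_⟩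
      intro x hx
      simpa using hub x (by simpa using hx)
    | succ j ih =>
      obtain ⟨p, hp, hpg, hpb, hpu⟩ := ih
      set r : ℝ := θ ^ j with hr
      have hr0 : 0 < r := by positivity
      have hr1 : r ≤ 1 := pow_le_one₀ hθ.le hθ1.le
      have hrl : 0 < r ^ lam := Real.rpow_pos_of_pos hr0 _
      obtain ⟨S', hS'⟩ := hcur.rescale h2l hr0 hr1
      have hballr : ∀ x : Eu n, ∀ t : ℝ, x ∈ ball (0 : Eu n) t →
          r • x ∈ ball (0 : Eu n) (r * t) := by
        intro x t hx
        rw [mem_ball_zero_iff] at hx ⊢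
        rw [norm_smul, Real.norm_of_nonneg hr0.le]
        gcongr
      have hball1 : ∀ x : Eu n, x ∈ ball (0 : Eu n) 1 → r • x ∈ ball (0 : Eu n) r := by
        intro x hx; simpa using hballr x 1 hx
      have hsub : ball (0 : Eu n) r ⊆ ball 0 1 := ball_subset_ball hr1
      have hpc : Continuous p := by
        rw [← continuousOn_univ]; exact hp.1.continuousOn
      have hgeom : ∑ i ∈ Finset.range j, θ ^ i ≤ 2 := by
        refine (geom_sum_le_inv hθ.le hθ1 j).trans ?_
        rw [inv_le_comm₀ (by linarith) two_pos]; linarith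
      set w : Eu n → ℝ := fun y => (r ^ lam)⁻¹ * (u (r • y) - p (r • y)) with hw
      have hwh : IsHarmonicOn w ((fun y => r • y) ⁻¹' Ω ∩ ball 0 1) := by
        have hop : IsOpen (Ω ∩ ball (0 : Eu n) 1) := hcur.isOpen.inter isOpen_ball
        have h1 := ((hu.sub hop (hp.mono (subset_univ _))).comp_smul hop r).const_mul
          (hop.preimage (continuous_const_smul r)) (r ^ lam)⁻¹
        exact h1.mono fun x hx => ⟨hx.1, hsub (hball1 x hx.2)⟩
      have hstrip : StripData e ((fun y => r • y) ⁻¹' Ω) δ₀ w := by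
        refine hS'.stripData (by linarith) ?_ hδ₀8 hwh ?_ ?_
        · have : δ * r ≤ δ * 1 := by gcongr
          nlinarith
        · intro x hx
          have := hpu _ ⟨hx.1, hball1 x hx.2⟩
          rw [hw, abs_mul, abs_of_pos (inv_pos.2 hrl), inv_mul_le_iff₀ hrl, mul_one]
          exact this
        · rintro z ⟨hz, hz1⟩
          rw [preimage_smul_frontier hr0.ne'] at hz
          have hT : Filter.Tendsto w (𝓝[(fun y => r • y) ⁻¹' Ω] z)
              (𝓝 ((r ^ lam)⁻¹ * (0 - p (r • z)))) := by
            refine Filter.Tendsto.const_mul _ (Filter.Tendsto.sub ?_ ?_)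
            · refine (hubd _ ⟨hz, hsub (hball1 z hz1)⟩).comp
                (tendsto_nhdsWithin_iff.2 ⟨?_, self_mem_nhdsWithin⟩)
              exact (continuous_const_smul r).continuousAt.mono_left nhdsWithin_le_nhds
            · exact (hpc.comp (continuous_const_smul r)).continuousAt.mono_left
                nhdsWithin_le_nhds
          have hlim : |(r ^ lam)⁻¹ * (0 - p (r • z))| < δ₀ := by
            have h1 := hpb _ ⟨hz, hball1 z hz1⟩
            have h2 : ‖r • z‖ ^ lam ≤ r ^ lam :=
              Real.rpow_le_rpow (norm_nonneg _) (mem_ball_zero_iff.1 (hball1 z hz1)).le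
                (by linarith)
            rw [abs_mul, abs_of_pos (inv_pos.2 hrl), zero_sub, abs_neg, inv_mul_lt_iff₀ hrl]
            calc |p (r • z)| ≤ C₁ * δ * 2 * r ^ lam := h1.trans (by gcongr)
              _ < r ^ lam * δ₀ := by
                rw [mul_comm]
                gcongr
                nlinarith
          filter_upwards [hT.abs.eventually (gt_mem_nhds hlim)] with x hx using le_of_lt hx
      obtain ⟨P, hPd, hPl, hPn, hPb, hPw⟩ := himp _ S' (δ * r) w (by positivity)
        ((mul_le_of_le_one_right hδpos.le hr1).trans (min_le_left _ _)) hS'.degIn hS'.pnorm_le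
        hstrip hS'.bdry
      have hrr : ∀ x : Eu n, r • r⁻¹ • x = x := fun x => by
        rw [smul_smul, mul_inv_cancel₀ hr0.ne', one_smul]
      have hrinv : ∀ (x : Eu n) (t : ℝ), x ∈ ball (0 : Eu n) (r * t) →
          r⁻¹ • x ∈ ball (0 : Eu n) t := by
        intro x t hx
        rw [mem_ball_zero_iff] at hx ⊢
        rw [norm_smul, norm_inv, Real.norm_of_nonneg hr0.le, inv_mul_lt_iff₀ hr0]
        exact hx
      refine ⟨fun x => p x + r ^ lam * ev P (r⁻¹ • x), ?_, ?_, ?_, ?_⟩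
      · refine hp.add isOpen_univ (IsHarmonicOn.const_mul isOpen_univ ?_ _)
        exact (isHarmonicOn_ev hPl univ).comp_smul isOpen_univ r⁻¹
      · intro x
        have h1 : r ^ lam * |ev P (r⁻¹ • x)| ≤ C₁ * q ^ j * (1 + ‖x‖) ^ k := by
          have h2 := abs_ev_le_growth hPd (r⁻¹ • x)
          rw [norm_smul, norm_inv, Real.norm_of_nonneg hr0.le] at h2
          have h3 := mul_one_add_div_pow_le (lam := lam) (k := k) hr0 hr1 (norm_nonneg x)
          have h4 : r ^ (lam - k) = q ^ j := by
            rw [hr, hq, ← Real.rpow_natCast, ← Real.rpow_natCast, ← Real.rpow_mul hθ.le,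
              ← Real.rpow_mul hθ.le, mul_comm]
          rw [h4] at h3
          calc r ^ lam * |ev P (r⁻¹ • x)| ≤ r ^ lam * (C₁ * (1 + r⁻¹ * ‖x‖) ^ k) := by
                gcongr
                exact h2.trans (by gcongr)
            _ = C₁ * (r ^ lam * (1 + r⁻¹ * ‖x‖) ^ k) := by ring
            _ ≤ C₁ * (q ^ j * (1 + ‖x‖) ^ k) := by gcongr
            _ = _ := by ring
        refine (abs_add_le _ _).trans ?_
        rw [abs_mul, abs_of_pos hrl, Finset.sum_range_succ]
        linarith [hpg x]
      · rintro x ⟨hx, hxb⟩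
        rw [pow_succ] at hxb
        have hxr : x ∈ ball (0 : Eu n) r :=
          ball_subset_ball (mul_le_of_le_one_right hr0.le hθ1.le) hxb
        have h1 := hPb (r⁻¹ • x) ⟨by
          rw [preimage_smul_frontier hr0.ne']
          simpa only [mem_preimage, hrr] using hx, hrinv x 1 (by rwa [mul_one])⟩
        have h2 : r ^ lam * ‖r⁻¹ • x‖ ^ lam = ‖x‖ ^ lam := by
          rw [← Real.mul_rpow hr0.le (norm_nonneg _), norm_smul, norm_inv,
            Real.norm_of_nonneg hr0.le, mul_inv_cancel_left₀ hr0.ne']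
        have h3 : r ^ lam * |ev P (r⁻¹ • x)| ≤ C₁ * δ * θ ^ j * ‖x‖ ^ lam := by
          calc r ^ lam * |ev P (r⁻¹ • x)| ≤ r ^ lam * (C₁ * (δ * r) * ‖r⁻¹ • x‖ ^ lam) := by gcongr
            _ = C₁ * δ * r * (r ^ lam * ‖r⁻¹ • x‖ ^ lam) := by ring
            _ = _ := by rw [h2]
        refine (abs_add_le _ _).trans ?_
        rw [abs_mul, abs_of_pos hrl, Finset.sum_range_succ]
        linarith [hpb x ⟨hx, hxr⟩]
      · rintro x ⟨hx, hxb⟩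
        rw [pow_succ] at hxb
        have h1 := hPw (r⁻¹ • x) ⟨by simpa only [mem_preimage, hrr] using hx, hrinv x θ hxb⟩
        rw [hw] at h1
        simp only [hrr] at h1
        have h2 : u x - (p x + r ^ lam * ev P (r⁻¹ • x)) =
            r ^ lam * ((r ^ lam)⁻¹ * (u x - p x) - ev P (r⁻¹ • x)) := by
          field_simp; ring
        rw [h2, abs_mul, abs_of_pos hrl, pow_succ, Real.mul_rpow hr0.le hθ.le]
        gcongr
  have hθl : 0 < θ ^ lam := Real.rpow_pos_of_pos hθ _
  refine ⟨δ, max (C₁ / (1 - q)) (θ ^ lam)⁻¹, hδpos, lt_max_of_lt_right (by positivity), ?_⟩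
  intro Ω S u hcur hu hub hubd ρ hρ hρ1
  obtain ⟨j, hj1, hj2⟩ := exists_nat_pow_near_of_lt_one hρ hρ1 hθ hθ1
  obtain ⟨p, hp, hpg, -, hpu⟩ := key Ω S u hcur hu hub hubd j
  refine ⟨p, hp, fun x => (hpg x).trans ?_, fun x hx => ?_⟩
  · gcongr
    refine le_trans ?_ (le_max_left _ _)
    rw [div_eq_mul_inv]
    gcongr
    exact geom_sum_le_inv hq0.le hq1 j
  · refine (hpu x ⟨hx.1, ball_subset_ball hj2 hx.2⟩).trans ?_
    refine le_trans ?_ (mul_le_mul_of_nonneg_right (le_max_right _ _) (Real.rpow_nonneg hρ.le _))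
    rw [le_inv_mul_iff₀ hθl, ← Real.mul_rpow hθ.le (by positivity), ← pow_succ']
    exact Real.rpow_le_rpow (by positivity) hj1.le (by linarith)

end

section

open Pol

/-- The linear part of a similarity. -/
def simLin (L : Eu n ≃ₗᵢ[ℝ] Eu n) {r : ℝ} (hr : r ≠ 0) : Eu n ≃L[ℝ] Eu n :=
  L.toContinuousLinearEquiv.trans (ContinuousLinearEquiv.smulLeft (Units.mk0 r hr))

lemma simLin_apply (L : Eu n ≃ₗᵢ[ℝ] Eu n) {r : ℝ} (hr : r ≠ 0) (x : Eu n) :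
    simLin L hr x = r • L x := rfl

lemma norm_simLin_le (L : Eu n ≃ₗᵢ[ℝ] Eu n) {r : ℝ} (hr : r ≠ 0) :
    ‖(simLin L hr : Eu n →L[ℝ] Eu n)‖ ≤ |r| := by
  refine ContinuousLinearMap.opNorm_le_bound _ (abs_nonneg r) fun x => ?_
  rw [ContinuousLinearEquiv.coe_coe, simLin_apply, norm_smul, L.norm_map, Real.norm_eq_abs]

lemma iteratedFDeriv_comp_similarity (f : Eu n → ℝ) (L : Eu n ≃ₗᵢ[ℝ] Eu n) (a : Eu n) {r : ℝ}
    (hr : r ≠ 0) (m : ℕ) (x : Eu n) :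
    iteratedFDeriv ℝ m (fun y => f (a + r • L y)) x =
      (iteratedFDeriv ℝ m f (a + r • L x)).compContinuousLinearMap
        fun _ => (simLin L hr : Eu n →L[ℝ] Eu n) := by
  have h := (simLin L hr).iteratedFDerivWithin_comp_right (fun z => f (a + z))
    uniqueDiffOn_univ (mem_univ (simLin L hr x)) m
  rw [preimage_univ, iteratedFDerivWithin_univ, iteratedFDerivWithin_univ,
    iteratedFDeriv_comp_add_left] at h
  exact h

lemma norm_comp_simLin_le {m : ℕ} (A : (Eu n) [×m]→L[ℝ] ℝ) (L : Eu n ≃ₗᵢ[ℝ] Eu n) {r : ℝ}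
    (hr : 0 < r) : ‖A.compContinuousLinearMap fun _ => (simLin L hr.ne' : Eu n →L[ℝ] Eu n)‖ ≤
      ‖A‖ * r ^ m := by
  refine (ContinuousMultilinearMap.norm_compContinuousLinearMap_le _ _).trans ?_
  rw [Finset.prod_const, Finset.card_univ, Fintype.card_fin]
  have := norm_simLin_le L hr.ne'
  rw [abs_of_pos hr] at this
  gcongr

lemma norm_iteratedFDeriv_comp_similarity_le (f : Eu n → ℝ) (L : Eu n ≃ₗᵢ[ℝ] Eu n) (a : Eu n)
    {r : ℝ} (hr : 0 < r) (m : ℕ) (x : Eu n) :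
    ‖iteratedFDeriv ℝ m (fun y => f (a + r • L y)) x‖ ≤
      ‖iteratedFDeriv ℝ m f (a + r • L x)‖ * r ^ m := by
  rw [iteratedFDeriv_comp_similarity f L a hr.ne']
  exact norm_comp_simLin_le _ L hr

lemma norm_iteratedFDeriv_le_of_comp_similarity (f : Eu n → ℝ) (L : Eu n ≃ₗᵢ[ℝ] Eu n) (a : Eu n)
    {r : ℝ} (hr : 0 < r) (m : ℕ) (x : Eu n) :
    ‖iteratedFDeriv ℝ m f (a + r • L x)‖ ≤
      ‖iteratedFDeriv ℝ m (fun y => f (a + r • L y)) x‖ * r⁻¹ ^ m := by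
  have h := norm_iteratedFDeriv_comp_similarity_le (fun y => f (a + r • L y)) L.symm
    (-(r⁻¹ • L.symm a)) (inv_pos.2 hr) m (a + r • L x)
  have h1 : ∀ y, a + r • L (-(r⁻¹ • L.symm a) + r⁻¹ • L.symm y) = y := by
    intro y
    simp only [map_add, map_neg, map_smul, L.apply_symm_apply, smul_add, smul_neg, smul_smul,
      mul_inv_cancel₀ hr.ne', one_smul]
    abel
  have h2 : -(r⁻¹ • L.symm a) + r⁻¹ • L.symm (a + r • L x) = x := by
    simp only [map_add, map_smul, L.symm_apply_apply, smul_add, smul_smul,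
      inv_mul_cancel₀ hr.ne', one_smul]
    abel
  rw [h2] at h
  simpa only [h1] using h

/-- Derivatives of order larger than the growth exponent of an entire harmonic function vanish. -/
lemma iteratedFDeriv_eq_zero_of_growth (hn : 2 < n) {p : Eu n → ℝ} (hp : IsHarmonicOn p univ)
    {C : ℝ} (hC : 0 ≤ C) {k : ℕ} (hg : ∀ x, |p x| ≤ C * (1 + ‖x‖) ^ k) (x : Eu n) :
    ‖iteratedFDeriv ℝ (k + 1) p x‖ = 0 := by
  obtain ⟨K, hK, hInt⟩ := interior_estimate hn (k + 1)
  refine le_antisymm (le_of_forall_pos_le_add fun ε hε => ?_) (norm_nonneg _)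
  set A : ℝ := K * C * 2 ^ k with hA
  have hA0 : 0 ≤ A := by positivity
  set R : ℝ := 1 + ‖x‖ + A / ε with hR
  have hR0 : 0 < R := by positivity
  have h1 := hInt p x R (C * (2 * R) ^ k) hR0 (hp.mono (subset_univ _)) fun y hy => by
    refine (hg y).trans ?_
    have : ‖y‖ ≤ ‖x‖ + R := by
      have h2 := norm_le_insert' y x
      have h3 : ‖y - x‖ < R := by rwa [← dist_eq_norm]
      linarith
    have : 0 ≤ A / ε := by positivity
    gcongr
    linarith
  refine h1.trans ?_
  have h2 : K * (C * (2 * R) ^ k) * R⁻¹ ^ (k + 1) = A / R := by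
    rw [hA, mul_pow, inv_pow, pow_succ]
    field_simp
  rw [h2, zero_add, div_le_iff₀ hR0]
  have : A / ε ≤ R := by rw [hR]; linarith [norm_nonneg x]
  rw [div_le_iff₀ hε] at this
  linarith

/-- Derivative bounds at a point whose nearest boundary point is the origin. -/
theorem Curved.deriv_estimate (hn : 2 < n) (e : Fin n) {k : ℕ} (hk : 2 ≤ k) {lam : ℝ}
    (hklam : k < lam) (hlam : lam < k + 1) :
    ∃ δ C : ℝ, 0 < δ ∧ 0 < C ∧ ∀ (Ω : Set (Eu n)) (S : Pol n) (u : Eu n → ℝ),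
      Curved e k lam Ω S δ → IsHarmonicOn u (Ω ∩ ball 0 1) → (∀ x ∈ Ω ∩ ball 0 1, |u x| ≤ 1) →
      (∀ z ∈ frontier Ω ∩ ball 0 1, Filter.Tendsto u (𝓝[Ω] z) (𝓝 0)) →
      ∀ (x : Eu n) (d : ℝ), 0 < d → 2 * d ≤ 1 → ‖x‖ ≤ d → ball x d ⊆ Ω →
        (∀ m ≤ k, ‖iteratedFDeriv ℝ m u x‖ ≤ C) ∧
        ‖iteratedFDeriv ℝ (k + 1) u x‖ ≤ C * d ^ (lam - (k + 1)) := by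
  obtain ⟨δ, C, hδ, hC, happ⟩ := Curved.exists_approx hn e hk hklam hlam
  choose Ci hCi0 hCi using interior_estimate (n := n) hn
  set K : ℝ := ∑ m ∈ Finset.range (k + 2), Ci m with hK
  have hKm : ∀ m ≤ k + 1, Ci m ≤ K := fun m hm =>
    Finset.single_le_sum (f := Ci) (fun i _ => (hCi0 i).le) (Finset.mem_range.2 (by omega))
  have hK0 : 0 < K := (hCi0 0).trans_le (hKm 0 (by omega))
  refine ⟨δ, K * (C * 2 ^ lam) + K * (C * 3 ^ k), hδ, by positivity, ?_⟩
  intro Ω S u hcur hu hub hubd x d hd hd1 hxd hball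
  obtain ⟨p, hp, hpg, hpu⟩ := happ Ω S u hcur hu hub hubd (2 * d) (by positivity) hd1
  have hsub : ball x d ⊆ Ω ∩ ball 0 (2 * d) := fun y hy => ⟨hball hy, by
    have h1 := norm_le_insert' y x
    have h2 : ‖y - x‖ < d := by rwa [← dist_eq_norm]
    rw [mem_ball_zero_iff]; linarith⟩
  have hsub1 : ball x d ⊆ Ω ∩ ball 0 1 :=
    hsub.trans (inter_subset_inter_right _ (ball_subset_ball hd1))
  have hud := hu.mono hsub1
  have hpd := hp.mono (subset_univ (ball x d))
  have hdiff : ∀ m ≤ k + 1, ‖iteratedFDeriv ℝ m (fun y => u y - p y) x‖ ≤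
      K * (C * 2 ^ lam) * (d ^ lam * d⁻¹ ^ m) := by
    intro m hm
    refine (hCi m _ x d (C * (2 * d) ^ lam) hd (hud.sub isOpen_ball hpd)
      fun y hy => hpu y (hsub hy)).trans ?_
    rw [Real.mul_rpow two_pos.le hd.le]
    calc Ci m * (C * (2 ^ lam * d ^ lam)) * d⁻¹ ^ m
        ≤ K * (C * (2 ^ lam * d ^ lam)) * d⁻¹ ^ m := by gcongr; exact hKm m hm
      _ = _ := by ring
  have hpm : ∀ m ≤ k + 1, ‖iteratedFDeriv ℝ m p x‖ ≤ K * (C * 3 ^ k) := by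
    intro m hm
    have := hCi m p x 1 (C * 3 ^ k) one_pos (hp.mono (subset_univ _)) fun y hy => by
      refine (hpg y).trans ?_
      have h1 := norm_le_insert' y x
      have h2 : ‖y - x‖ < 1 := by rwa [← dist_eq_norm]
      gcongr
      linarith
    rw [inv_one, one_pow, mul_one] at this
    exact this.trans (by gcongr; exact hKm m hm)
  have hxx := mem_ball_self (x := x) hd
  have hsum : ∀ m : ℕ, ‖iteratedFDeriv ℝ m u x‖ ≤
      ‖iteratedFDeriv ℝ m (fun y => u y - p y) x‖ + ‖iteratedFDeriv ℝ m p x‖ := by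
    intro m
    have h1 : ContDiffAt ℝ m (fun y => u y - p y) x :=
      ((hud.sub isOpen_ball hpd).smooth hn isOpen_ball hxx).of_le (by exact_mod_cast le_top)
    have h2 : ContDiffAt ℝ m p x := (hpd.smooth hn isOpen_ball hxx).of_le (by exact_mod_cast le_top)
    have h3 := iteratedFDeriv_add_apply h1 h2
    have h4 : (fun y => u y - p y) + p = u := by ext y; simp
    rw [h4] at h3
    rw [h3]
    exact norm_add_le _ _
  have hd1' : d ≤ 1 := by linarith
  constructor
  · intro m hm
    refine (hsum m).trans (add_le_add ((hdiff m (by omega)).trans ?_) (hpm m (by omega)))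
    refine mul_le_of_le_one_right (by positivity) ?_
    rw [inv_pow, ← div_eq_mul_inv, div_le_one (by positivity), ← Real.rpow_natCast]
    refine Real.rpow_le_rpow_of_exponent_ge hd hd1' ?_
    have : (m : ℝ) ≤ k := by exact_mod_cast hm
    linarith
  · have h0 := iteratedFDeriv_eq_zero_of_growth hn hp hC.le hpg x
    have h1 := hsum (k + 1)
    rw [h0, add_zero] at h1
    refine (h1.trans (hdiff _ le_rfl)).trans ?_
    have h2 : d ^ lam * d⁻¹ ^ (k + 1) = d ^ (lam - (k + 1)) := by
      rw [Real.rpow_sub hd, inv_pow, div_eq_mul_inv]; norm_cast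
    rw [h2]
    gcongr
    have : 0 ≤ K * (C * 3 ^ k) := by positivity
    linarith

end

section

open Pol MvPolynomial

lemma exists_linearIsometryEquiv_stdE (e : Fin n) {v : Eu n} (hv : ‖v‖ = 1) :
    ∃ L : Eu n ≃ₗᵢ[ℝ] Eu n, L (stdE e) = v := by
  have h : Orthonormal ℝ (({e} : Set (Fin n)).domRestrict fun _ => v) := by
    constructor
    · intro i; exact hv
    · intro i j hij
      exact absurd (Subsingleton.elim i j) hij
  obtain ⟨b, hb⟩ := h.exists_orthonormalBasis_extension_of_card_eq (by simp)
  refine ⟨(EuclideanSpace.basisFun (Fin n) ℝ).equiv b (Equiv.refl _), ?_⟩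
  have h1 : stdE e = EuclideanSpace.basisFun (Fin n) ℝ e := by simp [stdE]
  rw [h1, OrthonormalBasis.equiv_apply_basis]
  exact hb e rfl

lemma iteratedFDeriv_clm_const (ℓ : Eu n →L[ℝ] ℝ) {k : ℕ} (hk : k ≠ 0) (x y : Eu n) :
    iteratedFDeriv ℝ k ℓ x = iteratedFDeriv ℝ k ℓ y := by
  have h1 : iteratedFDeriv ℝ k (fun z => ℓ (z + (x - y))) y = iteratedFDeriv ℝ k ℓ x := by
    rw [iteratedFDeriv_comp_add_right]
    simp
  rw [← h1]
  have h2 : (fun z => ℓ (z + (x - y))) = fun z => ℓ z + ℓ (x - y) := by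
    funext z; exact map_add _ _ _
  rw [h2, fun_iteratedFDeriv_add_apply ℓ.contDiff.contDiffAt contDiffAt_const,
    iteratedFDeriv_const_of_ne hk]
  simp

/-- The part of degree at least two of the Taylor polynomial of `f` at the origin. -/
def highJet (k : ℕ) (f : Eu n → ℝ) : Pol n :=
  ∑ α ∈ (multiIdxLE n k).filter (fun α => 2 ≤ multiDeg α), monomial (toFinsupp α) (jetCoeff f α)

lemma degIn_highJet (k : ℕ) (f : Eu n → ℝ) : DegIn 2 k (highJet k f) := by
  refine degIn_sum fun α hα => ?_
  rw [Finset.mem_filter, mem_multiIdxLE] at hα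
  exact degIn_monomial (hα.2.trans (degree_toFinsupp α).ge) ((degree_toFinsupp α).le.trans hα.1)

lemma pnorm_highJet_le {k : ℕ} {f : Eu n → ℝ} (hf : ContDiffAt ℝ k f 0) {B : ℝ} (hB0 : 0 ≤ B)
    (hB : ∀ m, 2 ≤ m → m ≤ k → ‖iteratedFDeriv ℝ m f 0‖ ≤ B) :
    pnorm (highJet k f) ≤ (multiIdxLE n k).card * B := by
  refine (pnorm_sum_le _ _).trans ?_
  refine (Finset.sum_le_card_nsmul _ _ B fun α hα => ?_).trans ?_
  · rw [Finset.mem_filter, mem_multiIdxLE] at hα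
    rw [pnorm_monomial]
    refine (abs_inv_multiFact_mul_le _ _).trans ?_
    refine (abs_pdMulti_le _ (hf.of_le ?_)).trans ?_
    · rw [length_multiList]; exact_mod_cast hα.1
    · rw [length_multiList]; exact hB _ hα.2 hα.1
  · rw [nsmul_eq_mul]
    refine mul_le_mul_of_nonneg_right ?_ hB0
    exact_mod_cast Finset.card_le_card (Finset.filter_subset _ (multiIdxLE n k))

lemma tay_eq_highJet {k : ℕ} (hk : 1 ≤ k) {f : Eu n → ℝ} (hf : ContDiffAt ℝ k f 0) (x : Eu n) :
    tay k f 0 x = f 0 + fderiv ℝ f 0 x + ev (highJet k f) x := by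
  have h1 : tay 1 f 0 x = f 0 + fderiv ℝ f 0 x := by
    rw [tay_eq_sum (hf.of_le (by exact_mod_cast hk))]
    simp [Finset.sum_range_succ, iteratedFDeriv_one_apply]
  rw [← h1, tay, tay, ← Finset.sum_filter_add_sum_filter_not (multiIdxLE n k)
    (fun α => multiDeg α ≤ 1)]
  congr 1
  · refine Finset.sum_congr ?_ fun _ _ => rfl
    ext α
    rw [Finset.mem_filter, mem_multiIdxLE, mem_multiIdxLE]
    omega
  · rw [highJet, ev_sum]
    refine Finset.sum_congr ?_ fun α _ => ?_
    · ext α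
      rw [Finset.mem_filter, Finset.mem_filter, mem_multiIdxLE]
      omega
    · rw [ev_monomial]; rfl

/-- A function of class `C^{k, lam - k}`, rescaled at a zero `z` where its gradient does not
vanish, is a small perturbation of a coordinate function. -/
lemma exists_rescaled_coord (e : Fin n) {k : ℕ} (hk : 2 ≤ k) {lam : ℝ} (hkl : (k : ℝ) < lam)
    {Φ : Eu n → ℝ} (hΦ : ContDiff ℝ k Φ) {C B : ℝ} (hC0 : 0 ≤ C)
    (hC : ∀ x y, ‖iteratedFDeriv ℝ k Φ x - iteratedFDeriv ℝ k Φ y‖ ≤ C * ‖x - y‖ ^ (lam - k))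
    {z : Eu n} (hz : Φ z = 0) (hgrad : 1 ≤ ‖fderiv ℝ Φ z‖) (hB0 : 0 ≤ B)
    (hB : ∀ m ≤ k, ‖iteratedFDeriv ℝ m Φ z‖ ≤ B) :
    ∃ L : Eu n ≃ₗᵢ[ℝ] Eu n, ∀ ρ, 0 < ρ → ρ ≤ 1 → ∃ S : Pol n, ∃ c : ℝ, 0 < c ∧
      DegIn 2 k S ∧ pnorm S ≤ (multiIdxLE n k).card * (B * ρ) ∧
      ∀ x, |c * Φ (z + ρ • L x) - (x e + ev S x)| ≤ C * ρ * ‖x‖ ^ lam := by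
  set a := ‖fderiv ℝ Φ z‖ with ha
  have ha0 : 0 < a := by linarith
  set w : Eu n := (InnerProductSpace.toDual ℝ (Eu n)).symm (fderiv ℝ Φ z) with hw
  have hwn : ‖w‖ = a := by rw [hw, LinearIsometryEquiv.norm_map]
  obtain ⟨L, hL⟩ := exists_linearIsometryEquiv_stdE e (v := a⁻¹ • w) (by
    rw [norm_smul, hwn, Real.norm_of_nonneg (inv_nonneg.2 ha0.le), inv_mul_cancel₀ ha0.ne'])
  refine ⟨L, fun ρ hρ hρ1 => ?_⟩
  set c := (a * ρ)⁻¹ with hc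
  have hc0 : 0 < c := by positivity
  have hcle : c * ρ ≤ 1 := by
    rw [hc, mul_inv, mul_assoc, inv_mul_cancel₀ hρ.ne', mul_one]
    exact inv_le_one_of_one_le₀ hgrad
  set f0 : Eu n → ℝ := fun x => Φ (z + ρ • L x) with hf0
  set f : Eu n → ℝ := fun x => c * f0 x with hf
  have hf0c : ContDiff ℝ k f0 := hΦ.comp (by fun_prop)
  have hfc : ContDiff ℝ k f := contDiff_const.mul hf0c
  have hfm : ∀ m ≤ k, ∀ x, iteratedFDeriv ℝ m f x = c • iteratedFDeriv ℝ m f0 x := fun m hm x =>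
    iteratedFDeriv_const_smul_apply' (a := c) (hf0c.of_le (by exact_mod_cast hm)).contDiffAt
  have hm : ∀ m, 2 ≤ m → m ≤ k → ‖iteratedFDeriv ℝ m f 0‖ ≤ B * ρ := by
    intro m h2 hmk
    rw [hfm m hmk, norm_smul, Real.norm_of_nonneg hc0.le]
    have h1 := norm_iteratedFDeriv_comp_similarity_le Φ L z hρ m 0
    have h3 : z + ρ • L 0 = z := by simp
    rw [h3] at h1
    calc c * ‖iteratedFDeriv ℝ m f0 0‖ ≤ c * (B * ρ ^ m) := by
          gcongr
          exact h1.trans (by gcongr; exact hB m hmk)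
      _ = (c * ρ) * (B * ρ ^ (m - 1)) := by
          obtain ⟨m', rfl⟩ : ∃ m', m = m' + 1 := ⟨m - 1, by omega⟩
          simp only [Nat.add_sub_cancel]; ring
      _ ≤ 1 * (B * ρ ^ 1) := by
          have : ρ ^ (m - 1) ≤ ρ ^ 1 := pow_le_pow_of_le_one hρ.le hρ1 (by omega)
          gcongr
      _ = B * ρ := by ring
  refine ⟨highJet k f, c, hc0, degIn_highJet k f,
    pnorm_highJet_le hfc.contDiffAt (by positivity) hm, fun x => ?_⟩
  have hfz : f 0 = 0 := by simp [hf, hf0, hz]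
  have hfd : fderiv ℝ f 0 x = x e := by
    have h1 : HasFDerivAt f0 ((fderiv ℝ Φ z).comp (simLin L hρ.ne' : Eu n →L[ℝ] Eu n)) 0 := by
      have h2 : HasFDerivAt Φ (fderiv ℝ Φ z) (z + simLin L hρ.ne' 0) := by
        rw [map_zero, add_zero]
        exact (hΦ.differentiable (by norm_cast; omega) z).hasFDerivAt
      exact h2.comp 0 ((simLin L hρ.ne').hasFDerivAt.const_add z)
    have h3 := (h1.const_mul c).fderiv
    rw [hf, h3]
    simp only [_root_.smul_apply, ContinuousLinearMap.comp_apply, ContinuousLinearEquiv.coe_coe,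
      simLin_apply, smul_eq_mul, map_smul]
    have h4 : fderiv ℝ Φ z (L x) = ⟪w, L x⟫ := by
      rw [hw, InnerProductSpace.toDual_symm_apply]
    have h5 : w = a • L (stdE e) := by rw [hL, smul_smul, mul_inv_cancel₀ ha0.ne', one_smul]
    rw [h4, h5, real_inner_smul_left, L.inner_map_map]
    have h6 : ⟪stdE e, x⟫ = x e := by
      rw [EuclideanSpace.inner_single_left]; simp
    rw [h6, hc]
    field_simp
  have htay := taylor_holder (k := k - 1) (f := f) (x := 0) (h := x)
    (B := C * ρ * ‖x‖ ^ (lam - k)) ?_ ?_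
  · have hk1 : k - 1 + 1 = k := by omega
    rw [hk1, zero_add, tay_eq_highJet (by omega) hfc.contDiffAt, hfz, hfd, zero_add] at htay
    refine htay.trans_eq ?_
    rw [mul_assoc, ← Real.rpow_natCast ‖x‖ k,
      ← Real.rpow_add_of_nonneg (norm_nonneg x) (by linarith) (by positivity)]
    congr 2; ring
  · intro t _
    have : ((k - 1 : ℕ) : WithTop ℕ∞) + 1 = k := by
      have : k - 1 + 1 = k := by omega
      exact_mod_cast this
    rw [this]; exact hfc.contDiffAt
  · intro t ht
    have hk1 : k - 1 + 1 = k := by omega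
    rw [hk1, zero_add, hfm k le_rfl, hfm k le_rfl, ← smul_sub, norm_smul,
      Real.norm_of_nonneg hc0.le, hf0, iteratedFDeriv_comp_similarity Φ L z hρ.ne',
      iteratedFDeriv_comp_similarity Φ L z hρ.ne']
    have h1 : ∀ A A' : (Eu n) [×k]→L[ℝ] ℝ, (A.compContinuousLinearMap
        fun _ => (simLin L hρ.ne' : Eu n →L[ℝ] Eu n)) - (A'.compContinuousLinearMap
        fun _ => (simLin L hρ.ne' : Eu n →L[ℝ] Eu n)) = (A - A').compContinuousLinearMap
        fun _ => (simLin L hρ.ne' : Eu n →L[ℝ] Eu n) := by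
      intro A A'; ext; simp
    rw [h1]
    have h2 : ‖z + ρ • L (t • x) - (z + ρ • L 0)‖ ≤ ‖x‖ := by
      rw [add_sub_add_left_eq_sub, map_zero, smul_zero, sub_zero, norm_smul, L.norm_map,
        norm_smul, Real.norm_of_nonneg hρ.le, Real.norm_of_nonneg ht.1]
      have : ρ * t ≤ 1 := mul_le_one₀ hρ1 ht.1 ht.2
      nlinarith [norm_nonneg x]
    calc c * _ ≤ c * (C * ‖x‖ ^ (lam - k) * ρ ^ k) := by
          gcongr
          refine (norm_comp_simLin_le _ L hρ).trans ?_
          gcongr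
          refine (hC _ _).trans ?_
          gcongr
      _ = (c * ρ) * (C * ‖x‖ ^ (lam - k) * ρ ^ (k - 1)) := by
          obtain ⟨m', rfl⟩ : ∃ m', k = m' + 1 := ⟨k - 1, by omega⟩
          simp only [Nat.add_sub_cancel]; ring
      _ ≤ 1 * (C * ‖x‖ ^ (lam - k) * ρ ^ 1) := by
          have : ρ ^ (k - 1) ≤ ρ ^ 1 := pow_le_pow_of_le_one hρ.le hρ1 (by omega)
          gcongr
      _ = C * ρ * ‖x‖ ^ (lam - k) := by ring

end

section

open Pol MvPolynomial

lemma exists_curved_local (e : Fin n) {lam : ℝ} (hlam : 2 < lam) (hni : ∀ m : ℕ, lam ≠ m)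
    {D : Set (Eu n)} (hDo : IsOpen D) (hbd : HasGraphBoundary D (HolderSmooth lam)) {δ : ℝ}
    (hδ : 0 < δ) {y : Eu n} (hy : y ∈ frontier D) :
    ∃ r, 0 < r ∧ ∀ z ∈ frontier D ∩ ball y r, ∀ ρ, 0 < ρ → ρ ≤ r →
      ∃ (L : Eu n ≃ₗᵢ[ℝ] Eu n) (S : Pol n),
        Curved e ⌊lam⌋₊ lam ((fun x => z + ρ • L x) ⁻¹' D) S δ := by
  obtain ⟨v, hv, V, hV, hyV, g, ⟨hg, hgH⟩, hgv, hDV, hfV⟩ := hbd y hy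
  obtain ⟨C, hC⟩ := hgH (hni _)
  set k := ⌊lam⌋₊ with hk
  have hk2 : 2 ≤ k := Nat.le_floor (by exact_mod_cast hlam.le)
  have hkl : (k : ℝ) < lam := lt_of_le_of_ne (Nat.floor_le (by linarith)) (hni k).symm
  set Φ : Eu n → ℝ := fun x => g x - innerSL ℝ v x with hΦ
  have hΦc : ContDiff ℝ k Φ := hg.sub (innerSL ℝ v).contDiff
  have hΦC : ∀ x x', ‖iteratedFDeriv ℝ k Φ x - iteratedFDeriv ℝ k Φ x'‖ ≤
      C * ‖x - x'‖ ^ (lam - k) := by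
    intro x x'
    have h1 : ∀ x, iteratedFDeriv ℝ k Φ x = iteratedFDeriv ℝ k g x -
        iteratedFDeriv ℝ k (innerSL ℝ v) x := fun x =>
      fun_iteratedFDeriv_sub_apply hg.contDiffAt (innerSL ℝ v).contDiff.contDiffAt
    rw [h1, h1, iteratedFDeriv_clm_const (innerSL ℝ v) (by omega) x x', sub_sub_sub_cancel_right]
    have h2 := hC.dist_le x x'
    rwa [Real.coe_toNNReal _ (by linarith), dist_eq_norm, dist_eq_norm] at h2
  have hC0 : (0 : ℝ) ≤ C := C.2
  clear hC
  generalize (C : ℝ) = C at hC0 hΦC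
  have hgrad : ∀ z, 1 ≤ ‖fderiv ℝ Φ z‖ := by
    intro z
    have hd : HasFDerivAt Φ (fderiv ℝ Φ z) z :=
      (hΦc.differentiable (by norm_cast; omega) z).hasFDerivAt
    have h1 : HasDerivAt (fun t : ℝ => Φ (z + t • v)) (fderiv ℝ Φ z v) 0 := by
      have h2 : HasFDerivAt Φ (fderiv ℝ Φ z) (z + (0 : ℝ) • v) := by simpa using hd
      have h3 : HasDerivAt (fun t : ℝ => z + t • v) v 0 := by
        simpa using ((hasDerivAt_id (0 : ℝ)).smul_const v).const_add z
      exact h2.comp_hasDerivAt 0 h3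
    have h4 : (fun t : ℝ => Φ (z + t • v)) = fun t => Φ z - t := by
      funext t
      have h5 : g (z + t • v) = g z := by
        rw [hgv (z + t • v), hgv z]
        congr 1
        rw [inner_add_left, real_inner_smul_left, real_inner_self_eq_norm_sq, hv]
        module
      have h6 : innerSL ℝ v (z + t • v) = innerSL ℝ v z + t := by
        rw [map_add, map_smul, innerSL_apply_apply, innerSL_apply_apply,
          real_inner_self_eq_norm_sq, hv]
        simp
      simp only [hΦ, h5, h6]; ring
    rw [h4] at h1
    have h7 : fderiv ℝ Φ z v = -1 :=
      h1.unique (by simpa using (hasDerivAt_id (0 : ℝ)).const_sub (Φ z))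
    have h8 := (fderiv ℝ Φ z).le_opNorm v
    rw [h7, hv] at h8
    simpa using h8
  have hbound : ∃ B, 0 ≤ B ∧ ∀ m ≤ k, ∀ z ∈ closedBall y 1, ‖iteratedFDeriv ℝ m Φ z‖ ≤ B := by
    have h1 : ∀ m ≤ k, ∃ B, 0 ≤ B ∧ ∀ z ∈ closedBall y 1, ‖iteratedFDeriv ℝ m Φ z‖ ≤ B := by
      intro m hm
      have h2 := hΦc.continuous_iteratedFDeriv (m := m) (by exact_mod_cast hm)
      obtain ⟨B, hB⟩ := (isCompact_closedBall y 1).exists_bound_of_continuousOn h2.continuousOn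
      exact ⟨B, (norm_nonneg _).trans (hB y (mem_closedBall_self zero_le_one)), hB⟩
    choose! B hB0 hB using h1
    refine ⟨∑ m ∈ Finset.range (k + 1), B m, Finset.sum_nonneg fun m hm => hB0 m
      (by rw [Finset.mem_range] at hm; omega), fun m hm z hz => (hB m hm z hz).trans ?_⟩
    exact Finset.single_le_sum (f := B) (fun m hm => hB0 m (by rw [Finset.mem_range] at hm; omega))
      (by rw [Finset.mem_range]; omega)
  obtain ⟨B, hB0, hB⟩ := hbound
  obtain ⟨r0, hr0, hr0V⟩ := Metric.isOpen_iff.1 hV y hyV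
  obtain ⟨N, hN⟩ : ∃ N : ℝ, N = ((multiIdxLE n k).card : ℝ) := ⟨_, rfl⟩
  have hN0 : 0 ≤ N := hN ▸ Nat.cast_nonneg _
  set r := min (min (r0 / 2) 1) (δ / (1 + C + N * B)) with hr
  have hden : 0 < 1 + C + N * B := by positivity
  have hr00 : 0 < r := by positivity
  have hrr0 : r ≤ r0 / 2 := (min_le_left _ _).trans (min_le_left _ _)
  have hr1 : r ≤ 1 := (min_le_left _ _).trans (min_le_right _ _)
  have hrδ : (1 + C + N * B) * r ≤ δ := by
    have := min_le_right (min (r0 / 2) 1) (δ / (1 + C + N * B))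
    rw [← hr, le_div_iff₀ hden] at this
    linarith
  refine ⟨r, hr00, fun z ⟨hzf, hzr⟩ ρ hρ hρr => ?_⟩
  have hzV : z ∈ V := hr0V (ball_subset_ball (by linarith) hzr)
  have hzΦ : ∀ x ∈ V, (x ∈ D ↔ 0 < Φ x) ∧ (x ∈ frontier D ↔ Φ x = 0) := by
    intro x hx
    have h1 : x ∈ D ∩ V ↔ x ∈ {x ∈ V | ⟪x, v⟫ < g x} := by rw [hDV]
    have h2 : x ∈ frontier D ∩ V ↔ x ∈ {x ∈ V | ⟪x, v⟫ = g x} := by rw [hfV]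
    have h3 : (0 < Φ x ↔ ⟪x, v⟫ < g x) ∧ (Φ x = 0 ↔ ⟪x, v⟫ = g x) := by
      simp only [hΦ, innerSL_apply_apply]
      rw [real_inner_comm, sub_pos, sub_eq_zero]
      exact ⟨Iff.rfl, eq_comm⟩
    constructor
    · rw [h3.1]
      exact ⟨fun h => (h1.1 ⟨h, hx⟩).2, fun h => (h1.2 ⟨hx, h⟩).1⟩
    · rw [h3.2]
      exact ⟨fun h => (h2.1 ⟨h, hx⟩).2, fun h => (h2.2 ⟨hx, h⟩).1⟩
  obtain ⟨L, hL⟩ := exists_rescaled_coord e hk2 hkl hΦc hC0 hΦC ((hzΦ z hzV).2.1 hzf) (hgrad z) hB0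
    (fun m hm => hB m hm z (ball_subset_closedBall (ball_subset_ball hr1 hzr)))
  obtain ⟨S, c, hc, hS, hSn, hSf⟩ := hL ρ hρ (hρr.trans hr1)
  have hxV : ∀ x ∈ ball (0 : Eu n) 1, z + ρ • L x ∈ V := by
    intro x hx
    refine hr0V ?_
    rw [mem_ball, dist_eq_norm] at hzr ⊢
    rw [mem_ball_zero_iff] at hx
    have h1 : ‖ρ • L x‖ ≤ ρ := by
      rw [norm_smul, L.norm_map, Real.norm_of_nonneg hρ.le]
      nlinarith
    calc ‖z + ρ • L x - y‖ = ‖(z - y) + ρ • L x‖ := by congr 1; abel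
      _ ≤ ‖z - y‖ + ‖ρ • L x‖ := norm_add_le _ _
      _ < r0 := by linarith
  have hCρ : C * ρ ≤ δ := by
    have h1 : C * ρ ≤ C * r := by gcongr
    have h2 : 0 ≤ N * B * r := by positivity
    nlinarith
  have hSf' : ∀ x, |c * Φ (z + ρ • L x) - (x e + ev S x)| ≤ δ * ‖x‖ ^ lam := fun x =>
    (hSf x).trans (mul_le_mul_of_nonneg_right hCρ (Real.rpow_nonneg (norm_nonneg _) _))
  refine ⟨L, S, ⟨hDo.preimage (by fun_prop), hS, hSn.trans ?_, fun x hx h => ?_,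
    fun x hx => ?_, fun x hx => ?_⟩⟩
  · rw [← hN]
    have h1 : N * (B * ρ) ≤ N * (B * r) := by gcongr
    have h2 : 0 ≤ C * r := by positivity
    nlinarith
  · refine (hzΦ _ (hxV x hx)).1.2 ?_
    have h1 := (abs_le.1 (hSf' x)).1
    exact pos_of_mul_pos_right (by linarith : 0 < c * Φ (z + ρ • L x)) hc.le
  · have h1 := (abs_le.1 (hSf' x)).2
    have h2 : 0 < c * Φ (z + ρ • L x) := mul_pos hc ((hzΦ _ (hxV x hx.2)).1.1 hx.1)
    linarith
  · rw [preimage_similarity_frontier L z hρ.ne'] at hx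
    have h1 := hSf' x
    rw [(hzΦ _ (hxV x hx.2)).2.1 hx.1, mul_zero, zero_sub, abs_neg] at h1
    exact h1

/-- A bounded set with boundary of class `C^lam` is, at small scales and uniformly along its
boundary, a small perturbation of a half space. -/
lemma exists_curved (e : Fin n) {lam : ℝ} (hlam : 2 < lam) (hni : ∀ m : ℕ, lam ≠ m)
    {D : Set (Eu n)} (hDo : IsOpen D) (hDb : Bornology.IsBounded D)
    (hbd : HasGraphBoundary D (HolderSmooth lam)) {δ : ℝ} (hδ : 0 < δ) :
    ∃ R : ℝ, 0 < R ∧ ∀ z ∈ frontier D, ∀ ρ, 0 < ρ → ρ ≤ R →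
      ∃ (L : Eu n ≃ₗᵢ[ℝ] Eu n) (S : Pol n),
        Curved e ⌊lam⌋₊ lam ((fun x => z + ρ • L x) ⁻¹' D) S δ := by
  have hK : IsCompact (frontier D) :=
    Metric.isCompact_of_isClosed_isBounded isClosed_frontier
      (hDb.closure.subset frontier_subset_closure)
  suffices h : ∃ R : ℝ, 0 < R ∧ ∀ z ∈ frontier D ∩ frontier D, ∀ ρ, 0 < ρ → ρ ≤ R →
      ∃ (L : Eu n ≃ₗᵢ[ℝ] Eu n) (S : Pol n),
        Curved e ⌊lam⌋₊ lam ((fun x => z + ρ • L x) ⁻¹' D) S δ by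
    simpa only [inter_self] using h
  refine hK.induction_on (p := fun s => ∃ R : ℝ, 0 < R ∧ ∀ z ∈ frontier D ∩ s, ∀ ρ, 0 < ρ → ρ ≤ R →
      ∃ (L : Eu n ≃ₗᵢ[ℝ] Eu n) (S : Pol n),
        Curved e ⌊lam⌋₊ lam ((fun x => z + ρ • L x) ⁻¹' D) S δ) ?_ ?_ ?_ ?_
  · exact ⟨1, one_pos, fun z hz => absurd hz.2 (notMem_empty z)⟩
  · rintro s t hst ⟨R, hR, h⟩
    exact ⟨R, hR, fun z hz => h z ⟨hz.1, hst hz.2⟩⟩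
  · rintro s t ⟨R, hR, h⟩ ⟨R', hR', h'⟩
    refine ⟨min R R', lt_min hR hR', fun z hz ρ hρ hρR => ?_⟩
    rcases hz.2 with h1 | h1
    · exact h z ⟨hz.1, h1⟩ ρ hρ (hρR.trans (min_le_left _ _))
    · exact h' z ⟨hz.1, h1⟩ ρ hρ (hρR.trans (min_le_right _ _))
  · intro y hy
    obtain ⟨r, hr, h⟩ := exists_curved_local e hlam hni hDo hbd hδ hy
    exact ⟨ball y r, mem_nhdsWithin_of_mem_nhds (ball_mem_nhds y hr), r, hr, h⟩

end

section

open Pol MvPolynomial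

/-- Every point of a bounded open set has a nearest boundary point. -/
lemma exists_nearest_frontier (hn : 2 < n) {D : Set (Eu n)} (hDo : IsOpen D)
    (hDb : Bornology.IsBounded D) {x : Eu n} (hx : x ∈ D) :
    0 < infDist x Dᶜ ∧ ∃ z ∈ frontier D, dist x z = infDist x Dᶜ := by
  have : Nontrivial (Eu n) := by
    refine ⟨⟨stdE ⟨0, by omega⟩, 0, fun h => ?_⟩⟩
    have := norm_stdE (n := n) ⟨0, by omega⟩
    rw [h, norm_zero] at this
    exact zero_ne_one this
  have hne : (Dᶜ).Nonempty := by
    rw [nonempty_compl]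
    rintro rfl
    exact NormedSpace.unbounded_univ ℝ (Eu n) hDb
  have hd : 0 < infDist x Dᶜ :=
    (hDo.isClosed_compl.notMem_iff_infDist_pos hne).1 (not_not.2 hx)
  obtain ⟨z, hz, hzd⟩ := hDo.isClosed_compl.exists_infDist_eq_dist hne x
  refine ⟨hd, z, ⟨?_, ?_⟩, hzd.symm⟩
  · refine closure_mono (ball_infDist_compl_subset (x := x)) ?_
    rw [closure_ball x hd.ne', mem_closedBall, dist_comm, hzd]
  · rw [hDo.interior_eq]; exact hz

/-- Derivative estimates up to the boundary for harmonic functions vanishing on the boundary. -/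
theorem boundary_estimate (hn : 2 < n) {lam : ℝ} (hlam : 2 < lam) (hni : ∀ m : ℕ, lam ≠ m)
    {D : Set (Eu n)} (hDo : IsOpen D) (hDb : Bornology.IsBounded D)
    (hbd : HasGraphBoundary D (HolderSmooth lam)) :
    ∃ C R : ℝ, 0 < C ∧ 0 < R ∧ ∀ (u : Eu n → ℝ) (x : Eu n) (r M : ℝ), x ∈ D → 0 < r → r ≤ R →
      0 < M → IsHarmonicOn u (D ∩ ball x r) → (∀ y ∈ D ∩ ball x r, |u y| ≤ M) →
      (∀ z ∈ frontier D ∩ ball x r, Filter.Tendsto u (𝓝[D] z) (𝓝 0)) →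
      (∀ m ≤ ⌊lam⌋₊, ‖iteratedFDeriv ℝ m u x‖ ≤ C * M * r⁻¹ ^ m) ∧
      ∀ d, 0 < d → d ≤ r → ball x d ⊆ D → ‖iteratedFDeriv ℝ (⌊lam⌋₊ + 1) u x‖ ≤
        C * M * r ^ (-lam) * d ^ (lam - (⌊lam⌋₊ + 1)) := by
  set k := ⌊lam⌋₊ with hk
  have hk2 : 2 ≤ k := Nat.le_floor (by exact_mod_cast hlam.le)
  have hkl : (k : ℝ) < lam := lt_of_le_of_ne (Nat.floor_le (by linarith)) (hni k).symm
  have hlk : lam < k + 1 := Nat.lt_floor_add_one lam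
  set e : Fin n := ⟨0, by omega⟩
  obtain ⟨δ, C₁, hδ, hC₁, hcur⟩ := Curved.deriv_estimate hn e hk2 hkl hlk
  obtain ⟨R, hR, hchart⟩ := exists_curved e hlam hni hDo hDb hbd hδ
  choose Ci hCi0 hCi using interior_estimate (n := n) hn
  set K : ℝ := ∑ m ∈ Finset.range (k + 2), Ci m with hK
  have hKm : ∀ m ≤ k + 1, Ci m ≤ K := fun m hm =>
    Finset.single_le_sum (f := Ci) (fun i _ => (hCi0 i).le) (Finset.mem_range.2 (by omega))
  have hK0 : 0 < K := (hCi0 0).trans_le (hKm 0 (by omega))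
  refine ⟨K * 4 ^ (k + 1) + C₁ * 4 ^ (k + 1), R, by positivity, hR, ?_⟩
  intro u x r M hx hr hrR hM hu huM hbdry
  obtain ⟨hd0, z, hz, hxz⟩ := exists_nearest_frontier hn hDo hDb hx
  set d₀ := infDist x Dᶜ with hd₀
  have hbD : ball x d₀ ⊆ D := ball_infDist_compl_subset
  rcases le_or_gt (r / 4) d₀ with hcase | hcase
  · have hsub : ball x (r / 4) ⊆ D ∩ ball x r := fun y hy =>
      ⟨hbD (ball_subset_ball hcase hy), ball_subset_ball (by linarith) hy⟩
    have hm : ∀ m ≤ k + 1, ‖iteratedFDeriv ℝ m u x‖ ≤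
        (K * 4 ^ (k + 1) + C₁ * 4 ^ (k + 1)) * M * r⁻¹ ^ m := by
      intro m hm
      refine (hCi m u x (r / 4) M (by positivity) (hu.mono hsub)
        (fun y hy => huM y (hsub hy))).trans ?_
      have h1 : (r / 4)⁻¹ ^ m = 4 ^ m * r⁻¹ ^ m := by rw [inv_div, div_eq_mul_inv, mul_pow]
      have h2 : (4 : ℝ) ^ m ≤ 4 ^ (k + 1) := pow_le_pow_right₀ (by norm_num) hm
      have h3 : 0 ≤ C₁ * 4 ^ (k + 1) * M * r⁻¹ ^ m := by positivity
      have h4 : Ci m * M * (4 ^ m * r⁻¹ ^ m) ≤ K * M * (4 ^ (k + 1) * r⁻¹ ^ m) := by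
        gcongr
        · exact hKm m hm
      rw [h1]; nlinarith
    refine ⟨fun m hmk => hm m (by omega), fun d hd hdr hbd => (hm (k + 1) le_rfl).trans ?_⟩
    rw [mul_assoc _ (r ^ (-lam))]
    gcongr
    have h1 : r⁻¹ ^ (k + 1) = r ^ (-lam) * r ^ (lam - (k + 1)) := by
      rw [← Real.rpow_add hr, inv_pow, ← Real.rpow_natCast, ← Real.rpow_neg hr.le]
      congr 1; push_cast; ring
    rw [h1]
    exact mul_le_mul_of_nonneg_left (Real.rpow_le_rpow_of_nonpos hd hdr (by linarith))
      (Real.rpow_nonneg hr.le _)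
  · set ρ := r / 2 with hρ
    have hρ0 : 0 < ρ := by positivity
    obtain ⟨L, S, hS⟩ := hchart z hz ρ hρ0 (by linarith)
    set w : Eu n → ℝ := fun y => u (z + ρ • L y) with hw
    set y₀ : Eu n := L.symm (ρ⁻¹ • (x - z)) with hy₀
    have hAy : z + ρ • L y₀ = x := by
      rw [hy₀, L.apply_symm_apply, smul_smul, mul_inv_cancel₀ hρ0.ne', one_smul]; abel
    have hdist : ∀ y y', dist (z + ρ • L y) (z + ρ • L y') = ρ * dist y y' := by
      intro y y'
      rw [dist_add_left, dist_smul₀, L.dist_map, Real.norm_of_nonneg hρ0.le]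
    have hAb : ∀ y ∈ ball (0 : Eu n) 1, z + ρ • L y ∈ ball x r := by
      intro y hy
      have h1 := hdist y 0
      rw [map_zero, smul_zero, add_zero] at h1
      rw [mem_ball] at hy ⊢
      have h2 : ρ * dist y 0 < ρ := by nlinarith
      have := dist_triangle (z + ρ • L y) z x
      rw [dist_comm z x, hxz] at this
      linarith
    set d₁ := d₀ / ρ with hd₁
    have hd₁0 : 0 < d₁ := by positivity
    have hy₀n : ‖y₀‖ = d₁ := by
      rw [hy₀, L.symm.norm_map, norm_smul, ← dist_eq_norm, hxz, norm_inv,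
        Real.norm_of_nonneg hρ0.le, hd₁, div_eq_inv_mul]
    have hAc : Continuous fun y : Eu n => z + ρ • L y := by fun_prop
    have hDB : IsOpen (D ∩ ball x r) := hDo.inter isOpen_ball
    have hsub : (fun y => z + ρ • L y) ⁻¹' D ∩ ball 0 1 ⊆
        (fun y => z + ρ • L y) ⁻¹' (D ∩ ball x r) := fun y hy => ⟨hy.1, hAb y hy.2⟩
    have hwh : IsHarmonicOn w ((fun y => z + ρ • L y) ⁻¹' D ∩ ball 0 1) :=
      (hu.comp_similarity hDB L z ρ).mono hsub
    have hΩo : IsOpen ((fun y => z + ρ • L y) ⁻¹' D ∩ ball (0 : Eu n) 1) :=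
      (hDo.preimage hAc).inter isOpen_ball
    have hd₁h : 2 * d₁ ≤ 1 := by
      rw [hd₁, mul_div_assoc', div_le_one hρ0]; linarith
    have hy₀m : y₀ ∈ (fun y => z + ρ • L y) ⁻¹' D ∩ ball (0 : Eu n) 1 := by
      refine ⟨by rw [mem_preimage, hAy]; exact hx, ?_⟩
      rw [mem_ball_zero_iff, hy₀n]; linarith
    obtain ⟨h1, h2⟩ := hcur _ S (fun y => M⁻¹ * w y) hS (hwh.const_mul hΩo M⁻¹)
      (fun y hy => by
        rw [abs_mul, abs_of_pos (inv_pos.2 hM), inv_mul_le_one₀ hM]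
        exact huM _ (hsub hy))
      (fun y hy => by
        rw [preimage_similarity_frontier L z hρ0.ne'] at hy
        have h3 : Filter.Tendsto (fun y => z + ρ • L y) (𝓝[(fun y => z + ρ • L y) ⁻¹' D] y)
            (𝓝[D] (z + ρ • L y)) :=
          hAc.continuousWithinAt.tendsto_nhdsWithin (mapsTo_preimage _ _)
        have h4 := ((hbdry _ ⟨hy.1, hAb y hy.2⟩).comp h3).const_mul M⁻¹
        rwa [mul_zero] at h4)
      y₀ d₁ hd₁0 hd₁h hy₀n.le
      (fun y hy => by
        refine hbD ?_
        change z + ρ • L y ∈ ball x d₀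
        rw [mem_ball] at hy ⊢
        rw [← hAy, hdist]
        rw [hd₁, lt_div_iff₀ hρ0] at hy
        linarith)
    have hscale : ∀ m : ℕ, ∀ B, ‖iteratedFDeriv ℝ m (fun y => M⁻¹ * w y) y₀‖ ≤ B →
        ‖iteratedFDeriv ℝ m u x‖ ≤ B * M * ρ⁻¹ ^ m := by
      intro m B hB
      have h3 := norm_iteratedFDeriv_le_of_comp_similarity u L z hρ0 m y₀
      rw [hAy] at h3
      refine h3.trans ?_
      gcongr
      have h4 : iteratedFDeriv ℝ m (fun y => M⁻¹ * w y) y₀ = M⁻¹ • iteratedFDeriv ℝ m w y₀ :=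
        iteratedFDeriv_const_smul_apply' (a := M⁻¹)
          ((hwh.smooth hn hΩo hy₀m).of_le (by exact_mod_cast le_top))
      rw [h4, norm_smul, norm_inv, Real.norm_of_nonneg hM.le, inv_mul_le_iff₀ hM] at hB
      linarith
    have hρi : ∀ m : ℕ, m ≤ k + 1 → ρ⁻¹ ^ m ≤ 4 ^ (k + 1) * r⁻¹ ^ m := by
      intro m hm
      rw [hρ, inv_div, div_eq_mul_inv, mul_pow]
      gcongr
      exact (pow_le_pow_left₀ (by norm_num) (by norm_num) m).trans
        (pow_le_pow_right₀ (by norm_num : (1 : ℝ) ≤ 4) hm)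
    refine ⟨fun m hm => (hscale m _ (h1 m hm)).trans ?_, fun d hd hdr hbd =>
      (hscale (k + 1) _ h2).trans ?_⟩
    · have h3 : C₁ * M * ρ⁻¹ ^ m ≤ C₁ * M * (4 ^ (k + 1) * r⁻¹ ^ m) :=
        mul_le_mul_of_nonneg_left (hρi m (by omega)) (by positivity)
      have h4 : 0 ≤ K * 4 ^ (k + 1) * M * r⁻¹ ^ m := by positivity
      nlinarith
    · have hdd : d ≤ d₀ := by
        by_contra hlt
        have : z ∈ D := hbd (by rw [mem_ball, dist_comm, hxz]; linarith)
        exact hz.2 (by rwa [hDo.interior_eq])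
      have h3 : d₀ ^ (lam - (k + 1)) ≤ d ^ (lam - (k + 1)) :=
        Real.rpow_le_rpow_of_nonpos hd hdd (by linarith)
      have h4 : d₁ ^ (lam - (k + 1)) * ρ⁻¹ ^ (k + 1) = ρ ^ (-lam) * d₀ ^ (lam - (k + 1)) := by
        rw [hd₁, Real.div_rpow hd0.le hρ0.le, div_eq_mul_inv, ← Real.rpow_neg hρ0.le, inv_pow,
          ← Real.rpow_natCast, ← Real.rpow_neg hρ0.le, mul_assoc, ← Real.rpow_add hρ0, mul_comm]
        congr 2; push_cast; ring
      have h5 : ρ ^ (-lam) ≤ 4 ^ (k + 1) * r ^ (-lam) := by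
        rw [hρ, Real.div_rpow hr.le (by norm_num), div_eq_mul_inv, mul_comm,
          ← Real.rpow_neg (by norm_num), neg_neg]
        gcongr
        calc (2 : ℝ) ^ lam ≤ 2 ^ ((k + 1 : ℕ) : ℝ) :=
              Real.rpow_le_rpow_of_exponent_le (by norm_num) (by push_cast; linarith)
          _ = 2 ^ (k + 1) := Real.rpow_natCast _ _
          _ ≤ 4 ^ (k + 1) := pow_le_pow_left₀ (by norm_num) (by norm_num) _
      have h6 : 0 < r ^ (-lam) := Real.rpow_pos_of_pos hr _
      have h7 : 0 < d ^ (lam - (k + 1)) := Real.rpow_pos_of_pos hd _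
      calc C₁ * d₁ ^ (lam - (k + 1)) * M * ρ⁻¹ ^ (k + 1)
          = C₁ * M * (d₁ ^ (lam - (k + 1)) * ρ⁻¹ ^ (k + 1)) := by ring
        _ = C₁ * M * (ρ ^ (-lam) * d₀ ^ (lam - (k + 1))) := by rw [h4]
        _ ≤ C₁ * M * ((4 ^ (k + 1) * r ^ (-lam)) * d ^ (lam - (k + 1))) := by
            gcongr
        _ ≤ (K * 4 ^ (k + 1) + C₁ * 4 ^ (k + 1)) * M * r ^ (-lam) * d ^ (lam - (k + 1)) := by
            have h8 : 0 ≤ K * 4 ^ (k + 1) * M * r ^ (-lam) * d ^ (lam - (k + 1)) := by positivity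
            nlinarith

end

lemma sphereArea_pos (hn : 2 < n) : 0 < sphereArea n := by
  have h1 : 0 < volume (ball (0 : Eu n) 1) := measure_ball_pos _ _ one_pos
  have h2 : volume (ball (0 : Eu n) 1) < ⊤ := measure_ball_lt_top
  have h3 : (0 : ℝ) < n := by exact_mod_cast (by omega : 0 < n)
  exact mul_pos h3 (ENNReal.toReal_pos h1.ne' h2.ne)

/-- The normalizing constant of the fundamental solution. -/
def fundConst (n : ℕ) : ℝ := ((n : ℝ) - 2)⁻¹ * (sphereArea n)⁻¹

lemma fundConst_pos (hn : 2 < n) : 0 < fundConst n := by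
  have h3 : (2 : ℝ) < n := by exact_mod_cast hn
  exact mul_pos (inv_pos.2 (by linarith)) (inv_pos.2 (sphereArea_pos hn))

lemma fundSol_eq (x : Eu n) : fundSol n x = -(fundConst n * ‖x‖ ^ (2 - (n : ℝ))) := rfl

lemma fundSol_nonpos (hn : 2 < n) (x : Eu n) : fundSol n x ≤ 0 := by
  rw [fundSol_eq, neg_nonpos]
  exact mul_nonneg (fundConst_pos hn).le (Real.rpow_nonneg (norm_nonneg _) _)

lemma fundSol_congr {x y : Eu n} (h : ‖x‖ = ‖y‖) : fundSol n x = fundSol n y := by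
  rw [fundSol_eq, fundSol_eq, h]

lemma fundSol_sub_comm (x y : Eu n) : fundSol n (x - y) = fundSol n (y - x) :=
  fundSol_congr (norm_sub_rev x y)

lemma fundSol_le_fundSol (hn : 2 < n) {x y : Eu n} (hx : 0 < ‖x‖) (h : ‖x‖ ≤ ‖y‖) :
    fundSol n x ≤ fundSol n y := by
  have h3 : (2 : ℝ) < n := by exact_mod_cast hn
  rw [fundSol_eq, fundSol_eq, neg_le_neg_iff]
  exact mul_le_mul_of_nonneg_left (Real.rpow_le_rpow_of_nonpos hx h (by linarith))
    (fundConst_pos hn).le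

lemma contDiffAt_fundSol {x : Eu n} (hx : x ≠ 0) : ContDiffAt ℝ ∞ (fundSol n) x := by
  have h : ContDiffAt ℝ ∞ (fun x : Eu n => -(fundConst n * ‖x‖ ^ (2 - (n : ℝ)))) x :=
    (contDiffAt_const.mul ((contDiffAt_norm ℝ hx).rpow_const_of_ne (norm_ne_zero_iff.2 hx))).neg
  exact h

lemma lapl_fundSol {x : Eu n} (hx : x ≠ 0) : lapl (fundSol n) x = 0 := by
  set p : ℝ := (2 - (n : ℝ)) / 2 with hp
  have hx2 : 0 < ‖x‖ ^ 2 := by positivity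
  have h1 : fundSol n = fun y : Eu n => (fun s : ℝ => -(fundConst n * s ^ p)) (‖y‖ ^ 2) := by
    funext y
    rw [fundSol_eq]
    have : (‖y‖ ^ 2) ^ p = ‖y‖ ^ (2 - (n : ℝ)) := by
      rw [← Real.rpow_natCast, ← Real.rpow_mul (norm_nonneg _), hp]
      congr 1; push_cast; ring
    simp only [this]
  have hd : ∀ q s : ℝ, 0 < s → HasDerivAt (fun s : ℝ => s ^ q) (q * s ^ (q - 1)) s := fun q s hs =>
    Real.hasDerivAt_rpow_const (Or.inl hs.ne')
  rw [h1, lapl_radial (f := fun s : ℝ => -(fundConst n * s ^ p))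
    (f' := fun s => -(fundConst n * (p * s ^ (p - 1))))
    (f'' := -(fundConst n * (p * ((p - 1) * (‖x‖ ^ 2) ^ (p - 1 - 1)))))]
  · have h2 : (‖x‖ ^ 2) ^ (p - 1) = ‖x‖ ^ 2 * (‖x‖ ^ 2) ^ (p - 1 - 1) := by
      rw [Real.rpow_sub_one hx2.ne' (p - 1)]; field_simp
    simp only [h2]
    have h3 : (n : ℝ) = 2 - 2 * p := by rw [hp]; ring
    rw [h3]; ring
  · filter_upwards [lt_mem_nhds hx2] with s hs
    exact ((hd p s hs).const_mul _).neg
  · exact (((hd (p - 1) _ hx2).const_mul p).const_mul _).neg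

lemma contDiffAt_fundSol_sub {x y : Eu n} (hx : x ≠ y) :
    ContDiffAt ℝ ∞ (fun z => fundSol n (z - y)) x :=
  ContDiffAt.comp (f := fun z => z - y) (g := fundSol n) x
    (contDiffAt_fundSol (sub_ne_zero.2 hx)) (contDiffAt_id.sub contDiffAt_const)

lemma isHarmonicOn_fundSol_sub (y : Eu n) : IsHarmonicOn (fun z => fundSol n (z - y)) {y}ᶜ := by
  refine isHarmonicOn_of_contDiffAt fun x hx =>
    ⟨(contDiffAt_fundSol_sub hx).of_le two_le_infty, ?_⟩
  have h := lapl_comp_similarity (u := fundSol n) (LinearIsometryEquiv.refl ℝ (Eu n)) (-y) 1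
    (x := x) ?_
  · have h1 : (fun z : Eu n => fundSol n (-y + (1 : ℝ) • LinearIsometryEquiv.refl ℝ (Eu n) z)) =
        fun z => fundSol n (z - y) := by
      funext z; congr 1; simp; abel
    rw [h1] at h
    rw [h, lapl_fundSol, mul_zero]
    simpa [neg_add_eq_sub, sub_eq_zero] using hx
  · refine (contDiffAt_fundSol ?_).of_le two_le_infty
    simpa [neg_add_eq_sub, sub_eq_zero] using hx

lemma continuousAt_fundSol_sub {x y : Eu n} (hx : x ≠ y) :
    ContinuousAt (fun p : Eu n × Eu n => fundSol n (p.1 - p.2)) (x, y) := by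
  have h : ContinuousAt (fundSol n) (x - y) := (contDiffAt_fundSol (sub_ne_zero.2 hx)).continuousAt
  exact ContinuousAt.comp (f := fun p : Eu n × Eu n => p.1 - p.2) (x := (x, y)) h (by fun_prop)

/-- The fundamental solution tends to `-∞` at its pole. -/
lemma eventually_fundSol_sub_le (hn : 2 < n) (y : Eu n) (M : ℝ) :
    ∀ᶠ x in 𝓝[≠] y, fundSol n (x - y) ≤ M := by
  have h3 : (2 : ℝ) < n := by exact_mod_cast hn
  have h1 : Filter.Tendsto (fun x : Eu n => ‖x - y‖) (𝓝[≠] y) (𝓝[>] 0) :=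
    tendsto_norm_sub_self_nhdsNE y
  have h2 : Filter.Tendsto (fun t : ℝ => t ^ (2 - (n : ℝ))) (𝓝[>] 0) Filter.atTop :=
    tendsto_rpow_neg_nhdsGT_zero (by linarith)
  have h4 := ((h2.comp h1).const_mul_atTop (fundConst_pos hn)).eventually_ge_atTop (-M)
  filter_upwards [h4] with x hx
  rw [fundSol_eq]
  simp only [Function.comp] at hx
  linarith

lemma IsKernel.pdMulti_dil_eq_zero {η : Eu n → ℝ} (hη : IsKernel n η) {t : ℝ} (ht : 0 < t)
    (L : List (Fin n)) {x : Eu n} (hx : t < ‖x‖) : pdMulti L (dil η t) x = 0 := by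
  refine image_eq_zero_of_notMem_tsupport fun h => ?_
  have h1 : tsupport (dil η t) ⊆ closedBall 0 t := by
    refine closure_minimal (fun z hz => ?_) isClosed_closedBall
    rw [mem_closedBall_zero_iff]
    by_contra! h
    exact hz (hη.dil_eq_zero ht h.le)
  have h2 := h1 (tsupport_pdMulti_subset L _ h)
  rw [mem_closedBall_zero_iff] at h2
  linarith

lemma IsKernel.tsupport_pdMulti_dil_sub {η : Eu n → ℝ} (hη : IsKernel n η) {t : ℝ} (ht : 0 < t)
    (L : List (Fin n)) (x : Eu n) :
    tsupport (fun y => pdMulti L (dil η t) (x - y)) ⊆ closedBall x t := by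
  refine closure_minimal (fun y hy => ?_) isClosed_closedBall
  rw [mem_closedBall, dist_comm, dist_eq_norm]
  by_contra! h
  exact hy (hη.pdMulti_dil_eq_zero ht L h)

lemma IsKernel.continuous_pdMulti_dil_sub {η : Eu n → ℝ} (hη : IsKernel n η) (t : ℝ)
    (L : List (Fin n)) (x : Eu n) : Continuous (fun y => pdMulti L (dil η t) (x - y)) :=
  ((contDiff_dil hη.smooth t).pdMulti_top L).continuous.comp (by fun_prop)

/-- Derivatives of a harmonic function as averages over balls. -/
lemma IsHarmonicOn.pdMulti_eq_integral {η : Eu n → ℝ} (hη : IsKernel n η) {f : Eu n → ℝ}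
    {Ω : Set (Eu n)} (hf : IsHarmonicOn f Ω) {x : Eu n} {t r : ℝ} (ht : 0 < t)
    (htr : t < r) (hr : closedBall x r ⊆ Ω) (L : List (Fin n)) :
    pdMulti L f x = ∫ y, f y * pdMulti L (dil η t) (x - y) := by
  have hsub := ball_subset_closedBall.trans hr
  have hc : ContinuousOn f (closedBall x r) := hf.1.continuousOn.mono hr
  obtain ⟨M, hM⟩ := (isCompact_closedBall x r).exists_bound_of_continuousOn hc
  have hloc : LocallyIntegrable ((ball x r).indicator f) :=
    locallyIntegrable_indicator_of_bound isOpen_ball (hc.mono ball_subset_closedBall)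
      (M := M) fun y hy => hM y (ball_subset_closedBall hy)
  have h1 := WeaklyHarmonicOn.eventuallyEq_cv hη ht htr (hc.mono ball_subset_closedBall)
    ((hf.mono hsub).weaklyHarmonicOn isOpen_ball)
  rw [(pdMulti_congr_nhds L h1).eq_of_nhds, pdMulti_cv hloc (contDiff_dil hη.smooth t)
    (hη.dil_hasCompactSupport ht), cv]
  refine integral_congr_ae (ae_of_all _ fun y => ?_)
  by_cases hy : y ∈ ball x r
  · simp only [indicator_of_mem hy]
  · simp only [indicator_of_notMem hy, zero_mul]
    rw [hη.pdMulti_dil_eq_zero ht L, mul_zero]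
    rw [mem_ball, dist_comm, dist_eq_norm] at hy
    linarith

lemma eventually_le_add_of_continuousOn_closure {Ω : Set (Eu n)} {u v : Eu n → ℝ}
    (hu : ContinuousOn u (closure Ω)) (hv : ContinuousOn v (closure Ω)) {z : Eu n}
    (hz : z ∈ closure Ω) (h : u z ≤ v z) {ε : ℝ} (hε : 0 < ε) :
    ∀ᶠ x in 𝓝[Ω] z, u x ≤ v x + ε := by
  have h1 : Filter.Tendsto (fun x => v x + ε - u x) (𝓝[Ω] z) (𝓝 (v z + ε - u z)) :=
    (((hv z hz).mono subset_closure).add tendsto_const_nhds).sub ((hu z hz).mono subset_closure)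
  filter_upwards [h1.eventually (lt_mem_nhds (by linarith : (0 : ℝ) < v z + ε - u z))] with x hx
  linarith

/-- Comparison of harmonic functions that are continuous up to the boundary. -/
lemma IsHarmonicOn.le_of_le_frontier (hn : 0 < n) {Ω : Set (Eu n)} (hΩ : IsOpen Ω)
    (hb : Bornology.IsBounded Ω) {u v : Eu n → ℝ} (hu : IsHarmonicOn u Ω)
    (hv : IsHarmonicOn v Ω) (huc : ContinuousOn u (closure Ω)) (hvc : ContinuousOn v (closure Ω))
    (h : ∀ z ∈ frontier Ω, u z ≤ v z) : ∀ x ∈ closure Ω, u x ≤ v x := by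
  intro x hx
  by_cases hxΩ : x ∈ Ω
  · refine comparison_principle hn hΩ hb (fun x hx => hu.contDiffAt hΩ hx)
      (fun x hx => hv.contDiffAt hΩ hx) (fun x hx => (hv.2 x hx).trans_le (hu.2 x hx).ge)
      (fun z hz ε hε => ?_) x hxΩ
    exact eventually_le_add_of_continuousOn_closure huc hvc (frontier_subset_closure hz) (h z hz) hε
  · exact h x ⟨hx, by rwa [hΩ.interior_eq]⟩

section Green

variable {D : Set (Eu n)} {U : Eu n → Eu n → ℝ}

lemma IsGreenCorrection.nonpos (hn : 2 < n) (hDo : IsOpen D) (hDb : Bornology.IsBounded D)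
    (hU : IsGreenCorrection D U) {x y : Eu n} (hx : x ∈ closure D) (hy : y ∈ D) : U x y ≤ 0 := by
  obtain ⟨h1, h2, h3⟩ := hU y hy
  refine IsHarmonicOn.le_of_le_frontier (by omega) hDo hDb h1 (isHarmonicOn_const 0 D) h2
    continuousOn_const (fun z hz => ?_) x hx
  rw [h3 z hz]
  exact fundSol_nonpos hn _

lemma IsGreenCorrection.fundSol_le (hn : 2 < n) (hDo : IsOpen D) (hDb : Bornology.IsBounded D)
    (hU : IsGreenCorrection D U) {x y : Eu n} (hx : x ∈ D) (hy : y ∈ D) (hxy : x ≠ y) :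
    fundSol n (x - y) ≤ U x y := by
  obtain ⟨h1, h2, h3⟩ := hU y hy
  have hO : IsOpen (D \ {y}) := hDo.sdiff isClosed_singleton
  have hF := (isHarmonicOn_fundSol_sub y).mono (fun z hz => hz.2 : D \ {y} ⊆ {y}ᶜ)
  have hU' := h1.mono (sdiff_subset : D \ {y} ⊆ D)
  refine comparison_principle (by omega) hO (hDb.subset sdiff_subset)
      (fun x hx => hF.contDiffAt hO hx)
      (fun x hx => hU'.contDiffAt hO hx) (fun x hx => (hU'.2 x hx).trans_le (hF.2 x hx).ge)
      (fun z hz ε hε => ?_) x ⟨hx, hxy⟩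
  have hzc : z ∈ closure D := closure_mono sdiff_subset (frontier_subset_closure hz)
  have hUz : Filter.Tendsto (fun x => U x y) (𝓝[D \ {y}] z) (𝓝 (U z y)) :=
    (h2 z hzc).mono (sdiff_subset.trans subset_closure)
  by_cases hzy : z = y
  · subst hzy
    have h4 : ∀ᶠ x in 𝓝[D \ {z}] z, fundSol n (x - z) ≤ U z z - 1 :=
      (eventually_fundSol_sub_le hn z _).filter_mono (nhdsWithin_mono _ fun w hw => hw.2)
    filter_upwards [h4, hUz.eventually (lt_mem_nhds (by linarith : U z z - 1 < U z z))] with x a b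
    linarith
  · have hzD : z ∉ D := by
      intro hzD
      have := hz.2
      rw [hO.interior_eq] at this
      exact this ⟨hzD, hzy⟩
    have h4 : Filter.Tendsto (fun x => fundSol n (x - y)) (𝓝[D \ {y}] z) (𝓝 (fundSol n (z - y))) :=
      (contDiffAt_fundSol_sub hzy).continuousAt.continuousWithinAt
    have h5 : fundSol n (z - y) = U z y := by
      rw [h3 z ⟨hzc, by rwa [hDo.interior_eq]⟩, fundSol_sub_comm]
    rw [h5] at h4
    filter_upwards [(h4.sub hUz).eventually (gt_mem_nhds (by linarith : U z y - U z y < ε))]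
      with x a
    linarith

/-- The correction term is jointly continuous. -/
lemma IsGreenCorrection.continuousOn (hn : 2 < n) (hDo : IsOpen D) (hDb : Bornology.IsBounded D)
    (hU : IsGreenCorrection D U) :
    ContinuousOn (fun p : Eu n × Eu n => U p.1 p.2) (closure D ×ˢ D) := by
  rintro ⟨x, y⟩ ⟨hx, hy⟩
  simp only at hx hy
  have hcpt : IsCompact (frontier D) :=
    Metric.isCompact_of_isClosed_isBounded isClosed_frontier
      (hDb.closure.subset frontier_subset_closure)
  rw [ContinuousWithinAt, Metric.tendsto_nhds]
  intro ε hε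
  have key : ∀ᶠ y' in 𝓝 y, ∀ z ∈ frontier D, |fundSol n (y' - z) - fundSol n (y - z)| < ε / 2 := by
    refine hcpt.eventually_forall_of_forall_eventually fun z hz => ?_
    have hyz : y ≠ z := by
      rintro rfl
      exact hz.2 (by rwa [hDo.interior_eq])
    have h1 := continuousAt_fundSol_sub hyz
    have h2 : ContinuousAt (fun p : Eu n × Eu n => fundSol n (y - p.2)) (y, z) :=
      ContinuousAt.comp (f := fun p : Eu n × Eu n => (y, p.2))
        (g := fun p : Eu n × Eu n => fundSol n (p.1 - p.2)) (x := (y, z)) h1 (by fun_prop)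
    have h3 := (h1.sub h2).abs
    have h4 : |fundSol n (y - z) - fundSol n (y - z)| < ε / 2 := by simpa using half_pos hε
    exact h3.eventually (gt_mem_nhds h4)
  have h1 : ∀ᶠ p : Eu n × Eu n in 𝓝[closure D ×ˢ D] (x, y), |U p.1 p.2 - U p.1 y| ≤ ε / 2 := by
    have h2 : Filter.Tendsto (Prod.snd : Eu n × Eu n → Eu n) (𝓝[closure D ×ˢ D] (x, y)) (𝓝 y) :=
      (continuous_snd.tendsto (x, y)).mono_left nhdsWithin_le_nhds
    filter_upwards [h2.eventually key, self_mem_nhdsWithin] with p hp hpD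
    obtain ⟨a1, a2, a3⟩ := hU p.2 hpD.2
    obtain ⟨b1, b2, b3⟩ := hU y hy
    have c1 := IsHarmonicOn.le_of_le_frontier (by omega) hDo hDb a1
      (b1.add hDo (isHarmonicOn_const (ε / 2) D)) a2 (b2.add continuousOn_const) (fun z hz => by
        have := abs_lt.1 (hp z hz); rw [a3 z hz, b3 z hz]; linarith) p.1 hpD.1
    have c2 := IsHarmonicOn.le_of_le_frontier (by omega) hDo hDb b1
      (a1.add hDo (isHarmonicOn_const (ε / 2) D)) b2 (a2.add continuousOn_const) (fun z hz => by
        have := abs_lt.1 (hp z hz); rw [a3 z hz, b3 z hz]; linarith) p.1 hpD.1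
    rw [abs_le]
    constructor <;> linarith
  have h3 : Filter.Tendsto (fun p : Eu n × Eu n => U p.1 y) (𝓝[closure D ×ˢ D] (x, y))
      (𝓝 (U x y)) := by
    have h4 := (hU y hy).2.1 x hx
    refine Filter.Tendsto.comp h4 (tendsto_nhdsWithin_iff.2
      ⟨(continuous_fst.tendsto (x, y)).mono_left nhdsWithin_le_nhds, ?_⟩)
    filter_upwards [self_mem_nhdsWithin] with p hp using hp.1
  filter_upwards [h1, (Metric.tendsto_nhds.1 h3) (ε / 2) (half_pos hε)] with p a b
  rw [Real.dist_eq] at b ⊢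
  calc |U p.1 p.2 - U x y| = |(U p.1 p.2 - U p.1 y) + (U p.1 y - U x y)| := by ring_nf
    _ ≤ _ := abs_add_le _ _
    _ < ε := by linarith

end Green

section Parametric

variable {A D : Set (Eu n)} {F : Eu n → Eu n → ℝ}

lemma continuousOn_mul_of_tsupport (hD : IsOpen D)
    (hF : ContinuousOn (fun p : Eu n × Eu n => F p.1 p.2) (A ×ˢ D)) {ψ : Eu n → ℝ}
    (hψ : Continuous ψ) (hs : tsupport ψ ⊆ D) :
    ContinuousOn (fun p : Eu n × Eu n => F p.1 p.2 * ψ p.2) (A ×ˢ univ) := by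
  rintro ⟨x, y⟩ ⟨hx, -⟩
  simp only at hx
  by_cases hy : y ∈ tsupport ψ
  · have h1 := (hF (x, y) ⟨hx, hs hy⟩).mul (hψ.comp continuous_snd).continuousWithinAt
    refine h1.mono_of_mem_nhdsWithin ?_
    have h2 : (Prod.snd : Eu n × Eu n → Eu n) ⁻¹' D ∈ 𝓝[A ×ˢ univ] (x, y) :=
      nhdsWithin_le_nhds (continuous_snd.continuousAt (hD.mem_nhds (hs hy)))
    filter_upwards [h2, self_mem_nhdsWithin] with p hp hp'
    exact ⟨hp'.1, hp⟩
  · have h2 : (Prod.snd : Eu n × Eu n → Eu n) ⁻¹' (tsupport ψ)ᶜ ∈ 𝓝[A ×ˢ univ] (x, y) :=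
      nhdsWithin_le_nhds
        (continuous_snd.continuousAt ((isClosed_tsupport ψ).isOpen_compl.mem_nhds hy))
    refine (continuousWithinAt_const (b := (0 : ℝ))).congr_of_eventuallyEq ?_ ?_
    · filter_upwards [h2] with p hp
      rw [image_eq_zero_of_notMem_tsupport hp, mul_zero]
    · simp only [image_eq_zero_of_notMem_tsupport hy, mul_zero]

lemma continuousOn_integral_mul (hD : IsOpen D)
    (hF : ContinuousOn (fun p : Eu n × Eu n => F p.1 p.2) (A ×ˢ D)) {ψ : Eu n → ℝ}
    (hψ : Continuous ψ) (hc : HasCompactSupport ψ) (hs : tsupport ψ ⊆ D) :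
    ContinuousOn (fun x => ∫ y, F x y * ψ y) A := by
  refine continuousOn_integral_of_compact_support (k := tsupport ψ) hc
    (continuousOn_mul_of_tsupport hD hF hψ hs) fun x y _ hy => ?_
  rw [image_eq_zero_of_notMem_tsupport hy, mul_zero]

lemma weaklyHarmonicOn_integral_mul (hA : IsOpen A) (hD : IsOpen D)
    (hF : ContinuousOn (fun p : Eu n × Eu n => F p.1 p.2) (A ×ˢ D))
    (hw : ∀ y ∈ D, WeaklyHarmonicOn (fun x => F x y) A) {ψ : Eu n → ℝ}
    (hψ : Continuous ψ) (hc : HasCompactSupport ψ) (hs : tsupport ψ ⊆ D) :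
    WeaklyHarmonicOn (fun x => ∫ y, F x y * ψ y) A := by
  intro φ hφ hφc hφs
  have hLs : tsupport (lapl φ) ⊆ A := (tsupport_lapl_subset φ).trans hφs
  have hcont : Continuous (Function.uncurry fun x y => F x y * ψ y * lapl φ x) := by
    rw [continuous_iff_continuousAt]
    rintro ⟨x, y⟩
    by_cases hx : x ∈ tsupport (lapl φ)
    · have h1 := (continuousOn_mul_of_tsupport hD hF hψ hs).continuousAt
        (x := (x, y)) ((hA.prod isOpen_univ).mem_nhds ⟨hLs hx, mem_univ _⟩)
      exact h1.mul (hφ.lapl_top.continuous.comp continuous_fst).continuousAt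
    · refine (continuousAt_const (y := (0 : ℝ))).congr ?_
      have h2 : (Prod.fst : Eu n × Eu n → Eu n) ⁻¹' (tsupport (lapl φ))ᶜ ∈ 𝓝 (x, y) :=
        continuous_fst.continuousAt ((isClosed_tsupport _).isOpen_compl.mem_nhds hx)
      filter_upwards [h2] with p hp
      simp only [Function.uncurry, image_eq_zero_of_notMem_tsupport hp, mul_zero]
  have hsupp : HasCompactSupport (Function.uncurry fun x y => F x y * ψ y * lapl φ x) := by
    refine HasCompactSupport.intro (K := tsupport (lapl φ) ×ˢ tsupport ψ)
      (hφc.lapl.isCompact.prod hc.isCompact) ?_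
    rintro ⟨x, y⟩ hp
    simp only [Function.uncurry]
    by_cases hx : x ∈ tsupport (lapl φ)
    · have hy : y ∉ tsupport ψ := fun hy => hp ⟨hx, hy⟩
      simp [image_eq_zero_of_notMem_tsupport hy]
    · simp [image_eq_zero_of_notMem_tsupport hx]
  simp only [← integral_mul_const]
  rw [integral_integral_swap_of_hasCompactSupport hcont hsupp]
  refine integral_eq_zero_of_ae (ae_of_all _ fun y => ?_)
  have h1 : ∀ x, F x y * ψ y * lapl φ x = F x y * lapl φ x * ψ y := fun x => by ring
  simp only [h1, integral_mul_const, Pi.zero_apply]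
  by_cases hy : y ∈ tsupport ψ
  · rw [hw y (hs hy) φ hφ hφc hφs, zero_mul]
  · rw [image_eq_zero_of_notMem_tsupport hy, mul_zero]

/-- Derivatives in one variable of a separately harmonic function are harmonic in the other. -/
lemma isHarmonicOn_pdMulti_left (hn : 2 < n) {A B : Set (Eu n)} {F : Eu n → Eu n → ℝ}
    (hA : IsOpen A) (hB : IsOpen B)
    (hF : ContinuousOn (fun p : Eu n × Eu n => F p.1 p.2) (B ×ˢ A))
    (hl : ∀ y ∈ A, IsHarmonicOn (fun ξ => F ξ y) B) (hr : ∀ ξ ∈ B, IsHarmonicOn (F ξ) A)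
    {x : Eu n} (hx : x ∈ B) (L : List (Fin n)) :
    IsHarmonicOn (fun y => pdMulti L (fun ξ => F ξ y) x) A := by
  obtain ⟨η, hη⟩ := exists_kernel hn
  obtain ⟨r, hr0, hrB⟩ := Metric.nhds_basis_closedBall.mem_iff.1 (hB.mem_nhds hx)
  have ht : 0 < r / 2 := half_pos hr0
  set ψ : Eu n → ℝ := fun y => pdMulti L (dil η (r / 2)) (x - y) with hψ
  have hψs : tsupport ψ ⊆ closedBall x (r / 2) := hη.tsupport_pdMulti_dil_sub ht L x
  have hψc : Continuous ψ := hη.continuous_pdMulti_dil_sub _ L x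
  have hψK : HasCompactSupport ψ :=
    (isCompact_closedBall x (r / 2)).of_isClosed_subset (isClosed_tsupport _) hψs
  have hψB : tsupport ψ ⊆ B :=
    hψs.trans ((closedBall_subset_closedBall (by linarith)).trans hrB)
  have heq : ∀ y ∈ A, pdMulti L (fun ξ => F ξ y) x = ∫ ξ, F ξ y * ψ ξ := fun y hy =>
    (hl y hy).pdMulti_eq_integral hη ht (by linarith) hrB L
  have hc : ContinuousOn (fun p : Eu n × Eu n => F p.2 p.1) (A ×ˢ B) :=
    hF.comp (f := fun p : Eu n × Eu n => (p.2, p.1)) (by fun_prop) fun p hp => ⟨hp.2, hp.1⟩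
  have hcW := continuousOn_integral_mul (F := fun y ξ => F ξ y) hB hc hψc hψK hψB
  have hW := WeaklyHarmonicOn.isHarmonicOn hn hA hcW
    (weaklyHarmonicOn_integral_mul (F := fun y ξ => F ξ y) hA hB hc
      (fun ξ hξ => (hr ξ hξ).weaklyHarmonicOn hA) hψc hψK hψB)
  refine isHarmonicOn_of_contDiffAt fun y hy => ?_
  have he : (fun y => pdMulti L (fun ξ => F ξ y) x) =ᶠ[𝓝 y] fun y => ∫ ξ, F ξ y * ψ ξ := by
    filter_upwards [hA.mem_nhds hy] with y' hy' using heq y' hy'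
  exact ⟨((hW.1 y hy).of_le two_le_infty).congr_of_eventuallyEq he,
    ((lapl_congr_nhds he).eq_of_nhds).trans (hW.2.2 y hy)⟩

end Parametric

section Green

variable {D : Set (Eu n)} {U : Eu n → Eu n → ℝ}

/-- The correction term is harmonic in the pole variable. -/
lemma IsGreenCorrection.isHarmonicOn_right (hn : 2 < n) (hDo : IsOpen D)
    (hDb : Bornology.IsBounded D) (hU : IsGreenCorrection D U) {x : Eu n} (hx : x ∈ closure D) :
    IsHarmonicOn (U x) D := by
  have hc := hU.continuousOn hn hDo hDb
  have hcx : ContinuousOn (U x) D :=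
    hc.comp (f := fun y => (x, y)) (by fun_prop) fun y hy => ⟨hx, hy⟩
  refine (WeaklyHarmonicOn.isHarmonicOn hn hDo hcx fun φ hφ hφc hφs => ?_).2
  have hψc : Continuous (lapl φ) := hφ.lapl_top.continuous
  have hLs : tsupport (lapl φ) ⊆ D := (tsupport_lapl_subset φ).trans hφs
  have hVc := continuousOn_integral_mul hDo hc hψc hφc.lapl hLs
  have hcD := hc.mono (prod_mono subset_closure subset_rfl : D ×ˢ D ⊆ closure D ×ˢ D)
  have hV := (WeaklyHarmonicOn.isHarmonicOn hn hDo (hVc.mono subset_closure)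
    (weaklyHarmonicOn_integral_mul hDo hDo hcD
      (fun y hy => (hU y hy).1.weaklyHarmonicOn hDo) hψc hφc.lapl hLs)).2
  have hV0 : ∀ z ∈ frontier D, ∫ y, U z y * lapl φ y = 0 := by
    intro z hz
    have h1 : ∫ y, fundSol n (y - z) * lapl φ y = 0 := by
      refine ((isHarmonicOn_fundSol_sub z).weaklyHarmonicOn isOpen_compl_singleton) φ hφ hφc
        (hφs.trans fun y hy => ?_)
      rintro rfl
      exact hz.2 (by rwa [hDo.interior_eq])
    rw [← h1]
    refine integral_congr_ae (ae_of_all _ fun y => ?_)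
    by_cases hy : y ∈ tsupport (lapl φ)
    · simp only [(hU y (hLs hy)).2.2 z hz]
    · simp only [image_eq_zero_of_notMem_tsupport hy, mul_zero]
  have h0 := isHarmonicOn_const (n := n) 0 D
  exact le_antisymm
    (IsHarmonicOn.le_of_le_frontier (by omega) hDo hDb hV h0 hVc continuousOn_const
      (fun z hz => (hV0 z hz).le) x hx)
    (IsHarmonicOn.le_of_le_frontier (by omega) hDo hDb h0 hV continuousOn_const hVc
      (fun z hz => (hV0 z hz).ge) x hx)

end Green

section

open Pol

lemma Curved.disjoint_ball {e : Fin n} {k : ℕ} {lam : ℝ} (hlam : 2 < lam) {Ω : Set (Eu n)}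
    {S : Pol n} (h : Curved e k lam Ω S (1 / 4)) :
    Disjoint Ω (ball (-((1 / 4 : ℝ) • stdE e)) (1 / 4)) := by
  rw [Set.disjoint_left]
  intro x hx hxb
  rw [mem_ball, dist_eq_norm, sub_neg_eq_add] at hxb
  have hR : ‖(1 / 4 : ℝ) • stdE (n := n) e‖ = 1 / 4 := by
    rw [norm_smul, norm_stdE, mul_one, Real.norm_of_nonneg (by norm_num)]
  have hx1 : ‖x‖ < 1 := by
    have h1 := norm_sub_le (x + (1 / 4 : ℝ) • stdE e) ((1 / 4 : ℝ) • stdE e)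
    rw [add_sub_cancel_right, hR] at h1
    linarith
  have h2 : ‖x + (1 / 4 : ℝ) • stdE e‖ ^ 2 = ‖x‖ ^ 2 + 1 / 2 * x e + (1 / 4) ^ 2 := by
    rw [norm_add_sq_real, hR, inner_smul_right, stdE, EuclideanSpace.inner_single_right]
    simp
    ring
  have h3 := h.lower x ⟨hx, mem_ball_zero_iff.2 hx1⟩
  have h4 := abs_le.1 (abs_ev_le_pow h.degIn hx1.le)
  have h5 : ‖x‖ ^ lam ≤ ‖x‖ ^ 2 := by
    rw [← Real.rpow_natCast]
    rcases (norm_nonneg x).eq_or_lt with h0 | h0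
    · rw [← h0, Real.zero_rpow (by linarith), Real.zero_rpow (by norm_num)]
    · exact Real.rpow_le_rpow_of_exponent_ge h0 hx1.le (by exact_mod_cast hlam.le)
  have h6 : pnorm S * ‖x‖ ^ 2 ≤ 1 / 4 * ‖x‖ ^ 2 :=
    mul_le_mul_of_nonneg_right h.pnorm_le (sq_nonneg _)
  nlinarith [norm_nonneg (x + (1 / 4 : ℝ) • stdE e), sq_nonneg ‖x‖]

lemma exists_exterior_ball (hn : 2 < n) {lam : ℝ} (hlam : 2 < lam) (hni : ∀ m : ℕ, lam ≠ m)
    {D : Set (Eu n)} (hDo : IsOpen D) (hDb : Bornology.IsBounded D)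
    (hbd : HasGraphBoundary D (HolderSmooth lam)) {z : Eu n} (hz : z ∈ frontier D) :
    ∃ (c : Eu n) (R : ℝ), 0 < R ∧ ‖z - c‖ = R ∧ Disjoint D (closedBall c R) := by
  have e : Fin n := ⟨0, by omega⟩
  obtain ⟨ρ, hρ, h⟩ := exists_curved e hlam hni hDo hDb hbd (δ := 1 / 4) (by norm_num)
  obtain ⟨L, S, hS⟩ := h z hz ρ hρ le_rfl
  have hdis := hS.disjoint_ball hlam
  set c : Eu n := z + ρ • L (-((1 / 4 : ℝ) • stdE e)) with hc
  have hR : (0 : ℝ) < ρ * (1 / 4) := by positivity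
  refine ⟨c, ρ * (1 / 4), hR, ?_, ?_⟩
  · rw [hc, sub_add_cancel_left, norm_neg, norm_smul, L.norm_map, norm_neg, norm_smul, norm_stdE,
      Real.norm_of_nonneg hρ.le, Real.norm_of_nonneg (by norm_num), mul_one]
  · have h1 : Disjoint D (ball c (ρ * (1 / 4))) := by
      rw [Set.disjoint_left] at hdis ⊢
      intro w hw hwb
      have hw' : z + ρ • L (L.symm (ρ⁻¹ • (w - z))) = w := by
        rw [L.apply_symm_apply, smul_inv_smul₀ hρ.ne', add_sub_cancel]
      refine hdis (a := L.symm (ρ⁻¹ • (w - z))) (by rw [mem_preimage, hw']; exact hw) ?_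
      rw [mem_ball, dist_eq_norm] at hwb ⊢
      have h2 : w - c = ρ • L (L.symm (ρ⁻¹ • (w - z)) - -((1 / 4 : ℝ) • stdE e)) := by
        conv_lhs => rw [← hw']
        rw [hc, add_sub_add_left_eq_sub, ← smul_sub, ← map_sub]
      rw [h2, norm_smul, L.norm_map, Real.norm_of_nonneg hρ.le] at hwb
      exact lt_of_mul_lt_mul_left hwb hρ.le
    have h2 := h1.closure_right hDo
    rwa [closure_ball _ hR.ne'] at h2

section Green

variable {D : Set (Eu n)} {U : Eu n → Eu n → ℝ}

/-- Comparison with the Green function of the exterior of a ball. -/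
lemma IsGreenCorrection.le_kelvin (hn : 2 < n) (hDo : IsOpen D) (hDb : Bornology.IsBounded D)
    (hU : IsGreenCorrection D U) {c : Eu n} {R : ℝ} (hR : 0 < R)
    (hdis : Disjoint D (closedBall c R)) {x y : Eu n} (hx : x ∈ D) (hy : y ∈ D) :
    U x y ≤ fundSol n ((‖y - c‖ / R) • (x - c) - (‖y - c‖ / R)⁻¹ • (y - c)) := by
  have hDc : ∀ w ∈ D, R < ‖w - c‖ := fun w hw => by
    by_contra! h
    exact Set.disjoint_left.1 hdis hw (by rwa [mem_closedBall, dist_eq_norm])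
  have hcl : IsClosed {w : Eu n | R ≤ ‖w - c‖} := isClosed_le continuous_const (by fun_prop)
  have hDc' : ∀ w ∈ closure D, R ≤ ‖w - c‖ := fun w hw =>
    closure_minimal (fun w hw => (hDc w hw).le) hcl hw
  have hyR := hDc y hy
  set s := ‖y - c‖ / R with hs
  have hs1 : 1 < s := by rw [hs, lt_div_iff₀ hR]; linarith
  have hs0 : 0 < s := by linarith
  have hsR : ‖y - c‖ = s * R := by rw [hs]; field_simp
  have hN : ∀ w ∈ closure D, s • (w - c) - s⁻¹ • (y - c) ≠ 0 := by
    intro w hw h0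
    have h1 := congrArg norm (sub_eq_zero.1 h0)
    rw [norm_smul, norm_smul, hsR, Real.norm_of_nonneg hs0.le,
      Real.norm_of_nonneg (inv_nonneg.2 hs0.le), inv_mul_cancel_left₀ hs0.ne'] at h1
    nlinarith [hDc' w hw]
  have hform : ∀ w, s • (w - c) - s⁻¹ • (y - c) =
      (-(s • c) - s⁻¹ • (y - c)) + s • LinearIsometryEquiv.refl ℝ (Eu n) w := fun w => by
    rw [LinearIsometryEquiv.coe_refl, id, smul_sub]; abel
  have hh : IsHarmonicOn (fun w => fundSol n (s • (w - c) - s⁻¹ • (y - c))) D := by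
    have h1 : IsHarmonicOn (fundSol n) ({0}ᶜ : Set (Eu n)) := by
      simpa using isHarmonicOn_fundSol_sub (0 : Eu n)
    have h2 := h1.comp_similarity isOpen_compl_singleton (LinearIsometryEquiv.refl ℝ (Eu n))
      (-(s • c) - s⁻¹ • (y - c)) s
    simp only [← hform] at h2
    exact h2.mono fun w hw => hN w (subset_closure hw)
  have hcont : ContinuousOn (fun w => fundSol n (s • (w - c) - s⁻¹ • (y - c))) (closure D) := by
    intro w hw
    exact (ContinuousAt.comp (f := fun w => s • (w - c) - s⁻¹ • (y - c)) (g := fundSol n) (x := w)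
      (contDiffAt_fundSol (hN w hw)).continuousAt (by fun_prop)).continuousWithinAt
  obtain ⟨h1, h2, h3⟩ := hU y hy
  refine IsHarmonicOn.le_of_le_frontier (by omega) hDo hDb h1 hh h2 hcont (fun z hz => ?_) x
    (subset_closure hx)
  have hzD : z ∉ D := fun h => hz.2 (by rwa [hDo.interior_eq])
  have hyz : y ≠ z := fun h => hzD (h ▸ hy)
  rw [h3 z hz]
  refine fundSol_le_fundSol hn (norm_pos_iff.2 (sub_ne_zero.2 hyz)) ?_
  have e1 : y - z = (y - c) - (z - c) := by abel
  rw [e1]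
  generalize hb : z - c = b
  generalize ha : y - c = a at hsR ⊢
  have hbR : R ≤ ‖b‖ := hb ▸ hDc' z (frontier_subset_closure hz)
  refine le_of_sq_le_sq ?_ (norm_nonneg _)
  rw [norm_sub_sq_real, norm_sub_sq_real, norm_smul, norm_smul, inner_smul_left, inner_smul_right,
    Real.norm_of_nonneg hs0.le, Real.norm_of_nonneg (inv_nonneg.2 hs0.le), real_inner_comm b a, hsR]
  have e2 : s * (s⁻¹ * inner ℝ b a) = inner ℝ b a := mul_inv_cancel_left₀ hs0.ne' _
  have e3 : s⁻¹ * (s * R) = R := inv_mul_cancel_left₀ hs0.ne' _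
  simp only [conj_trivial]
  rw [e2, e3]
  have e4 : 0 ≤ (s ^ 2 - 1) * (‖b‖ ^ 2 - R ^ 2) :=
    mul_nonneg (by nlinarith) (by nlinarith)
  nlinarith

/-- The Green function vanishes at the boundary in the pole variable. -/
lemma IsGreenCorrection.tendsto_greenFn (hn : 2 < n) {lam : ℝ} (hlam : 2 < lam)
    (hni : ∀ m : ℕ, lam ≠ m) (hDo : IsOpen D) (hDb : Bornology.IsBounded D)
    (hbd : HasGraphBoundary D (HolderSmooth lam)) (hU : IsGreenCorrection D U) {x z : Eu n}
    (hx : x ∈ D) (hz : z ∈ frontier D) :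
    Filter.Tendsto (fun y => greenFn U x y) (𝓝[D] z) (𝓝 0) := by
  obtain ⟨c, R, hR, hzR, hdis⟩ := exists_exterior_ball hn hlam hni hDo hDb hbd hz
  have hxz : x ≠ z := fun h => hz.2 (by rw [hDo.interior_eq]; exact h ▸ hx)
  have h1 : ContinuousAt (fun y => fundSol n (x - y)) z :=
    ContinuousAt.comp (f := fun y => x - y) (g := fundSol n) (x := z)
      (contDiffAt_fundSol (sub_ne_zero.2 hxz)).continuousAt (by fun_prop)
  have e0 : (‖z - c‖ / R) • (x - c) - (‖z - c‖ / R)⁻¹ • (z - c) = x - z := by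
    rw [hzR, div_self hR.ne', inv_one, one_smul, one_smul]; abel
  have h2 : ContinuousAt (fun y => fundSol n ((‖y - c‖ / R) • (x - c) - (‖y - c‖ / R)⁻¹ • (y - c)))
      z := by
    refine ContinuousAt.comp (f := fun y => (‖y - c‖ / R) • (x - c) - (‖y - c‖ / R)⁻¹ • (y - c))
      (g := fundSol n) (x := z) ?_ ?_
    · rw [e0]
      exact (contDiffAt_fundSol (sub_ne_zero.2 hxz)).continuousAt
    · have hne : ‖z - c‖ / R ≠ 0 := by rw [hzR, div_self hR.ne']; exact one_ne_zero
      have h3 : ContinuousAt (fun y : Eu n => ‖y - c‖ / R) z := by fun_prop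
      exact (h3.smul continuousAt_const).sub ((h3.inv₀ hne).smul (by fun_prop))
  have h3 : Filter.Tendsto (fun y => fundSol n (x - y) -
      fundSol n ((‖y - c‖ / R) • (x - c) - (‖y - c‖ / R)⁻¹ • (y - c))) (𝓝[D] z) (𝓝 0) := by
    have := h1.tendsto.sub h2.tendsto
    rw [e0, sub_self] at this
    exact this.mono_left nhdsWithin_le_nhds
  refine tendsto_of_tendsto_of_tendsto_of_le_of_le' h3 tendsto_const_nhds ?_ ?_
  · filter_upwards [self_mem_nhdsWithin] with y hy
    exact sub_le_sub_left (hU.le_kelvin hn hDo hDb hR hdis hx hy) _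
  · have h4 : ∀ᶠ y in 𝓝[D] z, y ≠ x :=
      nhdsWithin_le_nhds (isOpen_ne.mem_nhds hxz.symm)
    filter_upwards [self_mem_nhdsWithin, h4] with y hy hyx
    exact sub_nonpos.2 (hU.fundSol_le hn hDo hDb hx hy hyx.symm)

end Green

end

lemma pdMulti_sub {f g : Eu n → ℝ} {x : Eu n} (L : List (Fin n)) (hf : ContDiffAt ℝ ∞ f x)
    (hg : ContDiffAt ℝ ∞ g x) :
    pdMulti L (fun y => f y - g y) x = pdMulti L f x - pdMulti L g x := by
  have hf' : ContDiffAt ℝ L.length f x := hf.of_le (by exact_mod_cast le_top)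
  have hg' : ContDiffAt ℝ L.length g x := hg.of_le (by exact_mod_cast le_top)
  rw [pdMulti_eq_iteratedFDeriv L hf', pdMulti_eq_iteratedFDeriv L hg',
    pdMulti_eq_iteratedFDeriv L (hf'.sub hg'), fun_iteratedFDeriv_sub_apply hf' hg']
  rfl

section Green

variable {D : Set (Eu n)} {U : Eu n → Eu n → ℝ}

lemma abs_fundSol (hn : 2 < n) (x : Eu n) : |fundSol n x| = fundConst n * ‖x‖ ^ (2 - (n : ℝ)) := by
  rw [abs_of_nonpos (fundSol_nonpos hn x), fundSol_eq, neg_neg]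

lemma abs_fundSol_le (hn : 2 < n) {x : Eu n} {r : ℝ} (hr : 0 < r) (h : r ≤ ‖x‖) :
    |fundSol n x| ≤ fundConst n * r ^ (2 - (n : ℝ)) := by
  have h3 : (2 : ℝ) < n := by exact_mod_cast hn
  rw [abs_fundSol hn]
  exact mul_le_mul_of_nonneg_left (Real.rpow_le_rpow_of_nonpos hr h (by linarith))
    (fundConst_pos hn).le

lemma IsGreenCorrection.abs_greenFn_le (hn : 2 < n) (hDo : IsOpen D)
    (hDb : Bornology.IsBounded D) (hU : IsGreenCorrection D U) {x y : Eu n} (hx : x ∈ D)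
    (hy : y ∈ D) (hxy : x ≠ y) : |greenFn U x y| ≤ |fundSol n (x - y)| := by
  have h1 := hU.nonpos hn hDo hDb (subset_closure hx) hy
  have h2 := hU.fundSol_le hn hDo hDb hx hy hxy
  rw [greenFn, abs_of_nonpos (by linarith), abs_of_nonpos (fundSol_nonpos hn _)]
  linarith

lemma isHarmonicOn_fundSol_sub_left (x : Eu n) :
    IsHarmonicOn (fun y => fundSol n (x - y)) {x}ᶜ := by
  simpa only [fundSol_sub_comm x] using isHarmonicOn_fundSol_sub x

lemma IsGreenCorrection.isHarmonicOn_greenFn (hDo : IsOpen D) (hU : IsGreenCorrection D U)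
    {y : Eu n} (hy : y ∈ D) : IsHarmonicOn (fun x => greenFn U x y) (D \ {y}) :=
  ((isHarmonicOn_fundSol_sub y).mono fun _ h => h.2).sub (hDo.sdiff isClosed_singleton)
    ((hU y hy).1.mono sdiff_subset)

lemma IsGreenCorrection.tendsto_greenFn_left (hDo : IsOpen D) (hU : IsGreenCorrection D U)
    {y z : Eu n} (hy : y ∈ D) (hz : z ∈ frontier D) :
    Filter.Tendsto (fun x => greenFn U x y) (𝓝[D] z) (𝓝 0) := by
  have hyz : z ≠ y := fun h => hz.2 (by rw [hDo.interior_eq]; exact h ▸ hy)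
  have h1 : Filter.Tendsto (fun x => fundSol n (x - y)) (𝓝[D] z) (𝓝 (fundSol n (z - y))) :=
    (contDiffAt_fundSol_sub hyz).continuousAt.continuousWithinAt
  have h2 : Filter.Tendsto (fun x => U x y) (𝓝[D] z) (𝓝 (U z y)) :=
    ((hU y hy).2.1 z (frontier_subset_closure hz)).mono subset_closure
  have h3 := h1.sub h2
  rwa [(hU y hy).2.2 z hz, fundSol_sub_comm, sub_self] at h3

/-- A punctured-domain version of harmonicity from local statements away from the puncture. -/
lemma isHarmonicOn_diff_singleton {f : Eu n → ℝ} {Ω : Set (Eu n)} (hΩ : IsOpen Ω) {x : Eu n}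
    {r₀ : ℝ} (hr₀ : 0 < r₀) (h : ∀ r, 0 < r → r ≤ r₀ → IsHarmonicOn f (Ω \ closedBall x r)) :
    IsHarmonicOn f (Ω \ {x}) := by
  refine isHarmonicOn_of_contDiffAt fun y hy => ?_
  have hd : 0 < dist y x := dist_pos.2 hy.2
  have hr : 0 < min r₀ (dist y x / 2) := lt_min hr₀ (half_pos hd)
  have hm : y ∈ Ω \ closedBall x (min r₀ (dist y x / 2)) := by
    refine ⟨hy.1, fun hyb => ?_⟩
    have := (mem_closedBall.1 hyb).trans (min_le_right _ _)
    linarith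
  have h1 := h _ hr (min_le_left _ _)
  exact ⟨h1.contDiffAt (hΩ.sdiff isClosed_closedBall) hm, h1.2 y hm⟩

lemma isHarmonicOn_pdMulti_fundSol (hn : 2 < n) (x : Eu n) (L : List (Fin n)) :
    IsHarmonicOn (fun y => pdMulti L (fun ξ => fundSol n (ξ - y)) x) {x}ᶜ := by
  have h0 : ({x}ᶜ : Set (Eu n)) = univ \ {x} := by rw [compl_eq_univ_sdiff]
  rw [h0]
  refine isHarmonicOn_diff_singleton isOpen_univ one_pos fun r hr _ => ?_
  refine isHarmonicOn_pdMulti_left hn (B := ball x r) (F := fun ξ y => fundSol n (ξ - y))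
    (isOpen_univ.sdiff isClosed_closedBall)
    isOpen_ball ?_ (fun y hy => ?_) (fun ξ hξ => ?_) (mem_ball_self hr) L
  · rintro ⟨ξ, y⟩ ⟨hξ, hy⟩
    refine (continuousAt_fundSol_sub ?_).continuousWithinAt
    rintro rfl
    exact hy.2 (ball_subset_closedBall hξ)
  · refine (isHarmonicOn_fundSol_sub y).mono fun ξ hξ => ?_
    rintro rfl
    exact hy.2 (ball_subset_closedBall hξ)
  · refine (isHarmonicOn_fundSol_sub_left ξ).mono fun y hy => ?_
    rintro rfl
    exact hy.2 (ball_subset_closedBall hξ)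

lemma IsGreenCorrection.isHarmonicOn_pdMulti (hn : 2 < n) (hDo : IsOpen D)
    (hDb : Bornology.IsBounded D) (hU : IsGreenCorrection D U) {x : Eu n} (hx : x ∈ D)
    (L : List (Fin n)) : IsHarmonicOn (fun y => pdMulti L (fun ξ => U ξ y) x) D :=
  isHarmonicOn_pdMulti_left hn hDo hDo
    ((hU.continuousOn hn hDo hDb).mono (prod_mono subset_closure subset_rfl))
    (fun y hy => (hU y hy).1)
    (fun _ hξ => hU.isHarmonicOn_right hn hDo hDb (subset_closure hξ)) hx L

lemma IsGreenCorrection.pdMulti_greenFn (hn : 2 < n) (hDo : IsOpen D)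
    (hU : IsGreenCorrection D U) {x y : Eu n} (hx : x ∈ D) (hy : y ∈ D) (hxy : x ≠ y)
    (L : List (Fin n)) : pdMulti L (fun ξ => greenFn U ξ y) x =
      pdMulti L (fun ξ => fundSol n (ξ - y)) x - pdMulti L (fun ξ => U ξ y) x :=
  pdMulti_sub L (contDiffAt_fundSol_sub hxy) ((hU y hy).1.smooth hn hDo hx)

lemma IsGreenCorrection.isHarmonicOn_pdMulti_greenFn (hn : 2 < n) (hDo : IsOpen D)
    (hDb : Bornology.IsBounded D) (hU : IsGreenCorrection D U) {x : Eu n} (hx : x ∈ D)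
    (L : List (Fin n)) :
    IsHarmonicOn (fun y => pdMulti L (fun ξ => greenFn U ξ y) x) (D \ {x}) := by
  have hO : IsOpen (D \ {x}) := hDo.sdiff isClosed_singleton
  have h1 := ((isHarmonicOn_pdMulti_fundSol hn x L).mono
    (fun y hy => hy.2 : D \ {x} ⊆ {x}ᶜ)).sub hO
      ((hU.isHarmonicOn_pdMulti hn hDo hDb hx L).mono (sdiff_subset : D \ {x} ⊆ D))
  refine isHarmonicOn_of_contDiffAt fun y hy => ?_
  have he : (fun y => pdMulti L (fun ξ => greenFn U ξ y) x) =ᶠ[𝓝 y] fun y =>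
      pdMulti L (fun ξ => fundSol n (ξ - y)) x - pdMulti L (fun ξ => U ξ y) x := by
    filter_upwards [hO.mem_nhds hy] with w hw
    exact hU.pdMulti_greenFn hn hDo hx hw.1 (fun h => hw.2 h.symm) L
  exact ⟨(h1.contDiffAt hO hy).congr_of_eventuallyEq he,
    (lapl_congr_nhds he).eq_of_nhds.trans (h1.2 y hy)⟩

/-- Derivatives of the Green function vanish at the boundary in the pole variable. -/
lemma IsGreenCorrection.tendsto_pdMulti_greenFn (hn : 2 < n) {lam : ℝ} (hlam : 2 < lam)
    (hni : ∀ m : ℕ, lam ≠ m) (hDo : IsOpen D) (hDb : Bornology.IsBounded D)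
    (hbd : HasGraphBoundary D (HolderSmooth lam)) (hU : IsGreenCorrection D U) {x z : Eu n}
    (hx : x ∈ D) (hz : z ∈ frontier D) (L : List (Fin n)) :
    Filter.Tendsto (fun y => pdMulti L (fun ξ => greenFn U ξ y) x) (𝓝[D] z) (𝓝 0) := by
  obtain ⟨η, hη⟩ := exists_kernel hn
  obtain ⟨r, hr0, hrD⟩ := Metric.nhds_basis_closedBall.mem_iff.1 (hDo.mem_nhds hx)
  have ht : 0 < r / 2 := half_pos hr0
  have hzr : r < dist z x := by
    by_contra! h
    exact hz.2 (by rw [hDo.interior_eq]; exact hrD h)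
  set ψ : Eu n → ℝ := fun y => pdMulti L (dil η (r / 2)) (x - y) with hψ
  have hψs : tsupport ψ ⊆ closedBall x (r / 2) := hη.tsupport_pdMulti_dil_sub ht L x
  have hψc : Continuous ψ := hη.continuous_pdMulti_dil_sub _ L x
  have hψK : HasCompactSupport ψ :=
    (isCompact_closedBall x (r / 2)).of_isClosed_subset (isClosed_tsupport _) hψs
  have hψb : tsupport ψ ⊆ ball x r := hψs.trans (closedBall_subset_ball (by linarith))
  have hsub : ∀ y ∉ closedBall x r, closedBall x r ⊆ D \ {y} := fun y hy ξ hξ =>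
    ⟨hrD hξ, fun h => hy (h ▸ hξ)⟩
  have hev : ∀ᶠ y in 𝓝[D] z, y ∈ D ∧ y ∉ closedBall x r :=
    Filter.Eventually.and self_mem_nhdsWithin
      (nhdsWithin_le_nhds (isClosed_closedBall.isOpen_compl.mem_nhds (by simpa using hzr)))
  have heq : ∀ᶠ y in 𝓝[D] z, ∫ ξ, greenFn U ξ y * ψ ξ =
      pdMulti L (fun ξ => greenFn U ξ y) x := by
    filter_upwards [hev] with y hy
    exact ((hU.isHarmonicOn_greenFn hDo hy.1).pdMulti_eq_integral hη ht (by linarith)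
      (hsub y hy.2) L).symm
  refine Filter.Tendsto.congr' heq ?_
  have h0 : (0 : ℝ) = ∫ _ : Eu n, (0 : ℝ) := by simp
  rw [h0]
  set K : ℝ := fundConst n * ((dist z x - r) / 2) ^ (2 - (n : ℝ)) with hK
  refine tendsto_integral_filter_of_dominated_convergence (fun ξ => K * |ψ ξ|) ?_ ?_ ?_ ?_
  · filter_upwards [hev] with y hy
    exact (continuous_mul_of_tsupport isOpen_ball
      ((hU.isHarmonicOn_greenFn hDo hy.1).1.continuousOn.mono
      (ball_subset_closedBall.trans (hsub y hy.2))) hψc hψb).aestronglyMeasurable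
  · have hev2 : ∀ᶠ y in 𝓝[D] z, dist y z < (dist z x - r) / 2 :=
      nhdsWithin_le_nhds (ball_mem_nhds z (by linarith))
    filter_upwards [hev, hev2] with y hy hyz
    refine ae_of_all _ fun ξ => ?_
    rw [norm_mul, Real.norm_eq_abs, Real.norm_eq_abs]
    by_cases hξ : ξ ∈ tsupport ψ
    · refine mul_le_mul_of_nonneg_right ?_ (abs_nonneg _)
      have hξr := hψb hξ
      have hξy : ξ ≠ y := fun h => hy.2 (h ▸ ball_subset_closedBall hξr)
      refine (hU.abs_greenFn_le hn hDo hDb (hrD (ball_subset_closedBall hξr)) hy.1 hξy).trans ?_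
      refine abs_fundSol_le hn (by linarith) ?_
      rw [← dist_eq_norm]
      have h1 := dist_triangle4 z y ξ x
      rw [mem_ball] at hξr
      rw [dist_comm z y, dist_comm y ξ] at h1
      linarith
    · rw [image_eq_zero_of_notMem_tsupport hξ, abs_zero, mul_zero, mul_zero]
  · exact ((hψc.integrable_of_hasCompactSupport hψK).abs).const_mul K
  · refine ae_of_all _ fun ξ => ?_
    by_cases hξ : ξ ∈ tsupport ψ
    · have h1 := (hU.tendsto_greenFn hn hlam hni hDo hDb hbd
        (hrD (ball_subset_closedBall (hψb hξ))) hz).mul_const (ψ ξ)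
      rwa [zero_mul] at h1
    · simp only [image_eq_zero_of_notMem_tsupport hξ, mul_zero]
      exact tendsto_const_nhds

end Green

lemma half_rpow {ρ : ℝ} (hρ : 0 < ρ) (p : ℝ) : (ρ / 2) ^ p = (1 / 2) ^ p * ρ ^ p := by
  rw [← Real.mul_rpow (by norm_num) hρ.le, one_div_mul_eq_div]

lemma mul_inv_pow_eq_rpow {θ ρ : ℝ} (hρ : 0 < ρ) (m : ℕ) :
    (θ * ρ)⁻¹ ^ m = θ⁻¹ ^ m * ρ ^ (-(m : ℝ)) := by
  rw [mul_inv, mul_pow, Real.rpow_neg hρ.le, Real.rpow_natCast, inv_pow ρ]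

lemma dist_ge_half_of_mem_ball {x ξ y : Eu n} {r : ℝ} (hr : r ≤ dist x ξ / 2) (hy : y ∈ ball x r) :
    dist x ξ / 2 ≤ dist y ξ := by
  have := dist_triangle x y ξ
  rw [mem_ball, dist_comm] at hy
  linarith

/-- Pointwise bounds for the second derivatives of the fundamental solution. -/
lemma exists_pdMulti_fundSol_bound (hn : 2 < n) : ∃ C : ℝ, 0 < C ∧ ∀ L : List (Fin n),
    L.length = 2 → ∀ x ξ : Eu n, x ≠ ξ →
      |pdMulti L (fun x' => fundSol n (x' - ξ)) x| ≤ C * ‖x - ξ‖ ^ (-(n : ℝ)) := by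
  obtain ⟨C₀, hC₀, hInt⟩ := interior_estimate hn 2
  refine ⟨C₀ * fundConst n * (1 / 2) ^ (2 - (n : ℝ)) * (1 / 2)⁻¹ ^ 2,
    by have := fundConst_pos hn; positivity, fun L hL x ξ hx => ?_⟩
  have hρ : 0 < dist x ξ := dist_pos.2 hx
  have hne : ∀ w ∈ ball x (1 / 2 * dist x ξ), dist x ξ / 2 ≤ dist w ξ := fun w hw =>
    dist_ge_half_of_mem_ball (by linarith) hw
  have h1 := hInt (fun x' => fundSol n (x' - ξ)) x (1 / 2 * dist x ξ)
    (fundConst n * (dist x ξ / 2) ^ (2 - (n : ℝ))) (by linarith)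
    ((isHarmonicOn_fundSol_sub ξ).mono fun w hw => dist_pos.1 (by linarith [hne w hw]))
    fun w hw => abs_fundSol_le hn (half_pos hρ) (by rw [← dist_eq_norm]; exact hne w hw)
  have h2 := abs_pdMulti_le L (((contDiffAt_fundSol_sub hx).of_le (by exact_mod_cast le_top) :
    ContDiffAt ℝ L.length (fun x' => fundSol n (x' - ξ)) x))
  rw [hL] at h2
  refine (h2.trans h1).trans (le_of_eq ?_)
  rw [half_rpow hρ, mul_inv_pow_eq_rpow hρ, ← dist_eq_norm]
  have h3 : dist x ξ ^ (-(n : ℝ)) = dist x ξ ^ (2 - (n : ℝ)) * dist x ξ ^ (-((2 : ℕ) : ℝ)) := by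
    rw [← Real.rpow_add hρ]; congr 1; push_cast; ring
  rw [h3]; ring

/-- Bounds for all derivatives in the pole of the second derivatives of the fundamental
solution. -/
lemma exists_iteratedFDeriv_pdMulti_fundSol_bound (hn : 2 < n) (m : ℕ) :
    ∃ C : ℝ, 0 < C ∧ ∀ L : List (Fin n), L.length = 2 → ∀ x ξ : Eu n, x ≠ ξ →
      ‖iteratedFDeriv ℝ m (fun y => pdMulti L (fun x' => fundSol n (x' - y)) x) ξ‖ ≤
        C * ‖x - ξ‖ ^ (-((n : ℝ) + m)) := by
  obtain ⟨C₀, hC₀, hInt⟩ := interior_estimate hn m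
  obtain ⟨C₁, hC₁, hbd⟩ := exists_pdMulti_fundSol_bound hn
  refine ⟨C₀ * C₁ * (1 / 2) ^ (-(n : ℝ)) * (1 / 2)⁻¹ ^ m, by positivity, fun L hL x ξ hx => ?_⟩
  have hρ : 0 < dist ξ x := dist_pos.2 hx.symm
  have hne : ∀ w ∈ ball ξ (1 / 2 * dist ξ x), dist ξ x / 2 ≤ dist w x := fun w hw =>
    dist_ge_half_of_mem_ball (by linarith) hw
  have h1 := hInt (fun y => pdMulti L (fun x' => fundSol n (x' - y)) x) ξ (1 / 2 * dist ξ x)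
    (C₁ * (dist ξ x / 2) ^ (-(n : ℝ))) (by linarith)
    ((isHarmonicOn_pdMulti_fundSol hn x L).mono fun w hw =>
      dist_pos.1 (by linarith [hne w hw])) fun w hw => by
        have hw' := hne w hw
        have hxw : x ≠ w := (dist_pos.1 (by linarith : 0 < dist w x)).symm
        refine (hbd L hL x w hxw).trans (mul_le_mul_of_nonneg_left ?_ hC₁.le)
        rw [← dist_eq_norm, dist_comm x w]
        exact Real.rpow_le_rpow_of_nonpos (half_pos hρ) hw' (by simp)
  refine h1.trans (le_of_eq ?_)
  rw [half_rpow hρ, mul_inv_pow_eq_rpow hρ, ← dist_eq_norm, dist_comm x ξ]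
  have h3 : dist ξ x ^ (-((n : ℝ) + m)) = dist ξ x ^ (-(n : ℝ)) * dist ξ x ^ (-(m : ℝ)) := by
    rw [← Real.rpow_add hρ]; congr 1; ring
  rw [h3]; ring

/-- Derivative bounds for the second derivatives of the regular part of the Green function. -/
theorem green_correction_estimate (hn : 2 < n) {lam : ℝ} (hlam : 2 < lam)
    (hni : ∀ m : ℕ, lam ≠ m) {D : Set (Eu n)} (hDo : IsOpen D) (hDb : Bornology.IsBounded D)
    (hbd : HasGraphBoundary D (HolderSmooth lam)) {U : Eu n → Eu n → ℝ}
    (hU : IsGreenCorrection D U) : ∃ C θ : ℝ, 0 < C ∧ 0 < θ ∧ θ ≤ 1 ∧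
      ∀ L : List (Fin n), L.length = 2 → ∀ x ∈ D, ∀ ξ ∈ D, x ≠ ξ →
        (∀ m ≤ ⌊lam⌋₊, ‖iteratedFDeriv ℝ m (fun y => pdMulti L (fun x' => U x' y) x) ξ‖ ≤
          C * ‖x - ξ‖ ^ (-((n : ℝ) + m))) ∧
        ∀ d, 0 < d → d ≤ θ * ‖x - ξ‖ → ball ξ d ⊆ D →
          ‖iteratedFDeriv ℝ (⌊lam⌋₊ + 1) (fun y => pdMulti L (fun x' => U x' y) x) ξ‖ ≤
            C * ‖x - ξ‖ ^ (-((n : ℝ) + lam)) * d ^ (lam - (⌊lam⌋₊ + 1)) := by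
  obtain ⟨Cb, R, hCb, hR, hbe⟩ := boundary_estimate hn hlam hni hDo hDb hbd
  obtain ⟨P₀, hP₀⟩ := Metric.isBounded_iff.1 hDb
  choose Cf hCf0 hCf using fun m => exists_iteratedFDeriv_pdMulti_fundSol_bound (n := n) hn m
  set k := ⌊lam⌋₊ with hk
  have hk2 : 2 ≤ k := Nat.le_floor (by exact_mod_cast hlam.le)
  have hkl : (k : ℝ) < lam := lt_of_le_of_ne (Nat.floor_le (by linarith)) (hni k).symm
  have hlk : lam < k + 1 := Nat.lt_floor_add_one lam
  set P : ℝ := max P₀ 1 with hP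
  have hP0 : 0 < P := lt_max_of_lt_right one_pos
  obtain ⟨θ, hθ0, hθ2, hθR⟩ : ∃ θ : ℝ, 0 < θ ∧ θ ≤ 1 / 2 ∧ θ * P ≤ R := by
    refine ⟨min (1 / 2) (R / P), by positivity, min_le_left _ _, ?_⟩
    calc min (1 / 2) (R / P) * P ≤ R / P * P :=
          mul_le_mul_of_nonneg_right (min_le_right _ _) hP0.le
      _ = R := by field_simp
  have hrR : ∀ x ∈ D, ∀ ξ ∈ D, θ * dist x ξ ≤ R := fun x hx ξ hξ =>
    (mul_le_mul_of_nonneg_left ((hP₀ hx hξ).trans (le_max_left _ _)) hθ0.le).trans hθR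
  have hc0 := fundConst_pos hn
  set C₁ : ℝ := Cb * fundConst n * (1 / 2) ^ (2 - (n : ℝ)) * θ⁻¹ ^ 2 with hC₁
  have hC₁0 : 0 < C₁ := by positivity
  have hH : ∀ L : List (Fin n), L.length = 2 → ∀ x ∈ D, ∀ ξ ∈ D, x ≠ ξ →
      |pdMulti L (fun x' => greenFn U x' ξ) x| ≤ C₁ * dist ξ x ^ (-(n : ℝ)) := by
    intro L hL x hx ξ hξ hxξ
    have hρ : 0 < dist x ξ := dist_pos.2 hxξ
    have hne : ∀ w ∈ ball x (θ * dist x ξ), dist x ξ / 2 ≤ dist w ξ := fun w hw =>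
      dist_ge_half_of_mem_ball (by nlinarith) hw
    have hne' : ∀ w ∈ ball x (θ * dist x ξ), w ≠ ξ := fun w hw =>
      dist_pos.1 (by linarith [hne w hw])
    have h1 := (hbe (fun x' => greenFn U x' ξ) x (θ * dist x ξ)
      (fundConst n * (dist x ξ / 2) ^ (2 - (n : ℝ))) hx (by positivity) (hrR x hx ξ hξ)
      (by positivity)
      ((hU.isHarmonicOn_greenFn hDo hξ).mono fun w hw => ⟨hw.1, hne' w hw.2⟩)
      (fun w hw => (hU.abs_greenFn_le hn hDo hDb hw.1 hξ (hne' w hw.2)).trans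
        (abs_fundSol_le hn (half_pos hρ) (by rw [← dist_eq_norm]; exact hne w hw.2)))
      fun z hz => hU.tendsto_greenFn_left hDo hξ hz.1).1 2 hk2
    have hs : ContDiffAt ℝ L.length (fun x' => greenFn U x' ξ) x :=
      ((hU.isHarmonicOn_greenFn hDo hξ).smooth hn (hDo.sdiff isClosed_singleton)
        ⟨hx, hxξ⟩).of_le (by exact_mod_cast le_top)
    have h2 := abs_pdMulti_le L hs
    rw [hL] at h2
    refine (h2.trans h1).trans (le_of_eq ?_)
    rw [half_rpow hρ, mul_inv_pow_eq_rpow hρ, dist_comm ξ x]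
    have h3 : dist x ξ ^ (-(n : ℝ)) = dist x ξ ^ (2 - (n : ℝ)) * dist x ξ ^ (-((2 : ℕ) : ℝ)) := by
      rw [← Real.rpow_add hρ]; congr 1; push_cast; ring
    rw [h3, hC₁]; ring
  have hsum : ∀ m, 0 ≤ ∑ i ∈ Finset.range m, (Cf i + Cb * C₁ * (1 / 2) ^ (-(n : ℝ)) * θ⁻¹ ^ i) :=
    fun m => Finset.sum_nonneg fun i _ => by have := hCf0 i; positivity
  set C₂ : ℝ := ∑ i ∈ Finset.range (k + 2), (Cf i + Cb * C₁ * (1 / 2) ^ (-(n : ℝ)) * θ⁻¹ ^ i) +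
    Cb * C₁ * (1 / 2) ^ (-(n : ℝ)) * θ ^ (-lam) + 1 with hC₂
  have hterm : ∀ m, m ≤ k + 1 → Cf m + Cb * C₁ * (1 / 2) ^ (-(n : ℝ)) * θ⁻¹ ^ m ≤
      C₂ - Cb * C₁ * (1 / 2) ^ (-(n : ℝ)) * θ ^ (-lam) := by
    intro m hm
    have := Finset.single_le_sum
      (f := fun i => Cf i + Cb * C₁ * (1 / 2) ^ (-(n : ℝ)) * θ⁻¹ ^ i)
      (fun i _ => by have := hCf0 i; positivity) (Finset.mem_range.2 (by omega : m < k + 2))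
    rw [hC₂]; linarith
  have hE0 : 0 < Cb * C₁ * (1 / 2) ^ (-(n : ℝ)) * θ ^ (-lam) := by positivity
  have hC₂0 : 0 < C₂ := by have := hsum (k + 2); rw [hC₂]; linarith
  refine ⟨C₂, θ, hC₂0, hθ0, by linarith, fun L hL x hx ξ hξ hxξ => ?_⟩
  have hρ : 0 < dist ξ x := dist_pos.2 hxξ.symm
  have hne : ∀ w ∈ ball ξ (θ * dist ξ x), dist ξ x / 2 ≤ dist w x := fun w hw =>
    dist_ge_half_of_mem_ball (by nlinarith) hw
  have hne' : ∀ w ∈ ball ξ (θ * dist ξ x), w ≠ x := fun w hw =>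
    dist_pos.1 (by linarith [hne w hw])
  set H : Eu n → ℝ := fun y => pdMulti L (fun x' => greenFn U x' y) x with hHdef
  set Φ : Eu n → ℝ := fun y => pdMulti L (fun x' => fundSol n (x' - y)) x with hΦ
  obtain ⟨hb1, hb2⟩ := hbe H ξ (θ * dist ξ x) (C₁ * (dist ξ x / 2) ^ (-(n : ℝ))) hξ
    (by positivity) (hrR ξ hξ x hx) (by positivity)
    ((hU.isHarmonicOn_pdMulti_greenFn hn hDo hDb hx L).mono fun w hw => ⟨hw.1, hne' w hw.2⟩)
    (fun w hw => (hH L hL x hx w hw.1 (hne' w hw.2).symm).trans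
      (mul_le_mul_of_nonneg_left
        (Real.rpow_le_rpow_of_nonpos (half_pos hρ) (hne w hw.2) (by simp)) hC₁0.le))
    fun z hz => hU.tendsto_pdMulti_greenFn hn hlam hni hDo hDb hbd hx hz.1 L
  have hO : IsOpen (D \ {x}) := hDo.sdiff isClosed_singleton
  have hm : ξ ∈ D \ {x} := ⟨hξ, hxξ.symm⟩
  have he : (fun y => pdMulti L (fun x' => U x' y) x) =ᶠ[𝓝 ξ] fun y => Φ y - H y := by
    filter_upwards [hO.mem_nhds hm] with w hw
    simp only [hΦ, hHdef]
    rw [hU.pdMulti_greenFn hn hDo hx hw.1 (fun h => hw.2 h.symm) L, sub_sub_cancel]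
  have hdiff : ∀ m : ℕ, ‖iteratedFDeriv ℝ m (fun y => pdMulti L (fun x' => U x' y) x) ξ‖ ≤
      ‖iteratedFDeriv ℝ m Φ ξ‖ + ‖iteratedFDeriv ℝ m H ξ‖ := by
    intro m
    have hΦs : ContDiffAt ℝ m Φ ξ :=
      ((isHarmonicOn_pdMulti_fundSol hn x L).smooth hn isOpen_compl_singleton hxξ.symm).of_le
        (by exact_mod_cast le_top)
    have hHs : ContDiffAt ℝ m H ξ :=
      ((hU.isHarmonicOn_pdMulti_greenFn hn hDo hDb hx L).smooth hn hO hm).of_le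
        (by exact_mod_cast le_top)
    rw [(he.iteratedFDeriv ℝ m).eq_of_nhds, fun_iteratedFDeriv_sub_apply hΦs hHs]
    exact norm_sub_le _ _
  have hxe : ‖x - ξ‖ = dist ξ x := by rw [← dist_eq_norm, dist_comm]
  rw [hxe]
  have hadd : ∀ p : ℝ, dist ξ x ^ (-((n : ℝ) + p)) = dist ξ x ^ (-(n : ℝ)) * dist ξ x ^ (-p) :=
    fun p => by rw [← Real.rpow_add hρ]; congr 1; ring
  constructor
  · intro m hmk
    have h1 := hCf m L hL x ξ hxξ
    have h2 := hb1 m hmk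
    rw [hxe] at h1
    have h3 : Cb * (C₁ * (dist ξ x / 2) ^ (-(n : ℝ))) * (θ * dist ξ x)⁻¹ ^ m =
        Cb * C₁ * (1 / 2) ^ (-(n : ℝ)) * θ⁻¹ ^ m * dist ξ x ^ (-((n : ℝ) + m)) := by
      rw [half_rpow hρ, mul_inv_pow_eq_rpow hρ, hadd]; ring
    rw [h3] at h2
    calc _ ≤ _ := hdiff m
      _ ≤ (Cf m + Cb * C₁ * (1 / 2) ^ (-(n : ℝ)) * θ⁻¹ ^ m) * dist ξ x ^ (-((n : ℝ) + m)) := by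
        rw [add_mul]; exact add_le_add h1 h2
      _ ≤ _ := mul_le_mul_of_nonneg_right (by linarith [hterm m (by omega)]) (by positivity)
  · intro d hd hdθ hdD
    have h1 := hCf (k + 1) L hL x ξ hxξ
    have h2 := hb2 d hd hdθ hdD
    rw [hxe] at h1
    have h3 : Cb * (C₁ * (dist ξ x / 2) ^ (-(n : ℝ))) * (θ * dist ξ x) ^ (-lam) =
        Cb * C₁ * (1 / 2) ^ (-(n : ℝ)) * θ ^ (-lam) * dist ξ x ^ (-((n : ℝ) + lam)) := by
      rw [half_rpow hρ, Real.mul_rpow hθ0.le hρ.le, hadd]; ring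
    rw [h3] at h2
    have hdρ : d ≤ dist ξ x := hdθ.trans (by nlinarith)
    have h4 : dist ξ x ^ (-((n : ℝ) + (k + 1 : ℕ))) ≤
        dist ξ x ^ (-((n : ℝ) + lam)) * d ^ (lam - (k + 1)) := by
      have h5 : dist ξ x ^ (-((n : ℝ) + (k + 1 : ℕ))) =
          dist ξ x ^ (-((n : ℝ) + lam)) * dist ξ x ^ (lam - (k + 1)) := by
        rw [← Real.rpow_add hρ]; congr 1; push_cast; ring
      rw [h5]
      exact mul_le_mul_of_nonneg_left (Real.rpow_le_rpow_of_nonpos hd hdρ (by linarith))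
        (by positivity)
    have h6 := hterm (k + 1) le_rfl
    have h7 : 0 ≤ Cb * C₁ * (1 / 2) ^ (-(n : ℝ)) * θ⁻¹ ^ (k + 1) := by positivity
    calc _ ≤ _ := hdiff (k + 1)
      _ ≤ Cf (k + 1) * (dist ξ x ^ (-((n : ℝ) + lam)) * d ^ (lam - (k + 1))) +
          Cb * C₁ * (1 / 2) ^ (-(n : ℝ)) * θ ^ (-lam) * dist ξ x ^ (-((n : ℝ) + lam)) *
            d ^ (lam - (k + 1)) :=
        add_le_add (h1.trans (mul_le_mul_of_nonneg_left h4 (hCf0 _).le)) h2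
      _ = (Cf (k + 1) + Cb * C₁ * (1 / 2) ^ (-(n : ℝ)) * θ ^ (-lam)) *
          (dist ξ x ^ (-((n : ℝ) + lam)) * d ^ (lam - (k + 1))) := by ring
      _ ≤ C₂ * (dist ξ x ^ (-((n : ℝ) + lam)) * d ^ (lam - (k + 1))) :=
        mul_le_mul_of_nonneg_right (by linarith) (by positivity)
      _ = _ := by ring

lemma norm_le_card_mul_of_abs_le {v : Eu n} {M : ℝ} (hM : 0 ≤ M) (hv : ∀ i, |v i| ≤ M) :
    ‖v‖ ≤ n * M := by
  rw [EuclideanSpace.norm_eq]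
  refine Real.sqrt_le_iff.2 ⟨by positivity, ?_⟩
  have h1 : ∑ i, ‖v i‖ ^ 2 ≤ n * M ^ 2 := by
    refine (Finset.sum_le_card_nsmul _ _ (M ^ 2) fun i _ => ?_).trans (by simp)
    exact pow_le_pow_left₀ (norm_nonneg _) (hv i) 2
  have h2 : (n : ℝ) ≤ (n : ℝ) ^ 2 := by
    exact_mod_cast Nat.le_self_pow two_ne_zero n
  calc _ ≤ n * M ^ 2 := h1
    _ ≤ (n : ℝ) ^ 2 * M ^ 2 := by gcongr
    _ = _ := by ring

lemma Cube.norm_sub_le (Q : Cube n) {y z : Eu n} (hy : y ∈ Q.carrier) (hz : z ∈ Q.carrier) :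
    ‖y - z‖ ≤ n * Q.side := by
  have h0 := Q.half_pos
  refine norm_le_card_mul_of_abs_le (by rw [Cube.side]; positivity) fun i => ?_
  have h1 := abs_le.1 (hy i)
  have h2 := abs_le.1 (hz i)
  rw [PiLp.sub_apply, Cube.side, abs_le]
  constructor <;> linarith [h1.1, h1.2, h2.1, h2.2]

lemma Cube.add_smul_mem (Q : Cube n) {y z : Eu n} (hy : y ∈ Q.carrier) (hz : z ∈ Q.carrier)
    {t : ℝ} (ht : t ∈ Icc (0 : ℝ) 1) : z + t • (y - z) ∈ Q.carrier := by
  intro i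
  have h1 := abs_le.1 (hy i)
  have h2 := abs_le.1 (hz i)
  have e : (z + t • (y - z)) i - Q.center i =
      (1 - t) * (z i - Q.center i) + t * (y i - Q.center i) := by
    simp only [PiLp.add_apply, PiLp.smul_apply, PiLp.sub_apply, smul_eq_mul]; ring
  have ht0 := ht.1
  have ht1 : 0 ≤ 1 - t := sub_nonneg.2 ht.2
  rw [e, abs_le]
  constructor
  · linarith [mul_le_mul_of_nonneg_left h1.1 ht0, mul_le_mul_of_nonneg_left h2.1 ht1]
  · linarith [mul_le_mul_of_nonneg_left h1.2 ht0, mul_le_mul_of_nonneg_left h2.2 ht1]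

lemma Cube.ball_subset_scaled_two (Q : Cube n) {ξ : Eu n} (hξ : ξ ∈ Q.carrier) :
    ball ξ Q.half ⊆ Q.scaled 2 := by
  intro z hz i
  have h1 := abs_apply_le_norm (z - ξ) i
  have h2 := mem_ball_iff_norm.1 hz
  rw [PiLp.sub_apply] at h1
  have h3 := hξ i
  calc |z i - Q.center i| = |(z i - ξ i) + (ξ i - Q.center i)| := by ring_nf
    _ ≤ |z i - ξ i| + |ξ i - Q.center i| := abs_add_le _ _
    _ ≤ 2 * Q.half := by linarith

lemma Cube.half_le_norm_sub (Q : Cube n) {x ξ : Eu n} (hx : x ∉ Q.scaled 2)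
    (hξ : ξ ∈ Q.carrier) : Q.half ≤ ‖x - ξ‖ := by
  by_contra! h
  exact hx (Q.ball_subset_scaled_two hξ (mem_ball_iff_norm.2 h))

lemma rpow_neg_le_of_le_mul {A a b κ K : ℝ} (hA : 1 ≤ A) (hb : 0 < b)
    (hκ : 0 ≤ κ) (hK : κ ≤ K) (h : b ≤ A * a) : a ^ (-κ) ≤ A ^ K * b ^ (-κ) := by
  have hA0 : 0 < A := by linarith
  calc a ^ (-κ) ≤ (b / A) ^ (-κ) :=
        rpow_le_rpow_of_nonpos (by positivity) (by rw [div_le_iff₀ hA0]; linarith)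
          (by linarith)
    _ = A ^ κ * b ^ (-κ) := by
        rw [div_rpow hb.le hA0.le, rpow_neg hA0.le, div_inv_eq_mul, mul_comm]
    _ ≤ A ^ K * b ^ (-κ) := by
        gcongr

theorem green_taylor_estimate (hn : 2 < n) {lam : ℝ} (hlam : 2 < lam)
    (hni : ∀ m : ℕ, lam ≠ m) {D : Set (Eu n)} (hDo : IsOpen D) (hDb : Bornology.IsBounded D)
    (hbd : HasGraphBoundary D (HolderSmooth lam)) {U : Eu n → Eu n → ℝ}
    (hU : IsGreenCorrection D U) : ∃ C : ℝ, 0 < C ∧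
      ∀ L : List (Fin n), L.length = 2 → ∀ q ≤ ⌊lam⌋₊, ∀ Q : Cube n, Q.scaled 2 ⊆ D →
        ∀ x ∈ D \ Q.scaled 2, ∀ y ∈ Q.carrier, ∀ x₀ ∈ Q.carrier,
          |pdMulti L (fun x' => U x' y) x -
              tay q (fun y' => pdMulti L (fun x' => U x' y') x) x₀ (y - x₀)| ≤
            C * Q.side ^ (if q < ⌊lam⌋₊ then ((q : ℝ) + 1) else lam) /
              ‖x - x₀‖ ^ ((n : ℝ) + (if q < ⌊lam⌋₊ then ((q : ℝ) + 1) else lam)) := by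
  obtain ⟨C, θ, hC, hθ0, hθ1, hest⟩ := green_correction_estimate hn hlam hni hDo hDb hbd hU
  set k := ⌊lam⌋₊ with hk
  have hkl : (k : ℝ) < lam := lt_of_le_of_ne (Nat.floor_le (by linarith)) (hni k).symm
  have hlk : lam < k + 1 := Nat.lt_floor_add_one lam
  have hn1 : (1 : ℝ) ≤ n := by exact_mod_cast (by omega : 1 ≤ n)
  set A : ℝ := 1 + 2 * n with hA
  have hA1 : 1 ≤ A := by linarith
  have hA0 : 0 < A := by linarith
  set E : ℝ := (θ / 2) ^ (lam - (k + 1)) with hE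
  have hE1 : 1 ≤ E := one_le_rpow_of_pos_of_le_one_of_nonpos (by positivity) (by linarith)
    (by linarith)
  refine ⟨C * E * A ^ ((n : ℝ) + lam) * (n : ℝ) ^ (k + 1), by positivity, ?_⟩
  intro L hL q hq Q hQ x hx y hy x₀ hx₀
  have hδ : 0 < Q.side := mul_pos two_pos Q.half_pos
  set κ : ℝ := if q < k then ((q : ℝ) + 1) else lam with hκ
  have hqk : (q : ℝ) ≤ k := by exact_mod_cast hq
  have hκ0 : 0 ≤ κ := by rw [hκ]; split_ifs <;> [positivity; linarith]
  have hκl : κ ≤ lam := by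
    rw [hκ]; split_ifs with h
    · have : (q : ℝ) + 1 ≤ k := by exact_mod_cast h
      linarith
    · exact le_rfl
  have hsub : Q.carrier ⊆ D := fun ξ hξ =>
    hQ (Q.ball_subset_scaled_two hξ (mem_ball_self Q.half_pos))
  have hharm := hU.isHarmonicOn_pdMulti hn hDo hDb hx.1 L
  set F : Eu n → ℝ := fun y' => pdMulti L (fun x' => U x' y') x with hF
  have hx₀0 : 0 < ‖x - x₀‖ := Q.half_pos.trans_le (Q.half_le_norm_sub hx.2 hx₀)
  have hder : ∀ ξ ∈ Q.carrier, ‖iteratedFDeriv ℝ (q + 1) F ξ‖ ≤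
      C * E * (A ^ ((n : ℝ) + lam) * ‖x - x₀‖ ^ (-((n : ℝ) + κ))) * Q.side ^ (κ - (q + 1)) := by
    intro ξ hξ
    have hξ1 := Q.half_le_norm_sub hx.2 hξ
    have hξ0 : 0 < ‖x - ξ‖ := Q.half_pos.trans_le hξ1
    have hne : x ≠ ξ := fun h => by simp [h] at hξ0
    obtain ⟨hlow, htop⟩ := hest L hL x hx.1 ξ (hsub hξ) hne
    have hcmp : ‖x - x₀‖ ≤ A * ‖x - ξ‖ := by
      have h1 := Q.norm_sub_le hξ hx₀
      have h2 := norm_sub_le_norm_sub_add_norm_sub x ξ x₀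
      have h3 : (n : ℝ) * Q.side ≤ n * (2 * ‖x - ξ‖) := by
        rw [Cube.side]; gcongr
      rw [hA]; linarith
    have hdecay := rpow_neg_le_of_le_mul hA1 hx₀0 (κ := (n : ℝ) + κ)
      (K := (n : ℝ) + lam) (by positivity) (by linarith) hcmp
    suffices h : ‖iteratedFDeriv ℝ (q + 1) F ξ‖ ≤
        C * E * ‖x - ξ‖ ^ (-((n : ℝ) + κ)) * Q.side ^ (κ - (q + 1)) from
      h.trans (by gcongr)
    rcases lt_or_ge q k with h | h
    · have h1 := hlow (q + 1) h
      have e : κ = q + 1 := if_pos h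
      rw [e, sub_self, rpow_zero, mul_one]
      push_cast at h1
      refine h1.trans ?_
      gcongr
      exact le_mul_of_one_le_right hC.le hE1
    · obtain rfl : q = k := le_antisymm hq h
      have e : κ = lam := if_neg (lt_irrefl _)
      have hd : θ * Q.half ≤ θ * ‖x - ξ‖ := by gcongr
      have hb : ball ξ (θ * Q.half) ⊆ D :=
        (ball_subset_ball (mul_le_of_le_one_left Q.half_pos.le hθ1)).trans
          ((Q.ball_subset_scaled_two hξ).trans hQ)
      have h1 := htop (θ * Q.half) (mul_pos hθ0 Q.half_pos) hd hb
      have e2 : θ * Q.half = θ / 2 * Q.side := by rw [Cube.side]; ring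
      rw [e2, mul_rpow (by positivity) hδ.le] at h1
      rw [e]
      refine h1.trans (le_of_eq ?_)
      rw [hE]; ring
  have hT := taylor_le (k := q) (f := F) (x := x₀) (h := y - x₀)
    (fun t ht => (hharm.smooth hn hDo (hsub (Q.add_smul_mem hy hx₀ ht))).of_le
      (by exact_mod_cast le_top))
    (fun t ht => hder _ (Q.add_smul_mem hy hx₀ ht))
  rw [add_sub_cancel] at hT
  refine hT.trans ?_
  have hyx : ‖y - x₀‖ ^ (q + 1) ≤ (n : ℝ) ^ (k + 1) * Q.side ^ ((q : ℝ) + 1) := by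
    calc ‖y - x₀‖ ^ (q + 1) ≤ (n * Q.side) ^ (q + 1) := by
          gcongr; exact Q.norm_sub_le hy hx₀
      _ = (n : ℝ) ^ (q + 1) * Q.side ^ (q + 1) := mul_pow _ _ _
      _ ≤ (n : ℝ) ^ (k + 1) * Q.side ^ (q + 1) := by gcongr
      _ = _ := by congr 1; exact_mod_cast (rpow_natCast Q.side (q + 1)).symm
  calc _ ≤ C * E * (A ^ ((n : ℝ) + lam) * ‖x - x₀‖ ^ (-((n : ℝ) + κ))) *
        Q.side ^ (κ - (q + 1)) * ((n : ℝ) ^ (k + 1) * Q.side ^ ((q : ℝ) + 1)) := by gcongr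
    _ = C * E * A ^ ((n : ℝ) + lam) * (n : ℝ) ^ (k + 1) *
        (Q.side ^ (κ - (q + 1)) * Q.side ^ ((q : ℝ) + 1)) *
        ‖x - x₀‖ ^ (-((n : ℝ) + κ)) := by ring
    _ = _ := by
      rw [← rpow_add hδ, sub_add_cancel, rpow_neg hx₀0.le, div_eq_mul_inv]

end

/-- Corollary 2.3: Taylor-remainder estimate for ∂²U/∂xᵢ∂xⱼ in the
second variable, on a bounded domain with C^λ boundary (λ > 2 not an integer). -/
theorem stmt5 {n : ℕ} (hn : 2 < n) (lam : ℝ) (hlam : 2 < lam) (hni : ∀ m : ℕ, lam ≠ m)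
    (D : Set (Eu n)) (hD : IsBddDomain D) (hbd : HasGraphBoundary D (HolderSmooth lam))
    (U : Eu n → Eu n → ℝ) (hU : IsGreenCorrection D U) (i j : Fin n) :
    ∃ C : ℝ, 0 < C ∧ ∀ k : ℕ, k ≤ ⌊lam⌋₊ → ∀ Q : Cube n, Q.scaled 2 ⊆ D →
      ∀ x ∈ D \ Q.scaled 2, ∀ y ∈ Q.carrier, ∀ x₀ ∈ Q.carrier,
      |pd2 i j (fun x' => U x' y) x -
          ∑ α ∈ multiIdxLE n k, (multiFact α : ℝ)⁻¹ *
            pdAlpha α (fun y' => pd2 i j (fun x' => U x' y') x) x₀ * monom α (y - x₀)| ≤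
        C * Q.side ^ (if k < ⌊lam⌋₊ then ((k : ℝ) + 1) else lam) /
          ‖x - x₀‖ ^ ((n : ℝ) + (if k < ⌊lam⌋₊ then ((k : ℝ) + 1) else lam)) := by
  obtain ⟨C, hC, h⟩ := green_taylor_estimate hn hlam hni hD.1 hD.2.2 hbd hU
  exact ⟨C, hC, fun k hk Q hQ x hx y hy x₀ hx₀ => h [i, j] rfl k hk Q hQ x hx y hy x₀ hx₀⟩
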